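/- Let Ω ⊂ ℝ² be a closed polygon, let 0 < α, ᾶ ≤ 1, and let H, H̃ > 0. Set b₁ := −2/α + 2/(α²ᾶ) + 1/(α³ᾶ²), a₀ := 2b₁/(αᾶ) − 2/α, a₁ := b₁/(αᾶ), a₂ := 1/α. Then there exist ε₀ > 0 and constants A₀, A₁, A₂ > 0 (depending only on Ω, α, ᾶ, H, H̃) such that for every ε with 0 < ε ≤ ε₀ and every homeomorphism h : Ω → h(Ω) ⊂ ℝ² with |h|_α ≤ H and |h⁻¹|_ᾶ ≤ H̃ on h(Ω), there exist a triangulation K of Ω and a homeomorphism f : Ω → f(Ω) ⊂ ℝ², piecewise affine over K, such that ‖f − h‖_∞ ≤ ε, sin φ ≥ A₀ ε^{a₀} for every angle φ of every triangular face of K, and A₁ ε^{a₁} ≤ |e| ≤ A₂ ε^{a₂} for every edge e of K. -/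

import Mathlib

open Set Geometry EuclideanGeometry Metric Real

noncomputable section

abbrev E2 : Type := EuclideanSpace ℝ (Fin 2)

/-- The set of Hölder ratios of exponent `α` of `u` on `S`. -/
def holderRatioSet (α : ℝ) (S : Set E2) (u : E2 → E2) : Set ℝ :=
  {c | ∃ x ∈ S, ∃ y ∈ S, x ≠ y ∧ c = ‖u x - u y‖ / ‖x - y‖ ^ α}

/-- The Hölder seminorm of exponent `α` of `u` on `S`. -/
def holderSeminorm (α : ℝ) (S : Set E2) (u : E2 → E2) : ℝ :=
  sSup (holderRatioSet α S u)

/-- The supremum norm of `u` on `S`. -/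
def supNorm (S : Set E2) (u : E2 → E2) : ℝ :=
  sSup ((fun x => ‖u x‖) '' S)

/-- `f` is a homeomorphism of `S` onto its image `f '' S`. -/
def IsHomeoOn (f : E2 → E2) (S : Set E2) : Prop :=
  ContinuousOn f S ∧ Set.InjOn f S ∧ ContinuousOn (Function.invFunOn f S) (f '' S)

/-- `K` is a triangulation of `Ω`. -/
def IsTriangulation (K : SimplicialComplex ℝ E2) (Ω : Set E2) : Prop :=
  K.faces.Finite ∧ (∀ s ∈ K.faces, s.card ≤ 3) ∧ K.space = Ω ∧
    ∀ s ∈ K.faces, ∃ t ∈ K.faces, s ⊆ t ∧ t.card = 3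

/-- A closed polygon: a compact set admitting a triangulation. -/
def IsClosedPolygon (Ω : Set E2) : Prop :=
  IsCompact Ω ∧ ∃ K : SimplicialComplex ℝ E2, IsTriangulation K Ω

/-- `f` is piecewise affine over the simplicial complex `K`. -/
def PiecewiseAffineOn (f : E2 → E2) (K : SimplicialComplex ℝ E2) : Prop :=
  ∀ s ∈ K.faces, ∃ A : E2 →ᵃ[ℝ] E2, ∀ x ∈ convexHull ℝ (s : Set E2), f x = A x

/-- Every angle of every triangular face of `K` has sine at least `c`. -/
def AngleLB (K : SimplicialComplex ℝ E2) (c : ℝ) : Prop :=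
  ∀ s ∈ K.faces, ∀ p ∈ s, ∀ q ∈ s, ∀ r ∈ s,
    p ≠ q → q ≠ r → p ≠ r → c ≤ Real.sin (∠ p q r)

/-- Length of an edge (a two-element face). -/
def edgeLen (e : Finset E2) : ℝ := Metric.diam (e : Set E2)

/-- `o` is the incenter of the triangle `p₁p₂p₃` with inradius `r`. -/
def IsIncenter (p₁ p₂ p₃ o : E2) (r : ℝ) : Prop :=
  o ∈ interior (convexHull ℝ {p₁, p₂, p₃}) ∧
  Metric.infDist o (affineSpan ℝ ({p₁, p₂} : Set E2) : Set E2) = r ∧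
  Metric.infDist o (affineSpan ℝ ({p₂, p₃} : Set E2) : Set E2) = r ∧
  Metric.infDist o (affineSpan ℝ ({p₃, p₁} : Set E2) : Set E2) = r

section Preparation

variable {ι : Type*}

/-! ### Planar cross product and the angle subtended by a segment -/

/-- The planar cross product. -/
def cr (u v : ℂ) : ℝ := u.re * v.im - u.im * v.re

/-- Twice the signed area of the triangle `a b c`. -/
def orient (a b c : ℂ) : ℝ := cr (b - a) (c - a)

lemma orient_rotate (a b c : ℂ) : orient b c a = orient a b c := by
  simp [orient, cr]; ring

lemma orient_swap (a b c : ℂ) : orient b a c = -orient a b c := by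
  simp [orient, cr]; ring

lemma orient_swap_right (a b c : ℂ) : orient a c b = -orient a b c := by
  simp [orient, cr]; ring

lemma orient_add (a b c y : ℂ) :
    orient y a b + orient y b c + orient y c a = orient a b c := by
  simp [orient, cr]; ring

/-- The signed angle under which `y` sees the segment from `a` to `b`
(zero if `y` is on the segment). -/
def ang (y a b : ℂ) : ℝ := open Classical in
  if y ∈ segment ℝ a b then 0 else ((b - y) / (a - y)).arg

lemma div_sub_mem_slitPlane {y a b : ℂ} (h : y ∉ segment ℝ a b) :
    (b - y) / (a - y) ∈ Complex.slitPlane := by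
  by_contra hs
  apply h
  rw [Complex.mem_slitPlane_iff_not_le_zero, not_not, Complex.le_def] at hs
  obtain ⟨h1, h2⟩ := hs
  simp only [Complex.zero_re, Complex.zero_im] at h1 h2
  by_cases ha : a - y = 0
  · rw [sub_eq_zero.mp ha]
    exact left_mem_segment ℝ y b
  set z := (b - y) / (a - y) with hz
  have hb : b - y = z * (a - y) := by rw [hz, div_mul_cancel₀ _ ha]
  have hzr : z = ((z.re : ℝ) : ℂ) := by
    apply Complex.ext <;> simp [h2]
  set q := -z.re with hq
  have hq0 : 0 ≤ q := by linarith
  have hzr' : z = -(q : ℂ) := by rw [hzr]; simp [hq]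
  have h1q : (1 : ℂ) + q ≠ 0 := by
    have : (1 : ℝ) + q ≠ 0 := by positivity
    exact_mod_cast this
  refine ⟨q / (1 + q), 1 / (1 + q), by positivity, by positivity, by field_simp; ring, ?_⟩
  rw [Complex.real_smul, Complex.real_smul]
  push_cast
  have : b = y - q * (a - y) := by
    rw [hzr'] at hb; linear_combination hb
  rw [this]
  field_simp
  ring

lemma ang_of_notMem {y a b : ℂ} (h : y ∉ segment ℝ a b) :
    ang y a b = ((b - y) / (a - y)).arg := by
  simp [ang, h]

lemma ang_of_mem {y a b : ℂ} (h : y ∈ segment ℝ a b) : ang y a b = 0 := by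
  simp [ang, h]

lemma ang_swap (y a b : ℂ) : ang y b a = -ang y a b := by
  by_cases h : y ∈ segment ℝ a b
  · rw [ang_of_mem h, ang_of_mem (by rwa [segment_symm]), neg_zero]
  · have h' : y ∉ segment ℝ b a := by rwa [segment_symm]
    rw [ang_of_notMem h, ang_of_notMem h', ← inv_div, Complex.arg_inv, if_neg]
    exact fun hc => (Complex.mem_slitPlane_iff_arg.mp (div_sub_mem_slitPlane h)).1 hc

lemma isClosed_segment (a b : ℂ) : IsClosed (segment ℝ a b) := by
  rw [← convexHull_pair]
  exact ((Set.toFinite {a, b}).isCompact_convexHull ℝ).isClosed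

lemma sub_ne_zero_of_notMem_segment {y a b : ℂ} (h : y ∉ segment ℝ a b) :
    a - y ≠ 0 ∧ b - y ≠ 0 := by
  constructor <;> intro h0 <;> rw [sub_eq_zero] at h0 <;> apply h <;> rw [← h0]
  · exact left_mem_segment ℝ _ _
  · exact right_mem_segment ℝ _ _

lemma continuousAt_ang {y a b : ℂ} (h : y ∉ segment ℝ a b) :
    ContinuousAt (fun y => ang y a b) y := by
  have h1 : (fun y => ang y a b) =ᶠ[nhds y] fun y => ((b - y) / (a - y)).arg := by
    filter_upwards [(isClosed_segment a b).isOpen_compl.mem_nhds h] with z hz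
    exact ang_of_notMem hz
  refine ContinuousAt.congr ?_ h1.symm
  have h2 : ContinuousAt (fun y => (b - y) / (a - y)) y :=
    ContinuousAt.div (by fun_prop) (by fun_prop) (sub_ne_zero_of_notMem_segment h).1
  exact ContinuousAt.comp (f := fun y => (b - y) / (a - y))
    (Complex.continuousAt_arg (div_sub_mem_slitPlane h)) h2

lemma abs_ang_lt (y a b : ℂ) : |ang y a b| < π := by
  by_cases h : y ∈ segment ℝ a b
  · rw [ang_of_mem h]; simpa using Real.pi_pos
  · rw [ang_of_notMem h]
    have h1 := Complex.mem_slitPlane_iff_arg.mp (div_sub_mem_slitPlane h)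
    rw [abs_lt]
    exact ⟨Complex.neg_pi_lt_arg _, lt_of_le_of_ne (Complex.arg_le_pi _) h1.1⟩

lemma div_im_eq (u v : ℂ) : (v / u).im = cr u v / Complex.normSq u := by
  rw [Complex.div_im, cr]; ring

lemma ang_pos {y a b : ℂ} (h : 0 < orient y a b) : 0 < ang y a b := by
  have hy : y ∉ segment ℝ a b := by
    rintro ⟨s, t, hs, ht, hst, rfl⟩
    have : orient (s • a + t • b) a b = 0 := by
      obtain rfl : t = 1 - s := by linarith
      simp [orient, cr]; ring
    linarith
  rw [ang_of_notMem hy]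
  have him : 0 < ((b - y) / (a - y)).im := by
    rw [div_im_eq]
    exact div_pos h (Complex.normSq_pos.mpr (sub_ne_zero_of_notMem_segment hy).1)
  refine lt_of_le_of_ne (Complex.arg_nonneg_iff.mpr him.le) fun h0 => ?_
  exact him.ne' (Complex.arg_eq_zero_iff.mp h0.symm).2

lemma ang_neg {y a b : ℂ} (h : orient y a b < 0) : ang y a b < 0 := by
  have := @ang_pos y b a (by rw [orient_swap_right]; linarith)
  rw [ang_swap] at this
  linarith

lemma ang_nonpos {y a b : ℂ} (h : orient y a b ≤ 0) : ang y a b ≤ 0 := by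
  rcases h.lt_or_eq with h | h
  · exact (ang_neg h).le
  by_cases hy : y ∈ segment ℝ a b
  · rw [ang_of_mem hy]
  rw [ang_of_notMem hy]
  have him : ((b - y) / (a - y)).im = 0 := by
    rw [div_im_eq]
    have : cr (a - y) (b - y) = 0 := h
    rw [this, zero_div]
  have h1 := div_sub_mem_slitPlane hy
  rw [Complex.mem_slitPlane_iff] at h1
  have : 0 < ((b - y) / (a - y)).re := by tauto
  rw [Complex.arg_eq_zero_iff.mpr ⟨this.le, him⟩]

/-- The angle rotates the direction of `a` to the direction of `b`. -/
lemma exp_ang_mul {y a b : ℂ} (h : y ∉ segment ℝ a b) :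
    Complex.exp (ang y a b * Complex.I) * ((a - y) / ‖a - y‖) = (b - y) / ‖b - y‖ := by
  obtain ⟨h1, h2⟩ := sub_ne_zero_of_notMem_segment h
  have h1' : (‖a - y‖ : ℂ) ≠ 0 := by simpa using h1
  have h2' : (‖b - y‖ : ℂ) ≠ 0 := by simpa using h2
  have h3 := Complex.norm_mul_exp_arg_mul_I ((b - y) / (a - y))
  rw [ang_of_notMem h]
  rw [norm_div] at h3
  push_cast at h3
  set E := Complex.exp (((b - y) / (a - y)).arg * Complex.I)
  rw [div_mul_eq_mul_div, div_eq_div_iff h1' h1] at h3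
  rw [mul_div_assoc', div_eq_div_iff h1' h2']
  linear_combination h3

lemma ang_ge_of_re_neg {y a b : ℂ} (h : 0 < orient y a b)
    (hre : ((b - y) * (starRingEnd ℂ) (a - y)).re < 0) : π / 2 < ang y a b := by
  have hy : y ∉ segment ℝ a b := by
    intro hy
    rw [segment_symm] at hy
    obtain ⟨s, t, hs, ht, hst, rfl⟩ := hy
    have : orient (s • b + t • a) a b = 0 := by
      obtain rfl : t = 1 - s := by linarith
      simp [orient, cr]; ring
    linarith
  have hp := ang_pos h
  rw [ang_of_notMem hy] at hp ⊢
  obtain ⟨h1, h2⟩ := sub_ne_zero_of_notMem_segment hy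
  by_contra hle
  push Not at hle
  have : |((b - y) / (a - y)).arg| ≤ π / 2 := by rw [abs_of_pos hp]; exact hle
  rw [Complex.abs_arg_le_pi_div_two_iff] at this
  have h5 : ((b - y) / (a - y)).re =
      ((b - y) * (starRingEnd ℂ) (a - y)).re / Complex.normSq (a - y) := by
    rw [Complex.div_re]; simp; ring
  rw [h5] at this
  have := div_neg_of_neg_of_pos hre (Complex.normSq_pos.mpr h1)
  linarith

/-- Crossing a segment through a relatively interior point makes the angle jump. -/
lemma ang_jump {a b m : ℂ} (hm : m ∈ openSegment ℝ a b) (hab : a ≠ b) :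
    ∀ᶠ y in nhds m, (0 < orient y a b → π / 2 < ang y a b) ∧
      (orient y a b < 0 → ang y a b < -(π / 2)) := by
  have h0 : ((b - m) * (starRingEnd ℂ) (a - m)).re < 0 := by
    obtain ⟨s, t, hs, ht, hst, rfl⟩ := hm
    obtain rfl : t = 1 - s := by linarith
    have h1 : ((b - (s • a + (1 - s) • b)) *
        (starRingEnd ℂ) (a - (s • a + (1 - s) • b))).re
        = -(s * (1 - s) * Complex.normSq (a - b)) := by
      simp [Complex.normSq_apply]; ring
    rw [h1]
    have := Complex.normSq_pos.mpr (sub_ne_zero.mpr hab)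
    have : 0 < s * (1 - s) * Complex.normSq (a - b) := by positivity
    linarith
  have h1 : ContinuousAt (fun y : ℂ => ((b - y) * (starRingEnd ℂ) (a - y)).re) m := by
    fun_prop
  filter_upwards [h1.eventually_lt continuousAt_const h0] with y hy
  refine ⟨fun ho => ang_ge_of_re_neg ho hy, fun ho => ?_⟩
  have := @ang_ge_of_re_neg y b a (by rw [orient_swap_right]; linarith) (by
    have : ((a - y) * (starRingEnd ℂ) (b - y)).re = ((b - y) * (starRingEnd ℂ) (a - y)).re := by
      simp; ring
    rw [this]; exact hy)
  rw [ang_swap] at this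
  linarith

/-- If all points are in a half plane whose boundary contains `y`, angles are differences of
arguments. -/
lemma ang_eq_sub_arg {y a b w : ℂ} (ha : 0 < ((a - y) * w).re) (hb : 0 < ((b - y) * w).re) :
    ang y a b = ((b - y) * w).arg - ((a - y) * w).arg := by
  have hy : y ∉ segment ℝ a b := by
    rintro ⟨s, t, hs, ht, hst, h⟩
    have h1 : (s • (a - y) + t • (b - y)) * w = 0 := by
      have : s • (a - y) + t • (b - y) = (s • a + t • b) - (s + t) • y := by
        rw [add_smul, smul_sub, smul_sub]; ring
      rw [this, h, hst, one_smul, sub_self, zero_mul]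
    have h2 : ((s • (a - y) + t • (b - y)) * w).re =
        s * ((a - y) * w).re + t * ((b - y) * w).re := by
      simp; ring
    rw [h1] at h2
    simp only [Complex.zero_re] at h2
    rcases hs.eq_or_lt with rfl | hs
    · simp only [zero_add] at hst; subst hst; linarith
    · nlinarith [mul_pos hs ha, mul_nonneg ht hb.le]
  rw [ang_of_notMem hy]
  obtain ⟨h1, h2⟩ := sub_ne_zero_of_notMem_segment hy
  have hw : w ≠ 0 := by rintro rfl; simp at ha
  have haw : (a - y) * w ≠ 0 := mul_ne_zero h1 hw
  have hbw : (b - y) * w ≠ 0 := mul_ne_zero h2 hw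
  have e : (b - y) / (a - y) = ((b - y) * w) * ((a - y) * w)⁻¹ := by
    field_simp
  have ha' := abs_lt.mp (Complex.abs_arg_lt_pi_div_two_iff.mpr (Or.inl ha))
  have hb' := abs_lt.mp (Complex.abs_arg_lt_pi_div_two_iff.mpr (Or.inl hb))
  have hinv : (((a - y) * w)⁻¹).arg = -((a - y) * w).arg := by
    rw [Complex.arg_inv, if_neg]; linarith [Real.pi_pos]
  rw [e, (Complex.arg_mul_eq_add_arg_iff hbw (inv_ne_zero haw)).mpr, hinv]
  · ring
  · rw [hinv]; constructor <;> linarith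

/-! ### Polygonal paths and winding -/

/-- The consecutive pairs of a list. -/
def pathEdges : List ι → List (ι × ι)
  | [] => []
  | [_] => []
  | a :: b :: l => (a, b) :: pathEdges (b :: l)

/-- The edges of the closed polygon with the given list of vertices. -/
def polyEdges : List ι → List (ι × ι)
  | [] => []
  | a :: l => pathEdges (a :: l ++ [a])

/-- The sum over a list of oriented edges of a function of oriented edges. -/
def edgeSum (θ : ι → ι → ℝ) (E : List (ι × ι)) : ℝ := (E.map fun e => θ e.1 e.2).sum

/-- The total angle under which `y` sees a list of oriented edges. -/
def wind (r : ι → ℂ) (E : List (ι × ι)) (y : ℂ) : ℝ :=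
  edgeSum (fun a b => ang y (r a) (r b)) E

/-- The support of a list of edges. -/
def trace (r : ι → ℂ) (E : List (ι × ι)) : Set ℂ := ⋃ e ∈ E, segment ℝ (r e.1) (r e.2)

@[simp] lemma edgeSum_nil (θ : ι → ι → ℝ) : edgeSum θ [] = 0 := rfl

@[simp] lemma edgeSum_cons (θ : ι → ι → ℝ) (e : ι × ι) (E : List (ι × ι)) :
    edgeSum θ (e :: E) = θ e.1 e.2 + edgeSum θ E := by simp [edgeSum]

@[simp] lemma edgeSum_append (θ : ι → ι → ℝ) (E E' : List (ι × ι)) :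
    edgeSum θ (E ++ E') = edgeSum θ E + edgeSum θ E' := by simp [edgeSum]

lemma edgeSum_perm (θ : ι → ι → ℝ) {E E' : List (ι × ι)} (h : E.Perm E') :
    edgeSum θ E = edgeSum θ E' := (h.map _).sum_eq

lemma pathEdges_append (l₁ : List ι) (a : ι) (l₂ : List ι) :
    pathEdges (l₁ ++ a :: l₂) = pathEdges (l₁ ++ [a]) ++ pathEdges (a :: l₂) := by
  induction l₁ with
  | nil => simp [pathEdges]
  | cons b l ih =>
    cases l with
    | nil => simp [pathEdges]
    | cons c l => simpa [pathEdges] using ih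

lemma polyEdges_cons (a : ι) (l : List ι) : polyEdges (a :: l) = pathEdges (a :: l ++ [a]) := rfl

lemma polyEdges_append_cons (a : ι) (l₁ : List ι) (z : ι) (l₂ : List ι) :
    polyEdges (a :: l₁ ++ z :: l₂) =
      pathEdges (a :: l₁ ++ [z]) ++ pathEdges (z :: l₂ ++ [a]) := by
  have := pathEdges_append (a :: l₁) z (l₂ ++ [a])
  simpa [polyEdges] using this

lemma polyEdges_rotate_perm (l₁ l₂ : List ι) :
    (polyEdges (l₁ ++ l₂)).Perm (polyEdges (l₂ ++ l₁)) := by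
  cases l₁ with
  | nil => simp
  | cons a l₁ =>
    cases l₂ with
    | nil => simp
    | cons b l₂ =>
      rw [polyEdges_append_cons, polyEdges_append_cons]
      exact List.perm_append_comm

lemma mem_of_mem_pathEdges {l : List ι} {e : ι × ι} (h : e ∈ pathEdges l) :
    e.1 ∈ l ∧ e.2 ∈ l := by
  induction l with
  | nil => simp [pathEdges] at h
  | cons a l ih =>
    cases l with
    | nil => simp [pathEdges] at h
    | cons b l =>
      simp only [pathEdges, List.mem_cons] at h
      rcases h with rfl | h
      · simp
      · have := ih h
        exact ⟨List.mem_cons_of_mem _ this.1, List.mem_cons_of_mem _ this.2⟩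

lemma mem_of_mem_polyEdges {l : List ι} {e : ι × ι} (h : e ∈ polyEdges l) :
    e.1 ∈ l ∧ e.2 ∈ l := by
  cases l with
  | nil => simp [polyEdges] at h
  | cons a l =>
    have := mem_of_mem_pathEdges h
    simp only [List.cons_append, List.mem_cons, List.mem_append] at this ⊢
    tauto

/-- A property which holds along each edge of a path propagates from the first vertex. -/
lemma forall_mem_of_pathEdges {p : ι → Prop} {a : ι} {l : List ι} (h0 : p a)
    (h : ∀ e ∈ pathEdges (a :: l), p e.1 → p e.2) : ∀ x ∈ a :: l, p x := by
  induction l generalizing a with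
  | nil => simpa using h0
  | cons b l ih =>
    have hb : p b := h (a, b) (by simp [pathEdges]) h0
    have := ih hb (fun e he => h e (by simp [pathEdges, he]))
    intro x hx
    rcases List.mem_cons.mp hx with rfl | hx
    · exact h0
    · exact this x hx

lemma edgeSum_pathEdges_sub (L : ι → ℝ) (a : ι) (l : List ι) (z : ι) :
    edgeSum (fun a b => L b - L a) (pathEdges (a :: l ++ [z])) = L z - L a := by
  induction l generalizing a with
  | nil => simp [pathEdges]
  | cons b l ih =>
    have := ih b
    simp only [List.cons_append] at this
    simp [pathEdges, this]

lemma edgeSum_polyEdges_sub (L : ι → ℝ) (l : List ι) :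
    edgeSum (fun a b => L b - L a) (polyEdges l) = 0 := by
  cases l with
  | nil => rfl
  | cons a l => rw [polyEdges_cons, edgeSum_pathEdges_sub, sub_self]

lemma edgeSum_congr {θ θ' : ι → ι → ℝ} {E : List (ι × ι)}
    (h : ∀ e ∈ E, θ e.1 e.2 = θ' e.1 e.2) : edgeSum θ E = edgeSum θ' E := by
  unfold edgeSum
  congr 1
  exact List.map_congr_left h

/-- If the angles seen from `y` are differences, the winding vanishes. -/
lemma wind_eq_zero_of_sub {r : ι → ℂ} {l : List ι} {y : ℂ} (L : ι → ℝ)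
    (h : ∀ e ∈ polyEdges l, ang y (r e.1) (r e.2) = L e.2 - L e.1) :
    wind r (polyEdges l) y = 0 := by
  rw [wind, edgeSum_congr (θ' := fun a b => L b - L a) h, edgeSum_polyEdges_sub]

lemma wind_eq_zero_of_halfPlane {r : ι → ℂ} {l : List ι} {y w : ℂ}
    (h : ∀ a ∈ l, 0 < ((r a - y) * w).re) : wind r (polyEdges l) y = 0 := by
  refine wind_eq_zero_of_sub (fun a => ((r a - y) * w).arg) fun e he => ?_
  have := mem_of_mem_polyEdges he
  exact ang_eq_sub_arg (h _ this.1) (h _ this.2)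

lemma mem_trace {r : ι → ℂ} {E : List (ι × ι)} {y : ℂ} :
    y ∈ trace r E ↔ ∃ e ∈ E, y ∈ segment ℝ (r e.1) (r e.2) := by simp [trace]

lemma trace_append (r : ι → ℂ) (E E' : List (ι × ι)) :
    trace r (E ++ E') = trace r E ∪ trace r E' := by
  ext y
  simp only [mem_trace, List.mem_append, mem_union]
  constructor
  · rintro ⟨e, h | h, hy⟩
    exacts [Or.inl ⟨e, h, hy⟩, Or.inr ⟨e, h, hy⟩]
  · rintro (⟨e, h, hy⟩ | ⟨e, h, hy⟩)
    exacts [⟨e, Or.inl h, hy⟩, ⟨e, Or.inr h, hy⟩]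

lemma trace_cons (r : ι → ℂ) (e : ι × ι) (E : List (ι × ι)) :
    trace r (e :: E) = segment ℝ (r e.1) (r e.2) ∪ trace r E := by
  ext y; simp [mem_trace]

lemma trace_perm (r : ι → ℂ) {E E' : List (ι × ι)} (h : E.Perm E') :
    trace r E = trace r E' := by
  ext y; simp [mem_trace, h.mem_iff]

lemma wind_append (r : ι → ℂ) (E E' : List (ι × ι)) (y : ℂ) :
    wind r (E ++ E') y = wind r E y + wind r E' y := edgeSum_append _ _ _

lemma wind_cons (r : ι → ℂ) (e : ι × ι) (E : List (ι × ι)) (y : ℂ) :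
    wind r (e :: E) y = ang y (r e.1) (r e.2) + wind r E y := edgeSum_cons _ _ _

lemma wind_perm (r : ι → ℂ) {E E' : List (ι × ι)} (h : E.Perm E') (y : ℂ) :
    wind r E y = wind r E' y := edgeSum_perm _ h

lemma isClosed_trace (r : ι → ℂ) (E : List (ι × ι)) : IsClosed (trace r E) := by
  induction E with
  | nil => simp [trace]
  | cons e E ih => rw [trace_cons]; exact (isClosed_segment _ _).union ih

lemma continuousAt_wind {r : ι → ℂ} {E : List (ι × ι)} {y : ℂ} (h : y ∉ trace r E) :
    ContinuousAt (wind r E) y := by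
  induction E with
  | nil => exact continuousAt_const
  | cons e E ih =>
    rw [trace_cons, mem_union, not_or] at h
    exact (continuousAt_ang h.1).add (ih h.2)

lemma exp_wind_path {r : ι → ℂ} {a z : ι} {l : List ι} {y : ℂ}
    (h : y ∉ trace r (pathEdges (a :: l ++ [z]))) :
    Complex.exp (wind r (pathEdges (a :: l ++ [z])) y * Complex.I) *
      ((r a - y) / ‖r a - y‖) = (r z - y) / ‖r z - y‖ := by
  induction l generalizing a with
  | nil =>
    simp only [List.cons_append, List.nil_append, pathEdges, trace_cons, mem_union,
      not_or] at h
    have := exp_ang_mul h.1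
    simpa [pathEdges, wind] using this
  | cons b l ih =>
    simp only [List.cons_append, pathEdges, trace_cons, mem_union, not_or] at h ih ⊢
    have h1 := exp_ang_mul h.1
    have h2 := ih h.2
    rw [wind_cons]
    push_cast
    rw [add_mul, Complex.exp_add]
    rw [← h2, ← h1]
    ring

lemma exists_wind_eq {r : ι → ℂ} {l : List ι} {y : ℂ} (h : y ∉ trace r (polyEdges l)) :
    ∃ n : ℤ, wind r (polyEdges l) y = n * (2 * π) := by
  cases l with
  | nil => exact ⟨0, by simp [polyEdges, wind]⟩
  | cons a l =>
    have h1 := exp_wind_path (z := a) h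
    have ha : r a - y ≠ 0 := by
      intro h0
      apply h
      rw [mem_trace]
      have : ∃ b, (a, b) ∈ polyEdges (a :: l) := by
        cases l with
        | nil => exact ⟨a, by simp [polyEdges, pathEdges]⟩
        | cons b l => exact ⟨b, by simp [polyEdges, pathEdges]⟩
      obtain ⟨b, hb⟩ := this
      refine ⟨_, hb, ?_⟩
      rw [← sub_eq_zero.mp h0]
      exact left_mem_segment ℝ _ _
    have hn : (‖r a - y‖ : ℂ) ≠ 0 := by simpa using ha
    have h2 := mul_eq_right₀ (div_ne_zero ha hn) |>.mp h1
    rw [Complex.exp_eq_one_iff] at h2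
    obtain ⟨n, hn⟩ := h2
    refine ⟨n, ?_⟩
    have hI := Complex.I_ne_zero
    have : (wind r (pathEdges (a :: l ++ [a])) y : ℂ) = n * (2 * π) := by
      apply mul_right_cancel₀ hI
      rw [hn]; ring
    rw [polyEdges_cons]
    exact_mod_cast this

/-- The winding is constant on preconnected sets avoiding the polygon. -/
lemma wind_const {r : ι → ℂ} {l : List ι} {S : Set ℂ} (hS : IsPreconnected S)
    (hd : ∀ y ∈ S, y ∉ trace r (polyEdges l)) {x y : ℂ} (hx : x ∈ S) (hy : y ∈ S) :
    wind r (polyEdges l) x = wind r (polyEdges l) y := by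
  have hc : ContinuousOn (wind r (polyEdges l)) S :=
    fun y hy => (continuousAt_wind (hd y hy)).continuousWithinAt
  have hi := (hS.image _ hc).ordConnected
  have key : ∀ x ∈ S, ∀ y ∈ S, ¬ wind r (polyEdges l) x < wind r (polyEdges l) y := by
    intro x hx y hy hlt
    obtain ⟨n, hn⟩ := exists_wind_eq (hd x hx)
    obtain ⟨m, hm⟩ := exists_wind_eq (hd y hy)
    have hπ := Real.pi_pos
    have hnm : n < m := by
      rw [hn, hm] at hlt
      have := lt_of_mul_lt_mul_right hlt (by positivity)
      exact_mod_cast this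
    have hnm' : (n : ℝ) + 1 ≤ m := by exact_mod_cast hnm
    have hmid : wind r (polyEdges l) x + π ∈ wind r (polyEdges l) '' S := by
      refine hi.out (mem_image_of_mem _ hx) (mem_image_of_mem _ hy) ⟨by linarith, ?_⟩
      rw [hn, hm]
      nlinarith
    obtain ⟨z, hz, hz'⟩ := hmid
    obtain ⟨k, hk⟩ := exists_wind_eq (hd z hz)
    rw [hk, hn] at hz'
    have h2 : (2 * k : ℝ) = 2 * n + 1 := by
      apply mul_right_cancel₀ hπ.ne'
      linarith
    have h3 : (2 * k : ℤ) = 2 * n + 1 := by exact_mod_cast h2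
    omega
  exact le_antisymm (not_lt.mp (key y hy x hx)) (not_lt.mp (key x hx y hy))

lemma eventually_wind_eq {r : ι → ℂ} {l : List ι} {y : ℂ} (h : y ∉ trace r (polyEdges l)) :
    ∀ᶠ z in nhds y, z ∉ trace r (polyEdges l) ∧
      wind r (polyEdges l) z = wind r (polyEdges l) y := by
  obtain ⟨ε, hε, hb⟩ := Metric.isOpen_iff.mp (isClosed_trace r (polyEdges l)).isOpen_compl y h
  filter_upwards [Metric.ball_mem_nhds y hε] with z hz
  exact ⟨hb hz, wind_const (convex_ball y ε).isPreconnected (fun w hw => hb hw) hz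
    (Metric.mem_ball_self hε)⟩

/-! ### Triangles -/

lemma orient_comb {s t : ℝ} (h : s + t = 1) (x y a b : ℂ) :
    orient (s • x + t • y) a b = s * orient x a b + t * orient y a b := by
  obtain rfl : t = 1 - s := by linarith
  simp [orient, cr]; ring

lemma orient_rotate' (a b c : ℂ) : orient c a b = orient a b c := by
  simp [orient, cr]; ring

@[simp] lemma orient_self_left (a b : ℂ) : orient a a b = 0 := by simp [orient, cr]

@[simp] lemma orient_self_right (a b : ℂ) : orient a b b = 0 := by simp [orient, cr]; ring

@[simp] lemma orient_self_outer (a b : ℂ) : orient a b a = 0 := by simp [orient, cr]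

/-- The open triangle with orientation sign `σ`. -/
def openTri (σ : ℝ) (a b c : ℂ) : Set ℂ :=
  {y | 0 < σ * orient y a b ∧ 0 < σ * orient y b c ∧ 0 < σ * orient y c a}

/-- The closed triangle with orientation sign `σ`. -/
def closedTri (σ : ℝ) (a b c : ℂ) : Set ℂ :=
  {y | 0 ≤ σ * orient y a b ∧ 0 ≤ σ * orient y b c ∧ 0 ≤ σ * orient y c a}

lemma isOpen_openTri (σ : ℝ) (a b c : ℂ) : IsOpen (openTri σ a b c) := by
  unfold openTri orient cr
  refine IsOpen.and ?_ (IsOpen.and ?_ ?_) <;> exact isOpen_lt (by fun_prop) (by fun_prop)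

lemma convex_openTri (σ : ℝ) (a b c : ℂ) : Convex ℝ (openTri σ a b c) := by
  rintro x ⟨h1, h2, h3⟩ y ⟨k1, k2, k3⟩ s t hs ht hst
  have key : ∀ p q : ℂ, 0 < σ * orient x p q → 0 < σ * orient y p q →
      0 < σ * orient (s • x + t • y) p q := by
    intro p q hx hy
    rw [orient_comb hst, mul_add, mul_left_comm, mul_left_comm σ t]
    rcases hs.eq_or_lt with rfl | hs
    · simp only [zero_add] at hst; subst hst; simpa using hy
    · have := mul_pos hs hx
      have := mul_nonneg ht hy.le
      linarith
  exact ⟨key _ _ h1 k1, key _ _ h2 k2, key _ _ h3 k3⟩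

lemma comb_openTri {σ : ℝ} {a b c x y : ℂ} (hx : x ∈ openTri σ a b c) (hy : y ∈ closedTri σ a b c)
    {s t : ℝ} (hs : 0 < s) (ht : 0 ≤ t) (hst : s + t = 1) :
    s • x + t • y ∈ openTri σ a b c := by
  obtain ⟨h1, h2, h3⟩ := hx
  obtain ⟨k1, k2, k3⟩ := hy
  have key : ∀ p q : ℂ, 0 < σ * orient x p q → 0 ≤ σ * orient y p q →
      0 < σ * orient (s • x + t • y) p q := by
    intro p q hx hy
    rw [orient_comb hst, mul_add, mul_left_comm, mul_left_comm σ t]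
    have := mul_pos hs hx
    have := mul_nonneg ht hy
    linarith
  exact ⟨key _ _ h1 k1, key _ _ h2 k2, key _ _ h3 k3⟩

lemma nonempty_openTri {σ : ℝ} {a b c : ℂ} (h : 0 < σ * orient a b c) :
    (openTri σ a b c).Nonempty := by
  refine ⟨(1 / 3 : ℝ) • a + (1 / 3 : ℝ) • b + (1 / 3 : ℝ) • c, ?_⟩
  have e1 : orient ((1 / 3 : ℝ) • a + (1 / 3 : ℝ) • b + (1 / 3 : ℝ) • c) a b
      = 1 / 3 * orient a b c := by simp [orient, cr]; ring
  have e2 : orient ((1 / 3 : ℝ) • a + (1 / 3 : ℝ) • b + (1 / 3 : ℝ) • c) b c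
      = 1 / 3 * orient a b c := by simp [orient, cr]; ring
  have e3 : orient ((1 / 3 : ℝ) • a + (1 / 3 : ℝ) • b + (1 / 3 : ℝ) • c) c a
      = 1 / 3 * orient a b c := by simp [orient, cr]; ring
  refine ⟨?_, ?_, ?_⟩
  · rw [e1]; linarith
  · rw [e2]; linarith
  · rw [e3]; linarith

lemma closedTri_subset_closure {σ : ℝ} {a b c : ℂ} (h : 0 < σ * orient a b c) :
    closedTri σ a b c ⊆ closure (openTri σ a b c) := by
  intro y hy
  obtain ⟨g, hg⟩ := nonempty_openTri h
  have ht : Filter.Tendsto (fun s : ℝ => s • g + (1 - s) • y) (nhdsWithin 0 (Set.Ioi 0))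
      (nhds ((0 : ℝ) • g + (1 - (0 : ℝ)) • y)) := by
    apply Filter.Tendsto.mono_left _ nhdsWithin_le_nhds
    exact Continuous.tendsto (by fun_prop) _
  simp only [zero_smul, sub_zero, one_smul, zero_add] at ht
  refine mem_closure_of_tendsto ht ?_
  filter_upwards [Ioo_mem_nhdsGT (show (0 : ℝ) < 1 by norm_num)] with s hs
  exact comb_openTri hg hy hs.1 (by linarith [hs.2]) (by ring)

lemma closedTri_rotate (σ : ℝ) (a b c : ℂ) : closedTri σ b c a = closedTri σ a b c := by
  ext y; simp only [closedTri, mem_ofPred_eq]; tauto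

lemma openTri_rotate (σ : ℝ) (a b c : ℂ) : openTri σ b c a = openTri σ a b c := by
  ext y; simp only [openTri, mem_ofPred_eq]; tauto

lemma segment_subset_closedTri {σ : ℝ} {a b c : ℂ} (h : 0 < σ * orient a b c) :
    segment ℝ a b ⊆ closedTri σ a b c := by
  rintro y ⟨s, t, hs, ht, hst, rfl⟩
  refine ⟨?_, ?_, ?_⟩ <;> rw [orient_comb hst] <;> simp [orient_rotate]
  · have := mul_nonneg hs h.le; linarith
  · have := mul_nonneg ht h.le; linarith

lemma mem_segment_of_closedTri {σ : ℝ} {a b c y : ℂ} (h : 0 < σ * orient a b c)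
    (hy : y ∈ closedTri σ a b c) (h0 : orient y a b = 0) : y ∈ segment ℝ a b := by
  obtain ⟨-, h2, h3⟩ := hy
  have hs := orient_add a b c y
  rw [h0, zero_add] at hs
  set D := orient a b c with hD
  have hD0 : D ≠ 0 := by rintro h0; simp [h0] at h
  have hd : ∀ u : ℝ, 0 ≤ σ * u → 0 ≤ u / D := by
    intro u hu
    have hσ : σ ≠ 0 := by rintro rfl; simp at h
    rw [← mul_div_mul_left u D hσ]
    exact div_nonneg hu h.le
  refine ⟨orient y b c / D, orient y c a / D, hd _ h2, hd _ h3, ?_, ?_⟩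
  · rw [← add_div, hs, div_self hD0]
  · have e1 : ∀ x : ℂ, orient y b c * x.re + orient y c a * x.re = D * x.re := by
      intro x; rw [← add_mul, hs]
    apply Complex.ext
    · simp only [Complex.add_re, Complex.real_smul, Complex.mul_re, Complex.ofReal_re,
        Complex.ofReal_im, zero_mul, sub_zero]
      field_simp
      have : orient y b c * a.re + orient y c a * b.re + orient y a b * c.re = y.re * D := by
        rw [hD]; simp [orient, cr]; ring
      rw [h0] at this; linarith
    · simp only [Complex.add_im, Complex.real_smul, Complex.mul_im, Complex.ofReal_re,
        Complex.ofReal_im, zero_mul, add_zero]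
      field_simp
      have : orient y b c * a.im + orient y c a * b.im + orient y a b * c.im = y.im * D := by
        rw [hD]; simp [orient, cr]; ring
      rw [h0] at this; linarith

lemma polyEdges_three (a b c : ι) : polyEdges [a, b, c] = [(a, b), (b, c), (c, a)] := rfl

lemma trace_three (r : ι → ℂ) (a b c : ι) : trace r (polyEdges [a, b, c]) =
    segment ℝ (r a) (r b) ∪ (segment ℝ (r b) (r c) ∪ segment ℝ (r c) (r a)) := by
  rw [polyEdges_three, trace_cons, trace_cons, trace_cons]
  simp [trace]

lemma notMem_segment_of_orient {a b y : ℂ} (h : orient y a b ≠ 0) : y ∉ segment ℝ a b := by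
  rintro ⟨s, t, hs, ht, hst, rfl⟩
  apply h
  rw [orient_comb hst]
  simp

lemma openTri_disjoint_trace {r : ι → ℂ} {σ : ℝ} {a b c : ι} {y : ℂ}
    (hy : y ∈ openTri σ (r a) (r b) (r c)) : y ∉ trace r (polyEdges [a, b, c]) := by
  rw [trace_three]
  have h0 : ∀ u : ℝ, 0 < σ * u → u ≠ 0 := by rintro u hu rfl; simp at hu
  simp only [mem_union, not_or]
  exact ⟨notMem_segment_of_orient (h0 _ hy.1), notMem_segment_of_orient (h0 _ hy.2.1),
    notMem_segment_of_orient (h0 _ hy.2.2)⟩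

lemma trace_three_subset {r : ι → ℂ} {σ : ℝ} {a b c : ι}
    (h : 0 < σ * orient (r a) (r b) (r c)) :
    trace r (polyEdges [a, b, c]) ⊆ closedTri σ (r a) (r b) (r c) := by
  rw [trace_three]
  refine union_subset (segment_subset_closedTri h) (union_subset ?_ ?_)
  · rw [← closedTri_rotate]
    exact segment_subset_closedTri (by rwa [orient_rotate])
  · rw [← closedTri_rotate, ← closedTri_rotate]
    exact segment_subset_closedTri (by rwa [orient_rotate'])

lemma wind_three (r : ι → ℂ) (a b c : ι) (y : ℂ) : wind r (polyEdges [a, b, c]) y =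
    ang y (r a) (r b) + ang y (r b) (r c) + ang y (r c) (r a) := by
  simp [polyEdges_three, wind]; ring

lemma wind_triangle_pos {r : ι → ℂ} {a b c : ι} {y : ℂ}
    (h : 0 < orient (r a) (r b) (r c)) (hP : y ∉ trace r (polyEdges [a, b, c])) :
    (y ∈ openTri 1 (r a) (r b) (r c) → wind r (polyEdges [a, b, c]) y = 2 * π) ∧
    (y ∉ openTri 1 (r a) (r b) (r c) → wind r (polyEdges [a, b, c]) y = 0) := by
  obtain ⟨n, hn⟩ := exists_wind_eq hP
  have hs := orient_add (r a) (r b) (r c) y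
  have hπ := Real.pi_pos
  have b1 := abs_lt.mp (abs_ang_lt y (r a) (r b))
  have b2 := abs_lt.mp (abs_ang_lt y (r b) (r c))
  have b3 := abs_lt.mp (abs_ang_lt y (r c) (r a))
  have key : ∀ (u v : ℤ), (u : ℝ) * π < wind r (polyEdges [a, b, c]) y →
      wind r (polyEdges [a, b, c]) y < v * π → u < 2 * n ∧ 2 * n < v := by
    intro u v h1 h2
    rw [hn] at h1 h2
    have h1' : (u : ℝ) < 2 * n := by
      refine lt_of_mul_lt_mul_right (a := π) ?_ hπ.le; linarith
    have h2' : 2 * n < (v : ℝ) := by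
      refine lt_of_mul_lt_mul_right (a := π) ?_ hπ.le; linarith
    exact ⟨by exact_mod_cast h1', by exact_mod_cast h2'⟩
  rw [wind_three] at hn key
  rw [wind_three]
  constructor
  · rintro ⟨h1, h2, h3⟩
    rw [one_mul] at h1 h2 h3
    have := ang_pos h1
    have := ang_pos h2
    have := ang_pos h3
    have hk := key 0 3 (by push_cast; linarith) (by push_cast; linarith)
    obtain rfl : n = 1 := by omega
    rw [hn]; simp
  · intro hout
    suffices n = 0 by rw [hn, this]; simp
    rcases lt_or_ge 0 (orient y (r a) (r b)) with h1 | h1 <;>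
    rcases lt_or_ge 0 (orient y (r b) (r c)) with h2 | h2 <;>
    rcases lt_or_ge 0 (orient y (r c) (r a)) with h3 | h3
    · exact absurd (by simp [openTri, h1, h2, h3]) hout
    · have := ang_pos h1
      have := ang_pos h2
      have := ang_nonpos h3
      have hk := key (-1) 2 (by push_cast; linarith) (by push_cast; linarith)
      omega
    · have := ang_pos h1
      have := ang_nonpos h2
      have := ang_pos h3
      have hk := key (-1) 2 (by push_cast; linarith) (by push_cast; linarith)
      omega
    · have := ang_pos h1
      have := ang_nonpos h2
      have := ang_nonpos h3
      have hk := key (-2) 1 (by push_cast; linarith) (by push_cast; linarith)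
      omega
    · have := ang_nonpos h1
      have := ang_pos h2
      have := ang_pos h3
      have hk := key (-1) 2 (by push_cast; linarith) (by push_cast; linarith)
      omega
    · have := ang_nonpos h1
      have := ang_pos h2
      have := ang_nonpos h3
      have hk := key (-2) 1 (by push_cast; linarith) (by push_cast; linarith)
      omega
    · have := ang_nonpos h1
      have := ang_nonpos h2
      have := ang_pos h3
      have hk := key (-2) 1 (by push_cast; linarith) (by push_cast; linarith)
      omega
    · linarith

/-- The winding of a triangle of orientation `σ`. -/
lemma wind_triangle {r : ι → ℂ} {σ : ℝ} (hσ : σ = 1 ∨ σ = -1) {a b c : ι} {y : ℂ}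
    (h : 0 < σ * orient (r a) (r b) (r c)) (hP : y ∉ trace r (polyEdges [a, b, c])) :
    (y ∈ openTri σ (r a) (r b) (r c) → wind r (polyEdges [a, b, c]) y = 2 * π * σ) ∧
    (y ∉ openTri σ (r a) (r b) (r c) → wind r (polyEdges [a, b, c]) y = 0) := by
  rcases hσ with rfl | rfl
  · simpa using wind_triangle_pos (by simpa using h) hP
  · have hP' : y ∉ trace r (polyEdges [b, a, c]) := by
      rw [trace_three] at hP ⊢
      rw [segment_symm ℝ (r b), segment_symm ℝ (r a) (r c), segment_symm ℝ (r c) (r b)]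
      simp only [mem_union] at hP ⊢
      tauto
    have := wind_triangle_pos (r := r) (a := b) (b := a) (c := c)
      (by rw [orient_swap]; linarith) hP'
    have e1 : wind r (polyEdges [b, a, c]) y = -wind r (polyEdges [a, b, c]) y := by
      rw [wind_three, wind_three, ang_swap y (r a) (r b), ang_swap y (r c) (r a),
        ang_swap y (r b) (r c)]
      ring
    have e2 : openTri 1 (r b) (r a) (r c) = openTri (-1) (r a) (r b) (r c) := by
      ext y
      simp only [openTri, mem_ofPred_eq]
      rw [orient_swap_right y (r b) (r a), orient_swap_right y (r a) (r c),
        orient_swap_right y (r c) (r b)]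
      constructor <;> rintro ⟨h1, h2, h3⟩ <;> refine ⟨?_, ?_, ?_⟩ <;> linarith
    rw [e1, e2] at this
    refine ⟨fun hy => ?_, fun hy => ?_⟩
    · linarith [this.1 hy]
    · linarith [this.2 hy]

/-! ### Simple polygons and their fillings by triangles -/

/-- The segments `a b` and `c d` are either the same edge or meet at most in a common label. -/
def SegOK {V : Type*} [AddCommGroup V] [Module ℝ V] (r : ι → V) (a b c d : ι) : Prop :=
  ∀ x ∈ segment ℝ (r a) (r b), x ∈ segment ℝ (r c) (r d) →
    (a = c ∧ b = d) ∨ (a = d ∧ b = c) ∨ ∃ i, (i = a ∨ i = b) ∧ (i = c ∨ i = d) ∧ x = r i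

lemma SegOK.symm {V : Type*} [AddCommGroup V] [Module ℝ V] {r : ι → V} {a b c d : ι}
    (h : SegOK r a b c d) : SegOK r c d a b := by
  intro x hx hx'
  rcases h x hx' hx with ⟨rfl, rfl⟩ | ⟨rfl, rfl⟩ | ⟨i, h1, h2, h3⟩
  · exact Or.inl ⟨rfl, rfl⟩
  · exact Or.inr (Or.inl ⟨rfl, rfl⟩)
  · exact Or.inr (Or.inr ⟨i, h2, h1, h3⟩)

lemma SegOK.swap {V : Type*} [AddCommGroup V] [Module ℝ V] {r : ι → V} {a b c d : ι}
    (h : SegOK r a b c d) : SegOK r b a c d := by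
  intro x hx hx'
  rw [segment_symm] at hx
  rcases h x hx hx' with ⟨rfl, rfl⟩ | ⟨rfl, rfl⟩ | ⟨i, h1, h2, h3⟩
  · exact Or.inr (Or.inl ⟨rfl, rfl⟩)
  · exact Or.inl ⟨rfl, rfl⟩
  · exact Or.inr (Or.inr ⟨i, h1.symm, h2, h3⟩)

/-- A simple closed polygon. -/
structure SimplePoly (r : ι → ℂ) (l : List ι) : Prop where
  nodup : l.Nodup
  inj : ∀ a ∈ l, ∀ b ∈ l, r a = r b → a = b
  ok : ∀ e ∈ polyEdges l, ∀ f ∈ polyEdges l, SegOK r e.1 e.2 f.1 f.2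

/-- The points off the polygon about which it winds. -/
def inside (r : ι → ℂ) (l : List ι) : Set ℂ :=
  {y | y ∉ trace r (polyEdges l) ∧ wind r (polyEdges l) y ≠ 0}

/-- The triple occurs in `l` in this cyclic order. -/
def CycOrder (l : List ι) (t : ι × ι × ι) : Prop :=
  List.Sublist [t.1, t.2.1, t.2.2] l ∨ List.Sublist [t.2.1, t.2.2, t.1] l ∨
    List.Sublist [t.2.2, t.1, t.2.1] l

/-- The sum of a function of oriented edges over the boundary of a triple. -/
def bdrySum (θ : ι → ι → ℝ) (t : ι × ι × ι) : ℝ :=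
  θ t.1 t.2.1 + θ t.2.1 t.2.2 + θ t.2.2 t.1

/-- `ts` is a list of triangles of orientation `σ` filling the closed polygon `l`. -/
structure Filling (r : ι → ℂ) (l : List ι) (ts : List (ι × ι × ι)) (σ : ℝ) : Prop where
  sgn : σ = 1 ∨ σ = -1
  cyc : ∀ t ∈ ts, CycOrder l t
  pos : ∀ t ∈ ts, 0 < σ * orient (r t.1) (r t.2.1) (r t.2.2)
  chain : ∀ θ : ι → ι → ℝ, (∀ a b, θ b a = -θ a b) →
    (ts.map (bdrySum θ)).sum = edgeSum θ (polyEdges l)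
  two : ∀ y ∉ trace r (polyEdges l), wind r (polyEdges l) y = 0 ∨
    wind r (polyEdges l) y = 2 * π * σ
  conn : IsPreconnected (inside r l)
  cl : trace r (polyEdges l) ⊆ closure (inside r l)

lemma inside_rotate (r : ι → ℂ) (l₁ l₂ : List ι) : inside r (l₂ ++ l₁) = inside r (l₁ ++ l₂) := by
  have hp := polyEdges_rotate_perm l₂ l₁
  ext y
  simp only [inside, mem_ofPred_eq, trace_perm r hp, wind_perm r hp]

lemma SimplePoly.rotate {r : ι → ℂ} {l₁ l₂ : List ι} (h : SimplePoly r (l₁ ++ l₂)) :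
    SimplePoly r (l₂ ++ l₁) := by
  have hp := polyEdges_rotate_perm l₂ l₁
  refine ⟨List.nodup_append_comm.mp h.nodup, fun a ha b hb => h.inj a ?_ b ?_,
    fun e he e' he' => h.ok e (hp.subset he) e' (hp.subset he')⟩
  · simpa [or_comm] using ha
  · simpa [or_comm] using hb

lemma cycOrder_rotate {l₁ l₂ : List ι} {t : ι × ι × ι} (h : CycOrder (l₁ ++ l₂) t) :
    CycOrder (l₂ ++ l₁) t := by
  have key : ∀ a b c : ι, List.Sublist [a, b, c] (l₁ ++ l₂) →
      List.Sublist [a, b, c] (l₂ ++ l₁) ∨ List.Sublist [b, c, a] (l₂ ++ l₁) ∨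
      List.Sublist [c, a, b] (l₂ ++ l₁) := by
    intro a b c h
    obtain ⟨s₁, s₂, hs, h1, h2⟩ := List.sublist_append_iff.mp h
    have h3 := h2.append h1
    match s₁, hs with
    | [], hs => simp at hs; subst hs; left; simpa using h3
    | [x], hs => simp at hs; obtain ⟨rfl, rfl⟩ := hs; right; left; simpa using h3
    | [x, y], hs => simp at hs; obtain ⟨rfl, rfl, rfl⟩ := hs; right; right; simpa using h3
    | [x, y, z], hs => simp at hs; obtain ⟨rfl, rfl, rfl, rfl⟩ := hs; left; simpa using h3
  unfold CycOrder at h ⊢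
  rcases h with h | h | h
  · have := key _ _ _ h; tauto
  · have := key _ _ _ h; tauto
  · have := key _ _ _ h; tauto

lemma CycOrder.mono {l l' : List ι} (hl : l.Sublist l') {t : ι × ι × ι} (h : CycOrder l t) :
    CycOrder l' t := by
  unfold CycOrder at h ⊢
  exact h.imp (·.trans hl) (Or.imp (·.trans hl) (·.trans hl))

lemma Filling.rotate {r : ι → ℂ} {l₁ l₂ : List ι} {ts : List (ι × ι × ι)} {σ : ℝ}
    (h : Filling r (l₁ ++ l₂) ts σ) : Filling r (l₂ ++ l₁) ts σ := by
  have hp := polyEdges_rotate_perm l₁ l₂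
  refine ⟨h.sgn, fun t ht => cycOrder_rotate (h.cyc t ht), h.pos, fun θ hθ => ?_, ?_, ?_, ?_⟩
  · rw [h.chain θ hθ, edgeSum_perm θ hp]
  · rw [← trace_perm r hp]
    intro y hy
    rw [← wind_perm r hp]
    exact h.two y hy
  · rw [inside_rotate]; exact h.conn
  · rw [inside_rotate, ← trace_perm r hp]; exact h.cl

lemma inside_triangle {r : ι → ℂ} {σ : ℝ} (hσ : σ = 1 ∨ σ = -1) {a b c : ι}
    (h : 0 < σ * orient (r a) (r b) (r c)) :
    inside r [a, b, c] = openTri σ (r a) (r b) (r c) := by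
  ext y
  constructor
  · rintro ⟨h1, h2⟩
    by_contra h3
    exact h2 ((wind_triangle hσ h h1).2 h3)
  · intro hy
    have h1 := openTri_disjoint_trace hy
    refine ⟨h1, ?_⟩
    rw [(wind_triangle hσ h h1).1 hy]
    rcases hσ with rfl | rfl <;> simp [Real.pi_pos.ne']

lemma filling_triangle {r : ι → ℂ} {σ : ℝ} (hσ : σ = 1 ∨ σ = -1) {a b c : ι}
    (h : 0 < σ * orient (r a) (r b) (r c)) : Filling r [a, b, c] [(a, b, c)] σ where
  sgn := hσ
  cyc := by simp [CycOrder]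
  pos := by simpa using h
  chain θ _ := by simp [polyEdges_three, bdrySum]; ring
  two y hy := by
    by_cases hi : y ∈ openTri σ (r a) (r b) (r c)
    · exact Or.inr ((wind_triangle hσ h hy).1 hi)
    · exact Or.inl ((wind_triangle hσ h hy).2 hi)
  conn := by rw [inside_triangle hσ h]; exact (convex_openTri _ _ _ _).isPreconnected
  cl := by
    rw [inside_triangle hσ h]
    exact (trace_three_subset h).trans (closedTri_subset_closure h)

lemma wind_jump {r : ι → ℂ} {a b : ι} {E : List (ι × ι)} {m : ℂ}
    (hm : m ∈ openSegment ℝ (r a) (r b)) (hab : r a ≠ r b) (hE : m ∉ trace r E) :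
    ∃ N ∈ nhds m, ∀ y₁ ∈ N, ∀ y₂ ∈ N, 0 < orient y₁ (r a) (r b) → orient y₂ (r a) (r b) < 0 →
      wind r ((a, b) :: E) y₁ ≠ wind r ((a, b) :: E) y₂ := by
  have hc := Metric.continuousAt_iff.mp (continuousAt_wind hE) (π / 2)
    (by have := Real.pi_pos; positivity)
  obtain ⟨δ, hδ, hc⟩ := hc
  refine ⟨_, Filter.inter_mem (Metric.ball_mem_nhds m hδ) (ang_jump hm hab), ?_⟩
  rintro y₁ ⟨h1, k1⟩ y₂ ⟨h2, k2⟩ o1 o2 he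
  simp only [wind_cons] at he
  have := k1.1 o1
  have := k2.2 o2
  have := abs_lt.mp (Real.dist_eq _ _ ▸ hc h1)
  have := abs_lt.mp (Real.dist_eq _ _ ▸ hc h2)
  linarith

lemma exists_both_sides {a b m : ℂ} (hm : m ∈ segment ℝ a b) (hab : a ≠ b) {N : Set ℂ}
    (hN : N ∈ nhds m) : ∃ y₁ ∈ N, ∃ y₂ ∈ N, 0 < orient y₁ a b ∧ orient y₂ a b < 0 := by
  set ν : ℂ := Complex.I * (b - a)
  have ho : ∀ t : ℝ, orient (m + t * ν) a b = t * Complex.normSq (b - a) := by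
    intro t
    obtain ⟨p, q, hp, hq, hpq, rfl⟩ := hm
    obtain rfl : q = 1 - p := by linarith
    simp [orient, cr, ν, Complex.normSq_apply]; ring
  have hn := Complex.normSq_pos.mpr (sub_ne_zero.mpr hab.symm)
  have hc : Continuous fun t : ℝ => m + t * ν := by fun_prop
  have h0 : (fun t : ℝ => m + t * ν) ⁻¹' N ∈ nhds (0 : ℝ) :=
    hc.continuousAt.preimage_mem_nhds (by simpa using hN)
  obtain ⟨δ, hδ, hb⟩ := Metric.mem_nhds_iff.mp h0
  refine ⟨_, hb (show δ / 2 ∈ _ by simp [abs_of_pos hδ]; linarith), _,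
    hb (show -(δ / 2) ∈ _ by simp [abs_of_pos hδ]; linarith), ?_, ?_⟩
  · rw [ho]; positivity
  · rw [ho]; have : 0 < δ / 2 * Complex.normSq (b - a) := by positivity
    linarith

lemma fst_mem_of_pathEdges {l : List ι} {z : ι} {e : ι × ι} (h : e ∈ pathEdges (l ++ [z])) :
    e.1 ∈ l := by
  induction l with
  | nil => simp [pathEdges] at h
  | cons a l ih =>
    cases l with
    | nil => simp [pathEdges] at h; simp [h]
    | cons b l =>
      simp only [List.cons_append, pathEdges, List.mem_cons] at h ih ⊢
      rcases h with rfl | h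
      · simp
      · exact Or.inr (ih h)

lemma mem_or_mem_of_pathEdges {a z : ι} {l : List ι} (hl : l ≠ []) {e : ι × ι}
    (h : e ∈ pathEdges (a :: l ++ [z])) : e.1 ∈ l ∨ e.2 ∈ l := by
  cases l with
  | nil => exact absurd rfl hl
  | cons b l =>
    simp only [List.cons_append, pathEdges, List.mem_cons] at h
    rcases h with rfl | h
    · simp
    · exact Or.inl (fst_mem_of_pathEdges (l := b :: l) h)

lemma pathEdges_subset_append {l : List ι} {a z : ι} :
    ∀ e ∈ pathEdges l, e ∈ pathEdges (a :: l ++ [z]) := by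
  intro e he
  have h1 : ∀ e ∈ pathEdges l, e ∈ pathEdges (l ++ [z]) := by
    clear he
    induction l with
    | nil => simp [pathEdges]
    | cons b l ih =>
      cases l with
      | nil => simp [pathEdges]
      | cons c l =>
        intro e he
        simp only [List.cons_append, pathEdges, List.mem_cons] at he ih ⊢
        exact he.imp id (ih e)
  cases l with
  | nil => simp [pathEdges] at he
  | cons b l =>
    simp only [List.cons_append, pathEdges, List.mem_cons]
    exact Or.inr (h1 e he)

lemma segment_aux {p q x : ℂ} (h1 : x ∈ segment ℝ p q) (h2 : p ∈ segment ℝ x q) : x = p := by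
  rw [mem_segment_iff_wbtw] at h1 h2
  exact (wbtw_swap_left_iff ℝ q).mp ⟨h2, h1⟩

/-- The winding of a polygon `Q` is constant along a path meeting it at most at its ends. -/
lemma wind_const_path {r : ι → ℂ} {Q : List ι} {a z : ι} {l : List ι} (hl : l ≠ [])
    (hmeet : ∀ e ∈ pathEdges (a :: l ++ [z]), ∀ x ∈ segment ℝ (r e.1) (r e.2),
      x ∈ trace r (polyEdges Q) → ∃ i, i ∉ l ∧ (i = e.1 ∨ i = e.2) ∧ x = r i)
    {x y : ℂ} (hx : x ∈ trace r (pathEdges (a :: l ++ [z]))) (hxQ : x ∉ trace r (polyEdges Q))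
    (hy : y ∈ trace r (pathEdges (a :: l ++ [z]))) (hyQ : y ∉ trace r (polyEdges Q)) :
    wind r (polyEdges Q) x = wind r (polyEdges Q) y := by
  have h1 : ∀ e ∈ pathEdges (a :: l ++ [z]), ∀ i ∈ l, (i = e.1 ∨ i = e.2) →
      ∀ x ∈ segment ℝ (r e.1) (r e.2), x ∉ trace r (polyEdges Q) →
      wind r (polyEdges Q) x = wind r (polyEdges Q) (r i) := by
    intro e he i hi hie x hx hxQ
    have hri : r i ∈ segment ℝ (r e.1) (r e.2) := by
      rcases hie with rfl | rfl
      exacts [left_mem_segment ℝ _ _, right_mem_segment ℝ _ _]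
    refine wind_const (convex_segment x (r i)).isPreconnected (fun p hp hpQ => ?_)
      (left_mem_segment ℝ _ _) (right_mem_segment ℝ _ _)
    have hp' := (convex_segment (r e.1) (r e.2)).segment_subset hx hri hp
    obtain ⟨j, hj, hje, rfl⟩ := hmeet e he p hp' hpQ
    have hij : i ≠ j := fun h => hj (h ▸ hi)
    have : x = r j := by
      refine segment_aux (q := r i) ?_ hp
      rcases hie with rfl | rfl <;> rcases hje with rfl | rfl
      · exact absurd rfl hij
      · rwa [segment_symm]
      · exact hx
      · exact absurd rfl hij
    exact hxQ (this ▸ hpQ)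
  have hlQ : ∀ e ∈ pathEdges (a :: l ++ [z]), ∀ i ∈ l, (i = e.1 ∨ i = e.2) →
      (∀ j, (j = e.1 ∨ j = e.2) → j ∉ l → r j ≠ r i) → r i ∉ trace r (polyEdges Q) := by
    intro e he i hi hie hne hQ
    obtain ⟨j, hj, hje, h⟩ := hmeet e he (r i) (by
      rcases hie with rfl | rfl
      exacts [left_mem_segment ℝ _ _, right_mem_segment ℝ _ _]) hQ
    exact hne j hje hj h.symm
  obtain ⟨b, l', rfl⟩ := List.exists_cons_of_ne_nil hl
  have h2 : ∀ i ∈ b :: l', wind r (polyEdges Q) (r i) = wind r (polyEdges Q) (r b) := by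
    refine forall_mem_of_pathEdges rfl fun e he h => ?_
    rw [← h]
    have hm := mem_of_mem_pathEdges he
    have he' := pathEdges_subset_append (a := a) (z := z) e he
    refine h1 e he' _ hm.1 (Or.inl rfl) _ (right_mem_segment ℝ _ _) ?_
    refine hlQ e he' _ hm.2 (Or.inr rfl) fun j hj hjl => ?_
    rcases hj with rfl | rfl
    exacts [absurd hm.1 hjl, absurd hm.2 hjl]
  have h3 : ∀ x ∈ trace r (pathEdges (a :: (b :: l') ++ [z])), x ∉ trace r (polyEdges Q) →
      wind r (polyEdges Q) x = wind r (polyEdges Q) (r b) := by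
    intro x hx hxQ
    obtain ⟨e, he, hxe⟩ := mem_trace.mp hx
    rcases mem_or_mem_of_pathEdges hl he with h | h
    · rw [h1 e he _ h (Or.inl rfl) x hxe hxQ, h2 _ h]
    · rw [h1 e he _ h (Or.inr rfl) x hxe hxQ, h2 _ h]
  rw [h3 x hx hxQ, h3 y hy hyQ]

/-- Two regions are disjoint as soon as the first avoids the other polygon and
has a boundary point about which the other polygon does not wind. -/
lemma inside_disjoint {r : ι → ℂ} {l l' : List ι} {ts : List (ι × ι × ι)} {σ : ℝ}
    (h : Filling r l ts σ) (hd : ∀ y ∈ inside r l, y ∉ trace r (polyEdges l')) {x : ℂ}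
    (hx : x ∈ trace r (polyEdges l)) (hx' : x ∉ trace r (polyEdges l'))
    (hw : wind r (polyEdges l') x = 0) : ∀ y ∈ inside r l, y ∉ inside r l' := by
  obtain ⟨x', ⟨-, h2⟩, h3⟩ := mem_closure_iff_nhds.mp (h.cl hx) _ (eventually_wind_eq hx')
  intro y hy hy'
  apply hy'.2
  rw [wind_const h.conn hd hy h3, h2, hw]

set_option maxHeartbeats 800000 in
/-- Gluing the fillings of the two halves of a polygon cut by a diagonal. -/
lemma Filling.glue {r : ι → ℂ} {a z : ι} {l₁ l₂ : List ι} (h₁ : l₁ ≠ []) (h₂ : l₂ ≠ [])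
    (hP : SimplePoly r (a :: l₁ ++ z :: l₂))
    (hdiag : ∀ e ∈ polyEdges (a :: l₁ ++ z :: l₂), SegOK r a z e.1 e.2)
    {ts₁ ts₂ : List (ι × ι × ι)} {σ₁ σ₂ : ℝ} (F₁ : Filling r (a :: l₁ ++ [z]) ts₁ σ₁)
    (F₂ : Filling r (a :: z :: l₂) ts₂ σ₂) {x₁ x₂ : ℂ}
    (hx₁ : x₁ ∈ trace r (pathEdges (a :: l₁ ++ [z])))
    (hx₁' : x₁ ∉ trace r (polyEdges (a :: z :: l₂)))
    (hw₁ : wind r (polyEdges (a :: z :: l₂)) x₁ = 0)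
    (hx₂ : x₂ ∈ trace r (pathEdges (z :: l₂ ++ [a])))
    (hx₂' : x₂ ∉ trace r (polyEdges (a :: l₁ ++ [z])))
    (hw₂ : wind r (polyEdges (a :: l₁ ++ [z])) x₂ = 0) :
    Filling r (a :: l₁ ++ z :: l₂) (ts₁ ++ ts₂) σ₁ := by
  set C₁ := pathEdges (a :: l₁ ++ [z]) with hC₁
  set C₂ := pathEdges (z :: l₂ ++ [a]) with hC₂
  have hE : polyEdges (a :: l₁ ++ z :: l₂) = C₁ ++ C₂ := polyEdges_append_cons _ _ _ _
  have hE₁ : polyEdges (a :: l₁ ++ [z]) = C₁ ++ [(z, a)] := polyEdges_append_cons _ _ _ _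
  have hE₂ : polyEdges (a :: z :: l₂) = (a, z) :: C₂ := rfl
  have hnd := hP.nodup
  have ha₁ : a ∉ l₁ := by simp at hnd; tauto
  have ha₂ : a ∉ l₂ := by simp at hnd; tauto
  have haz : a ≠ z := by simp at hnd; tauto
  have hz₁ : z ∉ l₁ := fun h => by
    have := List.disjoint_of_nodup_append hnd (List.mem_cons_of_mem a h)
    simp at this
  have hz₂ : z ∉ l₂ := by
    have := (List.nodup_append.mp hnd).2.1; simp at this; tauto
  have h12 : ∀ i ∈ l₁, i ∉ l₂ := fun i h h' =>
    List.disjoint_of_nodup_append hnd (List.mem_cons_of_mem a h) (List.mem_cons_of_mem z h')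
  have hC₁l : ∀ e ∈ C₁, (e.1 ∈ l₁ ∨ e.2 ∈ l₁) ∧ (e.1 = a ∨ e.1 ∈ l₁ ∨ e.1 = z) ∧
      (e.2 = a ∨ e.2 ∈ l₁ ∨ e.2 = z) := by
    intro e he
    have := mem_of_mem_pathEdges he
    simp at this
    exact ⟨mem_or_mem_of_pathEdges h₁ he, this⟩
  have hC₂l : ∀ e ∈ C₂, (e.1 ∈ l₂ ∨ e.2 ∈ l₂) ∧ (e.1 = z ∨ e.1 ∈ l₂ ∨ e.1 = a) ∧
      (e.2 = z ∨ e.2 ∈ l₂ ∨ e.2 = a) := by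
    intro e he
    have := mem_of_mem_pathEdges he
    simp at this
    exact ⟨mem_or_mem_of_pathEdges h₂ he, this⟩
  have hdC₁ : ∀ e ∈ C₁, SegOK r a z e.1 e.2 := fun e he => hdiag e (by rw [hE]; simp [he])
  have hdC₂ : ∀ e ∈ C₂, SegOK r a z e.1 e.2 := fun e he => hdiag e (by rw [hE]; simp [he])
  have hCC : ∀ e ∈ C₁, ∀ e' ∈ C₂, SegOK r e.1 e.2 e'.1 e'.2 := fun e he e' he' =>
    hP.ok e (by rw [hE]; simp [he]) e' (by rw [hE]; simp [he'])
  have hraz : r a ≠ r z := fun h => haz (hP.inj a (by simp) z (by simp) h)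
  -- the chains meet the other polygons only at `a` and `z`
  have m₁ : ∀ e ∈ C₁, ∀ x ∈ segment ℝ (r e.1) (r e.2), x ∈ trace r (polyEdges (a :: z :: l₂)) →
      ∃ i, i ∉ l₁ ∧ (i = e.1 ∨ i = e.2) ∧ x = r i := by
    intro e he x hx hxt
    obtain ⟨k1, -, -⟩ := hC₁l e he
    rw [hE₂, trace_cons] at hxt
    rcases hxt with hxt | hxt
    · rcases hdC₁ e he x hxt hx with ⟨h1, h2⟩ | ⟨h1, h2⟩ | ⟨i, h1, h2, h3⟩
      · rw [← h1, ← h2] at k1; tauto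
      · rw [← h1, ← h2] at k1; tauto
      · exact ⟨i, by rcases h1 with rfl | rfl <;> assumption, h2, h3⟩
    · obtain ⟨e', he', hx'⟩ := mem_trace.mp hxt
      obtain ⟨-, j1, j2⟩ := hC₂l e' he'
      have j : ∀ i, (i = e'.1 ∨ i = e'.2) → i ∉ l₁ := by
        intro i hi hil
        have : i = z ∨ i ∈ l₂ ∨ i = a := by rcases hi with rfl | rfl <;> assumption
        rcases this with rfl | h | rfl
        exacts [hz₁ hil, h12 _ hil h, ha₁ hil]
      rcases hCC e he e' he' x hx hx' with ⟨h1, h2⟩ | ⟨h1, h2⟩ | ⟨i, h1, h2, h3⟩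
      · rw [h1, h2] at k1
        exact absurd k1 (not_or.mpr ⟨j _ (Or.inl rfl), j _ (Or.inr rfl)⟩)
      · rw [h1, h2] at k1
        exact absurd k1 (not_or.mpr ⟨j _ (Or.inr rfl), j _ (Or.inl rfl)⟩)
      · exact ⟨i, j i h2, h1, h3⟩
  have m₂ : ∀ e ∈ C₂, ∀ x ∈ segment ℝ (r e.1) (r e.2),
      x ∈ trace r (polyEdges (a :: l₁ ++ [z])) →
      ∃ i, i ∉ l₂ ∧ (i = e.1 ∨ i = e.2) ∧ x = r i := by
    intro e he x hx hxt
    obtain ⟨k1, -, -⟩ := hC₂l e he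
    rw [hE₁, trace_append, trace_cons, segment_symm] at hxt
    rcases hxt with hxt | hxt | hxt
    · obtain ⟨e', he', hx'⟩ := mem_trace.mp hxt
      obtain ⟨-, j1, j2⟩ := hC₁l e' he'
      have j : ∀ i, (i = e'.1 ∨ i = e'.2) → i ∉ l₂ := by
        intro i hi hil
        have : i = a ∨ i ∈ l₁ ∨ i = z := by rcases hi with rfl | rfl <;> assumption
        rcases this with rfl | h | rfl
        exacts [ha₂ hil, h12 _ h hil, hz₂ hil]
      rcases (hCC e' he' e he).symm x hx hx' with ⟨h1, h2⟩ | ⟨h1, h2⟩ | ⟨i, h1, h2, h3⟩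
      · rw [h1, h2] at k1
        exact absurd k1 (not_or.mpr ⟨j _ (Or.inl rfl), j _ (Or.inr rfl)⟩)
      · rw [h1, h2] at k1
        exact absurd k1 (not_or.mpr ⟨j _ (Or.inr rfl), j _ (Or.inl rfl)⟩)
      · exact ⟨i, j i h2, h1, h3⟩
    · rcases hdC₂ e he x hxt hx with ⟨h1, h2⟩ | ⟨h1, h2⟩ | ⟨i, h1, h2, h3⟩
      · rw [← h1, ← h2] at k1; tauto
      · rw [← h1, ← h2] at k1; tauto
      · exact ⟨i, by rcases h1 with rfl | rfl <;> assumption, h2, h3⟩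
    · simp [trace] at hxt
  have dP₁ : segment ℝ (r a) (r z) ⊆ trace r (polyEdges (a :: l₁ ++ [z])) := by
    rw [hE₁, trace_append, trace_cons, segment_symm ℝ (r z)]
    exact subset_union_left.trans subset_union_right
  have dP₂ : segment ℝ (r a) (r z) ⊆ trace r (polyEdges (a :: z :: l₂)) := by
    rw [hE₂, trace_cons]; exact subset_union_left
  -- each region avoids the other polygon
  have d₂ : ∀ y ∈ inside r (a :: z :: l₂), y ∉ trace r (polyEdges (a :: l₁ ++ [z])) := by
    rintro y ⟨hy1, hy2⟩ hyt
    rw [hE₁, trace_append, trace_cons, segment_symm] at hyt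
    rcases hyt with hyt | hyt | hyt
    · exact hy2 ((wind_const_path h₁ m₁ hyt hy1 hx₁ hx₁').trans hw₁)
    · exact hy1 (dP₂ hyt)
    · simp [trace] at hyt
  have d₁ : ∀ y ∈ inside r (a :: l₁ ++ [z]), y ∉ trace r (polyEdges (a :: z :: l₂)) := by
    rintro y ⟨hy1, hy2⟩ hyt
    rw [hE₂, trace_cons] at hyt
    rcases hyt with hyt | hyt
    · exact hy1 (dP₁ hyt)
    · exact hy2 ((wind_const_path h₂ m₂ hyt hy1 hx₂ hx₂').trans hw₂)
  have hC₂P₂ : trace r C₂ ⊆ trace r (polyEdges (a :: z :: l₂)) := by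
    rw [hE₂, trace_cons]; exact subset_union_right
  have hC₁P₁ : trace r C₁ ⊆ trace r (polyEdges (a :: l₁ ++ [z])) := by
    rw [hE₁, trace_append]; exact subset_union_left
  have d₂₁ := inside_disjoint F₂ d₂ (hC₂P₂ hx₂) hx₂' hw₂
  have hW : ∀ y, wind r (polyEdges (a :: l₁ ++ z :: l₂)) y =
      wind r (polyEdges (a :: l₁ ++ [z])) y + wind r (polyEdges (a :: z :: l₂)) y := by
    intro y
    rw [hE, hE₁, hE₂, wind_append, wind_append, wind_cons, wind_cons, ang_swap y (r a) (r z)]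
    simp [wind]
  have hT : trace r (polyEdges (a :: l₁ ++ z :: l₂)) = trace r C₁ ∪ trace r C₂ := by
    rw [hE, trace_append]
  have hopen : ∀ m ∈ openSegment ℝ (r a) (r z),
      m ∉ trace r (polyEdges (a :: l₁ ++ z :: l₂)) := by
    intro m hm hmt
    have hne : ∀ i, (i = a ∨ i = z) → m ≠ r i := by
      rintro i (rfl | rfl) rfl
      · exact hraz (left_mem_openSegment_iff.mp hm)
      · exact hraz (right_mem_openSegment_iff.mp hm)
    have hm' := openSegment_subset_segment ℝ _ _ hm
    rw [hT] at hmt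
    rcases hmt with hmt | hmt <;> obtain ⟨e, he, hx⟩ := mem_trace.mp hmt
    · obtain ⟨i, h1, h2, h3⟩ := m₁ e he m hx (dP₂ hm')
      obtain ⟨-, k2, k3⟩ := hC₁l e he
      refine hne i ?_ h3
      rcases h2 with rfl | rfl <;> tauto
    · obtain ⟨i, h1, h2, h3⟩ := m₂ e he m hx (dP₁ hm')
      obtain ⟨-, k2, k3⟩ := hC₂l e he
      refine hne i ?_ h3
      rcases h2 with rfl | rfl <;> tauto
  have hdiagwind : ∀ m ∈ openSegment ℝ (r a) (r z),
      wind r (polyEdges (a :: l₁ ++ z :: l₂)) m = 2 * π * σ₁ ∧ σ₁ = σ₂ := by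
    intro m hm
    have hmP := hopen m hm
    have hm₁ : m ∉ trace r C₁ := fun h => hmP (by rw [hT]; exact Or.inl h)
    have hm₂ : m ∉ trace r C₂ := fun h => hmP (by rw [hT]; exact Or.inr h)
    obtain ⟨N₁, hN₁, J₁⟩ := wind_jump (openSegment_symm ℝ (r a) (r z) ▸ hm) hraz.symm hm₁
    obtain ⟨N₂, hN₂, J₂⟩ := wind_jump hm hraz hm₂
    have hperm : (polyEdges (a :: l₁ ++ [z])).Perm ((z, a) :: C₁) := by
      rw [hE₁]; exact List.perm_append_comm
    have hoff : ∀ᶠ y in nhds m, y ∉ trace r C₁ ∧ y ∉ trace r C₂ := by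
      filter_upwards [(isClosed_trace r C₁).isOpen_compl.mem_nhds hm₁,
        (isClosed_trace r C₂).isOpen_compl.mem_nhds hm₂] with y h1 h2 using ⟨h1, h2⟩
    obtain ⟨yL, hL, yR, hR, oL, oR⟩ := exists_both_sides (openSegment_subset_segment ℝ _ _ hm) hraz
      (Filter.inter_mem (Filter.inter_mem hN₁ hN₂)
        (Filter.inter_mem hoff (eventually_wind_eq hmP)))
    obtain ⟨⟨L1, L2⟩, ⟨L3, L4⟩, L5, L6⟩ := hL
    obtain ⟨⟨R1, R2⟩, ⟨R3, R4⟩, R5, R6⟩ := hR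
    have sL := notMem_segment_of_orient oL.ne'
    have sR := notMem_segment_of_orient oR.ne
    have t₁ : ∀ y, y ∉ segment ℝ (r a) (r z) → y ∉ trace r C₁ →
        y ∉ trace r (polyEdges (a :: l₁ ++ [z])) := by
      intro y h1 h2
      rw [trace_perm r hperm, trace_cons, segment_symm]
      exact not_or.mpr ⟨h1, h2⟩
    have t₂ : ∀ y, y ∉ segment ℝ (r a) (r z) → y ∉ trace r C₂ →
        y ∉ trace r (polyEdges (a :: z :: l₂)) := by
      intro y h1 h2
      rw [hE₂, trace_cons]
      exact not_or.mpr ⟨h1, h2⟩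
    have n₁ : wind r (polyEdges (a :: l₁ ++ [z])) yR ≠ wind r (polyEdges (a :: l₁ ++ [z])) yL := by
      rw [wind_perm r hperm, wind_perm r hperm]
      refine J₁ yR R1 yL L1 ?_ ?_ <;> rw [orient_swap_right] <;> linarith
    have n₂ : wind r (polyEdges (a :: z :: l₂)) yL ≠ wind r (polyEdges (a :: z :: l₂)) yR := by
      rw [hE₂]
      exact J₂ yL L2 yR R2 oL oR
    have w₁L := F₁.two yL (t₁ _ sL L3)
    have w₁R := F₁.two yR (t₁ _ sR R3)
    have w₂L := F₂.two yL (t₂ _ sL L4)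
    have w₂R := F₂.two yR (t₂ _ sR R4)
    have dL : ¬ (wind r (polyEdges (a :: l₁ ++ [z])) yL ≠ 0 ∧
        wind r (polyEdges (a :: z :: l₂)) yL ≠ 0) := fun h =>
      d₂₁ yL ⟨t₂ _ sL L4, h.2⟩ ⟨t₁ _ sL L3, h.1⟩
    have dR : ¬ (wind r (polyEdges (a :: l₁ ++ [z])) yR ≠ 0 ∧
        wind r (polyEdges (a :: z :: l₂)) yR ≠ 0) := fun h =>
      d₂₁ yR ⟨t₂ _ sR R4, h.2⟩ ⟨t₁ _ sR R3, h.1⟩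
    have eL := hW yL
    have eR := hW yR
    rw [L6] at eL
    rw [R6] at eR
    have hπ : (2 * π) ≠ 0 := by positivity
    have key : wind r (polyEdges (a :: l₁ ++ z :: l₂)) m = 2 * π * σ₁ ∧
        2 * π * σ₁ = 2 * π * σ₂ := by
      rcases w₁L with u1 | u1 <;> rcases w₁R with u2 | u2 <;> rcases w₂L with u3 | u3 <;>
        rcases w₂R with u4 | u4 <;> grind
    exact ⟨key.1, mul_left_cancel₀ hπ key.2⟩
  set m : ℂ := (1 / 2 : ℝ) • r a + (1 / 2 : ℝ) • r z with hm_def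
  have hm : m ∈ openSegment ℝ (r a) (r z) :=
    ⟨1 / 2, 1 / 2, by norm_num, by norm_num, by norm_num, rfl⟩
  have hσ := (hdiagwind m hm).2
  subst hσ
  have hπσ : 2 * π * σ₁ ≠ 0 := by
    rcases F₁.sgn with h | h <;> rw [h] <;> simp [Real.pi_pos.ne']
  have hend : ∀ y, y ∈ segment ℝ (r a) (r z) → y ∉ trace r (polyEdges (a :: l₁ ++ z :: l₂)) →
      y ∈ openSegment ℝ (r a) (r z) := by
    intro y hy hyT
    rw [← insert_endpoints_openSegment] at hy
    have hraT : ∀ i, i = a ∨ i = z → r i ∈ trace r (polyEdges (a :: l₁ ++ z :: l₂)) := by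
      rintro i (rfl | rfl)
      · rw [hT]; left
        obtain ⟨b, l, rfl⟩ := List.exists_cons_of_ne_nil h₁
        exact mem_trace.mpr ⟨(i, b), by simp [hC₁, pathEdges], left_mem_segment ℝ _ _⟩
      · rw [hT]; right
        obtain ⟨b, l, rfl⟩ := List.exists_cons_of_ne_nil h₂
        exact mem_trace.mpr ⟨(i, b), by simp [hC₂, pathEdges], left_mem_segment ℝ _ _⟩
    rcases hy with rfl | rfl | hy
    · exact absurd (hraT a (Or.inl rfl)) hyT
    · exact absurd (hraT z (Or.inr rfl)) hyT
    · exact hy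
  have hoffd : ∀ y, y ∉ trace r (polyEdges (a :: l₁ ++ z :: l₂)) → y ∉ segment ℝ (r a) (r z) →
      y ∉ trace r (polyEdges (a :: l₁ ++ [z])) ∧ y ∉ trace r (polyEdges (a :: z :: l₂)) := by
    intro y hy hyd
    rw [hT, mem_union, not_or] at hy
    rw [hE₁, hE₂, trace_append, trace_cons, trace_cons, segment_symm]
    simp only [mem_union, not_or]
    refine ⟨⟨hy.1, hyd, by simp [trace]⟩, hyd, hy.2⟩
  have i₁ : inside r (a :: l₁ ++ [z]) ⊆ inside r (a :: l₁ ++ z :: l₂) := by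
    intro y hy
    have h2 := d₁ y hy
    refine ⟨?_, ?_⟩
    · rw [hT]; exact not_or.mpr ⟨fun h => hy.1 (hC₁P₁ h), fun h => h2 (hC₂P₂ h)⟩
    · rw [hW]
      have : wind r (polyEdges (a :: z :: l₂)) y = 0 := by
        by_contra h0
        exact d₂₁ y ⟨h2, h0⟩ hy
      rw [this, add_zero]; exact hy.2
  have i₂ : inside r (a :: z :: l₂) ⊆ inside r (a :: l₁ ++ z :: l₂) := by
    intro y hy
    have h2 := d₂ y hy
    refine ⟨?_, ?_⟩
    · rw [hT]; exact not_or.mpr ⟨fun h => h2 (hC₁P₁ h), fun h => hy.1 (hC₂P₂ h)⟩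
    · rw [hW]
      have : wind r (polyEdges (a :: l₁ ++ [z])) y = 0 := by
        by_contra h0
        exact d₂₁ y hy ⟨h2, h0⟩
      rw [this, zero_add]; exact hy.2
  have hsub : inside r (a :: l₁ ++ z :: l₂) ⊆
      closure (inside r (a :: l₁ ++ [z]) ∪ inside r (a :: z :: l₂)) := by
    intro y hy
    by_cases hyd : y ∈ segment ℝ (r a) (r z)
    · exact closure_mono subset_union_left (F₁.cl (dP₁ hyd))
    · obtain ⟨k1, k2⟩ := hoffd y hy.1 hyd
      apply subset_closure
      have := hy.2
      rw [hW] at this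
      by_cases h0 : wind r (polyEdges (a :: l₁ ++ [z])) y = 0
      · right; exact ⟨k2, by rwa [h0, zero_add] at this⟩
      · left; exact ⟨k1, h0⟩
  have hmI : m ∈ inside r (a :: l₁ ++ z :: l₂) :=
    ⟨hopen m hm, by rw [(hdiagwind m hm).1]; exact hπσ⟩
  have hm' := openSegment_subset_segment ℝ _ _ hm
  refine ⟨F₁.sgn, ?_, ?_, ?_, ?_, ?_, ?_⟩
  · intro t ht
    rcases List.mem_append.mp ht with ht | ht
    · exact (F₁.cyc t ht).mono (by simp)
    · exact (F₂.cyc t ht).mono (by simp)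
  · intro t ht
    rcases List.mem_append.mp ht with ht | ht
    exacts [F₁.pos t ht, F₂.pos t ht]
  · intro θ hθ
    rw [List.map_append, List.sum_append, F₁.chain θ hθ, F₂.chain θ hθ, hE, hE₁, hE₂]
    simp [hθ a z]
  · intro y hy
    by_cases hyd : y ∈ segment ℝ (r a) (r z)
    · exact Or.inr (hdiagwind y (hend y hyd hy)).1
    · obtain ⟨k1, k2⟩ := hoffd y hy hyd
      have dd : ¬ (wind r (polyEdges (a :: l₁ ++ [z])) y ≠ 0 ∧
          wind r (polyEdges (a :: z :: l₂)) y ≠ 0) := fun h => d₂₁ y ⟨k2, h.2⟩ ⟨k1, h.1⟩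
      rw [hW]
      rcases F₁.two y k1 with u1 | u1 <;> rcases F₂.two y k2 with u2 | u2 <;> rw [u1, u2]
      · simp
      · simp
      · simp
      · exact absurd ⟨by rwa [u1], by rwa [u2]⟩ dd
  · have c₁ : IsPreconnected (insert m (inside r (a :: l₁ ++ [z]))) :=
      F₁.conn.subset_closure (subset_insert _ _)
        (insert_subset (F₁.cl (dP₁ hm')) subset_closure)
    have c₂ : IsPreconnected (insert m (inside r (a :: z :: l₂))) :=
      F₂.conn.subset_closure (subset_insert _ _)
        (insert_subset (F₂.cl (dP₂ hm')) subset_closure)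
    have c := IsPreconnected.union m (mem_insert _ _) (mem_insert _ _) c₁ c₂
    refine c.subset_closure ?_ (hsub.trans (closure_mono ?_))
    · exact union_subset (insert_subset hmI i₁) (insert_subset hmI i₂)
    · exact union_subset_union (subset_insert _ _) (subset_insert _ _)
  · rw [hT]
    refine union_subset ((hC₁P₁.trans F₁.cl).trans (closure_mono i₁))
      ((hC₂P₂.trans F₂.cl).trans (closure_mono i₂))

lemma notMem_trace_of_halfPlane {r : ι → ℂ} {l : List ι} {y w : ℂ}
    (h : ∀ a ∈ l, 0 < ((r a - y) * w).re) : y ∉ trace r (polyEdges l) := by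
  intro hy
  obtain ⟨e, he, s, t, hs, ht, hst, hy⟩ := mem_trace.mp hy
  have hm := mem_of_mem_polyEdges he
  have h1 := h _ hm.1
  have h2 := h _ hm.2
  have e1 : s * ((r e.1 - y) * w).re + t * ((r e.2 - y) * w).re =
      ((s • r e.1 + t • r e.2 - (s + t) • y) * w).re := by
    simp; ring
  rw [hst, hy, one_smul, sub_self, zero_mul, Complex.zero_re] at e1
  rcases hs.eq_or_lt with rfl | hs
  · simp only [zero_add] at hst; subst hst; linarith
  · nlinarith [mul_pos hs h1, mul_nonneg ht h2.le]

lemma exists_edge_fst {l : List ι} {p : ι} (hp : p ∈ l) : ∃ e ∈ polyEdges l, e.1 = p := by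
  obtain ⟨s, t, rfl⟩ := List.append_of_mem hp
  have h : ∃ e ∈ polyEdges (p :: t ++ s), e.1 = p := by
    rw [List.cons_append, polyEdges_cons]
    rcases hl : t ++ s with _ | ⟨b, l⟩
    · exact ⟨(p, p), by simp [pathEdges], rfl⟩
    · exact ⟨(p, b), by simp [pathEdges], rfl⟩
  obtain ⟨e, he, h⟩ := h
  exact ⟨e, (polyEdges_rotate_perm _ _).subset he, h⟩

lemma SimplePoly.mem_edge {r : ι → ℂ} {l : List ι} (h : SimplePoly r l) {p : ι} (hp : p ∈ l)
    {e : ι × ι} (he : e ∈ polyEdges l) (hx : r p ∈ segment ℝ (r e.1) (r e.2)) :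
    p = e.1 ∨ p = e.2 := by
  obtain ⟨e', he', rfl⟩ := exists_edge_fst hp
  rcases h.ok e he e' he' _ hx (left_mem_segment ℝ _ _) with h1 | h1 | ⟨i, h1, h2, h3⟩
  · exact Or.inl h1.1.symm
  · exact Or.inr h1.2.symm
  · have hi : i ∈ l := by
      have := mem_of_mem_polyEdges he'
      rcases h2 with rfl | rfl
      exacts [this.1, this.2]
    rw [h.inj _ hp _ hi h3]
    exact h1

lemma SegOK.refl (r : ι → ℂ) (a b : ι) : SegOK r a b a b := fun _ _ _ => Or.inl ⟨rfl, rfl⟩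

lemma SimplePoly.left {r : ι → ℂ} {a z : ι} {l₁ l₂ : List ι}
    (hP : SimplePoly r (a :: l₁ ++ z :: l₂))
    (hdiag : ∀ e ∈ polyEdges (a :: l₁ ++ z :: l₂), SegOK r a z e.1 e.2) :
    SimplePoly r (a :: l₁ ++ [z]) := by
  have hs : (a :: l₁ ++ [z]).Sublist (a :: l₁ ++ z :: l₂) := by simp
  have hE : polyEdges (a :: l₁ ++ z :: l₂) = _ := polyEdges_append_cons _ _ _ _
  have hE₁ : polyEdges (a :: l₁ ++ [z]) = pathEdges (a :: l₁ ++ [z]) ++ [(z, a)] :=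
    polyEdges_append_cons _ _ _ _
  refine ⟨hP.nodup.sublist hs, fun p hp q hq => hP.inj p (hs.subset hp) q (hs.subset hq), ?_⟩
  rw [hE₁]
  rw [hE] at hdiag
  have hok := hP.ok
  rw [hE] at hok
  have hl : ∀ e ∈ pathEdges (a :: l₁ ++ [z]),
    e ∈ pathEdges (a :: l₁ ++ [z]) ++ pathEdges (z :: l₂ ++ [a]) := fun e he =>
    List.mem_append_left _ he
  intro e he e' he'
  rcases List.mem_append.mp he with he | he <;> rcases List.mem_append.mp he' with he' | he'
  · exact hok e (hl e he) e' (hl e' he')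
  · obtain rfl := List.mem_singleton.mp he'
    exact (hdiag e (hl e he)).swap.symm
  · obtain rfl := List.mem_singleton.mp he
    exact (hdiag e' (hl e' he')).swap
  · obtain rfl := List.mem_singleton.mp he
    obtain rfl := List.mem_singleton.mp he'
    exact SegOK.refl _ _ _

lemma SimplePoly.right {r : ι → ℂ} {a z : ι} {l₁ l₂ : List ι}
    (hP : SimplePoly r (a :: l₁ ++ z :: l₂))
    (hdiag : ∀ e ∈ polyEdges (a :: l₁ ++ z :: l₂), SegOK r a z e.1 e.2) :
    SimplePoly r (a :: z :: l₂) := by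
  have hs : (a :: z :: l₂).Sublist (a :: l₁ ++ z :: l₂) := by simp
  have hE : polyEdges (a :: l₁ ++ z :: l₂) = _ := polyEdges_append_cons _ _ _ _
  have hE₂ : polyEdges (a :: z :: l₂) = (a, z) :: pathEdges (z :: l₂ ++ [a]) := rfl
  refine ⟨hP.nodup.sublist hs, fun p hp q hq => hP.inj p (hs.subset hp) q (hs.subset hq), ?_⟩
  rw [hE₂]
  rw [hE] at hdiag
  have hok := hP.ok
  rw [hE] at hok
  have hl : ∀ e ∈ pathEdges (z :: l₂ ++ [a]),
    e ∈ pathEdges (a :: l₁ ++ [z]) ++ pathEdges (z :: l₂ ++ [a]) := fun e he =>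
    List.mem_append_right _ he
  intro e he e' he'
  rcases List.mem_cons.mp he with rfl | he <;> rcases List.mem_cons.mp he' with rfl | he'
  · exact SegOK.refl _ _ _
  · exact hdiag e' (hl e' he')
  · exact (hdiag e (hl e he)).symm
  · exact hok e (hl e he) e' (hl e' he')

/-- Leaving a triangle through one of two sides. -/
lemma exists_first_exit {f₀ f₁ g₀ g₁ : ℝ} (hf : 0 < f₀) (hg : 0 < g₀) (h : f₁ ≤ 0 ∨ g₁ ≤ 0) :
    ∃ t : ℝ, 0 < t ∧ t ≤ 1 ∧ 0 ≤ (1 - t) * f₀ + t * f₁ ∧ 0 ≤ (1 - t) * g₀ + t * g₁ ∧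
      ((1 - t) * f₀ + t * f₁ = 0 ∨ (1 - t) * g₀ + t * g₁ = 0) := by
  wlog h1 : f₁ ≤ 0 generalizing f₀ f₁ g₀ g₁
  · obtain ⟨t, a, b, c, d, e⟩ := this hg hf h.symm (h.resolve_left h1)
    exact ⟨t, a, b, d, c, e.symm⟩
  have hd : 0 < f₀ - f₁ := by linarith
  set t₁ := f₀ / (f₀ - f₁) with ht₁
  have e1 : (1 - t₁) * f₀ + t₁ * f₁ = 0 := by rw [ht₁]; field_simp; ring
  have p1 : 0 < t₁ := div_pos hf hd
  have q1 : t₁ ≤ 1 := by rw [ht₁, div_le_one hd]; linarith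
  rcases le_or_gt 0 ((1 - t₁) * g₀ + t₁ * g₁) with h2 | h2
  · exact ⟨t₁, p1, q1, e1.ge, h2, Or.inl e1⟩
  have hg1 : g₁ < 0 := by nlinarith
  have hd' : 0 < g₀ - g₁ := by linarith
  set t₂ := g₀ / (g₀ - g₁) with ht₂
  have e2 : (1 - t₂) * g₀ + t₂ * g₁ = 0 := by rw [ht₂]; field_simp; ring
  have p2 : 0 < t₂ := div_pos hg hd'
  have q2 : t₂ ≤ 1 := by rw [ht₂, div_le_one hd']; linarith
  have h12 : t₂ < t₁ := by
    by_contra hle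
    push Not at hle
    nlinarith
  refine ⟨t₂, p2, q2, ?_, e2.ge, Or.inr e2⟩
  nlinarith

lemma segment_orient_zero {a b y : ℂ} (h : y ∈ segment ℝ a b) : orient y a b = 0 := by
  by_contra h0; exact notMem_segment_of_orient h0 h

/-- A segment starting in the triangle and moving away from the side `u w`
either stays in the triangle or leaves it through the sides at `v`. -/
lemma trapped {σ : ℝ} {v u w x b : ℂ} (hD : 0 < σ * orient v u w)
    (h1 : 0 < σ * orient x v u) (h2 : 0 ≤ σ * orient x u w) (h3 : 0 < σ * orient x w v)
    (hb : σ * orient x u w ≤ σ * orient b u w) (hb0 : 0 < σ * orient b u w)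
    (hn : ∀ y ∈ segment ℝ x b, y ∈ segment ℝ v u ∨ y ∈ segment ℝ w v →
      ¬ 0 < σ * orient y u w) : 0 < σ * orient b v u ∧ 0 < σ * orient b w v := by
  by_contra hcon
  have hcon' : σ * orient b v u ≤ 0 ∨ σ * orient b w v ≤ 0 := by
    by_contra hc
    push Not at hc
    exact hcon hc
  obtain ⟨t, t0, t1, k1, k2, k3⟩ := exists_first_exit h1 h3 hcon'
  set y := (1 - t) • x + t • b with hy
  have ho : ∀ p q : ℂ,
      σ * orient y p q = (1 - t) * (σ * orient x p q) + t * (σ * orient b p q) := by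
    intro p q
    rw [hy, orient_comb (by ring)]; ring
  rw [← ho, ← ho] at k3
  rw [← ho] at k1 k2
  have hpos : 0 < σ * orient y u w := by
    rw [ho]
    have := mul_nonneg (sub_nonneg.mpr t1) h2
    have := mul_pos t0 hb0
    linarith
  have hyt : y ∈ closedTri σ v u w := ⟨k1, hpos.le, k2⟩
  have hσ : σ ≠ 0 := by rintro rfl; simp at hD
  refine hn y ⟨1 - t, t, by linarith, t0.le, by ring, hy.symm⟩ ?_ hpos
  rcases k3 with k3 | k3
  · left
    exact mem_segment_of_closedTri hD hyt ((mul_eq_zero.mp k3).resolve_left hσ)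
  · right
    exact mem_segment_of_closedTri (c := u) (σ := σ) (by rwa [orient_rotate'])
      (by rwa [closedTri_rotate, closedTri_rotate]) ((mul_eq_zero.mp k3).resolve_left hσ)

/-- Just beside an extreme vertex `V`, a polygon does not wind. -/
lemma exists_wind_zero_near {r : ι → ℂ} {Q : List ι} {V U W Z e : ℂ} {M : Set ℂ} {s : ℝ}
    (hM : IsClosed M) (hVM : V ∉ M)
    (hQ : trace r (polyEdges Q) ⊆ M ∪ (segment ℝ V Z ∪ segment ℝ V W))
    (hU : s * orient V Z U < 0) (hW : 0 < s * orient V Z W)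
    (he : ∀ a ∈ Q, 0 ≤ ((r a - V) * e).re) (heW : 0 < ((W - V) * e).re) :
    ∃ x ∈ segment ℝ V U, x ∉ trace r (polyEdges Q) ∧ wind r (polyEdges Q) x = 0 := by
  obtain ⟨δ, hδ, hb⟩ := Metric.isOpen_iff.mp hM.isOpen_compl V hVM
  set n := ‖U - V‖ + ‖W - V‖ + 1 with hn
  have hn0 : 0 < n := by positivity
  set t := min 1 (δ / n / 2) with ht
  have t0 : 0 < t := by positivity
  have t1 : t ≤ 1 := min_le_left _ _
  have tδ : t * n < δ := by
    have : t * n ≤ δ / n / 2 * n := mul_le_mul_of_nonneg_right (min_le_right _ _) hn0.le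
    have h2 : δ / n / 2 * n = δ / 2 := by field_simp
    linarith
  set x := V + t • (U - V) with hx
  set q := V - t • (W - V) with hq
  have hxb : x ∈ ball V δ := by
    rw [mem_ball, dist_eq_norm, hx, add_sub_cancel_left, norm_smul, Real.norm_of_nonneg t0.le]
    refine lt_of_le_of_lt (mul_le_mul_of_nonneg_left ?_ t0.le) tδ
    have := norm_nonneg (W - V); linarith
  have hqb : q ∈ ball V δ := by
    rw [mem_ball, dist_eq_norm, hq, sub_sub_cancel_left, norm_neg, norm_smul,
      Real.norm_of_nonneg t0.le]
    refine lt_of_le_of_lt (mul_le_mul_of_nonneg_left ?_ t0.le) tδ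
    have := norm_nonneg (U - V); linarith
  have hoa : ∀ {p r' : ℝ} (_ : p + r' = 1) (y z : ℂ), orient V Z (p • y + r' • z) =
      p * orient V Z y + r' * orient V Z z := by
    intro p r' h y z
    obtain rfl : r' = 1 - p := by linarith
    simp [orient, cr]; ring
  have hox : s * orient V Z x < 0 := by
    have : orient V Z x = t * orient V Z U := by simp [orient, cr, hx]; ring
    rw [this]; nlinarith
  have hoq : s * orient V Z q < 0 := by
    have : orient V Z q = -(t * orient V Z W) := by simp [orient, cr, hq]; ring
    rw [this]; nlinarith
  have hav : ∀ y ∈ segment ℝ x q, y ∉ trace r (polyEdges Q) := by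
    intro y hy hyQ
    have hyb := (convex_ball V δ).segment_subset hxb hqb hy
    have hyo : s * orient V Z y < 0 := by
      obtain ⟨p, p', hp, hp', hpp, rfl⟩ := hy
      rw [hoa hpp]
      rcases hp.eq_or_lt with rfl | hp
      · simp only [zero_add] at hpp; subst hpp; simpa using hoq
      · nlinarith
    rcases hQ hyQ with h | ⟨p, p', hp, hp', hpp, rfl⟩ | ⟨p, p', hp, hp', hpp, rfl⟩
    · exact hb hyb h
    · rw [hoa hpp] at hyo; simp at hyo
    · rw [hoa hpp] at hyo; simp only [orient_self_outer] at hyo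
      nlinarith [mul_nonneg hp' hW.le]
  refine ⟨x, ⟨1 - t, t, by linarith, t0.le, by ring, ?_⟩, hav x (left_mem_segment ℝ _ _), ?_⟩
  · rw [hx, sub_smul, one_smul, smul_sub]; ring
  · rw [wind_const (convex_segment x q).isPreconnected hav (left_mem_segment ℝ _ _)
      (right_mem_segment ℝ _ _)]
    refine wind_eq_zero_of_halfPlane (w := e) fun a ha => ?_
    have e1 : ((r a - q) * e).re = ((r a - V) * e).re + t * ((W - V) * e).re := by
      simp [hq]; ring
    rw [e1]
    have := he a ha
    positivity

/-! ### Every simple polygon has a filling -/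

lemma polyEdges_split (v u : ι) (m : List ι) (w : ι) : polyEdges (v :: u :: (m ++ [w])) =
    (v, u) :: (pathEdges (u :: (m ++ [w])) ++ [(w, v)]) := by
  have h := pathEdges_append (u :: m) w [v]
  rw [polyEdges_cons]
  simp only [List.cons_append, List.append_assoc, List.nil_append, pathEdges] at h ⊢
  rw [h]

lemma orient_smul_eq (v u w y : ℂ) : orient v u w • y =
    orient y u w • v + orient y w v • u + orient y v u • w := by
  apply Complex.ext <;> simp [orient, cr] <;> ring

lemma eq_of_orient_eq_zero {v u w y : ℂ} (hD : orient v u w ≠ 0) (h1 : orient y u w = 0)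
    (h2 : orient y v u = 0) : y = u := by
  have h := orient_smul_eq v u w y
  have h3 := orient_add v u w y
  rw [h1, h2, zero_add, zero_add] at h3
  rw [h1, h2, h3] at h
  simp only [zero_smul, zero_add, add_zero] at h
  exact smul_right_injective ℂ hD h

/-- A segment whose ends lie on different sides of a line meets the line. -/
lemma exists_orient_eq_zero {σ : ℝ} (hσ : σ ≠ 0) {a b y z : ℂ}
    (hfg : (σ * orient a y z) * (σ * orient b y z) ≤ 0)
    (hne : σ * orient a y z ≠ σ * orient b y z) {y' z' : ℂ} (ha : σ * orient a y' z' = 0)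
    (hb : σ * orient b y' z' = 0) :
    ∃ c ∈ segment ℝ a b, orient c y z = 0 ∧ orient c y' z' = 0 := by
  set f := σ * orient a y z with hf
  set g := σ * orient b y z with hg
  have hne' : g - f ≠ 0 := sub_ne_zero.mpr (Ne.symm hne)
  have hsum : g / (g - f) + -f / (g - f) = 1 := by field_simp; ring
  have hpn : 0 ≤ g / (g - f) ∧ 0 ≤ -f / (g - f) := by
    constructor <;> rw [div_eq_mul_inv]
    · rcases lt_or_gt_of_ne hne with hl | hl
      · exact mul_nonneg (by nlinarith) (inv_nonneg.mpr (by linarith))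
      · exact mul_nonneg_of_nonpos_of_nonpos (by nlinarith) (inv_nonpos.mpr (by linarith))
    · rcases lt_or_gt_of_ne hne with hl | hl
      · exact mul_nonneg (by nlinarith) (inv_nonneg.mpr (by linarith))
      · exact mul_nonneg_of_nonpos_of_nonpos (by nlinarith) (inv_nonpos.mpr (by linarith))
  refine ⟨_, ⟨_, _, hpn.1, hpn.2, hsum, rfl⟩, ?_, ?_⟩
  · apply mul_left_cancel₀ hσ
    rw [orient_comb hsum, mul_zero, mul_add, mul_left_comm σ, ← hf, mul_left_comm σ, ← hg]
    field_simp; ring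
  · apply mul_left_cancel₀ hσ
    rw [orient_comb hsum, mul_zero, mul_add, mul_left_comm σ, ha, mul_left_comm σ, hb]
    simp

/-- The configuration at a corner `w v u` of a simple polygon. -/
structure Corner (r : ι → ℂ) (σ : ℝ) (v u : ι) (mid : List ι) (w : ι) : Prop where
  poly : SimplePoly r (v :: u :: (mid ++ [w]))
  pos : 0 < σ * orient (r v) (r u) (r w)

namespace Corner
variable {r : ι → ℂ} {σ : ℝ} {v u w : ι} {mid : List ι}

lemma not_cross (h : Corner r σ v u mid w) {e : ι × ι}
    (he : e ∈ pathEdges (u :: (mid ++ [w]))) {y : ℂ} (hy : y ∈ segment ℝ (r e.1) (r e.2))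
    (hs : y ∈ segment ℝ (r v) (r u) ∨ y ∈ segment ℝ (r w) (r v)) :
    ¬ 0 < σ * orient y (r u) (r w) := by
  have hv : v ∉ u :: (mid ++ [w]) := (List.nodup_cons.mp h.poly.nodup).1
  have hm := mem_of_mem_pathEdges he
  have hv1 : e.1 ≠ v := fun h => hv (h ▸ hm.1)
  have hv2 : e.2 ≠ v := fun h => hv (h ▸ hm.2)
  have hE := polyEdges_split v u mid w
  have hok := h.poly.ok
  rw [hE] at hok
  have he' : e ∈ (v, u) :: (pathEdges (u :: (mid ++ [w])) ++ [(w, v)]) := by simp [he]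
  rcases hs with hs | hs
  · rcases hok e he' (v, u) (by simp) y hy hs with ⟨h1, _⟩ | ⟨_, h1⟩ | ⟨i, h1, h2, rfl⟩
    · exact absurd h1 hv1
    · exact absurd h1 hv2
    · rcases h2 with h2 | h2
      · simp only at h2; subst h2; rcases h1 with h1 | h1
        exacts [absurd h1.symm hv1, absurd h1.symm hv2]
      · simp only at h2; subst h2; simp
  · rcases hok e he' (w, v) (by simp) y hy hs with ⟨_, h1⟩ | ⟨h1, _⟩ | ⟨i, h1, h2, rfl⟩
    · exact absurd h1 hv2
    · exact absurd h1 hv1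
    · rcases h2 with h2 | h2
      · simp only at h2; subst h2; simp
      · simp only at h2; subst h2; rcases h1 with h1 | h1
        exacts [absurd h1.symm hv1, absurd h1.symm hv2]

/-- An endpoint of an edge through the triangle at the corner is in the triangle, if the edge
moves away from the third side. -/
lemma endpoint_mem (h : Corner r σ v u mid w) {e : ι × ι}
    (he : e ∈ pathEdges (u :: (mid ++ [w]))) {x : ℂ} (hx : x ∈ segment ℝ (r e.1) (r e.2))
    (h1 : 0 < σ * orient x (r v) (r u)) (h2 : 0 ≤ σ * orient x (r u) (r w))
    (h3 : 0 < σ * orient x (r w) (r v)) {b : ι} (hb : b = e.1 ∨ b = e.2)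
    (hb1 : σ * orient x (r u) (r w) ≤ σ * orient (r b) (r u) (r w))
    (hb0 : 0 < σ * orient (r b) (r u) (r w)) :
    b ∈ mid ∧ r b ∈ closedTri σ (r v) (r u) (r w) := by
  have hbs : r b ∈ segment ℝ (r e.1) (r e.2) := by
    rcases hb with rfl | rfl
    exacts [left_mem_segment ℝ _ _, right_mem_segment ℝ _ _]
  have ht := trapped h.pos h1 h2 h3 hb1 hb0 fun y hy =>
    h.not_cross he ((convex_segment _ _).segment_subset hx hbs hy)
  refine ⟨?_, ht.1.le, hb0.le, ht.2.le⟩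
  have hm : b ∈ u :: (mid ++ [w]) := by
    have := mem_of_mem_pathEdges he
    rcases hb with rfl | rfl
    exacts [this.1, this.2]
  simp only [List.mem_cons, List.mem_append, List.not_mem_nil, or_false] at hm
  rcases hm with rfl | hm | rfl
  · simp at hb0
  · exact hm
  · simp at hb0

lemma edge_cases (_h : Corner r σ v u mid w) {e : ι × ι}
    (he : e ∈ polyEdges (v :: u :: (mid ++ [w]))) :
    e = (v, u) ∨ e ∈ pathEdges (u :: (mid ++ [w])) ∨ e = (w, v) := by
  rw [polyEdges_split] at he
  simpa using he

lemma path_mem (_h : Corner r σ v u mid w) {e : ι × ι}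
    (he : e ∈ pathEdges (u :: (mid ++ [w]))) : e ∈ polyEdges (v :: u :: (mid ++ [w])) := by
  rw [polyEdges_split]
  simp [he]

lemma sgn_ne (h : Corner r σ v u mid w) : σ ≠ 0 := by
  rintro rfl
  simpa using h.pos

lemma orient_ne (h : Corner r σ v u mid w) : orient (r v) (r u) (r w) ≠ 0 := by
  intro h0
  simpa [h0] using h.pos

/-- If the corner triangle contains no further vertex, its third side is a diagonal. -/
lemma diag_of_empty (h : Corner r σ v u mid w)
    (hemp : ∀ p ∈ mid, r p ∉ closedTri σ (r v) (r u) (r w)) :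
    ∀ e ∈ polyEdges (v :: u :: (mid ++ [w])), SegOK r u w e.1 e.2 := by
  intro e he x hx hxe
  have hD := h.pos
  have huw : u ≠ w := by
    rintro rfl
    simp at hD
  obtain ⟨s, t, hs, ht, hst, hxe'⟩ := hx
  have hxo : ∀ p q, σ * orient x p q = s * (σ * orient (r u) p q) + t * (σ * orient (r w) p q) := by
    intro p q
    rw [← hxe', orient_comb hst]; ring
  have x0 : σ * orient x (r u) (r w) = 0 := by rw [hxo]; simp
  have xu : σ * orient x (r w) (r v) = s * (σ * orient (r v) (r u) (r w)) := by
    rw [hxo, orient_rotate, orient_self_left]; ring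
  have xw : σ * orient x (r v) (r u) = t * (σ * orient (r v) (r u) (r w)) := by
    rw [hxo, orient_rotate' (r v) (r u) (r w), orient_self_outer]; ring
  rcases h.edge_cases he with rfl | hep | rfl
  · have : orient x (r v) (r u) = 0 := segment_orient_zero hxe
    rw [this, mul_zero] at xw
    obtain rfl : t = 0 := by
      rcases mul_eq_zero.mp xw.symm with h | h
      · exact h
      · exact absurd h hD.ne'
    obtain rfl : s = 1 := by linarith
    exact Or.inr (Or.inr ⟨u, by simp, by simp, by simpa using hxe'.symm⟩)
  · rcases hs.eq_or_lt with rfl | hs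
    · obtain rfl : t = 1 := by linarith
      have hxw : x = r w := by simpa using hxe'.symm
      rw [hxw] at hxe
      exact Or.inr (Or.inr ⟨w, by simp, h.poly.mem_edge (by simp) he hxe, hxw⟩)
    rcases ht.eq_or_lt with rfl | ht
    · obtain rfl : s = 1 := by linarith
      have hxw : x = r u := by simpa using hxe'.symm
      rw [hxw] at hxe
      exact Or.inr (Or.inr ⟨u, by simp, h.poly.mem_edge (by simp) he hxe, hxw⟩)
    have xu0 : 0 < σ * orient x (r w) (r v) := xu ▸ mul_pos hs hD
    have xw0 : 0 < σ * orient x (r v) (r u) := xw ▸ mul_pos ht hD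
    have hle : ∀ b, b = e.1 ∨ b = e.2 → σ * orient (r b) (r u) (r w) ≤ 0 := by
      intro b hb
      by_contra hc
      push Not at hc
      obtain ⟨k1, k2⟩ := h.endpoint_mem hep hxe xw0 x0.ge xu0 hb (x0 ▸ hc.le) hc
      exact hemp _ k1 k2
    have hcor : ∀ b, b = e.1 ∨ b = e.2 → σ * orient (r b) (r u) (r w) = 0 →
        σ * orient (r b) (r v) (r u) ≤ 0 ∨ σ * orient (r b) (r w) (r v) ≤ 0 := by
      intro b hb h0
      have hm : b ∈ u :: (mid ++ [w]) := by
        have := mem_of_mem_pathEdges hep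
        rcases hb with rfl | rfl
        exacts [this.1, this.2]
      simp only [List.mem_cons, List.mem_append, List.not_mem_nil, or_false] at hm
      rcases hm with rfl | hm | rfl
      · left; simp
      · by_contra hc
        push Not at hc
        exact hemp b hm ⟨hc.1.le, h0.ge, hc.2.le⟩
      · right; simp
    obtain ⟨p, q, hp, hq, hpq, hxe2⟩ := hxe
    have hxo2 : ∀ y z, σ * orient x y z =
        p * (σ * orient (r e.1) y z) + q * (σ * orient (r e.2) y z) := by
      intro y z
      rw [← hxe2, orient_comb hpq]; ring
    have hin : x ∈ closedTri σ (r v) (r u) (r w) := ⟨xw0.le, x0.ge, xu0.le⟩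
    have noend : ∀ b, b = e.1 ∨ b = e.2 → x ≠ r b := by
      intro b hb hxb
      rcases hcor b hb (hxb ▸ x0) with h1 | h1 <;> rw [← hxb] at h1 <;> linarith
    have hp0 : 0 < p := hp.lt_of_ne (by
      rintro rfl
      obtain rfl : q = 1 := by linarith
      exact noend _ (Or.inr rfl) (by simpa using hxe2.symm))
    have hq0 : 0 < q := hq.lt_of_ne (by
      rintro rfl
      obtain rfl : p = 1 := by linarith
      exact noend _ (Or.inl rfl) (by simpa using hxe2.symm))
    have za : σ * orient (r e.1) (r u) (r w) = 0 := by
      have h1 := hle _ (Or.inl rfl)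
      have h2 := hle _ (Or.inr rfl)
      have h3 := hxo2 (r u) (r w)
      rw [x0] at h3
      nlinarith
    have zb : σ * orient (r e.2) (r u) (r w) = 0 := by
      have h3 := hxo2 (r u) (r w)
      rw [x0, za, mul_zero, zero_add] at h3
      exact (mul_eq_zero.mp h3.symm).resolve_left hq0.ne'
    have key : ∀ (a b : ι), (e = (a, b) ∨ e = (b, a)) →
        σ * orient (r a) (r v) (r u) ≤ 0 → σ * orient (r b) (r w) (r v) ≤ 0 →
        0 < σ * orient (r b) (r v) (r u) → 0 < σ * orient (r a) (r w) (r v) →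
        (u = a ∨ u = b) ∧ (w = a ∨ w = b) := by
      intro a b hab a1 b1 b2 a2
      have za' : σ * orient (r a) (r u) (r w) = 0 := by
        rcases hab with hab | hab <;> rw [hab] at za zb <;> assumption
      have zb' : σ * orient (r b) (r u) (r w) = 0 := by
        rcases hab with hab | hab <;> rw [hab] at za zb <;> assumption
      have hse : ∀ c ∈ segment ℝ (r a) (r b), c ∈ segment ℝ (r e.1) (r e.2) := by
        intro c hc
        rcases hab with hab | hab <;> rw [hab]
        · exact hc
        · rwa [segment_symm]
      have fin : ∀ i ∈ v :: u :: (mid ++ [w]), r i ∈ segment ℝ (r a) (r b) → i = a ∨ i = b := by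
        intro i hi his
        have := h.poly.mem_edge hi he (hse _ his)
        rcases hab with hab | hab <;> rw [hab] at this
        · exact this
        · exact this.symm
      constructor
      · obtain ⟨c, hc, h1, h2⟩ := exists_orient_eq_zero h.sgn_ne
          (mul_nonpos_of_nonpos_of_nonneg a1 b2.le) (by linarith) za' zb'
        rw [eq_of_orient_eq_zero h.orient_ne h2 h1] at hc
        exact fin u (by simp) hc
      · obtain ⟨c, hc, h1, h2⟩ := exists_orient_eq_zero h.sgn_ne
          (mul_nonpos_of_nonneg_of_nonpos a2.le b1) (by linarith) za' zb'
        have hcw : c = r w := by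
          refine eq_of_orient_eq_zero (v := r u) (w := r v) ?_ h1 h2
          rw [orient_rotate]; exact h.orient_ne
        rw [hcw] at hc
        exact fin w (by simp) hc
    have xw1 := hxo2 (r v) (r u)
    have xu1 := hxo2 (r w) (r v)
    have fin : ∀ a b : ι, (u = a ∨ u = b) ∧ (w = a ∨ w = b) →
        (u = a ∧ w = b) ∨ (u = b ∧ w = a) := by
      rintro a b ⟨rfl | rfl, rfl | rfl⟩ <;> first | exact absurd rfl huw | tauto
    rcases hcor _ (Or.inl rfl) za with c1 | c1
    · have hb : 0 < σ * orient (r e.2) (r v) (r u) := by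
        by_contra hc
        push Not at hc
        linarith [mul_nonpos_of_nonneg_of_nonpos hp c1, mul_nonpos_of_nonneg_of_nonpos hq hc]
      have c2 := (hcor _ (Or.inr rfl) zb).resolve_left (not_le.mpr hb)
      have ha : 0 < σ * orient (r e.1) (r w) (r v) := by
        by_contra hc
        push Not at hc
        linarith [mul_nonpos_of_nonneg_of_nonpos hp hc, mul_nonpos_of_nonneg_of_nonpos hq c2]
      rcases fin _ _ (key e.1 e.2 (Or.inl rfl) c1 c2 hb ha) with k | k <;> tauto
    · have hb : 0 < σ * orient (r e.2) (r w) (r v) := by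
        by_contra hc
        push Not at hc
        linarith [mul_nonpos_of_nonneg_of_nonpos hp c1, mul_nonpos_of_nonneg_of_nonpos hq hc]
      have c2 := (hcor _ (Or.inr rfl) zb).resolve_right (not_le.mpr hb)
      have ha : 0 < σ * orient (r e.1) (r v) (r u) := by
        by_contra hc
        push Not at hc
        linarith [mul_nonpos_of_nonneg_of_nonpos hp hc, mul_nonpos_of_nonneg_of_nonpos hq c2]
      rcases fin _ _ (key e.2 e.1 (Or.inr rfl) c2 c1 ha hb) with k | k <;> tauto
  · have : orient x (r w) (r v) = 0 := segment_orient_zero hxe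
    rw [this, mul_zero] at xu
    obtain rfl : s = 0 := by
      rcases mul_eq_zero.mp xu.symm with h | h
      · exact h
      · exact absurd h hD.ne'
    obtain rfl : t = 1 := by linarith
    exact Or.inr (Or.inr ⟨w, by simp, by simp, by simpa using hxe'.symm⟩)

lemma inner_pos (h : Corner r σ v u mid w) {z : ι} (hz : z ∈ mid)
    (hzt : r z ∈ closedTri σ (r v) (r u) (r w)) :
    0 < σ * orient (r z) (r v) (r u) ∧ 0 < σ * orient (r z) (r w) (r v) := by
  have hnd := h.poly.nodup
  simp only [List.nodup_cons, List.nodup_append, List.mem_cons, List.mem_append] at hnd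
  have hzm : z ∈ v :: u :: (mid ++ [w]) := by simp [hz]
  have e1 : z ≠ v := by rintro rfl; simp [hz] at hnd
  have e2 : z ≠ u := by rintro rfl; simp [hz] at hnd
  have e3 : z ≠ w := by
    rintro rfl
    exact hnd.2.2.2.2 z hz z (by simp) rfl
  have hE := polyEdges_split v u mid w
  constructor
  · refine hzt.1.lt_of_ne fun h0 => ?_
    have := mem_segment_of_closedTri h.pos hzt ((mul_eq_zero.mp h0.symm).resolve_left h.sgn_ne)
    rcases h.poly.mem_edge hzm (e := (v, u)) (by simp [hE]) this with h | h
    exacts [e1 h, e2 h]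
  · refine hzt.2.2.lt_of_ne fun h0 => ?_
    have := mem_segment_of_closedTri (c := r u) (σ := σ) (by rw [orient_rotate']; exact h.pos)
      (by rwa [closedTri_rotate, closedTri_rotate])
      ((mul_eq_zero.mp h0.symm).resolve_left h.sgn_ne)
    rcases h.poly.mem_edge hzm (e := (w, v)) (by simp [hE]) this with h | h
    exacts [e3 h, e1 h]

/-- The vertex of the corner triangle farthest from the third side can be joined to the corner. -/
lemma diag_of_max (h : Corner r σ v u mid w) {z : ι} (hz : z ∈ mid)
    (hzt : r z ∈ closedTri σ (r v) (r u) (r w))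
    (hmax : ∀ p ∈ mid, r p ∈ closedTri σ (r v) (r u) (r w) →
      σ * orient (r p) (r u) (r w) ≤ σ * orient (r z) (r u) (r w)) :
    ∀ e ∈ polyEdges (v :: u :: (mid ++ [w])), SegOK r v z e.1 e.2 := by
  intro e he x hx hxe
  have hD := h.pos
  obtain ⟨z1, z2⟩ := h.inner_pos hz hzt
  obtain ⟨s, t, hs, ht, hst, hxe'⟩ := hx
  have hxo : ∀ p q, σ * orient x p q = s * (σ * orient (r v) p q) + t * (σ * orient (r z) p q) := by
    intro p q
    rw [← hxe', orient_comb hst]; ring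
  have xw : σ * orient x (r v) (r u) = t * (σ * orient (r z) (r v) (r u)) := by
    rw [hxo]; simp
  have xu : σ * orient x (r w) (r v) = t * (σ * orient (r z) (r w) (r v)) := by
    rw [hxo]; simp
  have corner : t = 0 → x = r v := by
    rintro rfl
    obtain rfl : s = 1 := by linarith
    simpa using hxe'.symm
  rcases h.edge_cases he with rfl | hep | rfl
  · have : orient x (r v) (r u) = 0 := segment_orient_zero hxe
    rw [this, mul_zero] at xw
    exact Or.inr (Or.inr ⟨v, by simp, by simp,
      corner ((mul_eq_zero.mp xw.symm).resolve_right z1.ne')⟩)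
  · rcases hs.eq_or_lt with rfl | hs
    · obtain rfl : t = 1 := by linarith
      have hxz : x = r z := by simpa using hxe'.symm
      rw [hxz] at hxe
      exact Or.inr (Or.inr ⟨z, by simp, h.poly.mem_edge (by simp [hz]) he hxe, hxz⟩)
    have hv : v ∉ u :: (mid ++ [w]) := (List.nodup_cons.mp h.poly.nodup).1
    rcases ht.eq_or_lt with ht | ht
    · rw [corner ht.symm] at hxe
      have hm := mem_of_mem_pathEdges hep
      rcases h.poly.mem_edge (by simp) he hxe with k | k
      · exact absurd (k ▸ hm.1) hv
      · exact absurd (k ▸ hm.2) hv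
    exfalso
    have x1 : 0 < σ * orient x (r v) (r u) := xw ▸ mul_pos ht z1
    have x2 : 0 < σ * orient x (r w) (r v) := xu ▸ mul_pos ht z2
    have x3 : σ * orient (r z) (r u) (r w) < σ * orient x (r u) (r w) := by
      have h1 := hxo (r u) (r w)
      have h2 := orient_add (r v) (r u) (r w) (r z)
      have h3 : σ * orient (r v) (r u) (r w) > σ * orient (r z) (r u) (r w) := by
        rw [← h2, mul_add, mul_add]; linarith
      obtain rfl : t = 1 - s := by linarith
      nlinarith
    have z0 := hzt.2.1
    have bad : ∀ b, b = e.1 ∨ b = e.2 →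
        σ * orient x (r u) (r w) ≤ σ * orient (r b) (r u) (r w) → False := by
      intro b hb hle
      obtain ⟨k1, k2⟩ := h.endpoint_mem hep hxe x1 (by linarith) x2 hb hle (by linarith)
      have := hmax b k1 k2
      linarith
    obtain ⟨p, q, hp, hq, hpq, hxe2⟩ := hxe
    have hxo2 : σ * orient x (r u) (r w) =
        p * (σ * orient (r e.1) (r u) (r w)) + q * (σ * orient (r e.2) (r u) (r w)) := by
      rw [← hxe2, orient_comb hpq]; ring
    by_cases hc : σ * orient x (r u) (r w) ≤ σ * orient (r e.1) (r u) (r w)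
    · exact bad _ (Or.inl rfl) hc
    · refine bad _ (Or.inr rfl) ?_
      push Not at hc
      by_contra hc2
      push Not at hc2
      obtain rfl : q = 1 - p := by linarith
      rcases hp.eq_or_lt with rfl | hp
      · simp only [zero_mul, sub_zero, one_mul, zero_add] at hxo2; linarith
      · nlinarith
  · have : orient x (r w) (r v) = 0 := segment_orient_zero hxe
    rw [this, mul_zero] at xu
    exact Or.inr (Or.inr ⟨v, by simp, by simp,
      corner ((mul_eq_zero.mp xu.symm).resolve_right z2.ne')⟩)

end Corner

lemma exists_extreme (r : ι → ℂ) {l : List ι} (hl : l ≠ [])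
    (hinj : ∀ a ∈ l, ∀ b ∈ l, r a = r b → a = b) :
    ∃ v ∈ l, ∃ e : ℂ, ∀ p ∈ l, p ≠ v → 0 < ((r p - r v) * e).re := by
  obtain ⟨v, hv, hmax⟩ := Set.exists_max_image {x | x ∈ l} (fun p => Complex.normSq (r p))
    (List.finite_toSet l) ⟨_, List.head_mem hl⟩
  refine ⟨v, hv, -(starRingEnd ℂ) (r v), fun p hp hpv => ?_⟩
  have h1 := hmax p hp
  have h2 : r p - r v ≠ 0 := sub_ne_zero.mpr fun h => hpv (hinj p hp v hv h)
  have h3 := Complex.normSq_pos.mpr h2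
  simp only [Complex.normSq_apply, Complex.sub_re, Complex.sub_im] at h1 h3
  simp
  nlinarith

lemma mem_segment_of_cross {V U W e : ℂ} (h0 : orient V U W = 0) (hU : 0 < ((U - V) * e).re)
    (hW : 0 < ((W - V) * e).re) : W ∈ segment ℝ V U ∨ U ∈ segment ℝ W V := by
  have key : ∀ {U W : ℂ}, orient V U W = 0 → 0 < ((U - V) * e).re → 0 < ((W - V) * e).re →
      ((W - V) * e).re ≤ ((U - V) * e).re → W ∈ segment ℝ V U := by
    intro U W h0 hU hW hle
    set A := ((U - V) * e).re with hA
    set B := ((W - V) * e).re with hB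
    have heq : B • (U - V) = A • (W - V) := by
      simp only [orient, cr] at h0
      apply Complex.ext <;> simp only [hA, hB, Complex.smul_re, Complex.smul_im, smul_eq_mul,
        Complex.mul_re, Complex.sub_re, Complex.sub_im] at h0 ⊢
      · linear_combination -e.im * h0
      · linear_combination -e.re * h0
    refine ⟨1 - B / A, B / A, by rw [sub_nonneg, div_le_one hU]; exact hle, by positivity,
      by ring, ?_⟩
    have : W - V = (B / A) • (U - V) := by
      rw [div_eq_inv_mul, mul_smul, heq, smul_smul, inv_mul_cancel₀ hU.ne', one_smul]
    rw [← sub_eq_zero]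
    rw [smul_sub] at this
    rw [sub_smul, one_smul]
    linear_combination (exp := 1) -this
  rcases le_total ((W - V) * e).re ((U - V) * e).re with h | h
  · exact Or.inl (key h0 hU hW h)
  · right
    rw [segment_symm]
    exact key (by rw [orient_swap_right, h0, neg_zero]) hW hU h

lemma mem_trace_left {r : ι → ℂ} {E : List (ι × ι)} {a b : ι} (h : (a, b) ∈ E) :
    r a ∈ trace r E := mem_trace.mpr ⟨_, h, left_mem_segment ℝ _ _⟩

theorem SimplePoly.exists_filling {r : ι → ℂ} {l : List ι} (hl : 3 ≤ l.length)
    (hP : SimplePoly r l) : ∃ ts σ, Filling r l ts σ := by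
  induction hn : l.length using Nat.strong_induction_on generalizing l with
  | _ n ih =>
  subst hn
  obtain ⟨v, hv, e, hext⟩ := exists_extreme r (l := l) (by rintro rfl; simp at hl) hP.inj
  obtain ⟨s, t, rfl⟩ := List.append_of_mem hv
  suffices h : ∃ ts σ, Filling r ((v :: t) ++ s) ts σ by
    obtain ⟨ts, σ, h⟩ := h
    exact ⟨ts, σ, h.rotate⟩
  have hP' : SimplePoly r ((v :: t) ++ s) := hP.rotate
  have hext' : ∀ p ∈ (v :: t) ++ s, p ≠ v → 0 < ((r p - r v) * e).re := fun p hp =>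
    hext p (List.perm_append_comm.subset hp)
  have hlen : ((v :: t) ++ s).length = (s ++ v :: t).length := List.perm_append_comm.length_eq
  rw [← hlen] at ih hl
  clear hext hP hlen hv
  rw [List.cons_append] at *
  generalize t ++ s = tl at *
  obtain _ | ⟨u, rest⟩ := tl
  · simp at hl
  obtain rfl | ⟨mid, w, rfl⟩ := rest.eq_nil_or_concat
  · simp at hl
  simp only [List.concat_eq_append] at *
  have hnd := hP'.nodup
  simp only [List.nodup_cons, List.nodup_append, List.mem_cons, List.mem_append,
    List.not_mem_nil, or_false, not_or] at hnd
  obtain ⟨⟨hvu, hvmid, hvw⟩, ⟨humid, huw⟩, -, -, hmidw⟩ := hnd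
  have hU := hext' u (by simp) (Ne.symm hvu)
  have hW := hext' w (by simp) (Ne.symm hvw)
  have hE := polyEdges_split v u mid w
  obtain ⟨σ, hσ, hD⟩ : ∃ σ : ℝ, (σ = 1 ∨ σ = -1) ∧ 0 < σ * orient (r v) (r u) (r w) := by
    rcases lt_trichotomy (orient (r v) (r u) (r w)) 0 with h | h | h
    · exact ⟨-1, Or.inr rfl, by linarith⟩
    · exfalso
      rcases mem_segment_of_cross h hU hW with h | h
      · rcases hP'.mem_edge (p := w) (by simp) (e := (v, u)) (by simp [hE]) h with h | h
        exacts [hvw h.symm, huw h.symm]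
      · rcases hP'.mem_edge (p := u) (by simp) (e := (w, v)) (by simp [hE]) h with h | h
        exacts [huw h, hvu h.symm]
    · exact ⟨1, Or.inl rfl, by linarith⟩
  have hC : Corner r σ v u mid w := ⟨hP', hD⟩
  rcases eq_or_ne mid [] with rfl | hmid
  · exact ⟨_, σ, filling_triangle hσ hD⟩
  by_cases hA : ∀ p ∈ mid, r p ∉ closedTri σ (r v) (r u) (r w)
  · have hdiag := hC.diag_of_empty hA
    have hperm : (polyEdges (u :: mid ++ w :: [v])).Perm
        (polyEdges (v :: u :: (mid ++ [w]))) := by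
      have := polyEdges_rotate_perm (u :: mid ++ [w]) [v]
      simpa using this
    have hQ : SimplePoly r (u :: mid ++ w :: [v]) := by
      have := SimplePoly.rotate (l₁ := [v]) (l₂ := u :: mid ++ [w]) (by simpa using hP')
      simpa using this
    have hdiag' : ∀ e ∈ polyEdges (u :: mid ++ w :: [v]), SegOK r u w e.1 e.2 := fun e he =>
      hdiag e (hperm.subset he)
    have hm1 : 1 ≤ mid.length := List.length_pos_iff.mpr hmid
    obtain ⟨ts₁, σ₁, F₁⟩ := ih (u :: mid ++ [w]).length (by simp) (l := u :: mid ++ [w])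
      (by simp; omega) (hQ.left hdiag') rfl
    have hD' : 0 < σ * orient (r u) (r w) (r v) := by rwa [orient_rotate]
    have F₂ := filling_triangle (r := r) hσ hD'
    obtain ⟨p, hp⟩ := List.exists_mem_of_ne_nil mid hmid
    have hpt : r p ∉ trace r (polyEdges [u, w, v]) := fun h => by
      have := trace_three_subset hD' h
      rw [closedTri_rotate] at this
      exact hA p hp this
    have hG := Filling.glue hmid (by simp) hQ hdiag' F₁ F₂ (x₁ := r p) (x₂ := r v)
      ?_ hpt ?_ ?_ ?_ ?_
    · exact ⟨_, _, Filling.rotate (l₁ := u :: mid ++ [w]) (l₂ := [v]) (by simpa using hG)⟩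
    · obtain ⟨⟨a, b⟩, he, rfl⟩ := exists_edge_fst (l := u :: mid ++ [w]) (p := p) (by simp [hp])
      rw [polyEdges_append_cons] at he
      rcases List.mem_append.mp he with he | he
      · exact mem_trace_left he
      · simp [pathEdges] at he
        exact absurd he.1 (hmidw _ hp _ rfl)
    · refine (wind_triangle hσ hD' hpt).2 fun h => hA p hp ?_
      rw [openTri_rotate] at h
      exact ⟨h.1.le, h.2.1.le, h.2.2.le⟩
    · exact mem_trace_left (b := u) (by simp [pathEdges])
    · refine notMem_trace_of_halfPlane (w := e) fun a ha => hext' a ?_ ?_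
      · simp at ha ⊢; tauto
      · rintro rfl; simp at ha; tauto
    · refine wind_eq_zero_of_halfPlane (w := e) fun a ha => hext' a ?_ ?_
      · simp at ha ⊢; tauto
      · rintro rfl; simp at ha; tauto
  · push Not at hA
    obtain ⟨z, ⟨hz, hzt⟩, hmax⟩ := Set.exists_max_image
      {p | p ∈ mid ∧ r p ∈ closedTri σ (r v) (r u) (r w)}
      (fun p => σ * orient (r p) (r u) (r w))
      ((List.finite_toSet mid).subset fun p hp => hp.1) hA
    have hdiag := hC.diag_of_max hz hzt fun p h1 h2 => hmax p ⟨h1, h2⟩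
    obtain ⟨z1, z2⟩ := hC.inner_pos hz hzt
    obtain ⟨m1, m2, rfl⟩ := List.append_of_mem hz
    have hl' : v :: u :: (m1 ++ z :: m2 ++ [w]) = v :: (u :: m1) ++ z :: (m2 ++ [w]) := by simp
    have hmem : ∀ e ∈ pathEdges (u :: (m1 ++ z :: m2 ++ [w])), r v ∉ segment ℝ (r e.1) (r e.2) := by
      intro e he h
      have hm := mem_of_mem_pathEdges he
      have hvn := (List.nodup_cons.mp hP'.nodup).1
      rcases hP'.mem_edge (by simp) (hC.path_mem he) h with k | k
      · exact hvn (k ▸ hm.1)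
      · exact hvn (k ▸ hm.2)
    have hsplit : pathEdges (u :: (m1 ++ z :: m2 ++ [w])) =
        pathEdges (u :: (m1 ++ [z])) ++ pathEdges (z :: (m2 ++ [w])) := by
      have := pathEdges_append (u :: m1) z (m2 ++ [w])
      simpa using this
    rw [hsplit] at hmem
    have hP2 := polyEdges_split v z m2 w
    have hP1 := polyEdges_split v u m1 z
    have hge : ∀ a ∈ v :: u :: (m1 ++ z :: m2 ++ [w]), 0 ≤ ((r a - r v) * e).re := by
      intro a ha
      rcases eq_or_ne a v with rfl | h
      · simp
      · exact (hext' a ha h).le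
    have o1 : orient (r v) (r z) (r u) = -orient (r z) (r v) (r u) := orient_swap _ _ _
    have o2 : orient (r v) (r z) (r w) = orient (r z) (r w) (r v) := (orient_rotate _ _ _).symm
    obtain ⟨x₁, a1, a2, a3⟩ := exists_wind_zero_near (r := r) (Q := v :: z :: (m2 ++ [w]))
      (V := r v) (U := r u) (W := r w) (Z := r z) (e := e) (s := σ)
      (M := trace r (pathEdges (z :: (m2 ++ [w])))) (isClosed_trace _ _)
      (fun h => by
        obtain ⟨e, he, h⟩ := mem_trace.mp h
        exact hmem e (List.mem_append_right _ he) h)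
      (by
        rw [hP2, trace_cons, trace_append, trace_cons]
        rintro y (h | h | h | h)
        · exact Or.inr (Or.inl h)
        · exact Or.inl h
        · right; right; rwa [segment_symm]
        · simp [trace] at h)
      (by rw [o1, mul_neg]; linarith) (by rw [o2]; exact z2)
      (fun a ha => hge a (by simp at ha ⊢; tauto)) hW
    obtain ⟨x₂, b1, b2, b3⟩ := exists_wind_zero_near (r := r) (Q := v :: u :: (m1 ++ [z]))
      (V := r v) (U := r w) (W := r u) (Z := r z) (e := e) (s := -σ)
      (M := trace r (pathEdges (u :: (m1 ++ [z])))) (isClosed_trace _ _)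
      (fun h => by
        obtain ⟨e, he, h⟩ := mem_trace.mp h
        exact hmem e (List.mem_append_left _ he) h)
      (by
        rw [hP1, trace_cons, trace_append, trace_cons]
        rintro y (h | h | h | h)
        · exact Or.inr (Or.inr h)
        · exact Or.inl h
        · right; left; rwa [segment_symm]
        · simp [trace] at h)
      (by rw [o2, neg_mul]; linarith) (by rw [o1, neg_mul_neg]; exact z1)
      (fun a ha => hge a (by simp at ha ⊢; tauto)) hU
    rw [hl'] at hP' hdiag ⊢
    obtain ⟨ts₁, σ₁, F₁⟩ := ih (v :: (u :: m1) ++ [z]).length (by simp)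
      (l := v :: (u :: m1) ++ [z]) (by simp) (hP'.left hdiag) rfl
    obtain ⟨ts₂, σ₂, F₂⟩ := ih (v :: z :: (m2 ++ [w])).length (by simp)
      (l := v :: z :: (m2 ++ [w])) (by simp) (hP'.right hdiag) rfl
    refine ⟨_, _, Filling.glue (by simp) (by simp) hP' hdiag F₁ F₂ (x₁ := x₁) (x₂ := x₂)
      ?_ a2 a3 ?_ b2 b3⟩
    · exact mem_trace.mpr ⟨(v, u), by simp [pathEdges], a1⟩
    · refine mem_trace.mpr ⟨(w, v), ?_, by rwa [segment_symm]⟩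
      have := pathEdges_append (z :: m2) w [v]
      simp only [List.cons_append, List.append_assoc, List.nil_append] at this ⊢
      rw [this]
      simp [pathEdges]

/-! ### Barycentric weights -/

/-- Weights of a convex combination of the labels in `s`. -/
structure Wt (s : Finset ι) (w : ι → ℝ) : Prop where
  nonneg : ∀ i, 0 ≤ w i
  supp : ∀ i ∉ s, w i = 0
  sum : ∑ i ∈ s, w i = 1

/-- The convex combination with weights `w`. -/
def pt {V : Type*} [AddCommGroup V] [Module ℝ V] (r : ι → V) (s : Finset ι) (w : ι → ℝ) : V :=
  ∑ i ∈ s, w i • r i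

open Classical in
/-- The vertices of a triple. -/
def verts (t : ι × ι × ι) : Finset ι := {t.1, t.2.1, t.2.2}

lemma mem_verts {t : ι × ι × ι} {i : ι} :
    i ∈ verts t ↔ i = t.1 ∨ i = t.2.1 ∨ i = t.2.2 := by
  simp [verts]

lemma Wt.mono {s s' : Finset ι} {w : ι → ℝ} (h : Wt s w) (hs : s ⊆ s') : Wt s' w where
  nonneg := h.nonneg
  supp i hi := h.supp i fun h' => hi (hs h')
  sum := by rw [← h.sum]; exact (Finset.sum_subset hs fun i _ hi => h.supp i hi).symm

lemma Wt.pt_mono {V : Type*} [AddCommGroup V] [Module ℝ V] {s s' : Finset ι} {w : ι → ℝ}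
    (h : Wt s w) (hs : s ⊆ s') (r : ι → V) : pt r s' w = pt r s w :=
  (Finset.sum_subset hs fun i _ hi => by rw [h.supp i hi, zero_smul]).symm

lemma Wt.of_zero {s s' : Finset ι} {w : ι → ℝ} (h : Wt s w) (h' : ∀ i ∉ s', w i = 0) :
    Wt s' w := by
  classical
  refine ⟨h.nonneg, h', ?_⟩
  rw [← h.sum]
  calc ∑ i ∈ s', w i = ∑ i ∈ s ∪ s', w i :=
        Finset.sum_subset Finset.subset_union_right fun i _ hi => h' i hi
    _ = ∑ i ∈ s, w i :=
        (Finset.sum_subset Finset.subset_union_left fun i _ hi => h.supp i hi).symm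

lemma Wt.pt_of_zero {V : Type*} [AddCommGroup V] [Module ℝ V] {s s' : Finset ι} {w : ι → ℝ}
    (h : Wt s w) (h' : ∀ i ∉ s', w i = 0) (r : ι → V) : pt r s' w = pt r s w := by
  classical
  rw [← h.pt_mono (Finset.subset_union_left (s₂ := s')) r,
    ← (h.of_zero h').pt_mono (Finset.subset_union_right (s₁ := s)) r]

section triple
variable {r : ι → ℂ} {σ : ℝ} {t : ι × ι × ι}

lemma ne_of_pos (h : 0 < σ * orient (r t.1) (r t.2.1) (r t.2.2)) :
    t.1 ≠ t.2.1 ∧ t.2.1 ≠ t.2.2 ∧ t.2.2 ≠ t.1 := by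
  refine ⟨fun e => ?_, fun e => ?_, fun e => ?_⟩ <;> rw [e] at h <;> simp at h

lemma pt_verts {V : Type*} [AddCommGroup V] [Module ℝ V] (ρ : ι → V)
    (h : t.1 ≠ t.2.1 ∧ t.2.1 ≠ t.2.2 ∧ t.2.2 ≠ t.1) (w : ι → ℝ) :
    pt ρ (verts t) w = w t.1 • ρ t.1 + w t.2.1 • ρ t.2.1 + w t.2.2 • ρ t.2.2 := by
  classical
  simp only [pt, verts]
  rw [Finset.sum_insert (by simp [h.1, h.2.2.symm]), Finset.sum_pair h.2.1, add_assoc]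

lemma sum_verts (h : t.1 ≠ t.2.1 ∧ t.2.1 ≠ t.2.2 ∧ t.2.2 ≠ t.1) (w : ι → ℝ) :
    ∑ i ∈ verts t, w i = w t.1 + w t.2.1 + w t.2.2 := by
  classical
  simp only [verts]
  rw [Finset.sum_insert (by simp [h.1, h.2.2.symm]), Finset.sum_pair h.2.1, add_assoc]

lemma orient_pt (h : t.1 ≠ t.2.1 ∧ t.2.1 ≠ t.2.2 ∧ t.2.2 ≠ t.1) {w : ι → ℝ}
    (hw : Wt (verts t) w) (y z : ℂ) : orient (pt r (verts t) w) y z =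
      w t.1 * orient (r t.1) y z + w t.2.1 * orient (r t.2.1) y z +
        w t.2.2 * orient (r t.2.2) y z := by
  have h1 := hw.sum
  rw [sum_verts h] at h1
  rw [pt_verts r h]
  obtain h2 : w t.1 = 1 - w t.2.1 - w t.2.2 := by linarith
  simp only [orient, cr, h2]
  simp
  ring

/-- The three barycentric coordinates. -/
lemma orient_pt_coord (h : t.1 ≠ t.2.1 ∧ t.2.1 ≠ t.2.2 ∧ t.2.2 ≠ t.1) {w : ι → ℝ}
    (hw : Wt (verts t) w) :
    orient (pt r (verts t) w) (r t.1) (r t.2.1) =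
      w t.2.2 * orient (r t.1) (r t.2.1) (r t.2.2) ∧
    orient (pt r (verts t) w) (r t.2.1) (r t.2.2) =
      w t.1 * orient (r t.1) (r t.2.1) (r t.2.2) ∧
    orient (pt r (verts t) w) (r t.2.2) (r t.1) =
      w t.2.1 * orient (r t.1) (r t.2.1) (r t.2.2) := by
  refine ⟨?_, ?_, ?_⟩
  · rw [orient_pt h hw, orient_self_left, orient_self_outer, orient_rotate' (r t.1)]; ring
  · rw [orient_pt h hw, orient_self_left, orient_self_outer]; ring
  · rw [orient_pt h hw, orient_self_left, orient_self_outer, orient_rotate]; ring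

lemma pt_mem_closedTri (h : 0 < σ * orient (r t.1) (r t.2.1) (r t.2.2)) {w : ι → ℝ}
    (hw : Wt (verts t) w) : pt r (verts t) w ∈ closedTri σ (r t.1) (r t.2.1) (r t.2.2) := by
  obtain ⟨h1, h2, h3⟩ := orient_pt_coord (r := r) (ne_of_pos h) hw
  refine ⟨?_, ?_, ?_⟩
  · rw [h1, mul_left_comm]; exact mul_nonneg (hw.nonneg _) h.le
  · rw [h2, mul_left_comm]; exact mul_nonneg (hw.nonneg _) h.le
  · rw [h3, mul_left_comm]; exact mul_nonneg (hw.nonneg _) h.le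

lemma pt_injective (h : 0 < σ * orient (r t.1) (r t.2.1) (r t.2.2)) {w w' : ι → ℝ}
    (hw : Wt (verts t) w) (hw' : Wt (verts t) w')
    (he : pt r (verts t) w = pt r (verts t) w') : w = w' := by
  obtain ⟨h1, h2, h3⟩ := orient_pt_coord (r := r) (ne_of_pos h) hw
  obtain ⟨k1, k2, k3⟩ := orient_pt_coord (r := r) (ne_of_pos h) hw'
  have hD : orient (r t.1) (r t.2.1) (r t.2.2) ≠ 0 := fun h0 => by simp [h0] at h
  rw [he] at h1 h2 h3
  have e1 := mul_right_cancel₀ hD (h1.symm.trans k1)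
  have e2 := mul_right_cancel₀ hD (h2.symm.trans k2)
  have e3 := mul_right_cancel₀ hD (h3.symm.trans k3)
  ext i
  by_cases hi : i ∈ verts t
  · rcases mem_verts.mp hi with rfl | rfl | rfl <;> assumption
  · rw [hw.supp i hi, hw'.supp i hi]

lemma exists_wt_of_mem_closedTri (h : 0 < σ * orient (r t.1) (r t.2.1) (r t.2.2)) {y : ℂ}
    (hy : y ∈ closedTri σ (r t.1) (r t.2.1) (r t.2.2)) :
    ∃ w, Wt (verts t) w ∧ pt r (verts t) w = y := by
  classical
  have hne := ne_of_pos h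
  set D := orient (r t.1) (r t.2.1) (r t.2.2) with hDdef
  have hσ : σ ≠ 0 := by rintro rfl; simp at h
  have hD : D ≠ 0 := fun h0 => by simp [h0] at h
  set w : ι → ℝ := fun i => if i = t.1 then orient y (r t.2.1) (r t.2.2) / D else
    if i = t.2.1 then orient y (r t.2.2) (r t.1) / D else
    if i = t.2.2 then orient y (r t.1) (r t.2.1) / D else 0 with hw
  have w1 : w t.1 = orient y (r t.2.1) (r t.2.2) / D := by simp [hw]
  have w2 : w t.2.1 = orient y (r t.2.2) (r t.1) / D := by simp [hw, hne.1.symm]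
  have w3 : w t.2.2 = orient y (r t.1) (r t.2.1) / D := by simp [hw, hne.2.1.symm, hne.2.2]
  have nn : ∀ x, 0 ≤ σ * x → 0 ≤ x / D := by
    intro x hx
    rw [← mul_div_mul_left _ _ hσ]
    exact div_nonneg hx h.le
  have hwt : Wt (verts t) w := by
    refine ⟨fun i => ?_, fun i hi => ?_, ?_⟩
    · simp only [hw]
      split_ifs
      exacts [nn _ hy.2.1, nn _ hy.2.2, nn _ hy.1, le_rfl]
    · rw [mem_verts] at hi
      push Not at hi
      simp [hw, hi.1, hi.2.1, hi.2.2]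
    · rw [sum_verts hne, w1, w2, w3, ← add_div, ← add_div, div_eq_one_iff_eq hD, hDdef,
        ← orient_add (r t.1) (r t.2.1) (r t.2.2) y]
      ring
  refine ⟨w, hwt, ?_⟩
  rw [pt_verts r hne, w1, w2, w3]
  have := orient_smul_eq (r t.1) (r t.2.1) (r t.2.2) y
  rw [← hDdef] at this
  apply smul_right_injective ℂ hD
  simp only [smul_add, smul_smul, mul_div_cancel₀ _ hD]
  exact this.symm

end triple

/-! ### Tilings of polygons -/

/-- The oriented edges of a triple. -/
def triEdges (t : ι × ι × ι) : List (ι × ι) := [(t.1, t.2.1), (t.2.1, t.2.2), (t.2.2, t.1)]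

lemma mem_verts_of_mem_triEdges {t : ι × ι × ι} {e : ι × ι} (h : e ∈ triEdges t) :
    e.1 ∈ verts t ∧ e.2 ∈ verts t := by
  simp only [triEdges, List.mem_cons, List.not_mem_nil, or_false] at h
  simp only [mem_verts]
  rcases h with rfl | rfl | rfl <;> simp

/-- `ts` is a list of triangles of orientation `σ` whose sum has boundary the simple polygon `l`,
about which `l` winds at most once. -/
structure Tiling (r : ι → ℂ) (l : List ι) (ts : List (ι × ι × ι)) (σ : ℝ) : Prop where
  poly : SimplePoly r l
  len : 3 ≤ l.length
  sgn : σ = 1 ∨ σ = -1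
  pos : ∀ t ∈ ts, 0 < σ * orient (r t.1) (r t.2.1) (r t.2.2)
  chain : ∀ θ : ι → ι → ℝ, (∀ a b, θ b a = -θ a b) →
    (ts.map (bdrySum θ)).sum = edgeSum θ (polyEdges l)
  two : ∀ y ∉ trace r (polyEdges l), wind r (polyEdges l) y = 0 ∨
    wind r (polyEdges l) y = 2 * π * σ
  inj : ∀ t ∈ ts, ∀ t' ∈ ts, ∀ i ∈ verts t, ∀ j ∈ verts t', r i = r j → i = j

lemma dense_orient_ne {a b : ℂ} (hab : a ≠ b) : Dense {y | orient y a b ≠ 0} := by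
  intro y
  by_cases hy : orient y a b = 0
  · have hn : Complex.normSq (b - a) ≠ 0 := (Complex.normSq_pos.mpr (sub_ne_zero.mpr hab.symm)).ne'
    have ho : ∀ t : ℝ, orient (y + t * (Complex.I * (b - a))) a b =
        orient y a b + t * Complex.normSq (b - a) := by
      intro t
      simp [orient, cr, Complex.normSq_apply]; ring
    refine mem_closure_of_tendsto (f := fun t : ℝ => y + t * (Complex.I * (b - a)))
      (b := nhdsWithin 0 {0}ᶜ) ?_ ?_
    · have : Continuous fun t : ℝ => y + t * (Complex.I * (b - a)) := by fun_prop
      simpa using (this.tendsto 0).mono_left nhdsWithin_le_nhds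
    · filter_upwards [self_mem_nhdsWithin] with t ht
      simp only [ho, hy, zero_add]
      exact mul_ne_zero ht hn
  · exact subset_closure hy

lemma exists_generic (r : ι → ℂ) (E : List (ι × ι)) {U : Set ℂ} (hU : IsOpen U)
    (hne : U.Nonempty) : ∃ y ∈ U, y ∉ trace r E ∧
      ∀ e ∈ E, r e.1 ≠ r e.2 → orient y (r e.1) (r e.2) ≠ 0 := by
  induction E generalizing U with
  | nil =>
    obtain ⟨y, hy⟩ := hne
    exact ⟨y, hy, by simp [trace], by simp⟩
  | cons e E ih =>
    by_cases he : r e.1 = r e.2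
    · have h1 := (dense_compl_singleton (r e.2)).inter_open_nonempty U hU hne
      obtain ⟨y, hy, h2, h3⟩ := ih (hU.inter isOpen_compl_singleton) h1
      refine ⟨y, hy.1, ?_, ?_⟩
      · rw [trace_cons, he, segment_same]
        rintro (h | h)
        exacts [hy.2 h, h2 h]
      · intro e' he'
        rcases List.mem_cons.mp he' with rfl | he'
        · exact fun h => absurd he h
        · exact h3 e' he'
    · have h1 := (dense_orient_ne he).inter_open_nonempty U hU hne
      have hop : IsOpen {y | orient y (r e.1) (r e.2) ≠ 0} := by
        have : Continuous fun y => orient y (r e.1) (r e.2) := by unfold orient cr; fun_prop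
        exact isOpen_ne.preimage this
      obtain ⟨y, hy, h2, h3⟩ := ih (hU.inter hop) h1
      refine ⟨y, hy.1, ?_, ?_⟩
      · rw [trace_cons]
        rintro (h | h)
        exacts [hy.2 (segment_orient_zero h), h2 h]
      · intro e' he'
        rcases List.mem_cons.mp he' with rfl | he'
        · exact fun _ => hy.2
        · exact h3 e' he'

lemma sum_map_ite_eq {β : Type*} (P : β → Prop) [DecidablePred P] (c : ℝ) (l : List β) :
    (l.map fun t => if P t then c else 0).sum = (l.filter P).length * c := by
  induction l with
  | nil => simp
  | cons a l ih =>
    by_cases h : P a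
    · simp [h, ih]; ring
    · simp [h, ih]

/-- Two chains with the same boundary pairing share their unbalanced edges. -/
lemma mem_of_edgeSum_eq {E E' : List (ι × ι)}
    (h : ∀ θ : ι → ι → ℝ, (∀ a b, θ b a = -θ a b) → edgeSum θ E = edgeSum θ E') {a b : ι}
    (hab : a ≠ b) (h1 : (a, b) ∈ E) (h2 : (b, a) ∉ E) : (a, b) ∈ E' := by
  classical
  set θ : ι → ι → ℝ := fun x y => (if x = a ∧ y = b then 1 else 0) -
    (if x = b ∧ y = a then 1 else 0) with hθ
  have hskew : ∀ x y, θ y x = -θ x y := by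
    intro x y
    simp only [hθ, and_comm (a := y = _), neg_sub]
  by_contra h3
  have hE' : edgeSum θ E' ≤ 0 := by
    refine (List.sum_le_card_nsmul _ 0 ?_).trans_eq (smul_zero _)
    intro x hx
    obtain ⟨e, he, rfl⟩ := List.mem_map.mp hx
    have : ¬ (e.1 = a ∧ e.2 = b) := fun k => h3 (by rw [← k.1, ← k.2]; exact he)
    simp only [hθ, this, if_false]
    split_ifs <;> norm_num
  have hE : 0 < edgeSum θ E := by
    have hnn : ∀ x ∈ E.map (fun e => θ e.1 e.2), 0 ≤ x := by
      intro x hx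
      obtain ⟨e, he, rfl⟩ := List.mem_map.mp hx
      have : ¬ (e.1 = b ∧ e.2 = a) := fun k => h2 (by rw [← k.1, ← k.2]; exact he)
      simp only [hθ, this, if_false]
      split_ifs <;> norm_num
    have := List.single_le_sum hnn (θ a b) (List.mem_map.mpr ⟨_, h1, rfl⟩)
    have h4 : θ a b = 1 := by simp [hθ, hab, hab.symm]
    unfold edgeSum
    linarith
  rw [h θ hskew] at hE
  linarith

lemma polyEdges_perm_cons {l : List ι} (hnd : l.Nodup) (hl : 3 ≤ l.length) {e : ι × ι}
    (he : e ∈ polyEdges l) : ∃ E, (polyEdges l).Perm (e :: E) ∧ e.1 ≠ e.2 ∧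
      ∀ e' ∈ E, e' ≠ e ∧ e' ≠ (e.2, e.1) := by
  obtain ⟨s, t, rfl⟩ := List.append_of_mem (mem_of_mem_polyEdges he).1
  have hp := polyEdges_rotate_perm s (e.1 :: t)
  have hnd' : (e.1 :: t ++ s).Nodup := List.nodup_append_comm.mp hnd
  have hl' : 3 ≤ (e.1 :: t ++ s).length := by
    simp at hl ⊢; omega
  rw [List.cons_append] at hp hnd' hl'
  generalize t ++ s = tl at *
  obtain _ | ⟨u, rest⟩ := tl
  · simp at hl'
  obtain rfl | ⟨mid, w, rfl⟩ := rest.eq_nil_or_concat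
  · simp at hl'
  simp only [List.concat_eq_append] at *
  rw [polyEdges_split] at hp
  have hn1 := (List.nodup_cons.mp hnd').1
  have hn2 := (List.nodup_cons.mp (List.nodup_cons.mp hnd').2).1
  have hfst : ∀ e' ∈ pathEdges (u :: (mid ++ [w])) ++ [(w, e.1)], e'.1 ≠ e.1 := by
    intro e' he' h
    rcases List.mem_append.mp he' with k | k
    · exact hn1 (h ▸ (mem_of_mem_pathEdges k).1)
    · simp only [List.mem_singleton] at k
      subst k
      simp only at h
      subst h
      simp at hn1
  have hu : e = (e.1, u) := by
    rcases List.mem_cons.mp (hp.subset he) with h | h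
    · exact h
    · exact absurd rfl (hfst e h)
  have hu2 : e.2 = u := by rw [hu]
  refine ⟨_, ?_, ?_, fun e' he' => ⟨fun h => hfst e' he' (by rw [h]), fun h => ?_⟩⟩
  · rw [← hu] at hp; exact hp
  · rw [hu2]; rintro h; simp [h] at hn1
  · rw [hu2] at h
    rcases List.mem_append.mp he' with k | k
    · have := (mem_of_mem_pathEdges k).2
      rw [h] at this
      exact hn1 this
    · simp only [List.mem_singleton] at k
      rw [k] at h
      simp only [Prod.mk.injEq, and_true] at h
      subst h
      simp at hn2

lemma nhds_subset_openTri {σ : ℝ} {a b c p : ℂ} (h : 0 < σ * orient a b c)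
    (hp : p ∈ openSegment ℝ a b) :
    ∀ᶠ y in nhds p, 0 < σ * orient y a b → y ∈ openTri σ a b c := by
  obtain ⟨s, t, hs, ht, hst, rfl⟩ := hp
  have h1 : 0 < σ * orient (s • a + t • b) b c := by
    rw [orient_comb hst, orient_self_left, mul_zero, add_zero, mul_left_comm]
    positivity
  have h2 : 0 < σ * orient (s • a + t • b) c a := by
    rw [orient_comb hst, orient_self_outer, orient_rotate, mul_zero, zero_add, mul_left_comm]
    positivity
  have c1 : Continuous fun y => σ * orient y b c := by unfold orient cr; fun_prop
  have c2 : Continuous fun y => σ * orient y c a := by unfold orient cr; fun_prop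
  filter_upwards [c1.continuousAt.eventually (lt_mem_nhds h1),
    c2.continuousAt.eventually (lt_mem_nhds h2)] with y k1 k2 k0
  exact ⟨k0, k1, k2⟩

/-- The open triangle of a triple. -/
def tri (r : ι → ℂ) (σ : ℝ) (t : ι × ι × ι) : Set ℂ := openTri σ (r t.1) (r t.2.1) (r t.2.2)

lemma nhds_subset_tri {r : ι → ℂ} {σ : ℝ} {t : ι × ι × ι}
    (h : 0 < σ * orient (r t.1) (r t.2.1) (r t.2.2)) {a b : ι} (hab : (a, b) ∈ triEdges t) {p : ℂ}
    (hp : p ∈ openSegment ℝ (r a) (r b)) :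
    ∀ᶠ y in nhds p, 0 < σ * orient y (r a) (r b) → y ∈ tri r σ t := by
  simp only [triEdges, List.mem_cons, List.not_mem_nil, or_false, Prod.mk.injEq] at hab
  unfold tri
  rcases hab with ⟨rfl, rfl⟩ | ⟨rfl, rfl⟩ | ⟨rfl, rfl⟩
  · exact nhds_subset_openTri h hp
  · rw [← openTri_rotate]
    exact nhds_subset_openTri (by rwa [orient_rotate]) hp
  · rw [← openTri_rotate, ← openTri_rotate]
    exact nhds_subset_openTri (by rwa [orient_rotate']) hp

lemma segment_subset_closedTri' {r : ι → ℂ} {σ : ℝ} {t : ι × ι × ι}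
    (h : 0 < σ * orient (r t.1) (r t.2.1) (r t.2.2)) {a b : ι} (hab : (a, b) ∈ triEdges t) :
    segment ℝ (r a) (r b) ⊆ closedTri σ (r t.1) (r t.2.1) (r t.2.2) := by
  refine subset_trans ?_ (trace_three_subset h)
  intro y hy
  exact mem_trace.mpr ⟨(a, b), hab, hy⟩

lemma exists_generic_near {r : ι → ℂ} {σ : ℝ} {t : ι × ι × ι}
    (h : 0 < σ * orient (r t.1) (r t.2.1) (r t.2.2)) {p : ℂ}
    (hp : p ∈ closedTri σ (r t.1) (r t.2.1) (r t.2.2)) {N : Set ℂ} (hN : N ∈ nhds p)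
    (E : List (ι × ι)) : ∃ y ∈ N, y ∈ tri r σ t ∧ y ∉ trace r E ∧
      ∀ e ∈ E, r e.1 ≠ r e.2 → orient y (r e.1) (r e.2) ≠ 0 := by
  have h1 := closedTri_subset_closure h hp
  have h2 : (interior N ∩ tri r σ t).Nonempty :=
    mem_closure_iff.mp h1 _ isOpen_interior (mem_interior_iff_mem_nhds.mpr hN)
  obtain ⟨y, hy, h3⟩ := exists_generic r E (isOpen_interior.inter (isOpen_openTri _ _ _ _)) h2
  exact ⟨y, interior_subset hy.1, hy.2, h3⟩

lemma edgeSum_flatMap (θ : ι → ι → ℝ) (ts : List (ι × ι × ι)) :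
    edgeSum θ (ts.flatMap triEdges) = (ts.map (bdrySum θ)).sum := by
  induction ts with
  | nil => simp [edgeSum]
  | cons t ts ih =>
    rw [List.flatMap_cons, edgeSum_append, ih]
    simp [edgeSum, triEdges, bdrySum]
    ring

lemma trace_triEdges_subset {r : ι → ℂ} {ts : List (ι × ι × ι)} {t : ι × ι × ι} (ht : t ∈ ts) :
    trace r (triEdges t) ⊆ trace r (ts.flatMap triEdges) := by
  intro y hy
  obtain ⟨e, he, h⟩ := mem_trace.mp hy
  exact mem_trace.mpr ⟨e, List.mem_flatMap.mpr ⟨t, ht, he⟩, h⟩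

lemma wt_cases {t : ι × ι × ι} {w : ι → ℝ}
    (hw : Wt (verts t) w) : (0 < w t.1 ∧ 0 < w t.2.1 ∧ 0 < w t.2.2) ∨
    (∃ e ∈ triEdges t, 0 < w e.1 ∧ 0 < w e.2 ∧ ∀ i, i ≠ e.1 → i ≠ e.2 → w i = 0) ∨
    ∃ i ∈ verts t, ∀ j ≠ i, w j = 0 := by
  have hs : ∀ i, w i = 0 ∨ i = t.1 ∨ i = t.2.1 ∨ i = t.2.2 := fun i => by
    by_cases hi : i ∈ verts t
    · exact Or.inr (mem_verts.mp hi)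
    · exact Or.inl (hw.supp i hi)
  have h1 := hw.nonneg t.1
  have h2 := hw.nonneg t.2.1
  have h3 := hw.nonneg t.2.2
  rcases h1.eq_or_lt with k1 | k1 <;> rcases h2.eq_or_lt with k2 | k2 <;>
    rcases h3.eq_or_lt with k3 | k3
  · exact Or.inr (Or.inr ⟨t.1, by simp [mem_verts], fun j hj => by grind⟩)
  · exact Or.inr (Or.inr ⟨t.2.2, by simp [mem_verts], fun j hj => by grind⟩)
  · exact Or.inr (Or.inr ⟨t.2.1, by simp [mem_verts], fun j hj => by grind⟩)
  · exact Or.inr (Or.inl ⟨(t.2.1, t.2.2), by simp [triEdges], k2, k3, fun j hj hj' => by grind⟩)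
  · exact Or.inr (Or.inr ⟨t.1, by simp [mem_verts], fun j hj => by grind⟩)
  · exact Or.inr (Or.inl ⟨(t.2.2, t.1), by simp [triEdges], k3, k1, fun j hj hj' => by grind⟩)
  · exact Or.inr (Or.inl ⟨(t.1, t.2.1), by simp [triEdges], k1, k2, fun j hj hj' => by grind⟩)
  · exact Or.inl ⟨k1, k2, k3⟩

lemma sum_pair {s : Finset ι} {w : ι → ℝ} {V : Type*} [AddCommGroup V] [Module ℝ V]
    {a b : ι} (ha : a ∈ s) (hb : b ∈ s) (hab : a ≠ b) (f : ι → V)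
    (h0 : ∀ i, i ≠ a → i ≠ b → w i = 0) :
    ∑ i ∈ s, w i • f i = w a • f a + w b • f b := by
  classical
  rw [← Finset.sum_pair hab (f := fun i => w i • f i)]
  refine (Finset.sum_subset ?_ ?_).symm
  · intro i hi
    simp only [Finset.mem_insert, Finset.mem_singleton] at hi
    rcases hi with rfl | rfl <;> assumption
  · intro i _ hi
    simp only [Finset.mem_insert, Finset.mem_singleton, not_or] at hi
    rw [h0 i hi.1 hi.2, zero_smul]

lemma Wt.add_eq {s : Finset ι} {w : ι → ℝ} (hw : Wt s w) {a b : ι} (ha : a ∈ s) (hb : b ∈ s)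
    (hab : a ≠ b) (h0 : ∀ i, i ≠ a → i ≠ b → w i = 0) : w a + w b = 1 := by
  have := sum_pair ha hb hab (fun _ => (1 : ℝ)) h0
  simp only [smul_eq_mul, mul_one] at this
  rw [← this, hw.sum]

lemma Wt.single {s : Finset ι} {w : ι → ℝ} (hw : Wt s w) {i : ι} (hi : i ∈ s)
    (h0 : ∀ j ≠ i, w j = 0) : w i = 1 := by
  rw [← hw.sum, Finset.sum_eq_single_of_mem i hi fun j _ hj => h0 j hj]

lemma Wt.pt_single {V : Type*} [AddCommGroup V] [Module ℝ V] {s : Finset ι} {w : ι → ℝ}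
    (hw : Wt s w) {i : ι} (hi : i ∈ s) (h0 : ∀ j ≠ i, w j = 0) (ρ : ι → V) : pt ρ s w = ρ i := by
  unfold pt
  rw [Finset.sum_eq_single_of_mem i hi fun j _ hj => by rw [h0 j hj, zero_smul],
    hw.single hi h0, one_smul]

namespace Tiling

variable {r : ι → ℂ} {l : List ι} {ts : List (ι × ι × ι)} {σ : ℝ}

lemma sgn_ne (h : Tiling r l ts σ) : 2 * π * σ ≠ 0 := by
  have := Real.pi_pos
  rcases h.sgn with rfl | rfl <;> simp [this.ne']

lemma wind_eq_count (h : Tiling r l ts σ) {y : ℂ} (hy : y ∉ trace r (ts.flatMap triEdges)) :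
    open Classical in wind r (polyEdges l) y =
      (ts.filter fun t => y ∈ tri r σ t).length * (2 * π * σ) := by
  classical
  rw [← sum_map_ite_eq (fun t => y ∈ tri r σ t)]
  unfold wind
  rw [← h.chain (fun a b => ang y (r a) (r b)) (fun a b => ang_swap _ _ _)]
  congr 1
  refine List.map_congr_left fun t ht => ?_
  have h1 : y ∉ trace r (polyEdges [t.1, t.2.1, t.2.2]) := fun k => hy (trace_triEdges_subset ht k)
  have h2 := wind_triangle h.sgn (h.pos t ht) h1
  rw [wind_three] at h2
  unfold bdrySum
  split_ifs with k
  exacts [h2.1 k, h2.2 k]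

/-- A generic point lies in at most one triangle, and in one exactly when the polygon winds
about it. -/
lemma count (h : Tiling r l ts σ) {y : ℂ} (hy : y ∉ trace r (ts.flatMap triEdges))
    (hl : y ∉ trace r (polyEdges l)) :
    (∀ t ∈ ts, ∀ t' ∈ ts, y ∈ tri r σ t → y ∈ tri r σ t' → t = t') ∧
    (∀ t ∈ ts, y ∈ tri r σ t → wind r (polyEdges l) y = 2 * π * σ) ∧
    (wind r (polyEdges l) y ≠ 0 → ∃ t ∈ ts, y ∈ tri r σ t) := by
  classical
  have h1 := h.wind_eq_count hy
  have h2 := h.sgn_ne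
  set F := ts.filter fun t => y ∈ tri r σ t with hF
  have hm : ∀ t, t ∈ F ↔ t ∈ ts ∧ y ∈ tri r σ t := by simp [hF]
  have hle : F.length ≤ 1 := by
    rcases h.two y hl with k | k
    · rw [k] at h1
      have : (F.length : ℝ) = 0 := by simpa [h2] using h1.symm
      have : F.length = 0 := by exact_mod_cast this
      omega
    · rw [k] at h1
      have : (F.length : ℝ) = 1 := mul_right_cancel₀ h2 (by linarith)
      have : F.length = 1 := by exact_mod_cast this
      omega
  refine ⟨fun t ht t' ht' k k' => ?_, fun t ht k => ?_, fun k => ?_⟩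
  · have a1 := (hm t).mpr ⟨ht, k⟩
    have a2 := (hm t').mpr ⟨ht', k'⟩
    match F, hle, a1, a2 with
    | [x], _, a1, a2 => rw [List.mem_singleton] at a1 a2; rw [a1, a2]
  · have a1 := (hm t).mpr ⟨ht, k⟩
    have := List.length_pos_of_mem a1
    have : F.length = 1 := by omega
    rw [h1, this]; simp
  · obtain hF0 | ⟨t, ht⟩ := F.eq_nil_or_concat.imp id fun ⟨L, b, hb⟩ =>
      (⟨b, by rw [hb]; simp⟩ : ∃ t, t ∈ F)
    · rw [hF0] at h1; simp at h1; exact absurd h1 k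
    · exact ⟨t, (hm t).mp ht⟩

lemma chain' (h : Tiling r l ts σ) (θ : ι → ι → ℝ) (hθ : ∀ a b, θ b a = -θ a b) :
    edgeSum θ (ts.flatMap triEdges) = edgeSum θ (polyEdges l) := by
  rw [edgeSum_flatMap]; exact h.chain θ hθ

lemma edge_ne (h : Tiling r l ts σ) {t : ι × ι × ι} (ht : t ∈ ts) {e : ι × ι}
    (he : e ∈ triEdges t) : r e.1 ≠ r e.2 := by
  have h1 := h.pos t ht
  intro k
  simp only [triEdges, List.mem_cons, List.not_mem_nil, or_false] at he
  rcases he with rfl | rfl | rfl <;> simp only at k <;> rw [k] at h1 <;>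
    simp [orient_self_left, orient_self_right, orient_self_outer] at h1

lemma openTri_generic (h : Tiling r l ts σ) {t t' : ι × ι × ι} (ht : t ∈ ts) (ht' : t' ∈ ts)
    {p : ℂ} (hp : p ∈ tri r σ t) (hp' : p ∈ closedTri σ (r t'.1) (r t'.2.1) (r t'.2.2)) :
    t = t' := by
  obtain ⟨y, hy, hy', hg, -⟩ := exists_generic_near (h.pos t' ht') hp'
    ((isOpen_openTri _ _ _ _).mem_nhds hp) (ts.flatMap triEdges ++ polyEdges l)
  rw [trace_append] at hg
  exact (h.count (fun k => hg (Or.inl k)) (fun k => hg (Or.inr k))).1 t ht t' ht' hy hy'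

/-- An interior point of an edge of a triangle lies in no other triangle but its neighbour. -/
lemma edge_cases (h : Tiling r l ts σ) {t t' : ι × ι × ι} (ht : t ∈ ts) (ht' : t' ∈ ts)
    {a b : ι} (hab : (a, b) ∈ triEdges t) {p : ℂ} (hp : p ∈ openSegment ℝ (r a) (r b))
    (hp' : p ∈ closedTri σ (r t'.1) (r t'.2.1) (r t'.2.2)) :
    t' = t ∨ (b, a) ∈ triEdges t' := by
  have hne := h.edge_ne ht hab
  have hab' : a ≠ b := fun k => hne (by simp [k])
  have hD : (a, b) ∈ ts.flatMap triEdges := List.mem_flatMap.mpr ⟨t, ht, hab⟩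
  have hσ : ∀ x : ℝ, x ≠ 0 → 0 < σ * x ∨ 0 < σ * -x := by
    intro x hx
    have : σ * x ≠ 0 := mul_ne_zero (by rcases h.sgn with k | k <;> simp [k]) hx
    rcases lt_or_gt_of_ne this with k | k
    · right; linarith
    · left; exact k
  by_cases hD' : (b, a) ∈ ts.flatMap triEdges
  · obtain ⟨t'', ht'', hba⟩ := List.mem_flatMap.mp hD'
    have n1 := nhds_subset_tri (h.pos t ht) hab hp
    have n2 := nhds_subset_tri (h.pos t'' ht'') hba (by rwa [openSegment_symm])
    obtain ⟨y, hy, hy', hg, ho⟩ := exists_generic_near (h.pos t' ht') hp'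
      (Filter.inter_mem n1 n2) (ts.flatMap triEdges ++ polyEdges l)
    rw [trace_append] at hg
    have hc := (h.count (fun k => hg (Or.inl k)) (fun k => hg (Or.inr k))).1
    rcases hσ _ (ho (a, b) (by simp [hD]) hne) with k | k
    · left; exact hc t' ht' t ht hy' (hy.1 k)
    · right
      have : 0 < σ * orient y (r b) (r a) := by rwa [orient_swap_right]
      rw [hc t' ht' t'' ht'' hy' (hy.2 this)]; exact hba
  · have hl := mem_of_edgeSum_eq h.chain' hab' hD hD'
    obtain ⟨E, hE, -, hE'⟩ := polyEdges_perm_cons h.poly.nodup h.len hl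
    have hpE : p ∉ trace r E := by
      intro k
      obtain ⟨e, he, hpe⟩ := mem_trace.mp k
      have he' : e ∈ polyEdges l := hE.symm.subset (List.mem_cons_of_mem _ he)
      rcases h.poly.ok _ hl _ he' p (openSegment_subset_segment _ _ _ hp) hpe with
        ⟨k1, k2⟩ | ⟨k1, k2⟩ | ⟨i, k1, -, k3⟩
      · exact (hE' e he).1 (by rw [← Prod.mk.eta (p := e), ← k1, ← k2])
      · exact (hE' e he).2 (by rw [← Prod.mk.eta (p := e), ← k1, ← k2])
      · subst k3
        rcases k1 with rfl | rfl
        · exact hne (left_mem_openSegment_iff.mp hp)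
        · exact hne (right_mem_openSegment_iff.mp hp)
    obtain ⟨N, hN, hj⟩ := wind_jump hp hne hpE
    have n1 := nhds_subset_tri (h.pos t ht) hab hp
    left
    obtain ⟨y, hy, hy', hg, ho⟩ := exists_generic_near (h.pos t' ht') hp'
      (Filter.inter_mem n1 hN) (ts.flatMap triEdges ++ polyEdges l)
    obtain ⟨z, hz, hz', hgz, -⟩ := exists_generic_near (h.pos t ht)
      (segment_subset_closedTri' (h.pos t ht) hab (openSegment_subset_segment _ _ _ hp))
      (Filter.inter_mem n1 hN) (ts.flatMap triEdges ++ polyEdges l)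
    rw [trace_append] at hg hgz
    have hc := h.count (fun k => hg (Or.inl k)) (fun k => hg (Or.inr k))
    have hcz := h.count (fun k => hgz (Or.inl k)) (fun k => hgz (Or.inr k))
    rcases hσ _ (ho (a, b) (by simp [hD]) hne) with k | k
    · exact hc.1 t' ht' t ht hy' (hy.1 k)
    · exfalso
      have w1 := hc.2.1 t' ht' hy'
      have w2 := hcz.2.1 t ht hz'
      rw [wind_perm r hE] at w1 w2
      have hoz : 0 < σ * orient z (r a) (r b) := by
        simp only [triEdges, List.mem_cons, List.not_mem_nil, or_false, Prod.mk.injEq] at hab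
        rcases hab with ⟨rfl, rfl⟩ | ⟨rfl, rfl⟩ | ⟨rfl, rfl⟩
        exacts [hz'.1, hz'.2.1, hz'.2.2]
      rcases h.sgn with rfl | rfl
      · exact hj z hz.2 y hy.2 (by simpa using hoz) (by simpa using k) (w2.trans w1.symm)
      · exact hj y hy.2 z hz.2 (by simpa using k) (by simpa using hoz) (w1.trans w2.symm)

lemma wt_unique_aux (h : Tiling r l ts σ) {t t' : ι × ι × ι} (ht : t ∈ ts) (ht' : t' ∈ ts)
    {w w' : ι → ℝ} (hw : Wt (verts t) w) (hw' : Wt (verts t') w')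
    (he : pt r (verts t) w = pt r (verts t') w')
    (hc : (0 < w t.1 ∧ 0 < w t.2.1 ∧ 0 < w t.2.2) ∨
      ∃ e ∈ triEdges t, 0 < w e.1 ∧ 0 < w e.2 ∧ ∀ i, i ≠ e.1 → i ≠ e.2 → w i = 0) : w = w' := by
  have hn := ne_of_pos (h.pos t ht)
  have hp' := pt_mem_closedTri (h.pos t' ht') hw'
  rw [← he] at hp'
  have key : t' = t → w = w' := by
    rintro rfl
    exact pt_injective (h.pos t' ht) hw hw' he
  rcases hc with hc | ⟨e, hee, h1, h2, h0⟩
  · refine key (h.openTri_generic ht ht' (p := pt r (verts t) w) ?_ hp').symm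
    obtain ⟨c1, c2, c3⟩ := orient_pt_coord hn (r := r) hw
    have hpos := h.pos t ht
    refine ⟨?_, ?_, ?_⟩
    · rw [c1, mul_left_comm]; exact mul_pos hc.2.2 hpos
    · rw [c2, mul_left_comm]; exact mul_pos hc.1 hpos
    · rw [c3, mul_left_comm]; exact mul_pos hc.2.1 hpos
  · have hv := mem_verts_of_mem_triEdges hee
    have hne : e.1 ≠ e.2 := fun k => h.edge_ne ht hee (by rw [k])
    have hseg : pt r (verts t) w ∈ openSegment ℝ (r e.1) (r e.2) :=
      ⟨w e.1, w e.2, h1, h2, hw.add_eq hv.1 hv.2 hne h0, (sum_pair hv.1 hv.2 hne r h0).symm⟩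
    rcases h.edge_cases ht ht' hee hseg hp' with k | k
    · exact key k
    · have hv' := mem_verts_of_mem_triEdges k
      have hz : ∀ i ∉ verts t', w i = 0 := fun i hi =>
        h0 i (fun k => hi (k ▸ hv'.2)) (fun k => hi (k ▸ hv'.1))
      refine pt_injective (h.pos t' ht') (hw.of_zero hz) hw' ?_
      rw [hw.pt_of_zero hz, he]

/-- In a tiling, the barycentric coordinates of a point are well defined. -/
lemma wt_unique (h : Tiling r l ts σ) {t t' : ι × ι × ι} (ht : t ∈ ts) (ht' : t' ∈ ts)
    {w w' : ι → ℝ} (hw : Wt (verts t) w) (hw' : Wt (verts t') w')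
    (he : pt r (verts t) w = pt r (verts t') w') : w = w' := by
  rcases wt_cases hw with k | k | ⟨i, hi, k⟩
  · exact h.wt_unique_aux ht ht' hw hw' he (Or.inl k)
  · exact h.wt_unique_aux ht ht' hw hw' he (Or.inr k)
  rcases wt_cases hw' with k' | k' | ⟨j, hj, k'⟩
  · exact (h.wt_unique_aux ht' ht hw' hw he.symm (Or.inl k')).symm
  · exact (h.wt_unique_aux ht' ht hw' hw he.symm (Or.inr k')).symm
  rw [hw.pt_single hi k, hw'.pt_single hj k'] at he
  obtain rfl := h.inj t ht t' ht' i hi j hj he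
  funext m
  by_cases hm : m = i
  · rw [hm, hw.single hi k, hw'.single hj k']
  · exact (k m hm).trans (k' m hm).symm

/-- Each edge of the polygon is an edge of a triangle. -/
lemma exists_triEdge (h : Tiling r l ts σ) {e : ι × ι} (he : e ∈ polyEdges l) :
    ∃ t ∈ ts, e ∈ triEdges t := by
  obtain ⟨E, hE, hne, hE'⟩ := polyEdges_perm_cons h.poly.nodup h.len he
  have : (e.2, e.1) ∉ polyEdges l := by
    intro k
    rcases List.mem_cons.mp (hE.subset k) with k | k
    · exact hne (congrArg Prod.fst k).symm
    · exact (hE' _ k).2 rfl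
  have := mem_of_edgeSum_eq (fun θ hθ => (h.chain' θ hθ).symm) hne he this
  exact List.mem_flatMap.mp this

/-- A point of an edge of the polygon only involves the ends of this edge. -/
lemma wt_edge (h : Tiling r l ts σ) {t : ι × ι × ι} (ht : t ∈ ts) {w : ι → ℝ}
    (hw : Wt (verts t) w) {e : ι × ι} (he : e ∈ polyEdges l)
    (hp : pt r (verts t) w ∈ segment ℝ (r e.1) (r e.2)) :
    ∀ i, i ≠ e.1 → i ≠ e.2 → w i = 0 := by
  classical
  obtain ⟨t', ht', het⟩ := h.exists_triEdge he
  have hv := mem_verts_of_mem_triEdges het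
  have hne : e.1 ≠ e.2 := fun k => h.edge_ne ht' het (by rw [k])
  obtain ⟨x, y, hx, hy, hxy, hp⟩ := hp
  set w' : ι → ℝ := fun i => if i = e.1 then x else if i = e.2 then y else 0 with hw'
  have h0 : ∀ i, i ≠ e.1 → i ≠ e.2 → w' i = 0 := fun i h1 h2 => by simp [hw', h1, h2]
  have e1 : w' e.1 = x := by simp [hw']
  have e2 : w' e.2 = y := by simp [hw', hne.symm]
  have hW : Wt (verts t') w' := by
    refine ⟨fun i => ?_, fun i hi => h0 i (fun k => hi (k ▸ hv.1)) (fun k => hi (k ▸ hv.2)), ?_⟩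
    · simp only [hw']; split_ifs <;> first | assumption | rfl
    · have := sum_pair hv.1 hv.2 hne (fun _ => (1 : ℝ)) h0
      simp only [smul_eq_mul, mul_one] at this
      rw [this, e1, e2, hxy]
  have := h.wt_unique ht ht' hw hW (by
    rw [← hp]; unfold pt; rw [sum_pair hv.1 hv.2 hne r h0, e1, e2])
  rw [this]; exact h0

lemma wind_of_mem (h : Tiling r l ts σ) {t : ι × ι × ι} (ht : t ∈ ts) {y : ℂ}
    (hy : y ∈ closedTri σ (r t.1) (r t.2.1) (r t.2.2)) (hl : y ∉ trace r (polyEdges l)) :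
    wind r (polyEdges l) y = 2 * π * σ := by
  obtain ⟨z, hz, hz', hg, -⟩ := exists_generic_near (h.pos t ht) hy
    (eventually_wind_eq hl) (ts.flatMap triEdges ++ polyEdges l)
  rw [trace_append] at hg
  rw [← hz.2]
  exact (h.count (fun k => hg (Or.inl k)) (fun k => hg (Or.inr k))).2.1 t ht hz'

lemma mem_inside (h : Tiling r l ts σ) {t : ι × ι × ι} (ht : t ∈ ts) {y : ℂ}
    (hy : y ∈ closedTri σ (r t.1) (r t.2.1) (r t.2.2)) (hl : y ∉ trace r (polyEdges l)) :
    y ∈ inside r l := ⟨hl, by rw [h.wind_of_mem ht hy hl]; exact h.sgn_ne⟩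

/-- The triangles of a tiling cover the inside of the polygon. -/
lemma exists_of_mem_inside (h : Tiling r l ts σ) {y : ℂ} (hy : y ∈ inside r l) :
    ∃ t ∈ ts, y ∈ closedTri σ (r t.1) (r t.2.1) (r t.2.2) := by
  classical
  by_contra hno
  push Not at hno
  have hcl : ∀ t : ι × ι × ι, IsClosed (closedTri σ (r t.1) (r t.2.1) (r t.2.2)) := by
    intro t
    have c : ∀ a b : ℂ, Continuous fun y => σ * orient y a b := fun a b => by
      unfold orient cr; fun_prop
    exact (isClosed_le continuous_const (c _ _)).inter
      ((isClosed_le continuous_const (c _ _)).inter (isClosed_le continuous_const (c _ _)))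
  have hU : IsOpen (⋂ t ∈ ts.toFinset, (closedTri σ (r t.1) (r t.2.1) (r t.2.2))ᶜ) :=
    isOpen_biInter_finset fun t _ => (hcl t).isOpen_compl
  have hyU : y ∈ ⋂ t ∈ ts.toFinset, (closedTri σ (r t.1) (r t.2.1) (r t.2.2))ᶜ := by
    simp only [List.mem_toFinset, mem_iInter, mem_compl_iff]
    exact hno
  have hN := mem_interior_iff_mem_nhds.mpr
    (Filter.inter_mem (hU.mem_nhds hyU) (eventually_wind_eq hy.1))
  obtain ⟨z, hz, hg, -⟩ := exists_generic r (ts.flatMap triEdges ++ polyEdges l)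
    isOpen_interior ⟨y, hN⟩
  rw [trace_append] at hg
  have hz := interior_subset hz
  obtain ⟨t, ht, hzt⟩ := (h.count (fun k => hg (Or.inl k)) (fun k => hg (Or.inr k))).2.2
    (hz.2.2 ▸ hy.2)
  have := hz.1
  simp only [List.mem_toFinset, mem_iInter, mem_compl_iff] at this
  exact this t ht ⟨hzt.1.le, hzt.2.1.le, hzt.2.2.le⟩

end Tiling

/-! ### Fat triangles and polygons seen from an inner point -/

/-- A positively oriented triangle with sides at least `δ` and sines of angles at least `s`. -/
structure Fat (s δ : ℝ) (a b c : ℂ) : Prop where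
  pos : 0 < orient a b c
  ab : δ ≤ ‖a - b‖
  bc : δ ≤ ‖b - c‖
  ca : δ ≤ ‖c - a‖
  sb : s * (‖a - b‖ * ‖b - c‖) ≤ orient a b c
  sc : s * (‖b - c‖ * ‖c - a‖) ≤ orient a b c
  sa : s * (‖c - a‖ * ‖a - b‖) ≤ orient a b c

lemma Fat.rotate {s δ : ℝ} {a b c : ℂ} (h : Fat s δ a b c) : Fat s δ b c a := by
  have := orient_rotate a b c
  constructor <;> first | rw [this] | skip
  exacts [h.pos, h.bc, h.ca, h.ab, h.sc, h.sa, h.sb]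

lemma Fat.of_le {s δ M : ℝ} {a b c : ℂ} (hs : 0 ≤ s) (hM : 0 < M)
    (h : s * M ^ 2 ≤ orient a b c) (h0 : 0 < orient a b c) (hδ : δ * M ≤ orient a b c)
    (h1 : ‖a - b‖ ≤ M) (h2 : ‖b - c‖ ≤ M) (h3 : ‖c - a‖ ≤ M) : Fat s δ a b c := by
  have hcr : ∀ u v : ℂ, cr u v ≤ ‖u‖ * ‖v‖ := by
    intro u v
    have : cr u v = (starRingEnd ℂ u * v).im := by simp [cr]; ring
    rw [this]
    calc _ ≤ ‖starRingEnd ℂ u * v‖ := (le_abs_self _).trans (Complex.abs_im_le_norm _)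
      _ = _ := by simp
  have key : ∀ a b c : ℂ, ‖c - a‖ ≤ M → orient a b c ≤ ‖a - b‖ * M := by
    intro a b c h
    refine (hcr _ _).trans ?_
    rw [norm_sub_rev b a]
    gcongr
  have hh : ∀ x y : ℝ, 0 ≤ y → x ≤ M → y ≤ M → s * (x * y) ≤ orient a b c := by
    intro x y hy hx' hy'
    refine le_trans ?_ h
    rw [pow_two]
    gcongr
  refine ⟨h0, ?_, ?_, ?_, hh _ _ (norm_nonneg _) h1 h2, hh _ _ (norm_nonneg _) h2 h3,
    hh _ _ (norm_nonneg _) h3 h1⟩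
  · exact le_of_mul_le_mul_right (hδ.trans (key _ _ _ h3)) hM
  · exact le_of_mul_le_mul_right (hδ.trans (by rw [← orient_rotate]; exact key _ _ _ h1)) hM
  · exact le_of_mul_le_mul_right (hδ.trans (by rw [← orient_rotate']; exact key _ _ _ h2)) hM

lemma norm_exp_sub_exp (α β : ℝ) (h0 : 0 ≤ β - α) (h1 : β - α ≤ 2 * π) :
    ‖Complex.exp (α * Complex.I) - Complex.exp (β * Complex.I)‖ = 2 * sin ((β - α) / 2) := by
  have hs : 0 ≤ sin ((β - α) / 2) := sin_nonneg_of_nonneg_of_le_pi (by linarith) (by linarith)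
  rw [← abs_of_nonneg (norm_nonneg _), ← abs_of_nonneg (by positivity : 0 ≤ 2 * sin ((β - α) / 2)),
    ← sq_eq_sq_iff_abs_eq_abs, ← Complex.normSq_eq_norm_sq, Complex.normSq_apply]
  simp only [Complex.sub_re, Complex.sub_im, Complex.exp_ofReal_mul_I_re,
    Complex.exp_ofReal_mul_I_im]
  have e : cos (β - α) = 1 - 2 * sin ((β - α) / 2) ^ 2 := by
    rw [show β - α = 2 * ((β - α) / 2) by ring, cos_two_mul, cos_sq']
    ring_nf
  rw [cos_sub] at e
  nlinarith [sin_sq_add_cos_sq α, sin_sq_add_cos_sq β]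

lemma orient_exp (α β γ : ℝ) : orient (Complex.exp (α * Complex.I)) (Complex.exp (β * Complex.I))
    (Complex.exp (γ * Complex.I)) =
      4 * (sin ((β - α) / 2) * sin ((γ - β) / 2) * sin ((γ - α) / 2)) := by
  simp only [orient, cr, Complex.sub_re, Complex.sub_im, Complex.exp_ofReal_mul_I_re,
    Complex.exp_ofReal_mul_I_im]
  have e : ∀ x y : ℝ, sin (x + y) = sin x * cos y + cos x * sin y := sin_add
  set p := (β - α) / 2 with hp
  set q := (γ - β) / 2 with hq
  rw [show (γ - α) / 2 = p + q by rw [hp, hq]; ring]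
  rw [show β = α + 2 * p by rw [hp]; ring, show γ = α + 2 * (p + q) by rw [hp, hq]; ring]
  simp only [sin_add, cos_add, cos_two_mul, sin_two_mul]
  have h1 := sin_sq_add_cos_sq α
  have h2 := sin_sq_add_cos_sq p
  have h3 := sin_sq_add_cos_sq q
  have c1 : sin α ^ 2 = 1 - cos α ^ 2 := by linarith
  have c2 : sin p ^ 2 = 1 - cos p ^ 2 := by linarith
  have c3 : sin q ^ 2 = 1 - cos q ^ 2 := by linarith
  grind

lemma fat_circle {c : ℂ} {r₀ m α β γ : ℝ} (hr : 0 < r₀) (hm : 0 < m) (h1 : α + m ≤ β)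
    (h2 : β + m ≤ γ) (h3 : γ - α ≤ 2 * π - m) :
    Fat (sin (m / 2)) (2 * r₀ * sin (m / 2)) (c + r₀ * Complex.exp (α * Complex.I))
      (c + r₀ * Complex.exp (β * Complex.I)) (c + r₀ * Complex.exp (γ * Complex.I)) := by
  have hsin : ∀ x, m ≤ x → x ≤ 2 * π - m → sin (m / 2) ≤ sin (x / 2) := by
    intro x hx hx'
    rcases le_total x π with k | k
    · exact sin_le_sin_of_le_of_le_pi_div_two (by linarith) (by linarith) (by linarith)
    · rw [← sin_pi_sub (x / 2)]
      exact sin_le_sin_of_le_of_le_pi_div_two (by linarith) (by linarith) (by linarith)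
  have hm0 : 0 < sin (m / 2) := sin_pos_of_pos_of_lt_pi (by linarith) (by linarith [Real.pi_pos])
  have s1 := hsin (β - α) (by linarith) (by linarith)
  have s2 := hsin (γ - β) (by linarith) (by linarith)
  have s3 := hsin (γ - α) (by linarith) (by linarith)
  have n1 := norm_exp_sub_exp α β (by linarith) (by linarith)
  have n2 := norm_exp_sub_exp β γ (by linarith) (by linarith)
  have n3 := norm_exp_sub_exp α γ (by linarith) (by linarith)
  rw [norm_sub_rev] at n3
  have hn : ∀ x y : ℂ, ‖(c + r₀ * x) - (c + r₀ * y)‖ = r₀ * ‖x - y‖ := by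
    intro x y
    rw [show (c + r₀ * x) - (c + r₀ * y) = r₀ * (x - y) by ring, norm_mul, Complex.norm_real,
      Real.norm_of_nonneg hr.le]
  have ho : ∀ x y z : ℂ, orient (c + r₀ * x) (c + r₀ * y) (c + r₀ * z) = r₀ ^ 2 * orient x y z := by
    intro x y z
    simp [orient, cr]; ring
  set a := sin ((β - α) / 2)
  set b := sin ((γ - β) / 2)
  set d := sin ((γ - α) / 2)
  have ha : 0 < a := hm0.trans_le s1
  have hb : 0 < b := hm0.trans_le s2
  have hd : 0 < d := hm0.trans_le s3
  constructor <;> simp only [ho, hn, orient_exp, n1, n2, n3]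
  · positivity
  · nlinarith
  · nlinarith
  · nlinarith
  · rw [show r₀ ^ 2 * (4 * (a * b * d)) = d * (r₀ * (2 * a) * (r₀ * (2 * b))) by ring]
    gcongr
  · rw [show r₀ ^ 2 * (4 * (a * b * d)) = a * (r₀ * (2 * b) * (r₀ * (2 * d))) by ring]
    gcongr
  · rw [show r₀ ^ 2 * (4 * (a * b * d)) = b * (r₀ * (2 * d) * (r₀ * (2 * a))) by ring]
    gcongr

lemma exists_phase {r : ι → ℂ} {c : ℂ} {m : ℝ} (hm : 0 < m) (l : List ι) :
    ∀ (a z : ι), (a :: l).Nodup → (∀ e ∈ pathEdges (a :: l ++ [z]),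
      c ∉ segment ℝ (r e.1) (r e.2) ∧ m ≤ ang c (r e.1) (r e.2)) →
    ∃ φ : ι → ℝ, (∀ x ∈ a :: l, Complex.exp (φ x * Complex.I) = (r x - c) / ‖r x - c‖) ∧
      (a :: l).Pairwise (fun x y => φ x + m ≤ φ y) ∧
      ∀ x ∈ a :: l, φ x - φ a + m ≤ wind r (pathEdges (a :: l ++ [z])) c := by
  classical
  induction l with
  | nil =>
    intro a z _ h
    have h1 := h (a, z) (by simp [pathEdges])
    have hne := (sub_ne_zero_of_notMem_segment h1.1).1
    refine ⟨fun _ => (r a - c).arg, ?_, by simp, ?_⟩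
    · simp only [List.mem_singleton, forall_eq]
      rw [eq_div_iff (by simpa using hne), mul_comm, Complex.norm_mul_exp_arg_mul_I]
    · simp only [List.mem_singleton, forall_eq, sub_self, zero_add]
      simpa [pathEdges, wind, edgeSum] using h1.2
  | cons b l ih =>
    intro a z hnd h
    have hpe : pathEdges (a :: b :: l ++ [z]) = (a, b) :: pathEdges (b :: l ++ [z]) := rfl
    rw [hpe] at h ⊢
    rw [List.nodup_cons] at hnd
    obtain ⟨φ, h1, h2, h3⟩ := ih b z hnd.2 fun e he => h e (List.mem_cons_of_mem _ he)
    obtain ⟨hs, hma⟩ := h (a, b) List.mem_cons_self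
    simp only at hs hma
    set θ := ang c (r a) (r b) with hθ
    have hup : ∀ x ∈ b :: l, Function.update φ a (φ b - θ) x = φ x := fun x hx =>
      Function.update_of_ne (by rintro rfl; exact hnd.1 hx) _ _
    have hua : Function.update φ a (φ b - θ) a = φ b - θ := Function.update_self _ _ _
    have hle : ∀ x ∈ b :: l, φ b ≤ φ x := by
      intro x hx
      rcases List.mem_cons.mp hx with rfl | hx
      · exact le_rfl
      · linarith [(List.pairwise_cons.mp h2).1 x hx]
    refine ⟨Function.update φ a (φ b - θ), ?_, ?_, ?_⟩
    · intro x hx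
      rcases List.mem_cons.mp hx with rfl | hx
      · rw [hua]
        have e1 := exp_ang_mul hs
        rw [← h1 b List.mem_cons_self, ← hθ] at e1
        rw [Complex.ofReal_sub, sub_mul, Complex.exp_sub, ← e1, mul_div_cancel_left₀]
        exact Complex.exp_ne_zero _
      · rw [hup x hx]; exact h1 x hx
    · refine List.pairwise_cons.mpr ⟨fun x hx => ?_, h2.imp_of_mem fun {x y} hx hy k => ?_⟩
      · rw [hua, hup x hx]
        linarith [hle x hx]
      · rw [hup x hx, hup y hy]; exact k
    · intro x hx
      rw [wind_cons, hua]
      simp only [← hθ]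
      rcases List.mem_cons.mp hx with rfl | hx
      · rw [hua]
        linarith [h3 b List.mem_cons_self]
      · rw [hup x hx]
        linarith [h3 x hx]

/-- The radial projections to a circle of three vertices in cyclic order. -/
lemma fat_of_cycOrder {r : ι → ℂ} {c : ℂ} {m r₀ : ℝ} (hm : 0 < m) (hr : 0 < r₀) {l : List ι}
    (hnd : l.Nodup) (he : ∀ e ∈ polyEdges l,
      c ∉ segment ℝ (r e.1) (r e.2) ∧ m ≤ ang c (r e.1) (r e.2))
    (hw : wind r (polyEdges l) c = 2 * π) {n : ι → ι}
    (hn : ∀ a ∈ l, r (n a) = c + r₀ * ((r a - c) / ‖r a - c‖)) {t : ι × ι × ι}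
    (ht : CycOrder l t) : Fat (sin (m / 2)) (2 * r₀ * sin (m / 2)) (r (n t.1)) (r (n t.2.1))
      (r (n t.2.2)) := by
  obtain _ | ⟨a, l⟩ := l
  · simp [CycOrder] at ht
  obtain ⟨φ, h1, h2, h3⟩ := exists_phase hm l a a hnd he
  have h4 : ∀ x ∈ a :: l, ∀ y ∈ a :: l, φ x - φ y ≤ 2 * π - m := by
    intro x hx y hy
    have k1 := h3 x hx
    rw [← polyEdges_cons, hw] at k1
    have k2 : φ a ≤ φ y := by
      rcases List.mem_cons.mp hy with rfl | hy
      · exact le_rfl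
      · linarith [(List.pairwise_cons.mp h2).1 y hy]
    linarith
  have key : ∀ x y z, List.Sublist [x, y, z] (a :: l) →
      Fat (sin (m / 2)) (2 * r₀ * sin (m / 2)) (r (n x)) (r (n y)) (r (n z)) := by
    intro x y z hs
    have hx := hs.subset (show x ∈ [x, y, z] by simp)
    have hy := hs.subset (show y ∈ [x, y, z] by simp)
    have hz := hs.subset (show z ∈ [x, y, z] by simp)
    have hp := h2.sublist hs
    simp at hp
    rw [hn x hx, hn y hy, hn z hz, ← h1 x hx, ← h1 y hy, ← h1 z hz]
    exact fat_circle hr hm hp.1.1 hp.2 (h4 z hz x hx)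
  rcases ht with ht | ht | ht
  · exact key _ _ _ ht
  · exact (key _ _ _ ht).rotate.rotate
  · exact (key _ _ _ ht).rotate

lemma cr_eq_sin {y a b : ℂ} (h : y ∉ segment ℝ a b) :
    orient y a b = ‖a - y‖ * ‖b - y‖ * sin (ang y a b) := by
  have h1 := exp_ang_mul h
  obtain ⟨ha, hb⟩ := sub_ne_zero_of_notMem_segment h
  have ha' : (‖a - y‖ : ℂ) ≠ 0 := by simpa using ha
  have hb' : (‖b - y‖ : ℂ) ≠ 0 := by simpa using hb
  have h2 : (‖a - y‖ : ℂ) * (b - y) =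
      ‖b - y‖ * (Complex.exp (ang y a b * Complex.I) * (a - y)) := by
    field_simp at h1
    linear_combination -h1
  have hre := congrArg Complex.re h2
  have him := congrArg Complex.im h2
  simp only [Complex.mul_re, Complex.mul_im, Complex.ofReal_re, Complex.ofReal_im, zero_mul,
    sub_zero, add_zero, Complex.exp_ofReal_mul_I_re, Complex.exp_ofReal_mul_I_im] at hre him
  have hn := Complex.normSq_eq_norm_sq (a - y)
  rw [Complex.normSq_apply] at hn
  have hpos : 0 < ‖a - y‖ := norm_pos_iff.mpr ha
  have : ‖a - y‖ * orient y a b = ‖a - y‖ * (‖a - y‖ * ‖b - y‖ * sin (ang y a b)) := by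
    unfold orient cr
    calc _ = (a - y).re * (‖a - y‖ * (b - y).im) - (a - y).im * (‖a - y‖ * (b - y).re) := by ring
      _ = _ := by rw [hre, him]; linear_combination (‖b - y‖ * sin (ang y a b)) * hn
  exact mul_left_cancel₀ hpos.ne' this

lemma div_le_ang {y a b : ℂ} {M x : ℝ} (hx : 0 < x) (h : x ≤ orient y a b) (ha : ‖a - y‖ ≤ M)
    (hb : ‖b - y‖ ≤ M) : x / M ^ 2 ≤ ang y a b := by
  have hs : y ∉ segment ℝ a b := notMem_segment_of_orient (by linarith)
  have hp := ang_pos (hx.trans_le h)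
  rw [cr_eq_sin hs] at h
  have hM : 0 < M := (norm_pos_iff.mpr (sub_ne_zero_of_notMem_segment hs).1).trans_le ha
  have hsin : 0 < sin (ang y a b) :=
    sin_pos_of_pos_of_lt_pi hp ((le_abs_self _).trans_lt (abs_ang_lt _ _ _))
  rw [div_le_iff₀ (by positivity)]
  calc x ≤ ‖a - y‖ * ‖b - y‖ * sin (ang y a b) := h
    _ ≤ M * M * ang y a b := by gcongr; exact sin_le hp.le
    _ = _ := by ring

/-- A polygon seen in the positive sense from a point winds once around it. -/
lemma Filling.wind_of_pos {r : ι → ℂ} {l : List ι} {ts : List (ι × ι × ι)} {σ : ℝ}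
    (F : Filling r l ts σ) (hl : l ≠ []) {c : ℂ}
    (h : ∀ e ∈ polyEdges l, 0 < orient c (r e.1) (r e.2)) :
    σ = 1 ∧ wind r (polyEdges l) c = 2 * π := by
  have hc : c ∉ trace r (polyEdges l) := by
    intro k
    obtain ⟨e, he, hk⟩ := mem_trace.mp k
    exact notMem_segment_of_orient (h e he).ne' hk
  obtain ⟨p, hp⟩ := List.exists_mem_of_ne_nil l hl
  obtain ⟨e, he, -⟩ := exists_edge_fst hp
  have hpos : 0 < wind r (polyEdges l) c := by
    have hnn : ∀ x ∈ (polyEdges l).map (fun e => ang c (r e.1) (r e.2)), 0 ≤ x := by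
      intro x hx
      obtain ⟨e, he, rfl⟩ := List.mem_map.mp hx
      exact (ang_pos (h e he)).le
    have := List.single_le_sum hnn _ (List.mem_map.mpr ⟨e, he, rfl⟩)
    exact (ang_pos (h e he)).trans_le this
  have hpi := Real.pi_pos
  rcases F.two c hc with k | k
  · linarith
  · rcases F.sgn with rfl | rfl
    · exact ⟨rfl, by linarith⟩
    · linarith

/-- The two triangles between an edge and its inner copy. -/
def collar (n : ι → ι) (e : ι × ι) : List (ι × ι × ι) := [(e.1, e.2, n e.1), (e.2, n e.2, n e.1)]

/-- The triples filling a polygon: a collar along the polygon and inner copies of `ts`. -/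
def annulus (n : ι → ι) (l : List ι) (ts : List (ι × ι × ι)) : List (ι × ι × ι) :=
  (polyEdges l).flatMap (collar n) ++ ts.map fun t => (n t.1, n t.2.1, n t.2.2)

lemma mem_annulus {n : ι → ι} {l : List ι} {ts : List (ι × ι × ι)} {t : ι × ι × ι} :
    t ∈ annulus n l ts ↔ (∃ e ∈ polyEdges l, t = (e.1, e.2, n e.1) ∨ t = (e.2, n e.2, n e.1)) ∨
      ∃ t' ∈ ts, t = (n t'.1, n t'.2.1, n t'.2.2) := by
  simp only [annulus, collar, List.mem_append, List.mem_flatMap, List.mem_cons,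
    List.not_mem_nil, or_false, List.mem_map]
  constructor
  · rintro (h | ⟨t', h, rfl⟩)
    exacts [Or.inl h, Or.inr ⟨t', h, rfl⟩]
  · rintro (h | ⟨t', h, rfl⟩)
    exacts [Or.inl h, Or.inr ⟨t', h, rfl⟩]

lemma annulus_chain {n : ι → ι} {l : List ι} {ts : List (ι × ι × ι)}
    (hc : ∀ θ : ι → ι → ℝ, (∀ a b, θ b a = -θ a b) →
      (ts.map (bdrySum θ)).sum = edgeSum θ (polyEdges l))
    (θ : ι → ι → ℝ) (hθ : ∀ a b, θ b a = -θ a b) :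
    ((annulus n l ts).map (bdrySum θ)).sum = edgeSum θ (polyEdges l) := by
  have h1 := hc (fun a b => θ (n a) (n b)) (fun a b => hθ _ _)
  have h2 := edgeSum_polyEdges_sub (fun a => θ a (n a)) l
  have h3 : ∀ E : List (ι × ι), ((E.flatMap (collar n)).map (bdrySum θ)).sum =
      edgeSum θ E + edgeSum (fun a b => θ b (n b) - θ a (n a)) E -
        edgeSum (fun a b => θ (n a) (n b)) E := by
    intro E
    induction E with
    | nil => simp [edgeSum]
    | cons e E ih =>
      rw [List.flatMap_cons, List.map_append, List.sum_append, ih]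
      simp only [edgeSum, collar, bdrySum, List.map_cons, List.map_nil, List.sum_cons,
        List.sum_nil]
      rw [hθ e.1 (n e.1), hθ (n e.1) e.2, hθ (n e.1) (n e.2)]
      ring
  unfold annulus
  have h4 : ((ts.map fun t => (n t.1, n t.2.1, n t.2.2)).map (bdrySum θ)).sum =
      (ts.map (bdrySum fun a b => θ (n a) (n b))).sum := by
    rw [List.map_map]; rfl
  rw [List.map_append, List.sum_append, h3, h2, h4]
  linarith

lemma CycOrder.mem {l : List ι} {t : ι × ι × ι} (h : CycOrder l t) :
    t.1 ∈ l ∧ t.2.1 ∈ l ∧ t.2.2 ∈ l := by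
  rcases h with h | h | h
  all_goals
    have := h.subset
    simp at this
    tauto

lemma verts_annulus {n : ι → ι} {l : List ι} {ts : List (ι × ι × ι)}
    (hc : ∀ t ∈ ts, CycOrder l t) {t : ι × ι × ι} (ht : t ∈ annulus n l ts) {i : ι}
    (hi : i ∈ verts t) : ∃ a ∈ l, i = a ∨ i = n a := by
  rw [mem_verts] at hi
  rcases mem_annulus.mp ht with ⟨e, he, rfl | rfl⟩ | ⟨t', ht', rfl⟩
  · have := mem_of_mem_polyEdges he
    rcases hi with rfl | rfl | rfl
    exacts [⟨_, this.1, Or.inl rfl⟩, ⟨_, this.2, Or.inl rfl⟩, ⟨_, this.1, Or.inr rfl⟩]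
  · have := mem_of_mem_polyEdges he
    rcases hi with rfl | rfl | rfl
    exacts [⟨_, this.2, Or.inl rfl⟩, ⟨_, this.2, Or.inr rfl⟩, ⟨_, this.1, Or.inr rfl⟩]
  · have := (hc t' ht').mem
    rcases hi with rfl | rfl | rfl
    exacts [⟨_, this.1, Or.inr rfl⟩, ⟨_, this.2.1, Or.inr rfl⟩, ⟨_, this.2.2, Or.inr rfl⟩]

lemma annulus_tiling {r r' : ι → ℂ} {l : List ι} {ts ts' : List (ι × ι × ι)} {σ σ' : ℝ} {n : ι → ι}
    (hP : SimplePoly r l) (hl : 3 ≤ l.length) (F : Filling r l ts' σ) (F' : Filling r' l ts σ')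
    (h1 : ∀ e ∈ polyEdges l, 0 < σ * orient (r e.1) (r e.2) (r (n e.1)))
    (h2 : ∀ e ∈ polyEdges l, 0 < σ * orient (r e.2) (r (n e.2)) (r (n e.1)))
    (h3 : ∀ t ∈ ts, 0 < σ * orient (r (n t.1)) (r (n t.2.1)) (r (n t.2.2)))
    (i1 : ∀ a ∈ l, ∀ b ∈ l, r a ≠ r (n b))
    (i2 : ∀ a ∈ l, ∀ b ∈ l, r (n a) = r (n b) → a = b) :
    Tiling r l (annulus n l ts) σ where
  poly := hP
  len := hl
  sgn := F.sgn
  pos t ht := by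
    rcases mem_annulus.mp ht with ⟨e, he, rfl | rfl⟩ | ⟨t', ht', rfl⟩
    exacts [h1 e he, h2 e he, h3 t' ht']
  chain := annulus_chain F'.chain
  two := F.two
  inj t ht t' ht' i hi j hj hij := by
    obtain ⟨a, ha, rfl | rfl⟩ := verts_annulus F'.cyc ht hi <;>
      obtain ⟨b, hb, rfl | rfl⟩ := verts_annulus F'.cyc ht' hj
    · exact hP.inj _ ha _ hb hij
    · exact absurd hij (i1 _ ha _ hb)
    · exact absurd hij.symm (i1 _ hb _ ha)
    · rw [i2 _ ha _ hb hij]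

lemma exists_neighbours {l : List ι} (hnd : l.Nodup) (hl : 3 ≤ l.length) {a : ι} (ha : a ∈ l) :
    ∃ p q, p ≠ q ∧ p ≠ a ∧ q ≠ a ∧ (p, a) ∈ polyEdges l ∧ (a, q) ∈ polyEdges l ∧
      ∀ e ∈ polyEdges l, (e.1 = a → e.2 = q) ∧ (e.2 = a → e.1 = p) := by
  obtain ⟨l₁, l₂, rfl⟩ := List.append_of_mem ha
  have hp := polyEdges_rotate_perm l₁ (a :: l₂)
  have hnd' : (a :: l₂ ++ l₁).Nodup := List.nodup_append_comm.mp hnd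
  have hl' : 3 ≤ (a :: l₂ ++ l₁).length := by simp at hl ⊢; omega
  rw [List.cons_append] at hp hnd' hl'
  generalize l₂ ++ l₁ = k at hp hnd' hl'
  match k, hl' with
  | q :: k', hl' =>
    obtain ⟨m, p, rfl⟩ : ∃ m p, k' = m ++ [p] := by
      rcases List.eq_nil_or_concat k' with rfl | ⟨m, p, h⟩
      · simp at hl'
      · exact ⟨m, p, by simpa using h⟩
    have hs := polyEdges_split a q m p
    simp only [List.nodup_cons, List.mem_cons, List.mem_append, List.not_mem_nil, or_false,
      not_or] at hnd'
    have hmem : ∀ e, e ∈ polyEdges (l₁ ++ a :: l₂) ↔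
        e = (a, q) ∨ e ∈ pathEdges (q :: (m ++ [p])) ∨ e = (p, a) := by
      intro e
      rw [hp.mem_iff, hs]
      simp
    refine ⟨p, q, fun h => hnd'.2.1.2 h.symm, fun h => hnd'.1.2.2 h.symm,
      fun h => hnd'.1.1 h.symm, (hmem _).mpr (Or.inr (Or.inr rfl)), (hmem _).mpr (Or.inl rfl),
      fun e he => ?_⟩
    rcases (hmem e).mp he with rfl | h | rfl
    · exact ⟨fun _ => rfl, fun h => absurd h.symm hnd'.1.1⟩
    · have := mem_of_mem_pathEdges h
      simp only [List.mem_cons, List.mem_append, List.not_mem_nil, or_false] at this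
      constructor
      · intro h'
        rw [h'] at this
        exact absurd this.1 (by tauto)
      · intro h'
        rw [h'] at this
        exact absurd this.2 (by tauto)
    · exact ⟨fun h => absurd h.symm hnd'.1.2.2, fun _ => rfl⟩

lemma trace_congr {r r' : ι → ℂ} {E : List (ι × ι)}
    (h : ∀ e ∈ E, r' e.1 = r e.1 ∧ r' e.2 = r e.2) : trace r' E = trace r E := by
  ext y
  simp only [mem_trace]
  refine exists_congr fun e => and_congr_right fun he => ?_
  rw [(h e he).1, (h e he).2]

lemma wind_congr {r r' : ι → ℂ} {E : List (ι × ι)}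
    (h : ∀ e ∈ E, r' e.1 = r e.1 ∧ r' e.2 = r e.2) (y : ℂ) : wind r' E y = wind r E y :=
  edgeSum_congr fun e he => by rw [(h e he).1, (h e he).2]

lemma SegOK.congr {r r' : ι → ℂ} {a b c d : ι} (h : SegOK r a b c d) (ha : r' a = r a)
    (hb : r' b = r b) (hc : r' c = r c) (hd : r' d = r d) : SegOK r' a b c d := by
  intro x hx hx'
  rw [ha, hb] at hx
  rw [hc, hd] at hx'
  rcases h x hx hx' with h | h | ⟨i, hi, hi', rfl⟩
  · exact Or.inl h
  · exact Or.inr (Or.inl h)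
  · refine Or.inr (Or.inr ⟨i, hi, hi', ?_⟩)
    rcases hi with rfl | rfl <;> simp [*]

lemma SimplePoly.congr {r r' : ι → ℂ} {l : List ι} (h : SimplePoly r l)
    (hr : ∀ a ∈ l, r' a = r a) : SimplePoly r' l where
  nodup := h.nodup
  inj a ha b hb hab := h.inj a ha b hb (by rwa [← hr a ha, ← hr b hb])
  ok e he e' he' := by
    have h1 := mem_of_mem_polyEdges he
    have h2 := mem_of_mem_polyEdges he'
    exact (h.ok e he e' he').congr (hr _ h1.1) (hr _ h1.2) (hr _ h2.1) (hr _ h2.2)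

lemma Filling.congr {r r' : ι → ℂ} {l : List ι} {ts : List (ι × ι × ι)} {σ : ℝ}
    (h : Filling r l ts σ) (hr : ∀ a ∈ l, r' a = r a) : Filling r' l ts σ := by
  have hE : ∀ e ∈ polyEdges l, r' e.1 = r e.1 ∧ r' e.2 = r e.2 := fun e he =>
    ⟨hr _ (mem_of_mem_polyEdges he).1, hr _ (mem_of_mem_polyEdges he).2⟩
  have hi : inside r' l = inside r l := by
    ext y; simp only [inside, mem_ofPred_eq, trace_congr hE, wind_congr hE]
  refine ⟨h.sgn, h.cyc, fun t ht => ?_, h.chain, fun y hy => ?_, ?_, ?_⟩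
  · have := (h.cyc t ht).mem
    rw [hr _ this.1, hr _ this.2.1, hr _ this.2.2]
    exact h.pos t ht
  · rw [trace_congr hE] at hy
    rw [wind_congr hE]
    exact h.two y hy
  · rw [hi]; exact h.conn
  · rw [hi, trace_congr hE]; exact h.cl

/-- A direction pointing to a given side of two consecutive edges. -/
lemma exists_inner_dir {u v : ℂ} {σ : ℝ} (hσ : σ = 1 ∨ σ = -1) (hu : u ≠ 0) (hv : v ≠ 0)
    (huv : ∀ k : ℝ, 0 < k → u ≠ -(k • v)) : ∃ d : ℂ, 0 < σ * cr u d ∧ 0 < σ * cr v d := by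
  have hσ2 : σ * σ = 1 := by rcases hσ with rfl | rfl <;> norm_num
  have hu' := norm_pos_iff.mpr hu
  have hv' := norm_pos_iff.mpr hv
  set p := u.re * v.re + u.im * v.im with hp
  have hun : u.re * u.re + u.im * u.im = ‖u‖ ^ 2 := by
    rw [← Complex.normSq_apply, Complex.normSq_eq_norm_sq]
  have hvn : v.re * v.re + v.im * v.im = ‖v‖ ^ 2 := by
    rw [← Complex.normSq_apply, Complex.normSq_eq_norm_sq]
  have hkey : 0 < ‖u‖ * ‖v‖ + p := by
    by_contra hc
    push Not at hc
    refine huv (‖u‖ / ‖v‖) (by positivity) ?_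
    have h1 : ‖‖v‖ • u + ‖u‖ • v‖ ^ 2 ≤ 0 := by
      rw [← Complex.normSq_eq_norm_sq, Complex.normSq_apply]
      simp only [Complex.add_re, Complex.add_im, Complex.smul_re, Complex.smul_im, smul_eq_mul]
      nlinarith [mul_nonneg hu'.le hv'.le]
    have h2 : ‖v‖ • u + ‖u‖ • v = 0 := by
      rw [← norm_eq_zero]
      nlinarith [norm_nonneg (‖v‖ • u + ‖u‖ • v)]
    have h3 : u = ‖v‖⁻¹ • (‖v‖ • u) := by rw [smul_smul, inv_mul_cancel₀ hv'.ne', one_smul]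
    refine h3.trans ?_
    rw [eq_neg_of_add_eq_zero_left h2, smul_neg, smul_smul]
    congr 2
    field_simp
  refine ⟨σ • (Complex.I * (‖v‖ • u + ‖u‖ • v)), ?_, ?_⟩
  · have : σ * cr u (σ • (Complex.I * (‖v‖ • u + ‖u‖ • v))) =
        σ * σ * (‖v‖ * (u.re * u.re + u.im * u.im) + ‖u‖ * p) := by
      simp [cr, hp]; ring
    rw [this, hσ2, hun]
    have : 0 < ‖u‖ * (‖u‖ * ‖v‖ + p) := by positivity
    linarith
  · have : σ * cr v (σ • (Complex.I * (‖v‖ • u + ‖u‖ • v))) =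
        σ * σ * (‖u‖ * (v.re * v.re + v.im * v.im) + ‖v‖ * p) := by
      simp [cr, hp]; ring
    rw [this, hσ2, hvn]
    have : 0 < ‖v‖ * (‖u‖ * ‖v‖ + p) := by positivity
    linarith

lemma SimplePoly.not_antiparallel {r : ι → ℂ} {l : List ι} (h : SimplePoly r l) {p a q : ι}
    (hpq : p ≠ q) (hpa : p ≠ a) (hqa : q ≠ a) (h1 : (p, a) ∈ polyEdges l)
    (h2 : (a, q) ∈ polyEdges l) (k : ℝ) (hk : 0 < k) : r a - r p ≠ -(k • (r q - r a)) := by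
  intro he
  have hm1 := (mem_of_mem_polyEdges h1).1
  have hm2 := (mem_of_mem_polyEdges h2).2
  have hp : r p = r a + k • (r q - r a) := by linear_combination -he
  have hcase : r p ∈ segment ℝ (r a) (r q) ∨ r q ∈ segment ℝ (r p) (r a) := by
    rcases le_total k 1 with hk1 | hk1
    · left
      rw [hp, segment_eq_image']
      exact ⟨k, ⟨hk.le, hk1⟩, rfl⟩
    · right
      rw [segment_symm, segment_eq_image']
      refine ⟨k⁻¹, ⟨by positivity, inv_le_one_of_one_le₀ hk1⟩, ?_⟩
      simp only [hp, add_sub_cancel_left, smul_smul, inv_mul_cancel₀ hk.ne', one_smul]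
      ring
  rcases hcase with hx | hx
  · rcases h.mem_edge hm1 h2 hx with h | h
    exacts [hpa h, hpq h]
  · rcases h.mem_edge hm2 h1 hx with h | h
    exacts [hpq h.symm, hqa h]

lemma SimplePoly.exists_dir {r : ι → ℂ} {l : List ι} (h : SimplePoly r l) (hl : 3 ≤ l.length)
    {σ : ℝ} (hσ : σ = 1 ∨ σ = -1) (a : ι) : ∃ d : ℂ, ∀ e ∈ polyEdges l,
      (e.1 = a ∨ e.2 = a) → 0 < σ * cr (r e.2 - r e.1) d := by
  by_cases ha : a ∈ l
  · obtain ⟨p, q, hpq, hpa, hqa, h1, h2, h3⟩ := exists_neighbours h.nodup hl ha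
    obtain ⟨d, hd1, hd2⟩ := exists_inner_dir (u := r a - r p) (v := r q - r a) hσ
      (sub_ne_zero.mpr fun k => hpa (h.inj _ (mem_of_mem_polyEdges h1).1 _ ha k.symm))
      (sub_ne_zero.mpr fun k => hqa (h.inj _ (mem_of_mem_polyEdges h2).2 _ ha k))
      (h.not_antiparallel hpq hpa hqa h1 h2)
    refine ⟨d, fun e he hea => ?_⟩
    rcases hea with k | k
    · rw [(h3 e he).1 k, k]; exact hd2
    · rw [(h3 e he).2 k, k]; exact hd1
  · refine ⟨0, fun e he hea => ?_⟩
    have := mem_of_mem_polyEdges he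
    rcases hea with k | k
    · exact absurd (k ▸ this.1) ha
    · exact absurd (k ▸ this.2) ha

open Filter Topology

lemma continuous_cr : Continuous fun p : ℂ × ℂ => cr p.1 p.2 := by
  unfold cr
  fun_prop

lemma continuous_orient_comp {f g h : ℝ → ℂ} (hf : Continuous f) (hg : Continuous g)
    (hh : Continuous h) : Continuous fun s => orient (f s) (g s) (h s) :=
  continuous_cr.comp ((hg.sub hf).prodMk (hh.sub hf))

/-- A filled polygon is also filled by a thin collar and an inner copy of the filling. -/
lemma Filling.exists_offset {r : ι → ℂ} {l : List ι} {ts : List (ι × ι × ι)} {σ : ℝ}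
    (F : Filling r l ts σ) (hP : SimplePoly r l) (hl : 3 ≤ l.length) (n : ι → ι) {η : ℝ}
    (hη : 0 < η) : ∃ o : ι → ℂ, (∀ a ∈ l, ‖o a‖ ≤ η) ∧ ∀ r' : ι → ℂ, (∀ a ∈ l, r' a = r a) →
      (∀ a ∈ l, r' (n a) = r a + o a) → Tiling r' l (annulus n l ts) σ := by
  choose d hd using hP.exists_dir hl F.sgn
  have hev : ∀ᶠ s in 𝓝[>] (0 : ℝ), (∀ a ∈ l, ‖s • d a‖ ≤ η) ∧
      (∀ e ∈ polyEdges l, 0 < σ * orient (r e.2) (r e.2 + s • d e.2) (r e.1 + s • d e.1)) ∧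
      (∀ t ∈ ts, 0 < σ * orient (r t.1 + s • d t.1) (r t.2.1 + s • d t.2.1)
        (r t.2.2 + s • d t.2.2)) ∧
      (∀ a ∈ l, ∀ b ∈ l, a ≠ b → r a ≠ r b + s • d b) ∧
      (∀ a ∈ l, ∀ b ∈ l, a ≠ b → r a + s • d a ≠ r b + s • d b) := by
    have hfin : ∀ {β : Type _} (L : List β) (P : β → ℝ → Prop),
        (∀ x ∈ L, ∀ᶠ s in 𝓝[>] (0 : ℝ), P x s) → ∀ᶠ s in 𝓝[>] (0 : ℝ), ∀ x ∈ L, P x s := by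
      intro β L P h
      have := (Filter.eventually_all_finite (l := 𝓝[>] (0 : ℝ)) (p := fun x s => P x s)
        (List.finite_toSet L)).mpr h
      exact this
    have hcont : ∀ {f g : ℝ → ℂ}, Continuous f → Continuous g → f 0 ≠ g 0 →
        ∀ᶠ s in 𝓝[>] (0 : ℝ), f s ≠ g s := fun hf hg h =>
      ((hf.continuousAt.ne_iff_eventually_ne hg.continuousAt).mp h).filter_mono nhdsWithin_le_nhds
    refine (hfin _ _ fun a ha => ?_).and ((hfin _ _ fun e he => ?_).and
      ((hfin _ _ fun t ht => ?_).and ((hfin _ _ fun a ha => hfin _ _ fun b hb => ?_).and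
        (hfin _ _ fun a ha => hfin _ _ fun b hb => ?_))))
    · have : Continuous fun s : ℝ => ‖s • d a‖ := by fun_prop
      have h0 : ‖(0 : ℝ) • d a‖ < η := by simpa using hη
      exact ((this.tendsto 0).eventually_lt_const h0).mono (fun s hs => hs.le) |>.filter_mono
        nhdsWithin_le_nhds
    · have h0 := hd e.2 e he (Or.inr rfl)
      have hc : Continuous fun s : ℝ =>
          σ * cr (r e.2 - r e.1) (d e.2) + s * (σ * cr (d e.2) (d e.1)) := by fun_prop
      have h1 : 0 < σ * cr (r e.2 - r e.1) (d e.2) + 0 * (σ * cr (d e.2) (d e.1)) := by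
        simpa using h0
      filter_upwards [((hc.tendsto 0).eventually_const_lt h1).filter_mono nhdsWithin_le_nhds,
        self_mem_nhdsWithin] with s hs hs0
      have : σ * orient (r e.2) (r e.2 + s • d e.2) (r e.1 + s • d e.1) =
          s * (σ * cr (r e.2 - r e.1) (d e.2) + s * (σ * cr (d e.2) (d e.1))) := by
        simp [orient, cr]; ring
      rw [this]
      exact mul_pos hs0 hs
    · have hc : Continuous fun s : ℝ => σ * orient (r t.1 + s • d t.1) (r t.2.1 + s • d t.2.1)
          (r t.2.2 + s • d t.2.2) :=
        continuous_const.mul (continuous_orient_comp (by fun_prop) (by fun_prop) (by fun_prop))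
      have h1 : 0 < σ * orient (r t.1 + (0 : ℝ) • d t.1) (r t.2.1 + (0 : ℝ) • d t.2.1)
          (r t.2.2 + (0 : ℝ) • d t.2.2) := by simpa using F.pos t ht
      exact ((hc.tendsto 0).eventually_const_lt h1).filter_mono nhdsWithin_le_nhds
    · by_cases hab : a = b
      · simp [hab]
      · filter_upwards [hcont (f := fun _ => r a) (g := fun s => r b + s • d b) (by fun_prop)
          (by fun_prop) (by simpa using fun k => hab (hP.inj _ ha _ hb k))] with s hs _ using hs
    · by_cases hab : a = b
      · simp [hab]
      · filter_upwards [hcont (f := fun s => r a + s • d a) (g := fun s => r b + s • d b)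
          (by fun_prop) (by fun_prop) (by simpa using fun k => hab (hP.inj _ ha _ hb k))]
          with s hs _ using hs
  obtain ⟨s, ⟨hs1, hs2, hs3, hs4, hs5⟩, hs0⟩ := (hev.and self_mem_nhdsWithin).exists
  have hs0 : 0 < s := hs0
  refine ⟨fun a => s • d a, hs1, fun r' h1 h2 => ?_⟩
  refine annulus_tiling (hP.congr h1) hl (F.congr h1) (F.congr h1) (fun e he => ?_)
    (fun e he => ?_) (fun t ht => ?_) (fun a ha b hb => ?_) (fun a ha b hb => ?_)
  · have hm := mem_of_mem_polyEdges he
    rw [h1 _ hm.1, h1 _ hm.2, h2 _ hm.1]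
    have : σ * orient (r e.1) (r e.2) (r e.1 + s • d e.1) =
        s * (σ * cr (r e.2 - r e.1) (d e.1)) := by
      simp [orient, cr]; ring
    rw [this]
    exact mul_pos hs0 (hd e.1 e he (Or.inl rfl))
  · have hm := mem_of_mem_polyEdges he
    rw [h1 _ hm.2, h2 _ hm.1, h2 _ hm.2]
    exact hs2 e he
  · have hm := (F.cyc t ht).mem
    rw [h2 _ hm.1, h2 _ hm.2.1, h2 _ hm.2.2]
    exact hs3 t ht
  · rw [h1 _ ha, h2 _ hb]
    rcases eq_or_ne a b with rfl | hab
    · obtain ⟨e, he, hea⟩ := exists_edge_fst ha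
      have := hd a e he (Or.inl hea)
      intro k
      have hz : s • d a = 0 := by simpa using k
      rcases smul_eq_zero.mp hz with hz | hz
      · exact hs0.ne' hz
      · simp [hz, cr] at this
    · exact hs4 a ha b hb hab
  · rw [h2 _ ha, h2 _ hb]
    intro k
    by_contra hab
    exact hs5 a ha b hb hab k

lemma Fat.mono {s s' δ δ' : ℝ} {a b c : ℂ} (h : Fat s δ a b c) (hs : s' ≤ s) (hδ : δ' ≤ δ) :
    Fat s' δ' a b c where
  pos := h.pos
  ab := hδ.trans h.ab
  bc := hδ.trans h.bc
  ca := hδ.trans h.ca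
  sb := (mul_le_mul_of_nonneg_right hs (by positivity)).trans h.sb
  sc := (mul_le_mul_of_nonneg_right hs (by positivity)).trans h.sc
  sa := (mul_le_mul_of_nonneg_right hs (by positivity)).trans h.sa

/-- The radial projections of the vertices of a polygon winding positively are distinct. -/
lemma circle_injective {r : ι → ℂ} {c : ℂ} {m : ℝ} (hm : 0 < m) {l : List ι} (hnd : l.Nodup)
    (he : ∀ e ∈ polyEdges l, c ∉ segment ℝ (r e.1) (r e.2) ∧ m ≤ ang c (r e.1) (r e.2))
    (hw : wind r (polyEdges l) c = 2 * π) :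
    ∀ a ∈ l, ∀ b ∈ l, (r a - c) / ‖r a - c‖ = (r b - c) / ‖r b - c‖ → a = b := by
  match l, hnd, he, hw with
  | [], _, _, _ => simp
  | z :: l, hnd, he, hw =>
    rw [polyEdges_cons] at he hw
    obtain ⟨φ, h1, h2, h3⟩ := exists_phase hm l z z hnd he
    rw [hw] at h3
    have hz : ∀ x ∈ z :: l, φ z ≤ φ x := by
      intro x hx
      rcases List.mem_cons.mp hx with rfl | hx
      · exact le_rfl
      · linarith [List.rel_of_pairwise_cons h2 hx]
    have hsym : (z :: l).Pairwise fun x y => x ≠ y → φ x + m ≤ φ y ∨ φ y + m ≤ φ x :=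
      h2.imp fun h _ => Or.inl h
    have hall : ∀ x ∈ z :: l, ∀ y ∈ z :: l, x ≠ y → φ x + m ≤ φ y ∨ φ y + m ≤ φ x := by
      intro x hx y hy
      have : Std.Symm fun x y => x ≠ y → φ x + m ≤ φ y ∨ φ y + m ≤ φ x :=
        ⟨fun x y h hxy => (h hxy.symm).symm⟩
      exact hsym.forall_of_forall (fun x _ h => absurd rfl h) hx hy
    intro a ha b hb hab
    by_contra hne
    rw [← h1 a ha, ← h1 b hb, Complex.exp_eq_exp_iff_exists_int] at hab
    obtain ⟨k, hk⟩ := hab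
    have hk' : φ a = φ b + k * (2 * π) := by
      have := congrArg Complex.im hk
      simpa using this
    have hpi := Real.pi_pos
    have a1 := h3 a ha
    have a2 := h3 b hb
    have a3 := hz a ha
    have a4 := hz b hb
    have k1 : (k : ℝ) < 1 := by
      by_contra hc; push Not at hc; nlinarith
    have k2 : (-1 : ℝ) < k := by
      by_contra hc; push Not at hc; nlinarith
    have k0 : k = 0 := by
      have : k < 1 := by exact_mod_cast k1
      have : -1 < k := by exact_mod_cast k2
      omega
    rw [k0] at hk'
    rcases hall a ha b hb hne with h | h <;> norm_num at hk' <;> linarith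

lemma Fat.of_norm_sub_le {c x y z : ℂ} {M s δ : ℝ} (hs : 0 ≤ s) (hM : 0 < M)
    (hx : ‖x - c‖ ≤ M) (hy : ‖y - c‖ ≤ M) (hz : ‖z - c‖ ≤ M) (h0 : 0 < orient x y z)
    (h1 : s * (2 * M) ^ 2 ≤ orient x y z) (h2 : δ * (2 * M) ≤ orient x y z) : Fat s δ x y z := by
  have key : ∀ u v : ℂ, ‖u - c‖ ≤ M → ‖v - c‖ ≤ M → ‖u - v‖ ≤ 2 * M := by
    intro u v hu hv
    calc ‖u - v‖ = ‖(u - c) - (v - c)‖ := by ring_nf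
      _ ≤ ‖u - c‖ + ‖v - c‖ := norm_sub_le _ _
      _ ≤ _ := by linarith
  exact Fat.of_le hs (by positivity) h1 h0 h2 (key _ _ hx hy) (key _ _ hy hz) (key _ _ hz hx)

/-- A polygon around `c` is tiled by a collar outside a circle and triangles inscribed in it. -/
lemma annulus_circle {r g : ι → ℂ} {l : List ι} {ts : List (ι × ι × ι)} {σ : ℝ} {n : ι → ι}
    {c : ℂ} {x M r₀ : ℝ} (hP : SimplePoly r l) (hl : 3 ≤ l.length) (F : Filling g l ts σ)
    (hx : 0 < x) (hr : 0 < r₀) (he : ∀ e ∈ polyEdges l, x ≤ orient c (r e.1) (r e.2))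
    (hM : ∀ a ∈ l, ‖r a - c‖ ≤ M) (hρ : ∀ a ∈ l, 2 * r₀ ≤ ‖r a - c‖)
    (hn : ∀ a ∈ l, r (n a) = c + r₀ * ((r a - c) / ‖r a - c‖)) :
    Tiling r l (annulus n l ts) 1 ∧ ∀ t ∈ annulus n l ts,
      Fat (r₀ * x / (8 * M ^ 3)) (r₀ * x / (4 * M ^ 2)) (r t.1) (r t.2.1) (r t.2.2) := by
  obtain ⟨ts', σ', F'⟩ := hP.exists_filling hl
  have hl0 : l ≠ [] := by rintro rfl; simp at hl
  obtain ⟨rfl, hw⟩ := F'.wind_of_pos hl0 (fun e h => hx.trans_le (he e h))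
  have hM0 : 0 < M := by
    obtain ⟨a, ha⟩ := List.exists_mem_of_ne_nil l hl0
    linarith [hM a ha, hρ a ha]
  have hrM : 2 * r₀ ≤ M := by
    obtain ⟨a, ha⟩ := List.exists_mem_of_ne_nil l hl0
    linarith [hM a ha, hρ a ha]
  set m := x / M ^ 2 with hm
  have hm0 : 0 < m := by positivity
  have hang : ∀ e ∈ polyEdges l, c ∉ segment ℝ (r e.1) (r e.2) ∧ m ≤ ang c (r e.1) (r e.2) := by
    intro e h
    have h1 := mem_of_mem_polyEdges h
    exact ⟨notMem_segment_of_orient (hx.trans_le (he e h)).ne',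
      div_le_ang hx (he e h) (hM _ h1.1) (hM _ h1.2)⟩
  have hmpi : m < π := by
    obtain ⟨a, ha⟩ := List.exists_mem_of_ne_nil l hl0
    obtain ⟨e, h, -⟩ := exists_edge_fst ha
    exact (hang e h).2.trans_lt ((le_abs_self _).trans_lt (abs_ang_lt _ _ _))
  have hρ0 : ∀ a ∈ l, 0 < ‖r a - c‖ := fun a ha => by linarith [hρ a ha]
  have hfat : ∀ t ∈ ts, Fat (sin (m / 2)) (2 * r₀ * sin (m / 2)) (r (n t.1)) (r (n t.2.1))
      (r (n t.2.2)) := fun t ht => fat_of_cycOrder hm0 hr hP.nodup hang hw hn (F.cyc t ht)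
  have hnn : ∀ a ∈ l, ‖r (n a) - c‖ = r₀ := by
    intro a ha
    rw [hn a ha, add_sub_cancel_left, norm_mul, norm_div]
    have := hρ0 a ha
    simp [abs_of_pos hr, this.ne']
  have hlam : ∀ a ∈ l, ∃ μ : ℝ, r₀ / M ≤ μ ∧ μ ≤ 1 / 2 ∧ r (n a) = c + μ * (r a - c) := by
    intro a ha
    have h0 := hρ0 a ha
    refine ⟨r₀ / ‖r a - c‖, ?_, ?_, ?_⟩
    · exact div_le_div_of_nonneg_left hr.le h0 (hM a ha)
    · rw [div_le_iff₀ h0]; linarith [hρ a ha]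
    · rw [hn a ha]; push_cast; ring
  have c1 : ∀ e ∈ polyEdges l, x / 2 ≤ orient (r e.1) (r e.2) (r (n e.1)) := by
    intro e h
    obtain ⟨μ, h1, h2, h3⟩ := hlam _ (mem_of_mem_polyEdges h).1
    have : orient (r e.1) (r e.2) (r (n e.1)) = (1 - μ) * orient c (r e.1) (r e.2) := by
      rw [h3]; simp [orient, cr]; ring
    rw [this]
    nlinarith [he e h]
  have c2 : ∀ e ∈ polyEdges l, r₀ * x / (2 * M) ≤ orient (r e.2) (r (n e.2)) (r (n e.1)) := by
    intro e h
    obtain ⟨μ, h1, h2, h3⟩ := hlam _ (mem_of_mem_polyEdges h).1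
    obtain ⟨ν, k1, k2, k3⟩ := hlam _ (mem_of_mem_polyEdges h).2
    have : orient (r e.2) (r (n e.2)) (r (n e.1)) =
        (1 - ν) * μ * orient c (r e.1) (r e.2) := by
      rw [h3, k3]; simp [orient, cr]; ring
    rw [this]
    calc r₀ * x / (2 * M) = (1 - 1 / 2) * (r₀ / M) * x := by ring
      _ ≤ _ := by
        have hp : 0 < r₀ / M := by positivity
        have h5 : 0 ≤ 1 - ν := by linarith
        gcongr
        · exact mul_nonneg h5 (hp.le.trans h1)
        · exact he e h
  have c1' : ∀ e ∈ polyEdges l, 0 < orient (r e.1) (r e.2) (r (n e.1)) := fun e h =>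
    lt_of_lt_of_le (by positivity) (c1 e h)
  have c2' : ∀ e ∈ polyEdges l, 0 < orient (r e.2) (r (n e.2)) (r (n e.1)) := fun e h =>
    lt_of_lt_of_le (by positivity) (c2 e h)
  refine ⟨annulus_tiling hP hl F' F (by simpa using c1') (by simpa using c2')
    (by simpa using fun a b c h => (hfat (a, b, c) h).pos) ?_ ?_, ?_⟩
  · intro a ha b hb h
    have := hnn b hb
    rw [← h] at this
    linarith [hρ a ha]
  · intro a ha b hb h
    refine circle_injective hm0 hP.nodup hang hw a ha b hb ?_
    rw [hn a ha, hn b hb] at h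
    have hr' : (r₀ : ℂ) ≠ 0 := by exact_mod_cast hr.ne'
    exact mul_left_cancel₀ hr' (add_left_cancel h)
  · have hs0 : 0 ≤ r₀ * x / (8 * M ^ 3) := by positivity
    intro t ht
    rcases mem_annulus.mp ht with ⟨e, h, rfl | rfl⟩ | ⟨t', h, rfl⟩
    · have hm := mem_of_mem_polyEdges h
      refine Fat.of_norm_sub_le (c := c) (M := M) hs0 hM0 (hM _ hm.1) (hM _ hm.2)
        ((hnn _ hm.1).trans_le (by linarith)) (c1' e h) (le_trans ?_ (c1 e h))
        (le_trans ?_ (c1 e h))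
      · have : r₀ * x / (8 * M ^ 3) * (2 * M) ^ 2 = (r₀ / M) * (x / 2) := by field_simp; ring
        rw [this]
        exact mul_le_of_le_one_left (by positivity) (by rw [div_le_one hM0]; linarith)
      · have : r₀ * x / (4 * M ^ 2) * (2 * M) = (r₀ / M) * (x / 2) := by field_simp; ring
        rw [this]
        exact mul_le_of_le_one_left (by positivity) (by rw [div_le_one hM0]; linarith)
    · have hm := mem_of_mem_polyEdges h
      refine Fat.of_norm_sub_le (c := c) (M := M) hs0 hM0 (hM _ hm.2)
        ((hnn _ hm.2).trans_le (by linarith)) ((hnn _ hm.1).trans_le (by linarith)) (c2' e h)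
        (le_trans (le_of_eq ?_) (c2 e h)) (le_trans (le_of_eq ?_) (c2 e h))
      · field_simp; ring
      · field_simp; ring
    · have hsin : m / 4 ≤ sin (m / 2) := by
        have h1 := mul_le_sin (x := m / 2) (by positivity) (by linarith)
        refine le_trans ?_ h1
        have h4 : π ≤ 4 := pi_le_four
        rw [div_mul_div_comm, div_le_div_iff₀ (by norm_num) (by positivity)]
        nlinarith
      refine (hfat t' h).mono (le_trans ?_ hsin) (le_trans ?_
        (mul_le_mul_of_nonneg_left hsin (by positivity)))
      · have : r₀ * x / (8 * M ^ 3) = (r₀ / (2 * M)) * (m / 4) := by rw [hm]; field_simp; ring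
        rw [this]
        exact mul_le_of_le_one_left (by positivity) (by rw [div_le_one (by positivity)]; linarith)
      · rw [hm]; refine le_of_sub_nonneg ?_
        have : 2 * r₀ * (x / M ^ 2 / 4) - r₀ * x / (4 * M ^ 2) = r₀ * x / (4 * M ^ 2) := by
          field_simp; ring
        rw [this]; positivity

/-- The polygon `l'` lies outside of `l`: apart from the common edges it is made of paths whose
inner vertices are not on `l` and which have an end about which `l` does not wind. -/
structure Outside (r : ι → ℂ) (l l' : List ι) : Prop where
  ok : ∀ e ∈ polyEdges l, ∀ e' ∈ polyEdges l', SegOK r e.1 e.2 e'.1 e'.2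
  path : ∀ e ∈ polyEdges l', e ∈ polyEdges l ∨ (e.2, e.1) ∈ polyEdges l ∨
    ∃ a k z, k ≠ [] ∧ e ∈ pathEdges (a :: k ++ [z]) ∧
      (∀ e' ∈ pathEdges (a :: k ++ [z]), e' ∈ polyEdges l') ∧ (∀ i ∈ k, i ∉ l) ∧
      ∃ v, (v = a ∨ v = z) ∧ v ∉ l ∧ wind r (polyEdges l) (r v) = 0
  vertex : ∃ v ∈ l', v ∉ l ∧ wind r (polyEdges l) (r v) = 0

namespace Outside

variable {r : ι → ℂ} {l l' : List ι}

lemma notMem_trace (h : Outside r l l') (hP : SimplePoly r l') {v : ι} (hv : v ∈ l') (hvl : v ∉ l) :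
    r v ∉ trace r (polyEdges l) := by
  intro hx
  obtain ⟨e, he, hx⟩ := mem_trace.mp hx
  obtain ⟨e', he', rfl⟩ := exists_edge_fst hv
  have hm := mem_of_mem_polyEdges he
  have hm' := mem_of_mem_polyEdges he'
  rcases h.ok e he e' he' _ hx (left_mem_segment ℝ _ _) with k | k | ⟨i, hi, hi', k⟩
  · exact hvl (k.1 ▸ hm.1)
  · exact hvl (k.2 ▸ hm.2)
  · have hil : i ∈ l := by rcases hi with rfl | rfl; exacts [hm.1, hm.2]
    have hil' : i ∈ l' := by rcases hi' with rfl | rfl; exacts [hm'.1, hm'.2]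
    exact hvl (hP.inj _ hv _ hil' k ▸ hil)

lemma mem_path_trace {a z v : ι} {k : List ι} (hv : v = a ∨ v = z) :
    r v ∈ trace r (pathEdges (a :: k ++ [z])) := by
  rcases hv with rfl | rfl
  · cases k with
    | nil => exact mem_trace_left (b := z) (by simp [pathEdges])
    | cons b k => exact mem_trace_left (b := b) (by simp [pathEdges])
  · induction k generalizing a with
    | nil => exact mem_trace.mpr ⟨(a, v), by simp [pathEdges], right_mem_segment ℝ _ _⟩
    | cons b k ih =>
      have : pathEdges (a :: (b :: k) ++ [v]) = (a, b) :: pathEdges (b :: k ++ [v]) := rfl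
      rw [this, trace_cons]
      exact Or.inr ih

lemma disjoint_trace (h : Outside r l l') (hP : SimplePoly r l') :
    ∀ y ∈ inside r l, y ∉ trace r (polyEdges l') := by
  intro y hy hyt
  obtain ⟨e, he, hye⟩ := mem_trace.mp hyt
  rcases h.path e he with k | k | ⟨a, k, z, hk, hek, hsub, hkl, v, hv, hvl, hw⟩
  · exact hy.1 (mem_trace.mpr ⟨e, k, hye⟩)
  · exact hy.1 (mem_trace.mpr ⟨_, k, by rwa [segment_symm]⟩)
  · have hvt := mem_path_trace (r := r) (k := k) hv
    have hvl' : v ∈ l' := by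
      have hlast : ∃ e ∈ pathEdges (a :: k ++ [z]), v = e.1 ∨ v = e.2 := by
        clear hvt hek hsub hw hkl
        rcases hv with rfl | rfl
        · cases k with
          | nil => exact absurd rfl hk
          | cons b k => exact ⟨(v, b), by simp [pathEdges], Or.inl rfl⟩
        · clear hk
          induction k generalizing a with
          | nil => exact ⟨(a, v), by simp [pathEdges], Or.inr rfl⟩
          | cons b k ih =>
            obtain ⟨e, he, hv⟩ := ih b
            exact ⟨e, List.mem_cons_of_mem _ he, hv⟩
      obtain ⟨e', he', hve⟩ := hlast
      have := mem_of_mem_polyEdges (hsub e' he')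
      rcases hve with rfl | rfl
      exacts [this.1, this.2]
    refine hy.2 ?_
    rw [← hw]
    refine wind_const_path hk (fun e' he' x hx hxt => ?_) (mem_trace.mpr ⟨e, hek, hye⟩) hy.1
      hvt (h.notMem_trace hP hvl' hvl)
    obtain ⟨e₀, he₀, hx₀⟩ := mem_trace.mp hxt
    have hm := mem_of_mem_polyEdges he₀
    have hk' : e'.1 ∉ l ∨ e'.2 ∉ l := (mem_or_mem_of_pathEdges hk he').imp (hkl _) (hkl _)
    rcases h.ok e₀ he₀ e' (hsub e' he') x hx₀ hx with j | j | ⟨i, hi, hi', j⟩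
    · rw [← j.1, ← j.2] at hk'; tauto
    · rw [← j.1, ← j.2] at hk'; tauto
    · refine ⟨i, fun hik => hkl i hik ?_, hi', j⟩
      rcases hi with rfl | rfl
      exacts [hm.1, hm.2]

lemma disjoint_inside (h : Outside r l l') (h' : Outside r l' l) (hl : 3 ≤ l.length)
    (hP : SimplePoly r l) (hP' : SimplePoly r l') : ∀ y ∈ inside r l, y ∉ inside r l' := by
  obtain ⟨ts, σ, F⟩ := hP.exists_filling hl
  obtain ⟨v, hv, hvl, hw⟩ := h'.vertex
  obtain ⟨e, he, rfl⟩ := exists_edge_fst hv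
  exact inside_disjoint F (h.disjoint_trace hP') (mem_trace_left (b := e.2) he)
    (h'.notMem_trace hP hv hvl) hw

end Outside

open Classical in
lemma Wt.eq_of_pair {r : ι → ℂ} {a b : ι} (hab : r a ≠ r b) {w w' : ι → ℝ}
    (hw : Wt {a, b} w) (hw' : Wt {a, b} w') (h : pt r {a, b} w = pt r {a, b} w') : w = w' := by
  have hne : a ≠ b := fun k => hab (k ▸ rfl)
  have hz : ∀ {w : ι → ℝ}, Wt {a, b} w → ∀ i, i ≠ a → i ≠ b → w i = 0 := fun hw i h1 h2 =>
    hw.supp i (by simp [h1, h2])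
  have s := hw.sum
  have s' := hw'.sum
  simp only [pt, Finset.sum_pair hne] at h s s'
  have hk : ((w a - w' a : ℝ) : ℂ) * (r a - r b) = 0 := by
    have e1 : w b = 1 - w a := by linarith
    have e2 : w' b = 1 - w' a := by linarith
    rw [e1, e2] at h
    simp only [Complex.real_smul] at h
    push_cast at h ⊢
    linear_combination h
  have ha : w a = w' a := by
    rcases mul_eq_zero.mp hk with k | k
    · have : w a - w' a = 0 := by exact_mod_cast k
      linarith
    · exact absurd (sub_eq_zero.mp k) hab
  funext i
  by_cases h1 : i = a
  · rw [h1, ha]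
  by_cases h2 : i = b
  · rw [h2]; linarith
  · rw [hz hw i h1 h2, hz hw' i h1 h2]

open Classical in
/-- Barycentric coordinates agree on the intersection of two tilings apart from each other. -/
lemma Tiling.wt_unique_of_outside {r : ι → ℂ} {l l' : List ι} {ts ts' : List (ι × ι × ι)}
    {σ σ' : ℝ} (h : Tiling r l ts σ) (h' : Tiling r l' ts' σ') (hO : Outside r l l')
    (hO' : Outside r l' l) {t t' : ι × ι × ι} (ht : t ∈ ts) (ht' : t' ∈ ts') {w w' : ι → ℝ}
    (hw : Wt (verts t) w) (hw' : Wt (verts t') w')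
    (he : pt r (verts t) w = pt r (verts t') w') : w = w' := by
  have hy := pt_mem_closedTri (h.pos t ht) hw
  have hy' := pt_mem_closedTri (h'.pos t' ht') hw'
  have h1 : pt r (verts t) w ∈ trace r (polyEdges l) := by
    by_contra hc
    have hi := h.mem_inside ht hy hc
    refine hO.disjoint_inside hO' h.len h.poly h'.poly _ hi ?_
    rw [he]
    exact h'.mem_inside ht' hy' (he ▸ hO.disjoint_trace h'.poly _ hi)
  have h2 : pt r (verts t') w' ∈ trace r (polyEdges l') := by
    by_contra hc
    exact hO'.disjoint_trace h.poly _ (h'.mem_inside ht' hy' hc) (he ▸ h1)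
  obtain ⟨e, hel, hye⟩ := mem_trace.mp h1
  obtain ⟨e', hel', hye'⟩ := mem_trace.mp h2
  have hz := h.wt_edge ht hw hel hye
  have hz' := h'.wt_edge ht' hw' hel' hye'
  have hpair : ∀ {a b : ι} {t : ι × ι × ι} {w : ι → ℝ}, Wt (verts t) w →
      (∀ i, i ≠ a → i ≠ b → w i = 0) → Wt {a, b} w ∧ pt r {a, b} w = pt r (verts t) w := by
    intro a b t w hw hz
    have : ∀ i ∉ ({a, b} : Finset ι), w i = 0 := fun i hi => by
      simp only [Finset.mem_insert, Finset.mem_singleton, not_or] at hi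
      exact hz i hi.1 hi.2
    exact ⟨hw.of_zero this, hw.pt_of_zero this r⟩
  have hvertex : ∀ {i a b : ι}, r a ≠ r b → (i = a ∨ i = b) → ∀ {t : ι × ι × ι} {w : ι → ℝ},
      Wt (verts t) w → (∀ i, i ≠ a → i ≠ b → w i = 0) → pt r (verts t) w = r i →
      w = Pi.single i 1 := by
    intro i a b hab hi t w hw hz hy
    obtain ⟨k1, k2⟩ := hpair hw hz
    have hs : Wt {a, b} (Pi.single i (1 : ℝ)) := by
      refine ⟨fun j => ?_, fun j hj => ?_, ?_⟩
      · by_cases hji : j = i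
        · simp [hji]
        · simp [hji]
      · have : j ≠ i := by rintro rfl; simp at hj; tauto
        simp [this]
      · simp [Pi.single_apply, hi]
    refine Wt.eq_of_pair hab k1 hs ?_
    rw [k2, hy]
    simp [pt, Pi.single_apply, hi]
  obtain ⟨T, hT, heT⟩ := h.exists_triEdge hel
  obtain ⟨T', hT', heT'⟩ := h'.exists_triEdge hel'
  have hne := h.edge_ne hT heT
  have hne' := h'.edge_ne hT' heT'
  rcases hO.ok e hel e' hel' _ hye (he ▸ hye') with k | k | ⟨i, hi, hi', k⟩
  · rw [← k.1, ← k.2] at hz'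
    obtain ⟨a1, a2⟩ := hpair hw hz
    obtain ⟨b1, b2⟩ := hpair hw' hz'
    exact Wt.eq_of_pair hne a1 b1 (by rw [a2, b2, he])
  · rw [← k.1, ← k.2] at hz'
    obtain ⟨a1, a2⟩ := hpair hw hz
    obtain ⟨b1, b2⟩ := hpair hw' fun i h1 h2 => hz' i h2 h1
    exact Wt.eq_of_pair hne a1 b1 (by rw [a2, b2, he])
  · rw [hvertex hne hi hw hz k, hvertex hne' hi' hw' hz' (he ▸ k)]

section Sep

variable {V : Type*} [NormedAddCommGroup V] [NormedSpace ℝ V]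

/-- Faces of the family without common vertex are at distance at least `d`. -/
def FacesApart (𝒯 : Finset (Finset V)) (d : ℝ) : Prop :=
  ∀ S ∈ 𝒯, ∀ T ∈ 𝒯, ∀ x y : V → ℝ, Wt S x → Wt T y → (∀ v, x v = 0 ∨ y v = 0) →
    d ≤ ‖pt id S x - pt id T y‖

/-- The distance of two points controls the difference of their barycentric coordinates. -/
lemma FacesApart.bound {𝒯 : Finset (Finset V)} {d : ℝ} (h : FacesApart 𝒯 d) (hd : 0 ≤ d)
    {T T' : Finset V} (hT : T ∈ 𝒯) (hT' : T' ∈ 𝒯) {x y : V → ℝ}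
    (hx : Wt T x) (hy : Wt T' y) (S : Finset V) :
    (∑ v ∈ S, x v - ∑ v ∈ S, y v) * d ≤ ‖pt id T x - pt id T' y‖ := by
  classical
  set U := T ∪ T' with hU
  have hxU := hx.mono (s' := U) Finset.subset_union_left
  have hyU := hy.mono (s' := U) Finset.subset_union_right
  rw [← hx.pt_mono (s' := U) Finset.subset_union_left, ← hy.pt_mono (s' := U)
    Finset.subset_union_right]
  set m := ∑ v ∈ U, max (x v - y v) 0 with hm
  have hm' : ∑ v ∈ U, max (y v - x v) 0 = m := by
    have h1 : ∀ v, max (y v - x v) 0 = max (x v - y v) 0 - (x v - y v) := by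
      intro v
      rcases le_total (x v) (y v) with k | k
      · rw [max_eq_left (by linarith), max_eq_right (by linarith)]; ring
      · rw [max_eq_right (by linarith), max_eq_left (by linarith)]; ring
    simp only [h1, Finset.sum_sub_distrib, hxU.sum, hyU.sum]
    ring
  have hSm : ∑ v ∈ S, x v - ∑ v ∈ S, y v ≤ m := by
    rw [← Finset.sum_sub_distrib, ← Finset.sum_inter_add_sum_sdiff S U]
    have h1 : ∑ v ∈ S \ U, (x v - y v) = 0 := Finset.sum_eq_zero fun v hv => by
      have := (Finset.mem_sdiff.mp hv).2
      rw [hxU.supp v this, hyU.supp v this, sub_zero]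
    rw [h1, add_zero]
    calc ∑ v ∈ S ∩ U, (x v - y v) ≤ ∑ v ∈ S ∩ U, max (x v - y v) 0 :=
          Finset.sum_le_sum fun v _ => le_max_left _ _
      _ ≤ _ := Finset.sum_le_sum_of_subset_of_nonneg Finset.inter_subset_right
          fun v _ _ => le_max_right _ _
  refine (mul_le_mul_of_nonneg_right hSm hd).trans ?_
  have hm0 : 0 ≤ m := Finset.sum_nonneg fun v _ => le_max_right _ _
  rcases hm0.eq_or_lt with h0 | hpos
  · rw [← h0, zero_mul]; exact norm_nonneg _
  have w1 : Wt T fun v => max (x v - y v) 0 / m := by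
    have : Wt U fun v => max (x v - y v) 0 / m :=
      ⟨fun v => div_nonneg (le_max_right _ _) hm0, fun v hv => by
        simp [hxU.supp v hv, hyU.supp v hv], by
        rw [← Finset.sum_div, div_self hpos.ne']⟩
    refine this.of_zero fun v hv => ?_
    rw [hx.supp v hv, max_eq_right (by linarith [hy.nonneg v]), zero_div]
  have w2 : Wt T' fun v => max (y v - x v) 0 / m := by
    have : Wt U fun v => max (y v - x v) 0 / m :=
      ⟨fun v => div_nonneg (le_max_right _ _) hm0, fun v hv => by
        simp [hxU.supp v hv, hyU.supp v hv], by
        rw [← Finset.sum_div, hm', div_self hpos.ne']⟩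
    refine this.of_zero fun v hv => ?_
    rw [hy.supp v hv, max_eq_right (by linarith [hx.nonneg v]), zero_div]
  have key := h T hT T' hT' _ _ w1 w2 fun v => by
    rcases le_total (x v) (y v) with k | k
    · left; rw [max_eq_right (by linarith), zero_div]
    · right; rw [max_eq_right (by linarith), zero_div]
  rw [← w1.pt_mono (s' := U) Finset.subset_union_left, ← w2.pt_mono (s' := U)
    Finset.subset_union_right] at key
  have he : pt id U x - pt id U y = m • (pt id U (fun v => max (x v - y v) 0 / m) -
      pt id U (fun v => max (y v - x v) 0 / m)) := by
    simp only [pt, ← Finset.sum_sub_distrib, Finset.smul_sum, ← sub_smul, smul_smul]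
    refine Finset.sum_congr rfl fun v _ => ?_
    congr 1
    rw [← sub_div, mul_div_cancel₀ _ hpos.ne']
    rcases le_total (x v) (y v) with k | k
    · rw [max_eq_right (by linarith), max_eq_left (by linarith)]; ring
    · rw [max_eq_left (by linarith), max_eq_right (by linarith)]; ring
  rw [he, norm_smul, Real.norm_of_nonneg hm0]
  exact mul_le_mul_of_nonneg_left key hm0

/-- The midpoint. -/
def mid (a b : V) : V := (2⁻¹ : ℝ) • (a + b)

lemma mid_comm (a b : V) : mid a b = mid b a := by rw [mid, mid, add_comm]

/-- The midpoint of the side opposite to `v`, for a set of three points. -/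
def opp (T : Finset V) (v : V) : V := (2⁻¹ : ℝ) • (∑ u ∈ T, u - v)

lemma mid_injective (a : V) : Function.Injective (mid a) := by
  intro x y h
  exact add_left_cancel (smul_right_injective V (by norm_num : (2⁻¹ : ℝ) ≠ 0) h)

lemma opp_injective (T : Finset V) : Function.Injective (opp T) := by
  intro x y h
  exact sub_right_injective (smul_right_injective V (by norm_num : (2⁻¹ : ℝ) ≠ 0) h)

open Classical in
/-- The four triangles into which a triangle is cut by the midpoints of its sides. -/
def children (T : Finset V) : Finset (Finset V) :=
  insert (T.image (opp T)) (T.image fun a => T.image (mid a))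

open Classical in
lemma mem_children {T t : Finset V} : t ∈ children T ↔
    t = T.image (opp T) ∨ ∃ a ∈ T, t = T.image (mid a) := by
  simp [children, eq_comm]

open Classical in
/-- Weights on an image pull back to weights. -/
lemma Wt.comp_image {T : Finset V} {f : V → V} (hf : Function.Injective f) {w : V → ℝ}
    (h : Wt (T.image f) w) : Wt T (w ∘ f) ∧ pt id (T.image f) w = ∑ v ∈ T, w (f v) • f v := by
  refine ⟨⟨fun v => h.nonneg _, fun v hv => h.supp _ ?_, ?_⟩, ?_⟩
  · intro k
    obtain ⟨u, hu, hk⟩ := Finset.mem_image.mp k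
    exact hv (hf hk ▸ hu)
  · have := h.sum
    rwa [Finset.sum_image fun x _ y _ k => hf k] at this
  · rw [pt, Finset.sum_image fun x _ y _ k => hf k]; rfl

open Classical in
/-- Weights pull forward to an image. -/
lemma Wt.exists_image {T : Finset V} {f : V → V} (hf : Function.Injective f) {w : V → ℝ}
    (h : Wt T w) : ∃ w', Wt (T.image f) w' ∧ pt id (T.image f) w' = ∑ v ∈ T, w v • f v := by
  have hw : ∀ v, Function.extend f w 0 (f v) = w v := fun v => hf.extend_apply _ _ _
  refine ⟨Function.extend f w 0, ⟨fun v => ?_, fun v hv => ?_, ?_⟩, ?_⟩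
  · by_cases k : ∃ u, f u = v
    · obtain ⟨u, rfl⟩ := k
      rw [hw]; exact h.nonneg u
    · rw [Function.extend_apply' _ _ _ k]; exact le_rfl
  · by_cases k : ∃ u, f u = v
    · obtain ⟨u, rfl⟩ := k
      rw [hw]
      exact h.supp u fun hu => hv (Finset.mem_image_of_mem _ hu)
    · rw [Function.extend_apply' _ _ _ k]; rfl
  · rw [Finset.sum_image fun x _ y _ k => hf k]
    simp only [hw]; exact h.sum
  · rw [pt, Finset.sum_image fun x _ y _ k => hf k]
    simp only [hw, id]

open Classical in
lemma Wt.corner {T : Finset V} {a : V} (ha : a ∈ T) {w : V → ℝ} (h : Wt (T.image (mid a)) w) :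
    ∃ x, Wt T x ∧ pt id T x = pt id (T.image (mid a)) w ∧
      ∀ v, x v = (if v = a then 2⁻¹ else 0) + 2⁻¹ * w (mid a v) := by
  obtain ⟨h1, h2⟩ := h.comp_image (mid_injective a)
  have hs := h1.sum
  simp only [Function.comp] at hs
  refine ⟨_, ⟨fun v => ?_, fun v hv => ?_, ?_⟩, ?_, fun v => rfl⟩
  · have := h.nonneg (mid a v)
    show 0 ≤ _
    split_ifs <;> positivity
  · have h0 : w (mid a v) = 0 := h1.supp v hv
    have : v ≠ a := by rintro rfl; exact hv ha
    simp [this, h0]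
  · rw [Finset.sum_add_distrib, ← Finset.mul_sum, hs, Finset.sum_ite_eq' T a]
    simp [ha]; norm_num
  · have hs' : (2⁻¹ : ℝ) • a = ∑ v ∈ T, (2⁻¹ : ℝ) • w (mid a v) • a := by
      rw [← Finset.smul_sum, ← Finset.sum_smul, hs, one_smul]
    have h3 : ∑ v ∈ T, w (mid a v) • mid a v = (2⁻¹ : ℝ) • a +
        ∑ v ∈ T, (2⁻¹ * w (mid a v)) • v := by
      rw [hs', ← Finset.sum_add_distrib]
      refine Finset.sum_congr rfl fun v _ => ?_
      rw [mid]; module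
    rw [h2, h3, pt]
    simp only [add_smul, Finset.sum_add_distrib, ite_smul, zero_smul, id,
      Finset.sum_ite_eq' T a, ha, if_true]

open Classical in
lemma Wt.middle {T : Finset V} (hT : T.card = 3) {w : V → ℝ} (h : Wt (T.image (opp T)) w) :
    ∃ x, Wt T x ∧ pt id T x = pt id (T.image (opp T)) w ∧
      ∀ v, x v = if v ∈ T then 2⁻¹ - 2⁻¹ * w (opp T v) else 0 := by
  obtain ⟨h1, h2⟩ := h.comp_image (opp_injective T)
  have hs := h1.sum
  simp only [Function.comp] at hs
  refine ⟨_, ⟨fun v => ?_, fun v hv => if_neg hv, ?_⟩, ?_, fun v => rfl⟩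
  · show 0 ≤ _
    split_ifs with hv
    · have : w (opp T v) ≤ 1 := by
        rw [← hs]
        exact Finset.single_le_sum (f := fun v => w (opp T v)) (fun u _ => h.nonneg _) hv
      linarith
    · exact le_rfl
  · rw [Finset.sum_congr rfl fun v hv => if_pos hv, Finset.sum_sub_distrib, ← Finset.mul_sum, hs]
    simp [hT]; norm_num
  · rw [h2, pt, Finset.sum_congr rfl fun v hv => by rw [if_pos hv]]
    have hs' : ∑ v ∈ T, w (opp T v) • (∑ u ∈ T, u) = ∑ u ∈ T, u := by
      rw [← Finset.sum_smul, hs, one_smul]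
    have h3 : ∑ v ∈ T, w (opp T v) • opp T v = (2⁻¹ : ℝ) • ∑ v ∈ T, w (opp T v) • (∑ u ∈ T, u) -
        ∑ v ∈ T, (2⁻¹ * w (opp T v)) • v := by
      rw [Finset.smul_sum, ← Finset.sum_sub_distrib]
      refine Finset.sum_congr rfl fun v _ => ?_
      rw [opp]; module
    rw [h3, hs', Finset.smul_sum, ← Finset.sum_sub_distrib]
    refine Finset.sum_congr rfl fun v _ => ?_
    rw [id]; module

end Sep

section Refine

variable {V : Type*} [NormedAddCommGroup V] [NormedSpace ℝ V]

open Classical in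
lemma opp_eq {T : Finset V} {v : V} (hv : v ∈ T) : opp T v = (2⁻¹ : ℝ) • ∑ u ∈ T.erase v, u := by
  rw [opp, ← Finset.add_sum_erase T (fun u => u) hv, add_sub_cancel_left]

open Classical in
lemma half_corner_corner {T T' : Finset V} {a a' : V} {w w' x y : V → ℝ}
    (hw : Wt (T.image (mid a)) w) (hw' : Wt (T'.image (mid a')) w')
    (hx : ∀ v, x v = (if v = a then 2⁻¹ else 0) + 2⁻¹ * w (mid a v))
    (hy : ∀ v, y v = (if v = a' then 2⁻¹ else 0) + 2⁻¹ * w' (mid a' v))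
    (h0 : ∀ v, w v = 0 ∨ w' v = 0) :
    ∃ S : Finset V, 2⁻¹ ≤ ∑ v ∈ S, x v - ∑ v ∈ S, y v ∨ 2⁻¹ ≤ ∑ v ∈ S, y v - ∑ v ∈ S, x v := by
  by_cases h : a = a'
  · subst h
    have hs := (hw.comp_image (mid_injective a)).1.sum
    simp only [Function.comp] at hs
    refine ⟨T.filter fun v => w' (mid a v) = 0, Or.inl ?_⟩
    rw [← Finset.sum_sub_distrib, Finset.sum_filter]
    calc (2⁻¹ : ℝ) ≤ 2⁻¹ * ∑ v ∈ T, w (mid a v) := by rw [hs, mul_one]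
      _ = ∑ v ∈ T, 2⁻¹ * w (mid a v) := Finset.mul_sum ..
      _ ≤ _ := Finset.sum_le_sum fun v _ => by
        rw [hx, hy]
        split_ifs with k k1
        all_goals first
          | (rw [k]; linarith)
          | (rw [(h0 _).resolve_right k]; linarith)
  · rcases h0 (mid a a') with k | k
    · refine ⟨{a'}, Or.inr ?_⟩
      rw [Finset.sum_singleton, Finset.sum_singleton, hx, hy, if_pos rfl, if_neg (Ne.symm h), k]
      linarith [hw'.nonneg (mid a' a')]
    · refine ⟨{a}, Or.inl ?_⟩
      rw [Finset.sum_singleton, Finset.sum_singleton, hx, hy, if_pos rfl, if_neg h,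
        mid_comm a' a, k]
      linarith [hw.nonneg (mid a a)]

open Classical in
lemma half_corner_middle {T T' : Finset V} (hT' : T'.card = 3) {a : V}
    {w w' x y : V → ℝ} (hw : Wt (T.image (mid a)) w) (hyw : Wt T' y)
    (hx : ∀ v, x v = (if v = a then 2⁻¹ else 0) + 2⁻¹ * w (mid a v))
    (hy : ∀ v, y v = if v ∈ T' then 2⁻¹ - 2⁻¹ * w' (opp T' v) else 0)
    (hw' : Wt (T'.image (opp T')) w') (h0 : ∀ v, w v = 0 ∨ w' v = 0) :
    ∃ S : Finset V, 2⁻¹ ≤ ∑ v ∈ S, x v - ∑ v ∈ S, y v ∨ 2⁻¹ ≤ ∑ v ∈ S, y v - ∑ v ∈ S, x v := by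
  have hxa : 2⁻¹ ≤ x a := by
    rw [hx, if_pos rfl]; linarith [hw.nonneg (mid a a)]
  by_cases haT : a ∈ T'
  swap
  · refine ⟨{a}, Or.inl ?_⟩
    rw [Finset.sum_singleton, Finset.sum_singleton, hy, if_neg haT]
    linarith
  obtain ⟨b, c, hbc, hab⟩ := Finset.card_eq_two.mp
    (show (T'.erase a).card = 2 by rw [Finset.card_erase_of_mem haT, hT'])
  have hbm : b ∈ T'.erase a := by rw [hab]; simp
  have hcm : c ∈ T'.erase a := by rw [hab]; simp
  obtain ⟨hba, hb⟩ := Finset.mem_erase.mp hbm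
  obtain ⟨hca, hc⟩ := Finset.mem_erase.mp hcm
  have hsum : ∀ f : V → V, ∑ u ∈ T', f u = f a + (f b + f c) := fun f => by
    rw [← Finset.add_sum_erase T' f haT, hab, Finset.sum_pair hbc]
  have hsum' : ∀ f : V → ℝ, ∑ u ∈ T', f u = f a + (f b + f c) := fun f => by
    rw [← Finset.add_sum_erase T' f haT, hab, Finset.sum_pair hbc]
  have eb : opp T' b = mid a c := by rw [opp, hsum, mid]; module
  have ec : opp T' c = mid a b := by rw [opp, hsum, mid]; module
  have hys := hyw.sum
  rw [hsum'] at hys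
  have hya : y a ≤ 2⁻¹ := by
    rw [hy, if_pos haT]; linarith [hw'.nonneg (opp T' a)]
  have hyb : y b = 2⁻¹ - 2⁻¹ * w' (mid a c) := by rw [hy, if_pos hb, eb]
  have hyc : y c = 2⁻¹ - 2⁻¹ * w' (mid a b) := by rw [hy, if_pos hc, ec]
  have hxb : x b = 2⁻¹ * w (mid a b) := by rw [hx, if_neg hba, zero_add]
  have hxc : x c = 2⁻¹ * w (mid a c) := by rw [hx, if_neg hca, zero_add]
  by_cases kb : w (mid a b) = 0 <;> by_cases kc : w (mid a c) = 0
  · refine ⟨{b, c}, Or.inr ?_⟩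
    rw [Finset.sum_pair hbc, Finset.sum_pair hbc, hxb, hxc, kb, kc]
    linarith
  · refine ⟨{b}, Or.inr ?_⟩
    rw [Finset.sum_singleton, Finset.sum_singleton, hxb, kb, hyb, (h0 _).resolve_left kc]
    linarith
  · refine ⟨{c}, Or.inr ?_⟩
    rw [Finset.sum_singleton, Finset.sum_singleton, hxc, kc, hyc, (h0 _).resolve_left kb]
    linarith
  · refine ⟨{a}, Or.inl ?_⟩
    rw [(h0 _).resolve_left kc] at hyb
    rw [(h0 _).resolve_left kb] at hyc
    rw [Finset.sum_singleton, Finset.sum_singleton]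
    linarith

open Classical in
lemma half_middle_middle {T T' : Finset V} (hT : T.card = 3) (hT' : T'.card = 3)
    {w w' x y : V → ℝ} (hw : Wt (T.image (opp T)) w) (hw' : Wt (T'.image (opp T')) w')
    (hx : ∀ v, x v = if v ∈ T then 2⁻¹ - 2⁻¹ * w (opp T v) else 0)
    (hy : ∀ v, y v = if v ∈ T' then 2⁻¹ - 2⁻¹ * w' (opp T' v) else 0)
    (h0 : ∀ v, w v = 0 ∨ w' v = 0) :
    ∃ S : Finset V, 2⁻¹ ≤ ∑ v ∈ S, x v - ∑ v ∈ S, y v ∨ 2⁻¹ ≤ ∑ v ∈ S, y v - ∑ v ∈ S, x v := by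
  by_cases h : T = T'
  · subst h
    have hs := (hw'.comp_image (opp_injective T)).1.sum
    simp only [Function.comp] at hs
    refine ⟨T.filter fun v => w (opp T v) = 0, Or.inl ?_⟩
    rw [← Finset.sum_sub_distrib, Finset.sum_filter]
    calc (2⁻¹ : ℝ) ≤ 2⁻¹ * ∑ v ∈ T, w' (opp T v) := by rw [hs, mul_one]
      _ = ∑ v ∈ T, 2⁻¹ * w' (opp T v) := Finset.mul_sum ..
      _ ≤ _ := Finset.sum_le_sum fun v hv => by
        rw [hx, hy, if_pos hv, if_pos hv]
        split_ifs with k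
        · rw [k]; linarith
        · rw [(h0 _).resolve_left k]; linarith
  have hs := (hw.comp_image (opp_injective T)).1.sum
  simp only [Function.comp] at hs
  obtain ⟨c, hcT, hcT'⟩ : ∃ c ∈ T, c ∉ T' := by
    by_contra! k
    exact h (Finset.eq_of_subset_of_card_le k (by rw [hT, hT']))
  have hyc : y c = 0 := by rw [hy, if_neg hcT']
  have hxc : x c = 2⁻¹ - 2⁻¹ * w (opp T c) := by rw [hx, if_pos hcT]
  by_cases kc : w (opp T c) = 0
  · refine ⟨{c}, Or.inl ?_⟩
    rw [Finset.sum_singleton, Finset.sum_singleton, hyc, hxc, kc]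
    linarith
  by_cases hb : ∃ b ∈ T, b ∉ T' ∧ b ≠ c
  · obtain ⟨b, hbT, hbT', hbc⟩ := hb
    refine ⟨{b, c}, Or.inl ?_⟩
    have hle : w (opp T b) + w (opp T c) ≤ 1 := by
      rw [← hs, ← Finset.sum_pair (f := fun v => w (opp T v)) hbc]
      exact Finset.sum_le_sum_of_subset_of_nonneg (by simp [Finset.insert_subset_iff, hbT, hcT])
        fun u _ _ => hw.nonneg _
    rw [Finset.sum_pair hbc, Finset.sum_pair hbc, hyc, hxc, hx b, hy b, if_pos hbT, if_neg hbT']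
    linarith
  push Not at hb
  obtain ⟨c', hcT1, hcT2⟩ : ∃ c ∈ T', c ∉ T := by
    by_contra! k
    exact h (Finset.eq_of_subset_of_card_le k (by rw [hT, hT'])).symm
  have hE : T.erase c = T'.erase c' := by
    refine Finset.eq_of_subset_of_card_le (fun u hu => ?_) ?_
    · obtain ⟨hu1, hu2⟩ := Finset.mem_erase.mp hu
      refine Finset.mem_erase.mpr ⟨fun k => hcT2 (k ▸ hu2), ?_⟩
      by_contra k
      exact hu1 (hb u hu2 k)
    · rw [Finset.card_erase_of_mem hcT, Finset.card_erase_of_mem hcT1, hT, hT']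
  have he : opp T' c' = opp T c := by rw [opp_eq hcT, opp_eq hcT1, hE]
  refine ⟨{c'}, Or.inr ?_⟩
  rw [Finset.sum_singleton, Finset.sum_singleton, hx, hy, if_neg hcT2, if_pos hcT1, he,
    (h0 _).resolve_left kc]
  linarith

open Classical in
lemma FacesApart.children {𝒯 : Finset (Finset V)} {d : ℝ} (h : FacesApart 𝒯 d) (hd : 0 ≤ d)
    (h3 : ∀ T ∈ 𝒯, T.card = 3) : FacesApart (𝒯.biUnion children) (d / 2) := by
  intro t ht t' ht' w w' hw hw' h0
  obtain ⟨T, hT, htT⟩ := Finset.mem_biUnion.mp ht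
  obtain ⟨T', hT', htT'⟩ := Finset.mem_biUnion.mp ht'
  have fin : ∀ x y, Wt T x → Wt T' y → pt id T x = pt id t w → pt id T' y = pt id t' w' →
      (∃ S : Finset V, 2⁻¹ ≤ ∑ v ∈ S, x v - ∑ v ∈ S, y v ∨
        2⁻¹ ≤ ∑ v ∈ S, y v - ∑ v ∈ S, x v) → d / 2 ≤ ‖pt id t w - pt id t' w'‖ := by
    rintro x y hx hy ex ey ⟨S, hS | hS⟩
    · have := h.bound hd hT hT' hx hy S
      rw [ex, ey] at this
      nlinarith
    · have := h.bound hd hT' hT hy hx S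
      rw [ex, ey, norm_sub_rev] at this
      nlinarith
  rcases mem_children.mp htT with rfl | ⟨a, ha, rfl⟩ <;>
    rcases mem_children.mp htT' with rfl | ⟨a', ha', rfl⟩
  · obtain ⟨x, hx, ex, fx⟩ := hw.middle (h3 T hT)
    obtain ⟨y, hy, ey, fy⟩ := hw'.middle (h3 T' hT')
    exact fin x y hx hy ex ey (half_middle_middle (h3 T hT) (h3 T' hT') hw hw' fx fy h0)
  · obtain ⟨x, hx, ex, fx⟩ := hw.middle (h3 T hT)
    obtain ⟨y, hy, ey, fy⟩ := hw'.corner ha'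
    refine fin x y hx hy ex ey ?_
    obtain ⟨S, hS⟩ := half_corner_middle (h3 T hT) hw' hx fy fx hw fun v => (h0 v).symm
    exact ⟨S, hS.symm⟩
  · obtain ⟨x, hx, ex, fx⟩ := hw.corner ha
    obtain ⟨y, hy, ey, fy⟩ := hw'.middle (h3 T' hT')
    exact fin x y hx hy ex ey (half_corner_middle (h3 T' hT') hw hy fx fy hw' h0)
  · obtain ⟨x, hx, ex, fx⟩ := hw.corner ha
    obtain ⟨y, hy, ey, fy⟩ := hw'.corner ha'
    exact fin x y hx hy ex ey (half_corner_corner hw hw' fx fy h0)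

end Refine

/-- The isometry of the Euclidean plane with the complex plane. -/
def toC : E2 ≃ₗᵢ[ℝ] ℂ := Complex.orthonormalBasisOneI.repr.symm

lemma cr_smul_smul (s t : ℝ) (u v : ℂ) : cr (s • u) (t • v) = s * t * cr u v := by
  simp [cr]; ring

/-- A family of nondegenerate triangles covering `Ω` and meeting along common faces, with bounds on
the size, the separation and the area. -/
structure Mesh (Ω : Set E2) (𝒯 : Finset (Finset E2)) (ℓ d δ : ℝ) : Prop where
  card : ∀ T ∈ 𝒯, T.card = 3
  cover : ∀ x, x ∈ Ω ↔ ∃ T ∈ 𝒯, ∃ w, Wt T w ∧ pt id T w = x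
  diam : ∀ T ∈ 𝒯, ∀ a ∈ T, ∀ b ∈ T, ‖a - b‖ ≤ ℓ
  sep : FacesApart 𝒯 d
  fat : ∀ T ∈ 𝒯, ∀ a ∈ T, ∀ b ∈ T, ∀ c ∈ T, a ≠ b → b ≠ c → a ≠ c →
    δ ≤ |orient (toC a) (toC b) (toC c)|

lemma Mesh.mono {Ω : Set E2} {𝒯 : Finset (Finset E2)} {ℓ d δ ℓ' d' δ' : ℝ}
    (h : Mesh Ω 𝒯 ℓ d δ) (hℓ : ℓ ≤ ℓ') (hd : d' ≤ d) (hδ : δ' ≤ δ) : Mesh Ω 𝒯 ℓ' d' δ' :=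
  ⟨h.card, h.cover, fun T hT a ha b hb => (h.diam T hT a ha b hb).trans hℓ,
    fun T hT T' hT' x y hx hy h0 => hd.trans (h.sep T hT T' hT' x y hx hy h0),
    fun T hT a ha b hb c hc h1 h2 h3 => hδ.trans (h.fat T hT a ha b hb c hc h1 h2 h3)⟩

open Classical in
lemma exists_affine_of_mem_children {V : Type*} [NormedAddCommGroup V] [NormedSpace ℝ V]
    {T t : Finset V} (h : t ∈ children T) : ∃ f : V → V, Function.Injective f ∧ t = T.image f ∧
      ∃ s : ℝ, |s| = 2⁻¹ ∧ ∀ u v, f u - f v = s • (u - v) := by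
  rcases mem_children.mp h with rfl | ⟨a, -, rfl⟩
  · exact ⟨_, opp_injective T, rfl, -2⁻¹, by norm_num, fun u v => by simp only [opp]; module⟩
  · exact ⟨_, mid_injective a, rfl, 2⁻¹, by norm_num, fun u v => by simp only [mid]; module⟩

lemma card_of_mem_children {V : Type*} [NormedAddCommGroup V] [NormedSpace ℝ V]
    {T t : Finset V} (h : t ∈ children T) : t.card = T.card := by
  classical
  obtain ⟨f, hf, rfl, -⟩ := exists_affine_of_mem_children h
  convert Finset.card_image_of_injective T hf

open Classical in
lemma exists_wt_children {V : Type*} [NormedAddCommGroup V] [NormedSpace ℝ V] {T : Finset V}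
    (hT : T.card = 3) {x : V → ℝ} (hx : Wt T x) :
    ∃ t ∈ children T, ∃ w, Wt t w ∧ pt id t w = pt id T x := by
  by_cases h : ∃ a ∈ T, 2⁻¹ ≤ x a
  · obtain ⟨a, ha, hxa⟩ := h
    refine ⟨_, mem_children.mpr (Or.inr ⟨a, ha, rfl⟩), ?_⟩
    have hw : Wt T fun v => 2 * x v - if v = a then 1 else 0 := by
      refine ⟨fun v => ?_, fun v hv => ?_, ?_⟩
      · have := hx.nonneg v
        split_ifs with k
        · rw [k]; linarith
        · linarith
      · rw [hx.supp v hv, if_neg (by rintro rfl; exact hv ha)]; simp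
      · rw [Finset.sum_sub_distrib, ← Finset.mul_sum, hx.sum, Finset.sum_ite_eq' T a]
        simp [ha]; norm_num
    obtain ⟨w, hw, he⟩ := hw.exists_image (mid_injective a)
    refine ⟨w, hw, ?_⟩
    have h1 : a = ∑ v ∈ T, x v • a := by rw [← Finset.sum_smul, hx.sum, one_smul]
    have h2 : ∑ v ∈ T, (if v = a then (1 : ℝ) else 0) • mid a v = a := by
      simp only [ite_smul, one_smul, zero_smul, Finset.sum_ite_eq' T a, ha, if_true, mid]
      module
    rw [he, pt]
    simp only [sub_smul, Finset.sum_sub_distrib, h2, id]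
    rw [sub_eq_iff_eq_add']
    conv_rhs => rw [h1]
    rw [← Finset.sum_add_distrib]
    refine Finset.sum_congr rfl fun v _ => ?_
    rw [mid]; module
  · push Not at h
    refine ⟨_, mem_children.mpr (Or.inl rfl), ?_⟩
    have hw : Wt T fun v => if v ∈ T then 1 - 2 * x v else 0 := by
      refine ⟨fun v => ?_, fun v hv => if_neg hv, ?_⟩
      · split_ifs with k
        · linarith [h v k]
        · exact le_rfl
      · rw [Finset.sum_congr rfl fun v hv => if_pos hv, Finset.sum_sub_distrib, ← Finset.mul_sum,
          hx.sum]
        simp [hT]; norm_num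
    obtain ⟨w, hw, he⟩ := hw.exists_image (opp_injective T)
    refine ⟨w, hw, ?_⟩
    have h1 : ∑ u ∈ T, u = ∑ v ∈ T, x v • ∑ u ∈ T, u := by
      rw [← Finset.sum_smul, hx.sum, one_smul]
    have h2 : ∑ v ∈ T, opp T v = ∑ u ∈ T, u := by
      simp only [opp]
      rw [← Finset.smul_sum, Finset.sum_sub_distrib, Finset.sum_const, hT]
      module
    rw [he, pt, Finset.sum_congr rfl fun v hv => by rw [if_pos hv]]
    simp only [sub_smul, one_smul, Finset.sum_sub_distrib, h2, id]
    rw [sub_eq_iff_eq_add']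
    conv_lhs => rw [h1]
    rw [← Finset.sum_add_distrib]
    refine Finset.sum_congr rfl fun v _ => ?_
    rw [opp]; module

open Classical in
/-- The family of all children. -/
def refineFamily {V : Type*} [NormedAddCommGroup V] [NormedSpace ℝ V] (𝒯 : Finset (Finset V)) :
    Finset (Finset V) := 𝒯.biUnion children

open Classical in
lemma mem_refineFamily {V : Type*} [NormedAddCommGroup V] [NormedSpace ℝ V]
    {𝒯 : Finset (Finset V)} {t : Finset V} : t ∈ refineFamily 𝒯 ↔ ∃ T ∈ 𝒯, t ∈ children T :=
  Finset.mem_biUnion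

lemma Mesh.refine {Ω : Set E2} {𝒯 : Finset (Finset E2)} {ℓ d δ : ℝ} (h : Mesh Ω 𝒯 ℓ d δ)
    (hd : 0 ≤ d) : Mesh Ω (refineFamily 𝒯) (ℓ / 2) (d / 2) (δ / 4) := by
  refine ⟨fun t ht => ?_, fun x => ?_, fun t ht => ?_, h.sep.children hd h.card, fun t ht => ?_⟩
  · obtain ⟨T, hT, htT⟩ := mem_refineFamily.mp ht
    exact (card_of_mem_children htT).trans (h.card T hT)
  · rw [h.cover]
    constructor
    · rintro ⟨T, hT, w, hw, rfl⟩
      obtain ⟨t, ht, h'⟩ := exists_wt_children (h.card T hT) hw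
      exact ⟨t, mem_refineFamily.mpr ⟨T, hT, ht⟩, h'⟩
    · rintro ⟨t, ht, w, hw, rfl⟩
      obtain ⟨T, hT, htT⟩ := mem_refineFamily.mp ht
      rcases mem_children.mp htT with rfl | ⟨a, ha, rfl⟩
      · obtain ⟨x, hx, he, -⟩ := hw.middle (h.card T hT)
        exact ⟨T, hT, x, hx, he⟩
      · obtain ⟨x, hx, he, -⟩ := hw.corner ha
        exact ⟨T, hT, x, hx, he⟩
  · obtain ⟨T, hT, htT⟩ := mem_refineFamily.mp ht
    obtain ⟨f, hf, rfl, s, hs, hfs⟩ := exists_affine_of_mem_children htT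
    simp only [Finset.forall_mem_image]
    intro a ha b hb
    rw [hfs, norm_smul, Real.norm_eq_abs, hs]
    linarith [h.diam T hT a ha b hb]
  · obtain ⟨T, hT, htT⟩ := mem_refineFamily.mp ht
    obtain ⟨f, hf, rfl, s, hs, hfs⟩ := exists_affine_of_mem_children htT
    simp only [Finset.forall_mem_image]
    intro a ha b hb c hc hab hbc hac
    have := h.fat T hT a ha b hb c hc (ne_of_apply_ne f hab) (ne_of_apply_ne f hbc)
      (ne_of_apply_ne f hac)
    rw [orient, ← map_sub, ← map_sub] at this ⊢
    rw [hfs, hfs, map_smul, map_smul, cr_smul_smul, abs_mul, abs_mul, hs]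
    linarith

lemma Mesh.iterate {Ω : Set E2} {𝒯 : Finset (Finset E2)} {ℓ d δ : ℝ} (h : Mesh Ω 𝒯 ℓ d δ)
    (hd : 0 ≤ d) (n : ℕ) : ∃ 𝒯', Mesh Ω 𝒯' (2⁻¹ ^ n * ℓ) (2⁻¹ ^ n * d) ((2⁻¹ ^ n) ^ 2 * δ) := by
  induction n with
  | zero => exact ⟨𝒯, h.mono (by simp) (by simp) (by simp)⟩
  | succ n ih =>
    obtain ⟨𝒯', h'⟩ := ih
    refine ⟨_, (h'.refine (by positivity)).mono ?_ ?_ ?_⟩ <;> exact le_of_eq (by ring)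

lemma exists_pos_forall_mem {β : Type*} (s : Finset β) {P : β → ℝ → Prop}
    (hP : ∀ b d d', d' ≤ d → P b d → P b d') (h : ∀ b ∈ s, ∃ d > 0, P b d) :
    ∃ d > 0, ∀ b ∈ s, P b d := by
  classical
  induction s using Finset.induction_on with
  | empty => exact ⟨1, one_pos, by simp⟩
  | insert a s _ ih =>
    obtain ⟨d, hd, h1⟩ := ih fun b hb => h b (Finset.mem_insert_of_mem hb)
    obtain ⟨d', hd', h2⟩ := h a (Finset.mem_insert_self a s)
    refine ⟨min d d', lt_min hd hd', fun b hb => ?_⟩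
    rcases Finset.mem_insert.mp hb with rfl | hb
    · exact hP _ _ _ (min_le_right _ _) h2
    · exact hP _ _ _ (min_le_left _ _) (h1 b hb)

/-- The convex hull of a finite set is the set of its convex combinations. -/
lemma mem_convexHull_iff_wt {V : Type*} [AddCommGroup V] [Module ℝ V] {T : Finset V} {x : V} :
    x ∈ convexHull ℝ (T : Set V) ↔ ∃ w, Wt T w ∧ pt id T w = x := by
  classical
  rw [Finset.mem_convexHull']
  constructor
  · rintro ⟨w, h0, h1, h2⟩
    refine ⟨fun v => if v ∈ T then w v else 0, ⟨fun v => ?_, fun v hv => if_neg hv, ?_⟩, ?_⟩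
    · split_ifs with k
      exacts [h0 v k, le_rfl]
    · rw [← h1]; exact Finset.sum_congr rfl fun v hv => if_pos hv
    · rw [← h2]; exact Finset.sum_congr rfl fun v hv => by simp only [if_pos hv, id]
  · rintro ⟨w, hw, rfl⟩
    exact ⟨w, fun v _ => hw.nonneg v, hw.sum, rfl⟩

lemma orient_ne_zero_of_affineIndependent {a b c : E2} (h : AffineIndependent ℝ ![a, b, c]) :
    orient (toC a) (toC b) (toC c) ≠ 0 := by
  intro h0
  rw [affineIndependent_iff] at h
  have hab : toC b - toC a ≠ 0 := by
    intro k
    have := h Finset.univ ![1, -1, 0] (by simp [Fin.sum_univ_three])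
      (by
        rw [sub_eq_zero] at k
        simp [Fin.sum_univ_three, toC.injective k]) 0 (Finset.mem_univ _)
    simp at this
  obtain ⟨s, hs⟩ : ∃ s : ℝ, toC c - toC a = s • (toC b - toC a) := by
    rw [orient] at h0
    generalize toC b - toC a = u at *
    generalize toC c - toC a = v at *
    rw [cr] at h0
    by_cases k : u.re = 0
    · have k' : u.im ≠ 0 := fun k' => hab (Complex.ext k k')
      refine ⟨v.im / u.im, Complex.ext ?_ ?_⟩
      · simp only [Complex.real_smul, Complex.re_ofReal_mul]
        field_simp; linarith
      · simp only [Complex.real_smul, Complex.im_ofReal_mul]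
        field_simp
    · refine ⟨v.re / u.re, Complex.ext ?_ ?_⟩
      · simp only [Complex.real_smul, Complex.re_ofReal_mul]
        field_simp
      · simp only [Complex.real_smul, Complex.im_ofReal_mul]
        field_simp; linarith
  have hs' : c - a = s • (b - a) := toC.injective (by rw [map_smul, map_sub, map_sub, hs])
  have := h Finset.univ ![s - 1, -s, 1] (by simp [Fin.sum_univ_three]; ring)
    (by
      simp only [Fin.sum_univ_three, Matrix.cons_val_zero, Matrix.cons_val_one, Matrix.cons_val]
      rw [sub_eq_iff_eq_add.mp hs']; module) 2 (Finset.mem_univ _)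
  simp at this

open Classical in
lemma exists_mesh {Ω : Set E2} {K : SimplicialComplex ℝ E2} (h : IsTriangulation K Ω) :
    ∃ 𝒯 : Finset (Finset E2), ∃ ℓ > 0, ∃ d > 0, ∃ δ > 0, Mesh Ω 𝒯 ℓ d δ := by
  obtain ⟨hfin, -, hΩ, hpure⟩ := h
  set 𝒯 := hfin.toFinset.filter fun T => T.card = 3 with h𝒯
  have hmem : ∀ {T}, T ∈ 𝒯 ↔ T ∈ K.faces ∧ T.card = 3 := by simp [h𝒯]
  obtain ⟨d, hd, hsep⟩ := exists_pos_forall_mem (hfin.toFinset ×ˢ hfin.toFinset)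
    (P := fun p d => Disjoint p.1 p.2 → ∀ x ∈ convexHull ℝ (p.1 : Set E2),
      ∀ y ∈ convexHull ℝ (p.2 : Set E2), d ≤ ‖x - y‖)
    (fun p d d' hd hp hdis x hx y hy => hd.trans (hp hdis x hx y hy)) (by
      rintro ⟨A, B⟩ hAB
      simp only [Finset.mem_product, Finite.mem_toFinset] at hAB
      by_cases hdis : Disjoint A B
      swap
      · exact ⟨1, one_pos, fun k => absurd k hdis⟩
      have hAc : IsCompact (convexHull ℝ (A : Set E2)) :=
        A.finite_toSet.isCompact_convexHull (𝕜 := ℝ)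
      have hBc : IsClosed (convexHull ℝ (B : Set E2)) := B.finite_toSet.isClosed_convexHull (𝕜 := ℝ)
      have hD : Disjoint (convexHull ℝ (A : Set E2)) (convexHull ℝ (B : Set E2)) := by
        rw [Set.disjoint_iff]
        intro x hx
        have := K.inter_subset_convexHull hAB.1 hAB.2 hx
        rwa [← Finset.coe_inter, Finset.disjoint_iff_inter_eq_empty.mp hdis, Finset.coe_empty,
          convexHull_empty] at this
      obtain ⟨r, hr, hlt⟩ := Metric.exists_pos_forall_lt_edist hAc hBc hD
      refine ⟨r, by exact_mod_cast hr, fun _ x hx y hy => ?_⟩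
      have := hlt x hx y hy
      rw [edist_dist, ← ENNReal.ofReal_coe_nnreal] at this
      rw [← dist_eq_norm]
      exact ((ENNReal.ofReal_lt_ofReal_iff_of_nonneg r.2).mp this).le)
  obtain ⟨ℓ, hℓ, hdiam⟩ := exists_pos_forall_mem
    (𝒯.biUnion fun T => T ×ˢ T) (P := fun p d => ‖p.1 - p.2‖ ≤ d⁻¹ ∨ d ≤ 0)
    (fun p d d' hd hp => by
      rcases le_or_gt d' 0 with k | k
      · exact Or.inr k
      rcases hp with hp | hp
      · exact Or.inl (hp.trans (inv_anti₀ k hd))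
      · exact Or.inr (hd.trans hp))
    (fun p _ => ⟨(‖p.1 - p.2‖ + 1)⁻¹, by positivity, Or.inl (by rw [inv_inv]; linarith)⟩)
  obtain ⟨δ, hδ, hfat⟩ := exists_pos_forall_mem (𝒯.biUnion fun T => T ×ˢ T ×ˢ T)
    (P := fun p d => orient (toC p.1) (toC p.2.1) (toC p.2.2) ≠ 0 →
      d ≤ |orient (toC p.1) (toC p.2.1) (toC p.2.2)|)
    (fun p d d' hd hp k => hd.trans (hp k)) (fun p _ => by
      by_cases k : orient (toC p.1) (toC p.2.1) (toC p.2.2) = 0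
      · exact ⟨1, one_pos, fun k' => absurd k k'⟩
      · exact ⟨_, abs_pos.mpr k, fun _ => le_rfl⟩)
  refine ⟨𝒯, ℓ⁻¹, inv_pos.mpr hℓ, d, hd, δ, hδ, fun T hT => (hmem.mp hT).2, fun x => ?_,
    fun T hT a ha b hb => ?_, ?_, fun T hT a ha b hb c hc hab hbc hac => ?_⟩
  · rw [← hΩ, SimplicialComplex.mem_space_iff]
    constructor
    · rintro ⟨s, hs, hx⟩
      obtain ⟨T, hT, hsT, h3⟩ := hpure s hs
      exact ⟨T, hmem.mpr ⟨hT, h3⟩, mem_convexHull_iff_wt.mp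
        (convexHull_mono (Finset.coe_subset.mpr hsT) hx)⟩
    · rintro ⟨T, hT, hw⟩
      exact ⟨T, (hmem.mp hT).1, mem_convexHull_iff_wt.mpr hw⟩
  · refine (hdiam (a, b) (Finset.mem_biUnion.mpr ⟨T, hT,
      Finset.mk_mem_product ha hb⟩)).resolve_right hℓ.not_ge
  · intro T hT T' hT' x y hx hy h0
    have key : ∀ {T : Finset E2} {x : E2 → ℝ}, T ∈ 𝒯 → Wt T x →
        T.filter (fun v => x v ≠ 0) ∈ K.faces ∧
        pt id T x ∈ convexHull ℝ (T.filter (fun v => x v ≠ 0) : Set E2) := by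
      intro T x hT hx
      have hz : ∀ i ∉ T.filter (fun v => x v ≠ 0), x i = 0 := fun i hi => by
        by_contra k
        exact hi (Finset.mem_filter.mpr ⟨by by_contra k'; exact k (hx.supp i k'), k⟩)
      have hw := hx.of_zero hz
      refine ⟨K.down_closed (hmem.mp hT).1 (Finset.filter_subset _ _) ?_, ?_⟩
      · by_contra k
        rw [Finset.not_nonempty_iff_eq_empty] at k
        have := hw.sum
        rw [k, Finset.sum_empty] at this
        exact zero_ne_one this
      · rw [mem_convexHull_iff_wt]
        exact ⟨x, hw, (hx.pt_of_zero hz id)⟩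
    obtain ⟨k1, k2⟩ := key hT hx
    obtain ⟨k3, k4⟩ := key hT' hy
    refine hsep (_, _) (Finset.mk_mem_product (hfin.mem_toFinset.mpr k1)
      (hfin.mem_toFinset.mpr k3)) ?_ _ k2 _ k4
    rw [Finset.disjoint_left]
    intro v h1 h2
    exact (h0 v).elim (Finset.mem_filter.mp h1).2 (Finset.mem_filter.mp h2).2
  · refine hfat (a, b, c) (Finset.mem_biUnion.mpr ⟨T, hT, Finset.mk_mem_product ha
      (Finset.mk_mem_product hb hc)⟩) (orient_ne_zero_of_affineIndependent ?_)
    have hi := K.indep (hmem.mp hT).1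
    have hinj : Function.Injective (![⟨a, ha⟩, ⟨b, hb⟩, ⟨c, hc⟩] : Fin 3 → T) := by
      intro i j
      fin_cases i <;> fin_cases j <;> simp [hab, hbc, hac, hab.symm, hbc.symm, hac.symm]
    have he : (fun i => ((![⟨a, ha⟩, ⟨b, hb⟩, ⟨c, hc⟩] : Fin 3 → T) i : E2)) = ![a, b, c] := by
      funext i
      fin_cases i <;> rfl
    rw [← he]
    exact hi.comp_embedding ⟨_, hinj⟩

/-- A closed polygon has fat meshes at all scales. -/
lemma IsClosedPolygon.exists_mesh {Ω : Set E2} (h : IsClosedPolygon Ω) :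
    ∃ c > 0, ∃ C > 0, ∀ τ : ℝ, 0 < τ → τ ≤ 1 →
      ∃ 𝒯, Mesh Ω 𝒯 (C * τ) (c * τ) (c * τ ^ 2) := by
  obtain ⟨-, K, hK⟩ := h
  obtain ⟨𝒯, ℓ, hℓ, d, hd, δ, hδ, hM⟩ := _root_.exists_mesh hK
  refine ⟨min d δ, lt_min hd hδ, 2 * ℓ, by positivity, fun τ h0 h1 => ?_⟩
  obtain ⟨n, hn1, hn2⟩ := exists_nat_pow_near_of_lt_one h0 h1 (by norm_num : (0 : ℝ) < 2⁻¹)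
    (by norm_num)
  obtain ⟨𝒯', h'⟩ := hM.iterate hd.le n
  refine ⟨𝒯', h'.mono ?_ ?_ ?_⟩
  · rw [pow_succ] at hn1
    nlinarith
  · nlinarith [min_le_left d δ, lt_min hd hδ]
  · have : τ ^ 2 ≤ (2⁻¹ ^ n) ^ 2 := pow_le_pow_left₀ h0.le hn2 2
    nlinarith [min_le_right d δ, lt_min hd hδ, sq_nonneg τ]

lemma SegOK.swap_right {V : Type*} [AddCommGroup V] [Module ℝ V] {r : ι → V} {a b c d : ι}
    (h : SegOK r a b c d) : SegOK r a b d c := h.symm.swap.symm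

lemma segOK_of_add_lt {V : Type*} [NormedAddCommGroup V] [NormedSpace ℝ V] {r : ι → V}
    {a b c d : ι} (h : ‖r a - r b‖ + ‖r c - r d‖ < ‖r a - r c‖ + ‖r b - r d‖) :
    SegOK r a b c d := by
  intro x hx hx'
  exfalso
  have h1 := dist_add_dist_of_mem_segment hx
  have h2 := dist_add_dist_of_mem_segment hx'
  have h3 := dist_triangle (r a) x (r c)
  have h4 := dist_triangle (r b) x (r d)
  rw [dist_comm x (r c)] at h3
  rw [dist_comm (r b) x] at h4
  simp only [← dist_eq_norm] at h
  linarith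

lemma segOK_of_abs_lt {V : Type*} [NormedAddCommGroup V] [NormedSpace ℝ V] {r : ι → V}
    {a b c : ι} (h : |‖r a - r b‖ - ‖r c - r b‖| < ‖r a - r c‖) : SegOK r b a b c := by
  intro x hx hx'
  refine Or.inr (Or.inr ⟨b, Or.inl rfl, Or.inl rfl, ?_⟩)
  by_contra hne
  rw [segment_eq_image'] at hx hx'
  obtain ⟨s, hs, rfl⟩ := hx
  obtain ⟨t, ht, he⟩ := hx'
  have hs0 : 0 < s := hs.1.lt_of_ne (by rintro rfl; simp at hne)
  have ht0 : 0 < t := ht.1.lt_of_ne (by rintro rfl; exact hne (by rw [← he]; simp))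
  have hr : SameRay ℝ (r a - r b) (r c - r b) :=
    Or.inr (Or.inr ⟨s, t, hs0, ht0, (add_left_cancel he).symm⟩)
  have := hr.norm_sub
  rw [sub_sub_sub_cancel_right] at this
  linarith

/-- A chain of points on the segment `v w` whose images under `g` are consecutively close and
otherwise apart. -/
structure Chain (g : E2 → ℂ) (R κ : ℝ) (v w : E2) (n : ℕ) (x : ℕ → E2) : Prop where
  three : 3 ≤ n
  zero : x 0 = v
  last : x n = w
  mem : ∀ i ≤ n, x i ∈ segment ℝ v w
  fst : ‖g (x 1) - g v‖ = R
  lst : ‖g (x (n - 1)) - g w‖ = R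
  step : ∀ i, 1 ≤ i → i + 2 ≤ n → ‖g (x i) - g (x (i + 1))‖ ≤ κ
  ne : ∀ i, 1 ≤ i → i + 2 ≤ n → g (x i) ≠ g (x (i + 1))
  far : ∀ i j, 1 ≤ i → i + 2 ≤ j → j + 1 ≤ n → κ < ‖g (x i) - g (x j)‖
  left : ∀ i, 1 ≤ i → i + 1 ≤ n → R ≤ ‖g (x i) - g v‖
  right : ∀ i, 1 ≤ i → i + 1 ≤ n → R ≤ ‖g (x i) - g w‖

namespace Chain

variable {g : E2 → ℂ} {R κ : ℝ} {v w : E2} {n : ℕ} {x : ℕ → E2}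

lemma reverse (h : Chain g R κ v w n x) : Chain g R κ w v n fun i => x (n - i) := by
  have h3 := h.three
  refine ⟨h3, by simpa using h.last, by simpa using h.zero, fun i _ => ?_, h.lst, ?_, ?_, ?_, ?_,
    fun i h1 h2 => h.right _ (by omega) (by omega), fun i h1 h2 => h.left _ (by omega) (by omega)⟩
  · rw [segment_symm]; exact h.mem _ (by omega)
  · rw [show n - (n - 1) = 1 by omega]; exact h.fst
  · intro i h1 h2
    rw [norm_sub_rev]
    have := h.step (n - (i + 1)) (by omega) (by omega)
    rwa [show n - (i + 1) + 1 = n - i by omega] at this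
  · intro i h1 h2
    have := h.ne (n - (i + 1)) (by omega) (by omega)
    rw [show n - (i + 1) + 1 = n - i by omega] at this
    exact this.symm
  · intro i j h1 h2 h4
    rw [norm_sub_rev]
    exact h.far (n - j) (n - i) (by omega) (by omega) (by omega)

lemma step_le (h : Chain g R κ v w n x) (hκ : κ ≤ R) {i : ℕ} (hi : i < n) :
    ‖g (x i) - g (x (i + 1))‖ ≤ R := by
  rcases Nat.eq_zero_or_pos i with rfl | h0
  · rw [h.zero, norm_sub_rev]; exact h.fst.le
  rcases (show i + 2 ≤ n ∨ i = n - 1 by omega) with h1 | rfl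
  · exact (h.step i h0 h1).trans hκ
  · rw [show n - 1 + 1 = n by omega, h.last]; exact h.lst.le

lemma segOK_zero (h : Chain g R κ v w n x) (hκR : κ < R)
    (hvw : 2 * R < ‖g v - g w‖) {j : ℕ} (hj : j < n) :
    SegOK g (x 0) (x 1) (x j) (x (j + 1)) := by
  have h3 := h.three
  rcases Nat.eq_zero_or_pos j with rfl | h0
  · exact SegOK.refl _ _ _
  have hf : ‖g (x 0) - g (x 1)‖ = R := by rw [h.zero, norm_sub_rev]; exact h.fst
  rcases (show j + 2 ≤ n ∨ j = n - 1 by omega) with h1 | rfl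
  · have hs := h.step j h0 h1
    rcases (show j = 1 ∨ 2 ≤ j by omega) with rfl | h2
    · refine (segOK_of_abs_lt (a := x 0) (b := x 1) (c := x 2) ?_).swap
      have hl := h.left 2 (by omega) (by omega)
      have hne : 0 < ‖g (x 2) - g (x 1)‖ :=
        norm_pos_iff.mpr (sub_ne_zero.mpr (h.ne 1 le_rfl h1).symm)
      rw [norm_sub_rev] at hs
      rw [hf, h.zero, norm_sub_rev (g v), abs_of_nonneg (by linarith)]
      linarith
    · refine segOK_of_add_lt ?_
      have hl := h.left j h0 (by omega)
      have := h.far 1 (j + 1) le_rfl (by omega) (by omega)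
      rw [hf, h.zero, norm_sub_rev (g v)]
      linarith
  · refine SegOK.swap_right (segOK_of_add_lt ?_)
    have hl : ‖g (x (n - 1 + 1)) - g (x (n - 1))‖ = R := by
      rw [show n - 1 + 1 = n by omega, h.last, norm_sub_rev]; exact h.lst
    rw [hf, hl, h.zero, show n - 1 + 1 = n by omega, h.last]
    linarith [norm_nonneg (g (x 1) - g (x (n - 1)))]

lemma segOK_self (h : Chain g R κ v w n x) (hκR : κ < R)
    (hvw : 2 * R < ‖g v - g w‖) {i j : ℕ} (hi : i < n) (hj : j < n) :
    SegOK g (x i) (x (i + 1)) (x j) (x (j + 1)) := by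
  have h3 := h.three
  wlog hij : i ≤ j generalizing i j
  · exact (this hj hi (by omega)).symm
  rcases hij.eq_or_lt with rfl | hij
  · exact SegOK.refl _ _ _
  rcases Nat.eq_zero_or_pos i with rfl | h0
  · exact h.segOK_zero hκR hvw hj
  rcases (show j + 2 ≤ n ∨ j = n - 1 by omega) with h1 | rfl
  · have hs := h.step j (by omega) h1
    have hs' := h.step i h0 (by omega)
    rcases (show j = i + 1 ∨ i + 2 ≤ j by omega) with rfl | h2
    · refine (segOK_of_abs_lt (a := x i) (b := x (i + 1)) (c := x (i + 2)) ?_).swap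
      have hne : 0 < ‖g (x (i + 1)) - g (x (i + 2))‖ :=
        norm_pos_iff.mpr (sub_ne_zero.mpr (h.ne (i + 1) (by omega) h1))
      have hne' : 0 < ‖g (x i) - g (x (i + 1))‖ :=
        norm_pos_iff.mpr (sub_ne_zero.mpr (h.ne i h0 (by omega)))
      have := h.far i (i + 2) h0 le_rfl (by omega)
      rw [norm_sub_rev (g (x (i + 2))), abs_lt]
      rw [show i + 1 + 1 = i + 2 by omega] at hs
      constructor <;> linarith
    · refine segOK_of_add_lt ?_
      have := h.far i j h0 h2 (by omega)
      have := h.far (i + 1) (j + 1) (by omega) (by omega) (by omega)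
      linarith
  · have := h.reverse.segOK_zero hκR (by rwa [norm_sub_rev]) (j := n - 1 - i) (by omega)
    simp only [Nat.sub_zero] at this
    rw [show n - (n - 1 - i) = i + 1 by omega, show n - (n - 1 - i + 1) = i by omega] at this
    rw [show n - 1 + 1 = n by omega]
    exact this.swap.symm.swap

variable {v' w' : E2} {n' : ℕ} {x' : ℕ → E2}

lemma segOK_zero_left (h : Chain g R κ v w n x) (h' : Chain g R κ v' w' n' x')
    (hκ : 0 ≤ κ)
    (hfar : ∀ i j, 1 ≤ i → i < n → 1 ≤ j → j < n' → κ < ‖g (x i) - g (x' j)‖)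
    (hvv' : v ≠ v' → 2 * R < ‖g v - g v'‖) (hvw' : v ≠ w' → 2 * R < ‖g v - g w'‖)
    (hv : v ≠ v' → v ≠ w' → ∀ j ≤ n', R + κ < ‖g v - g (x' j)‖) {j : ℕ} (hj : j < n') :
    SegOK g (x 0) (x 1) (x' j) (x' (j + 1)) := by
  have h3 := h.three
  have h3' := h'.three
  have hf : ‖g (x 0) - g (x 1)‖ = R := by rw [h.zero, norm_sub_rev]; exact h.fst
  have key : ∀ {v' w' : E2} {x' : ℕ → E2}, Chain g R κ v' w' n' x' →
      (∀ j, 1 ≤ j → j < n' → κ < ‖g (x 1) - g (x' j)‖) →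
      (v ≠ v' → 2 * R < ‖g v - g v'‖) → SegOK g (x 0) (x 1) (x' 0) (x' 1) := by
    intro v' w' x' h' hfar hvv'
    have hf' : ‖g (x' 0) - g (x' 1)‖ = R := by rw [h'.zero, norm_sub_rev]; exact h'.fst
    by_cases hv : v = v'
    · have e : x 0 = x' 0 := by rw [h.zero, h'.zero, hv]
      have := segOK_of_abs_lt (r := g) (a := x 1) (b := x 0) (c := x' 1) (by
        rw [norm_sub_rev, hf, norm_sub_rev, e, hf', sub_self, abs_zero]
        linarith [hfar 1 le_rfl (by omega)])
      rwa [← e]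
    · refine segOK_of_add_lt ?_
      rw [hf, hf', h.zero, h'.zero]
      linarith [hvv' hv, norm_nonneg (g (x 1) - g (x' 1))]
  rcases Nat.eq_zero_or_pos j with rfl | h0
  · exact key h' (fun j => hfar 1 j le_rfl (by omega)) hvv'
  rcases (show j + 2 ≤ n' ∨ j = n' - 1 by omega) with h1 | rfl
  · refine segOK_of_add_lt ?_
    have hs := h'.step j h0 h1
    rw [hf, h.zero]
    have hk := hfar 1 (j + 1) le_rfl (by omega) (by omega) (by omega)
    by_cases e1 : v = v'
    · have := h'.left j h0 (by omega)
      rw [← e1, norm_sub_rev] at this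
      linarith
    by_cases e2 : v = w'
    · have := h'.right j h0 (by omega)
      rw [← e2, norm_sub_rev] at this
      linarith
    linarith [hv e1 e2 j (by omega)]
  · have := key h'.reverse (fun j hj1 hj2 => hfar 1 _ le_rfl (by omega) (by omega) (by omega)) hvw'
    simp only [Nat.sub_zero] at this
    rw [show n' - 1 + 1 = n' by omega]
    exact this.swap_right

lemma segOK (h : Chain g R κ v w n x) (h' : Chain g R κ v' w' n' x')
    (hκ : 0 ≤ κ)
    (hfar : ∀ i j, 1 ≤ i → i < n → 1 ≤ j → j < n' → κ < ‖g (x i) - g (x' j)‖)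
    (hvv : ∀ a, a = v ∨ a = w → ∀ b, b = v' ∨ b = w' → a ≠ b → 2 * R < ‖g a - g b‖)
    (hv : ∀ a, a = v ∨ a = w → a ≠ v' → a ≠ w' → ∀ j ≤ n', R + κ < ‖g a - g (x' j)‖)
    (hv' : ∀ a, a = v' ∨ a = w' → a ≠ v → a ≠ w → ∀ j ≤ n, R + κ < ‖g a - g (x j)‖)
    {i j : ℕ} (hi : i < n) (hj : j < n') : SegOK g (x i) (x (i + 1)) (x' j) (x' (j + 1)) := by
  have h3 := h.three
  have h3' := h'.three
  have hfar' : ∀ i j, 1 ≤ i → i < n' → 1 ≤ j → j < n → κ < ‖g (x' i) - g (x j)‖ :=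
    fun i j a b c d => by rw [norm_sub_rev]; exact hfar j i c d a b
  rcases Nat.eq_zero_or_pos i with rfl | h0
  · exact h.segOK_zero_left h' hκ hfar (hvv v (Or.inl rfl) v' (Or.inl rfl))
      (hvv v (Or.inl rfl) w' (Or.inr rfl)) (hv v (Or.inl rfl)) hj
  rcases (show i + 2 ≤ n ∨ i = n - 1 by omega) with h1 | rfl
  swap
  · have := h.reverse.segOK_zero_left h' hκ
      (fun i j a b c d => hfar _ j (by omega) (by omega) c d) (hvv w (Or.inr rfl) v' (Or.inl rfl))
      (hvv w (Or.inr rfl) w' (Or.inr rfl)) (hv w (Or.inr rfl)) hj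
    simp only [Nat.sub_zero] at this
    rw [show n - 1 + 1 = n by omega]
    exact this.swap
  rcases Nat.eq_zero_or_pos j with rfl | k0
  · exact (h'.segOK_zero_left h hκ hfar'
      (fun e => by rw [norm_sub_rev]; exact hvv v (Or.inl rfl) v' (Or.inl rfl) e.symm)
      (fun e => by rw [norm_sub_rev]; exact hvv w (Or.inr rfl) v' (Or.inl rfl) e.symm)
      (hv' v' (Or.inl rfl)) hi).symm
  rcases (show j + 2 ≤ n' ∨ j = n' - 1 by omega) with k1 | rfl
  swap
  · have := (h'.reverse.segOK_zero_left h hκ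
      (fun i j a b c d => hfar' _ j (by omega) (by omega) c d)
      (fun e => by rw [norm_sub_rev]; exact hvv v (Or.inl rfl) w' (Or.inr rfl) e.symm)
      (fun e => by rw [norm_sub_rev]; exact hvv w (Or.inr rfl) w' (Or.inr rfl) e.symm)
      (hv' w' (Or.inr rfl)) hi).symm
    simp only [Nat.sub_zero] at this
    rw [show n' - 1 + 1 = n' by omega]
    exact this.swap_right
  refine segOK_of_add_lt ?_
  linarith [h.step i h0 h1, h'.step j k0 k1, hfar i j h0 hi k0 hj,
    hfar (i + 1) (j + 1) (by omega) (by omega) (by omega) (by omega)]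

end Chain

/-- A shortest chain with steps at most `κ` has no two close points which are not neighbours. -/
lemma exists_shortest_chain {X E : Type*} [NormedAddCommGroup E] (g : X → E) {S : Set X} {p q : X}
    (hpq : g p ≠ g q) {κ : ℝ} {m : ℕ} {u : ℕ → X} (h0 : u 0 = p) (hm : u m = q)
    (hS : ∀ i ≤ m, u i ∈ S) (hs : ∀ i < m, ‖g (u i) - g (u (i + 1))‖ ≤ κ) :
    ∃ k ≤ m, ∃ y : ℕ → X, 1 ≤ k ∧ y 0 = p ∧ y k = q ∧ (∀ i ≤ k, y i ∈ S) ∧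
      (∀ i < k, ‖g (y i) - g (y (i + 1))‖ ≤ κ) ∧ (∀ i < k, g (y i) ≠ g (y (i + 1))) ∧
      ∀ i j, i + 2 ≤ j → j ≤ k → κ < ‖g (y i) - g (y j)‖ := by
  classical
  have hex : ∃ k, ∃ y : ℕ → X, y 0 = p ∧ y k = q ∧ (∀ i ≤ k, y i ∈ S) ∧
      ∀ i < k, ‖g (y i) - g (y (i + 1))‖ ≤ κ := ⟨m, u, h0, hm, hS, hs⟩
  obtain ⟨y, y0, yk, yS, ys⟩ := Nat.find_spec hex
  have hmin : ∀ l < Nat.find hex, _ := fun l hl => Nat.find_min hex hl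
  have hkm : Nat.find hex ≤ m := Nat.find_min' hex ⟨u, h0, hm, hS, hs⟩
  generalize Nat.find hex = k at *
  have far : ∀ i j, i + 2 ≤ j → j ≤ k → κ < ‖g (y i) - g (y j)‖ := by
    intro i j hij hj
    by_contra hc
    push Not at hc
    refine hmin (k - (j - i - 1)) (by omega)
      ⟨fun l => if l ≤ i then y l else y (l + (j - i - 1)), by simpa using y0, ?_, ?_, ?_⟩
    · show (if _ then _ else _) = q
      rw [if_neg (by omega), show k - (j - i - 1) + (j - i - 1) = k by omega, yk]
    · intro l hl
      show (if _ then _ else _) ∈ S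
      split_ifs <;> exact yS _ (by omega)
    · intro l hl
      show ‖g (if _ then _ else _) - g (if _ then _ else _)‖ ≤ κ
      rcases lt_trichotomy l i with h | rfl | h
      · rw [if_pos h.le, if_pos (by omega)]; exact ys l (by omega)
      · rw [if_pos le_rfl, if_neg (by omega), show l + 1 + (j - l - 1) = j by omega]; exact hc
      · rw [if_neg (by omega), if_neg (by omega),
          show l + 1 + (j - i - 1) = l + (j - i - 1) + 1 by omega]
        exact ys _ (by omega)
  have hk : 1 ≤ k := by
    by_contra hk
    have : k = 0 := by omega
    subst this
    exact hpq (by rw [← y0, ← yk])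
  refine ⟨k, hkm, y, hk, y0, yk, yS, ys, fun i hi he => ?_, far⟩
  by_cases h1 : i + 2 ≤ k
  · have := far i (i + 2) le_rfl h1
    rw [he] at this
    exact absurd (ys (i + 1) (by omega)) (not_le.mpr this)
  by_cases h2 : 1 ≤ i
  · have := far (i - 1) (i + 1) (by omega) (by omega)
    rw [← he] at this
    have h3 := ys (i - 1) (by omega)
    rw [show i - 1 + 1 = i by omega] at h3
    exact absurd h3 (not_le.mpr this)
  have : i = 0 := by omega
  subst this
  have : k = 1 := by omega
  subst this
  exact hpq (by rw [← y0, ← yk]; exact he)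

/-- A path between two remote points contains a stretch joining the circles of radius `R` about
them and staying outside both. -/
lemma exists_stretch {E : Type*} [NormedAddCommGroup E] {φ : ℝ → E}
    (hφ : ContinuousOn φ (Icc 0 1)) {R : ℝ} (hR : 0 < R) (h : 2 * R < ‖φ 0 - φ 1‖) :
    ∃ s ∈ Icc (0 : ℝ) 1, ∃ t ∈ Icc (0 : ℝ) 1, s ≤ t ∧ ‖φ s - φ 0‖ = R ∧ ‖φ t - φ 1‖ = R ∧
      ∀ z ∈ Icc s t, R ≤ ‖φ z - φ 0‖ ∧ R ≤ ‖φ z - φ 1‖ := by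
  have c0 : ContinuousOn (fun z => ‖φ z - φ 0‖) (Icc 0 1) := (hφ.sub continuousOn_const).norm
  have c1 : ContinuousOn (fun z => ‖φ z - φ 1‖) (Icc 0 1) := (hφ.sub continuousOn_const).norm
  have hcomp : ∀ {f : ℝ → ℝ} {a : ℝ}, 0 ≤ a → ContinuousOn f (Icc 0 1) →
      IsCompact (Icc a 1 ∩ f ⁻¹' {R}) := fun ha hf =>
    isCompact_Icc.of_isClosed_subset
      ((hf.mono (Icc_subset_Icc_left ha)).preimage_isClosed_of_isClosed isClosed_Icc
        isClosed_singleton) inter_subset_left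
  have d10 : 2 * R < ‖φ 1 - φ 0‖ := by rwa [norm_sub_rev]
  obtain ⟨s, ⟨hs, hsR⟩, hmax⟩ := (hcomp le_rfl c0).exists_isGreatest (by
    obtain ⟨z, hz, he⟩ := intermediate_value_Icc zero_le_one c0
      (show R ∈ Icc ‖φ 0 - φ 0‖ ‖φ 1 - φ 0‖ by
        simp only [sub_self, norm_zero]; constructor <;> linarith)
    exact ⟨z, hz, he⟩)
  simp only [mem_preimage, mem_singleton_iff] at hsR
  have out0 : ∀ z ∈ Icc s 1, R ≤ ‖φ z - φ 0‖ := by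
    intro z hz
    by_contra hc
    push Not at hc
    have hz0 : 0 ≤ z := hs.1.trans hz.1
    obtain ⟨y, hy, he⟩ := intermediate_value_Icc hz.2 (c0.mono (Icc_subset_Icc_left hz0))
      (show R ∈ Icc ‖φ z - φ 0‖ ‖φ 1 - φ 0‖ by constructor <;> linarith)
    have := hmax ⟨⟨hz0.trans hy.1, hy.2⟩, he⟩
    have hzs : z = s := le_antisymm (hy.1.trans this) hz.1
    rw [hzs] at hc
    linarith
  have hs1 : R < ‖φ s - φ 1‖ := by
    have := norm_sub_le_norm_sub_add_norm_sub (φ 0) (φ s) (φ 1)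
    rw [norm_sub_rev (φ 0) (φ s)] at this
    linarith
  obtain ⟨t, ⟨ht, htR⟩, hmin⟩ := (hcomp hs.1 c1).exists_isLeast (by
    obtain ⟨z, hz, he⟩ := intermediate_value_Icc' hs.2 (c1.mono (Icc_subset_Icc_left hs.1))
      (show R ∈ Icc ‖φ 1 - φ 1‖ ‖φ s - φ 1‖ by
        simp only [sub_self, norm_zero]; constructor <;> linarith)
    exact ⟨z, hz, he⟩)
  simp only [mem_preimage, mem_singleton_iff] at htR
  refine ⟨s, hs, t, ⟨hs.1.trans ht.1, ht.2⟩, ht.1, hsR, htR, fun z hz =>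
    ⟨out0 z ⟨hz.1, hz.2.trans ht.2⟩, ?_⟩⟩
  by_contra hc
  push Not at hc
  obtain ⟨y, hy, he⟩ := intermediate_value_Icc' hz.1
    (c1.mono (Icc_subset_Icc hs.1 (hz.2.trans ht.2)))
    (show R ∈ Icc ‖φ z - φ 1‖ ‖φ s - φ 1‖ by constructor <;> linarith)
  have := hmin ⟨⟨hy.1, hy.2.trans (hz.2.trans ht.2)⟩, he⟩
  have hzt : z = t := le_antisymm hz.2 (this.trans hy.2)
  rw [hzt] at hc
  linarith

/-- The image of a segment is followed by a chain. -/
lemma exists_chain {g : E2 → ℂ} {v w : E2} (hg : ContinuousOn g (segment ℝ v w)) {R κ s : ℝ}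
    (hR : 0 < R) (h : 2 * R < ‖g v - g w‖) {m : ℕ} (hm : 1 ≤ m) (hms : ‖v - w‖ ≤ m * s)
    (hs : ∀ x ∈ segment ℝ v w, ∀ y ∈ segment ℝ v w, ‖x - y‖ ≤ s → ‖g x - g y‖ ≤ κ) :
    ∃ n ≤ m + 2, ∃ x, Chain g R κ v w n x := by
  set γ : ℝ → E2 := fun t => v + t • (w - v) with hγ
  have γ0 : γ 0 = v := by simp [hγ]
  have γ1 : γ 1 = w := by simp [hγ]
  have hmem : ∀ t ∈ Icc (0 : ℝ) 1, γ t ∈ segment ℝ v w := fun t ht => by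
    rw [segment_eq_image']; exact ⟨t, ht, rfl⟩
  have hc : ContinuousOn (fun t => g (γ t)) (Icc 0 1) :=
    hg.comp (by fun_prop) hmem
  obtain ⟨a, ha, b, hb, hab, haR, hbR, hout⟩ := exists_stretch hc hR
    (by simpa only [γ0, γ1] using h)
  simp only [γ0, γ1] at haR hbR hout
  have hm0 : (0 : ℝ) < m := by exact_mod_cast hm
  have hu : ∀ i : ℕ, i ≤ m → a + i / m * (b - a) ∈ Icc a b := by
    intro i hi
    have h1 : (i : ℝ) / m ≤ 1 := by rw [div_le_one hm0]; exact_mod_cast hi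
    have h2 : (0 : ℝ) ≤ i / m := by positivity
    constructor <;> nlinarith
  have hIcc : Icc a b ⊆ Icc 0 1 := Icc_subset_Icc ha.1 hb.2
  have hne : g (γ a) ≠ g (γ b) := by
    intro e
    have := norm_sub_le_norm_sub_add_norm_sub (g v) (g (γ a)) (g w)
    rw [norm_sub_rev (g v) (g (γ a)), haR, e, hbR] at this
    linarith
  obtain ⟨k, hkm, y, hk1, y0, yk, yS, ys, yne, yfar⟩ := exists_shortest_chain g
    (S := γ '' Icc a b) hne (κ := κ) (m := m) (u := fun i => γ (a + i / m * (b - a))) (by simp)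
    (by simp only [div_self hm0.ne']; congr 1; ring)
    (fun i hi => ⟨_, hu i hi, rfl⟩) (fun i hi => by
      refine hs _ (hmem _ (hIcc (hu i hi.le))) _ (hmem _ (hIcc (hu (i + 1) hi))) ?_
      have e : γ (a + i / m * (b - a)) - γ (a + (i + 1 : ℕ) / m * (b - a)) =
          ((b - a) / m) • (v - w) := by
        simp only [hγ]; push_cast; module
      rw [e, norm_smul, Real.norm_of_nonneg (div_nonneg (by linarith) hm0.le)]
      have hba : b - a ≤ 1 := by linarith [ha.1, hb.2]
      calc (b - a) / m * ‖v - w‖ ≤ 1 / m * (m * s) := by gcongr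
        _ = s := by field_simp)
  set x : ℕ → E2 := fun i => if i = 0 then v else if i ≤ k + 1 then y (i - 1) else w with hx
  have hx1 : ∀ i, 1 ≤ i → i + 1 ≤ k + 2 → x i = y (i - 1) := fun i h1 h2 => by
    simp only [hx]; rw [if_neg (by omega), if_pos (by omega)]
  have hy : ∀ i ≤ k, y i ∈ segment ℝ v w ∧ R ≤ ‖g (y i) - g v‖ ∧ R ≤ ‖g (y i) - g w‖ := by
    intro i hi
    obtain ⟨t, ht, e⟩ := yS i hi
    rw [← e]
    exact ⟨hmem t (hIcc ht), hout t ht⟩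
  refine ⟨k + 2, by omega, x, by omega, by simp [hx], by simp [hx], fun i hi => ?_, ?_, ?_,
    fun i h1 h2 => ?_, fun i h1 h2 => ?_, fun i j h1 h2 h4 => ?_, fun i h1 h2 => ?_,
    fun i h1 h2 => ?_⟩
  · simp only [hx]
    split_ifs
    · exact left_mem_segment ..
    · exact (hy _ (by omega)).1
    · exact right_mem_segment ..
  · rw [hx1 1 le_rfl (by omega), y0, haR]
  · rw [hx1 _ (by omega) (by omega), show k + 2 - 1 - 1 = k by omega, yk, hbR]
  · rw [hx1 i h1 (by omega), hx1 (i + 1) (by omega) (by omega), show i + 1 - 1 = i - 1 + 1 by omega]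
    exact ys _ (by omega)
  · rw [hx1 i h1 (by omega), hx1 (i + 1) (by omega) (by omega), show i + 1 - 1 = i - 1 + 1 by omega]
    exact yne _ (by omega)
  · rw [hx1 i h1 (by omega), hx1 j (by omega) (by omega)]
    exact yfar _ _ (by omega) (by omega)
  · rw [hx1 i h1 h2]; exact (hy _ (by omega)).2.1
  · rw [hx1 i h1 h2]; exact (hy _ (by omega)).2.2

section Edges

variable {V : Type*}

/-- `v w` is a side of a member of the family. -/
def IsEdge (𝒯 : Finset (Finset V)) (v w : V) : Prop := v ≠ w ∧ ∃ T ∈ 𝒯, v ∈ T ∧ w ∈ T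

lemma IsEdge.symm {𝒯 : Finset (Finset V)} {v w : V} (h : IsEdge 𝒯 v w) : IsEdge 𝒯 w v := by
  obtain ⟨h1, T, hT, hv, hw⟩ := h
  exact ⟨h1.symm, T, hT, hw, hv⟩

variable [NormedAddCommGroup V] [NormedSpace ℝ V]

open Classical in
lemma exists_wt_segment {T : Finset V} {v w : V} (hv : v ∈ T) (hw : w ∈ T) (hvw : v ≠ w) {s : ℝ}
    (h0 : 0 ≤ s) (h1 : s ≤ 1) : ∃ u, Wt T u ∧ pt id T u = v + s • (w - v) ∧ u v = 1 - s ∧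
      u w = s ∧ ∀ i, i ≠ v → i ≠ w → u i = 0 := by
  have hu : Wt ({v, w} : Finset V) fun i => if i = v then 1 - s else if i = w then s else 0 := by
    refine ⟨fun i => ?_, fun i hi => ?_, ?_⟩
    · split_ifs <;> linarith
    · simp only [Finset.mem_insert, Finset.mem_singleton, not_or] at hi
      rw [if_neg hi.1, if_neg hi.2]
    · rw [Finset.sum_pair hvw, if_pos rfl, if_neg hvw.symm, if_pos rfl]; ring
  have hs : ({v, w} : Finset V) ⊆ T := by simp [Finset.insert_subset_iff, hv, hw]
  refine ⟨_, hu.mono hs, ?_, if_pos rfl, ?_, fun i hi hi' => ?_⟩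
  · rw [hu.pt_mono hs, pt, Finset.sum_pair hvw, if_pos rfl, if_neg hvw.symm, if_pos rfl, id, id]
    module
  · show (if _ then _ else _) = _
    rw [if_neg hvw.symm, if_pos rfl]
  · show (if _ then _ else _) = _
    rw [if_neg hi, if_neg hi']

variable {𝒯 : Finset (Finset V)} {d : ℝ}

lemma FacesApart.le_of_vertex (h : FacesApart 𝒯 d) (hd : 0 ≤ d) {T : Finset V} (hT : T ∈ 𝒯) {a : V}
    (ha : a ∈ T) {v w : V} (he : IsEdge 𝒯 v w) (hav : a ≠ v) (haw : a ≠ w) {y : V}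
    (hy : y ∈ segment ℝ v w) : d ≤ ‖a - y‖ := by
  classical
  obtain ⟨hvw, T', hT', hv, hw⟩ := he
  rw [segment_eq_image'] at hy
  obtain ⟨s, hs, rfl⟩ := hy
  obtain ⟨u, hu, hp, -, -, hu0⟩ := exists_wt_segment hv hw hvw hs.1 hs.2
  have hx : Wt T (fun i => if i = a then (1 : ℝ) else 0) := by
    refine ⟨fun i => by split_ifs <;> norm_num, fun i hi => if_neg ?_, ?_⟩
    · rintro rfl; exact hi ha
    · rw [Finset.sum_ite_eq' T a, if_pos ha]
  have hpx : pt id T (fun i => if i = a then (1 : ℝ) else 0) = a := by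
    simp only [pt, ite_smul, one_smul, zero_smul, id]
    rw [Finset.sum_ite_eq' T a, if_pos ha]
  have := h.bound hd hT hT' hx hu {a}
  rw [Finset.sum_singleton, Finset.sum_singleton, if_pos rfl, hu0 a hav haw, hpx, hp] at this
  linarith

lemma FacesApart.le_of_ne (h : FacesApart 𝒯 d) (hd : 0 ≤ d) {v w v' w' : V} (he : IsEdge 𝒯 v w)
    (he' : IsEdge 𝒯 v' w') (hne : ¬(v = v' ∧ w = w')) (hne' : ¬(v = w' ∧ w = v')) {s : ℝ}
    (h0 : 0 ≤ s) (h1 : s ≤ 1) {y : V} (hy : y ∈ segment ℝ v' w') :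
    min s (1 - s) * d ≤ ‖v + s • (w - v) - y‖ := by
  obtain ⟨hvw, T, hT, hv, hw⟩ := he
  obtain ⟨hvw', T', hT', hv', hw'⟩ := he'
  rw [segment_eq_image'] at hy
  obtain ⟨s', hs', rfl⟩ := hy
  obtain ⟨u, hu, hp, uv, uw, -⟩ := exists_wt_segment hv hw hvw h0 h1
  obtain ⟨u', hu', hp', -, -, hu0⟩ := exists_wt_segment hv' hw' hvw' hs'.1 hs'.2
  beta_reduce
  rw [← hp, ← hp']
  have key : (v ≠ v' ∧ v ≠ w') ∨ (w ≠ v' ∧ w ≠ w') := by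
    by_contra! k
    grind
  rcases key with k | k
  · have := h.bound hd hT hT' hu hu' {v}
    rw [Finset.sum_singleton, Finset.sum_singleton, hu0 v k.1 k.2, uv, sub_zero] at this
    exact (mul_le_mul_of_nonneg_right (min_le_right _ _) hd).trans this
  · have := h.bound hd hT hT' hu hu' {w}
    rw [Finset.sum_singleton, Finset.sum_singleton, hu0 w k.1 k.2, uw, sub_zero] at this
    exact (mul_le_mul_of_nonneg_right (min_le_left _ _) hd).trans this

/-- Two sides meet at most at their ends. -/
lemma FacesApart.edge_cases (h : FacesApart 𝒯 d) (hd : 0 < d) {v w v' w' : V} (he : IsEdge 𝒯 v w)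
    (he' : IsEdge 𝒯 v' w') {s s' : ℝ} (h0 : 0 ≤ s) (h1 : s ≤ 1) (h0' : 0 ≤ s') (h1' : s' ≤ 1)
    (heq : v + s • (w - v) = v' + s' • (w' - v')) :
    (v = v' ∧ w = w' ∧ s = s') ∨ (v = w' ∧ w = v' ∧ s = 1 - s') ∨
      ((s = 0 ∨ s = 1) ∧ (s' = 0 ∨ s' = 1)) := by
  have inj : ∀ {v w : V} {s s' : ℝ}, v ≠ w → v + s • (w - v) = v + s' • (w - v) → s = s' := by
    intro v w s s' hvw e
    have : (s - s') • (w - v) = 0 := by rw [sub_smul, sub_eq_zero]; exact add_left_cancel e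
    rcases smul_eq_zero.mp this with k | k
    · linarith
    · exact absurd (sub_eq_zero.mp k).symm hvw
  by_cases k : v = v' ∧ w = w'
  · obtain ⟨rfl, rfl⟩ := k
    exact Or.inl ⟨rfl, rfl, inj he.1 heq⟩
  by_cases k' : v = w' ∧ w = v'
  · obtain ⟨rfl, rfl⟩ := k'
    refine Or.inr (Or.inl ⟨rfl, rfl, inj he.1 (heq.trans ?_)⟩)
    module
  have hz : ∀ {s : ℝ}, 0 ≤ s → s ≤ 1 → min s (1 - s) * d ≤ 0 → s = 0 ∨ s = 1 := by
    intro s h0 h1 hm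
    rcases min_cases s (1 - s) with ⟨e, -⟩ | ⟨e, -⟩ <;> rw [e] at hm
    · left; nlinarith
    · right; nlinarith
  refine Or.inr (Or.inr ⟨hz h0 h1 ?_, hz h0' h1' ?_⟩)
  · have := h.le_of_ne hd.le he he' k k' h0 h1 (y := v' + s' • (w' - v'))
      (by rw [segment_eq_image']; exact ⟨s', ⟨h0', h1'⟩, rfl⟩)
    rwa [heq, sub_self, norm_zero] at this
  · have := h.le_of_ne hd.le he' he (fun e => k ⟨e.1.symm, e.2.symm⟩)
      (fun e => k' ⟨e.2.symm, e.1.symm⟩) h0' h1' (y := v + s • (w - v))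
      (by rw [segment_eq_image']; exact ⟨s, ⟨h0, h1⟩, rfl⟩)
    rwa [heq, sub_self, norm_zero] at this

/-- The points dividing the segment `v w` into `n` equal parts. -/
def node (n : ℕ) (v w : V) (i : ℕ) : V := v + ((i : ℝ) / n) • (w - v)

@[simp] lemma node_zero (n : ℕ) (v w : V) : node n v w 0 = v := by simp [node]

lemma node_self {n : ℕ} (hn : 0 < n) (v w : V) : node n v w n = w := by
  rw [node, div_self (by exact_mod_cast hn.ne')]; simp

lemma node_symm {n i : ℕ} (hn : 0 < n) (hi : i ≤ n) (v w : V) :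
    node n w v i = node n v w (n - i) := by
  have : (n : ℝ) ≠ 0 := by exact_mod_cast hn.ne'
  rw [node, node, Nat.cast_sub hi, sub_div, div_self this]
  module

lemma div_mem_Icc {n i : ℕ} (hi : i ≤ n) : 0 ≤ (i : ℝ) / n ∧ (i : ℝ) / n ≤ 1 :=
  ⟨by positivity, div_le_one_of_le₀ (by exact_mod_cast hi) (by positivity)⟩

lemma node_mem_segment {n i : ℕ} (hi : i ≤ n) (v w : V) : node n v w i ∈ segment ℝ v w := by
  rw [segment_eq_image']
  exact ⟨_, div_mem_Icc hi, rfl⟩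

lemma exists_of_mem_segment_node {n i : ℕ} {v w x : V}
    (hx : x ∈ segment ℝ (node n v w i) (node n v w (i + 1))) :
    ∃ s, (i : ℝ) / n ≤ s ∧ s ≤ (i + 1 : ℕ) / n ∧ x = v + s • (w - v) := by
  rw [segment_eq_image'] at hx
  obtain ⟨t, ht, rfl⟩ := hx
  have hn : (0 : ℝ) ≤ (n : ℝ)⁻¹ := by positivity
  refine ⟨(i + t) / n, ?_, ?_, ?_⟩
  · gcongr; linarith [ht.1]
  · push_cast; gcongr; linarith [ht.2]
  · simp only [node]; push_cast; module

/-- The partition points of the sides, `N v w` being the number of parts. -/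
def IsNode (𝒯 : Finset (Finset V)) (N : V → V → ℕ) (p : V) : Prop :=
  ∃ v w i, IsEdge 𝒯 v w ∧ i ≤ N v w ∧ p = node (N v w) v w i

/-- The oriented edges of the partitioned sides. -/
def IsSub (𝒯 : Finset (Finset V)) (N : V → V → ℕ) (e : V × V) : Prop :=
  ∃ v w i, IsEdge 𝒯 v w ∧ i < N v w ∧ e = (node (N v w) v w i, node (N v w) v w (i + 1))

lemma segOK_node_self {n i j : ℕ} (hn : 0 < n) {v w : V} (hvw : v ≠ w) :
    SegOK id (node n v w i) (node n v w (i + 1)) (node n v w j) (node n v w (j + 1)) := by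
  have hn' : (0 : ℝ) < n := by exact_mod_cast hn
  wlog hij : i ≤ j generalizing i j
  · exact (this (by omega)).symm
  rcases hij.eq_or_lt with rfl | hij
  · exact fun _ _ _ => Or.inl ⟨rfl, rfl⟩
  intro x hx hx'
  obtain ⟨s, -, hs2, rfl⟩ := exists_of_mem_segment_node hx
  obtain ⟨s', hs1', -, e⟩ := exists_of_mem_segment_node hx'
  have hss : s = s' := by
    have : (s - s') • (w - v) = 0 := by rw [sub_smul, sub_eq_zero]; exact add_left_cancel e
    rcases smul_eq_zero.mp this with k | k
    · linarith
    · exact absurd (sub_eq_zero.mp k).symm hvw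
  subst hss
  have h1 : (j : ℝ) ≤ (i + 1 : ℕ) := (div_le_div_iff_of_pos_right hn').mp (hs1'.trans hs2)
  have h2 : j = i + 1 := by
    have : j ≤ i + 1 := by exact_mod_cast h1
    omega
  subst h2
  refine Or.inr (Or.inr ⟨_, Or.inr rfl, Or.inl rfl, ?_⟩)
  rw [id, node, le_antisymm hs2 hs1']

lemma FacesApart.segOK_node (h : FacesApart 𝒯 d) (hd : 0 < d) {N : V → V → ℕ}
    (hN : ∀ v w, IsEdge 𝒯 v w → 0 < N v w ∧ N w v = N v w) {e e' : V × V}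
    (he : IsSub 𝒯 N e) (he' : IsSub 𝒯 N e') : SegOK id e.1 e.2 e'.1 e'.2 := by
  obtain ⟨v, w, i, he, hi, rfl⟩ := he
  obtain ⟨v', w', j, he', hj, rfl⟩ := he'
  by_cases k : v = v' ∧ w = w'
  · obtain ⟨rfl, rfl⟩ := k
    exact segOK_node_self (hN _ _ he).1 he.1
  by_cases k' : v = w' ∧ w = v'
  · obtain ⟨rfl, rfl⟩ := k'
    obtain ⟨hN0, hNs⟩ := hN _ _ he
    simp only [hNs] at hj ⊢
    rw [node_symm hN0 hj.le, node_symm hN0 (show j + 1 ≤ _ from hj)]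
    have := segOK_node_self (i := i) (j := N v w - (j + 1)) hN0 he.1
    rw [show N v w - (j + 1) + 1 = N v w - j by omega] at this
    exact this.swap_right
  have key : ∀ {v w : V} {i : ℕ} {s : ℝ}, i < N v w → (i : ℝ) / N v w ≤ s →
      s ≤ (i + 1 : ℕ) / N v w → s = 0 ∨ s = 1 →
      ∃ p, (p = node (N v w) v w i ∨ p = node (N v w) v w (i + 1)) ∧ v + s • (w - v) = p := by
    intro v w i s hi h1 h2 hs
    have hN : (0 : ℝ) < N v w := by exact_mod_cast (by omega : 0 < N v w)
    rcases hs with rfl | rfl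
    · have h0 : (i : ℝ) / N v w = 0 := le_antisymm h1 (by positivity)
      exact ⟨_, Or.inl rfl, by rw [node, h0]⟩
    · have h0 : ((i + 1 : ℕ) : ℝ) / N v w = 1 := le_antisymm (div_mem_Icc hi).2 h2
      exact ⟨_, Or.inr rfl, by rw [node, h0]⟩
  intro x hx hx'
  obtain ⟨s, hs1, hs2, rfl⟩ := exists_of_mem_segment_node hx
  obtain ⟨s', hs1', hs2', hxe⟩ := exists_of_mem_segment_node hx'
  rcases h.edge_cases hd he he' ((div_mem_Icc hi.le).1.trans hs1) (hs2.trans (div_mem_Icc hi).2)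
    ((div_mem_Icc hj.le).1.trans hs1') (hs2'.trans (div_mem_Icc hj).2) hxe with c | c | ⟨c, c'⟩
  · exact absurd ⟨c.1, c.2.1⟩ k
  · exact absurd ⟨c.1, c.2.1⟩ k'
  · obtain ⟨p, hp, hpe⟩ := key hi hs1 hs2 c
    obtain ⟨p', hp', hpe'⟩ := key hj hs1' hs2' c'
    have : p = p' := by rw [← hpe, ← hpe', hxe]
    exact Or.inr (Or.inr ⟨p, hp, this ▸ hp', hpe⟩)

end Edges

section Graph

/-- A subdivision of the sides of the members of the family. -/
structure IsSubdivision {V : Type*} [NormedAddCommGroup V] [NormedSpace ℝ V]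
    (𝒯 : Finset (Finset V)) (N : V → V → ℕ) (P : V → V → ℕ → V) : Prop where
  zero : ∀ v w, IsEdge 𝒯 v w → P v w 0 = v
  last : ∀ v w, IsEdge 𝒯 v w → P v w (N v w) = w
  mem : ∀ v w, IsEdge 𝒯 v w → ∀ i ≤ N v w, P v w i ∈ segment ℝ v w
  inj : ∀ v w, IsEdge 𝒯 v w → ∀ i ≤ N v w, ∀ j ≤ N v w, P v w i = P v w j → i = j
  symm : ∀ v w, IsEdge 𝒯 v w → ∀ i ≤ N v w, P w v i = P v w (N v w - i)

lemma IsSubdivision.congr {V : Type*} [NormedAddCommGroup V] [NormedSpace ℝ V]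
    {𝒯 : Finset (Finset V)} {N : V → V → ℕ} {P Q : V → V → ℕ → V} {d : ℝ}
    (hP : IsSubdivision 𝒯 N P) (hQ : IsSubdivision 𝒯 N Q) (h : FacesApart 𝒯 d) (hd : 0 < d)
    (hN : ∀ v w, IsEdge 𝒯 v w → N w v = N v w) {v w v' w' : V} (he : IsEdge 𝒯 v w)
    (he' : IsEdge 𝒯 v' w') {i j : ℕ} (hi : i ≤ N v w) (hj : j ≤ N v' w')
    (hij : P v w i = P v' w' j) : Q v w i = Q v' w' j := by
  by_cases k : v = v' ∧ w = w'
  · obtain ⟨rfl, rfl⟩ := k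
    rw [hP.inj v w he i hi j hj hij]
  by_cases k' : v = w' ∧ w = v'
  · obtain ⟨rfl, rfl⟩ := k'
    rw [hN _ _ he] at hj
    rw [hP.symm _ _ he j hj] at hij
    rw [hQ.symm _ _ he j hj, hP.inj v w he i hi _ (Nat.sub_le _ _) hij]
  have key : ∀ {v w : V} {i : ℕ} {s : ℝ}, IsEdge 𝒯 v w → i ≤ N v w → v + s • (w - v) = P v w i →
      s = 0 ∨ s = 1 → P v w i = Q v w i := by
    intro v w i s he hi hs h
    rcases h with rfl | rfl
    · have h0 : i = 0 := hP.inj v w he i hi 0 (Nat.zero_le _) (by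
        rw [hP.zero v w he, ← hs, zero_smul, add_zero])
      rw [h0, hP.zero v w he, hQ.zero v w he]
    · have h0 : i = N v w := hP.inj v w he i hi _ le_rfl (by
        rw [hP.last v w he, ← hs, one_smul, add_sub_cancel])
      rw [h0, hP.last v w he, hQ.last v w he]
  have hm := hP.mem v w he i hi
  have hm' := hP.mem v' w' he' j hj
  rw [segment_eq_image'] at hm hm'
  obtain ⟨s, hs, e⟩ := hm
  obtain ⟨s', hs', e'⟩ := hm'
  beta_reduce at e e'
  rcases h.edge_cases hd he he' hs.1 hs.2 hs'.1 hs'.2 (by rw [e, e', hij]) with c | c | ⟨c, c'⟩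
  · exact absurd ⟨c.1, c.2.1⟩ k
  · exact absurd ⟨c.1, c.2.1⟩ k'
  · rw [← key he hi e c, ← key he' hj e' c', hij]

lemma isSubdivision_node {V : Type*} [NormedAddCommGroup V] [NormedSpace ℝ V]
    {𝒯 : Finset (Finset V)} {N : V → V → ℕ} (hN : ∀ v w, IsEdge 𝒯 v w → 0 < N v w ∧ N w v = N v w) :
    IsSubdivision 𝒯 N fun v w => node (N v w) v w := by
  refine ⟨fun v w _ => node_zero _ _ _, fun v w he => node_self (hN v w he).1 _ _,
    fun v w _ i hi => node_mem_segment hi _ _, fun v w he i _ j _ hij => ?_, fun v w he i hi => ?_⟩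
  · have hn : (0 : ℝ) < N v w := by exact_mod_cast (hN v w he).1
    have : ((i : ℝ) / N v w - (j : ℝ) / N v w) • (w - v) = 0 := by
      rw [sub_smul, sub_eq_zero]; exact add_left_cancel hij
    rcases smul_eq_zero.mp this with k | k
    · rw [sub_eq_zero, div_left_inj' hn.ne'] at k
      exact_mod_cast k
    · exact absurd (sub_eq_zero.mp k).symm he.1
  · rw [(hN v w he).2]
    exact node_symm (hN v w he).1 hi _ _

lemma Chain.inj {g : E2 → ℂ} {R κ : ℝ} {v w : E2} {n : ℕ} {x : ℕ → E2} (h : Chain g R κ v w n x)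
    (hκ : 0 ≤ κ) (hR : 0 < R) (hvw : v ≠ w) {i j : ℕ} (hi : i ≤ n) (hj : j ≤ n)
    (hij : x i = x j) : i = j := by
  wlog hlt : i < j generalizing i j
  · by_contra hne
    exact hne (this hj hi hij.symm (by omega)).symm
  exfalso
  rcases Nat.eq_zero_or_pos i with rfl | h0
  · rcases hj.eq_or_lt with rfl | hj
    · exact hvw (by rw [← h.zero, hij, h.last])
    · have := h.left j hlt hj
      rw [← hij, h.zero, sub_self, norm_zero] at this
      linarith
  · rcases hj.eq_or_lt with rfl | hj
    · have := h.right i h0 hlt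
      rw [hij, h.last, sub_self, norm_zero] at this
      linarith
    · rcases (show i + 1 = j ∨ i + 2 ≤ j by omega) with rfl | h2
      · exact h.ne i h0 hj (by rw [hij])
      · have := h.far i j h0 h2 hj
        rw [hij, sub_self, norm_zero] at this
        linarith

lemma SegOK.of_comp {A V : Type*} [AddCommGroup V] [Module ℝ V] {g : A → V} {Ξ : ι → A} {S : Set ι}
    (hΞ : InjOn Ξ S) {a b c d : ι} (ha : a ∈ S) (hb : b ∈ S) (hc : c ∈ S) (hd : d ∈ S)
    (h : SegOK g (Ξ a) (Ξ b) (Ξ c) (Ξ d)) : SegOK (fun i => g (Ξ i)) a b c d := by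
  intro x hx hx'
  rcases h x hx hx' with ⟨h1, h2⟩ | ⟨h1, h2⟩ | ⟨i, hi, hi', rfl⟩
  · exact Or.inl ⟨hΞ ha hc h1, hΞ hb hd h2⟩
  · exact Or.inr (Or.inl ⟨hΞ ha hd h1, hΞ hb hc h2⟩)
  · refine Or.inr (Or.inr ?_)
    rcases hi with rfl | rfl <;> rcases hi' with k | k
    · exact ⟨a, Or.inl rfl, Or.inl (hΞ ha hc k), rfl⟩
    · exact ⟨a, Or.inl rfl, Or.inr (hΞ ha hd k), rfl⟩
    · exact ⟨b, Or.inr rfl, Or.inl (hΞ hb hc k), rfl⟩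
    · exact ⟨b, Or.inr rfl, Or.inr (hΞ hb hd k), rfl⟩

lemma FacesApart.le_of_vertices {V : Type*} [NormedAddCommGroup V] [NormedSpace ℝ V]
    {𝒯 : Finset (Finset V)} {d : ℝ} (h : FacesApart 𝒯 d) {T T' : Finset V}
    (hT : T ∈ 𝒯) (hT' : T' ∈ 𝒯) {a b : V} (ha : a ∈ T) (hb : b ∈ T') (hab : a ≠ b) :
    d ≤ ‖a - b‖ := by
  classical
  have key : ∀ {T : Finset V} {a : V}, a ∈ T → Wt T (fun i => if i = a then (1 : ℝ) else 0) ∧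
      pt id T (fun i => if i = a then (1 : ℝ) else 0) = a := by
    refine fun {T a} ha => ⟨⟨fun i => by split_ifs <;> norm_num, fun i hi => if_neg ?_, ?_⟩, ?_⟩
    · rintro rfl; exact hi ha
    · rw [Finset.sum_ite_eq' T a, if_pos ha]
    · simp only [pt, ite_smul, one_smul, zero_smul, id]
      rw [Finset.sum_ite_eq' T a, if_pos ha]
  have := h T hT T' hT' _ _ (key ha).1 (key hb).1 fun i => by
    by_cases hi : i = a
    · exact Or.inr (if_neg (hi ▸ hab))
    · exact Or.inl (if_neg hi)
  rwa [(key ha).2, (key hb).2] at this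

/-- The scales at which the image of the sides of a mesh is followed by broken lines. -/
structure Scales (Ω : Set E2) (g : E2 → ℂ) (ℓ d R κ ζ s : ℝ) (m : ℕ) : Prop where
  cont : ContinuousOn g Ω
  nonneg : 0 ≤ κ
  lt : κ < R
  apart : ∀ x ∈ Ω, ∀ y ∈ Ω, d ≤ ‖x - y‖ → 4 * R < ‖g x - g y‖
  zeta : ∀ x ∈ Ω, ∀ y ∈ Ω, R ≤ ‖g x - g y‖ → ζ ≤ ‖x - y‖
  far : ∀ x ∈ Ω, ∀ y ∈ Ω, ζ / ℓ * d ≤ ‖x - y‖ → κ < ‖g x - g y‖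
  step : ∀ x ∈ Ω, ∀ y ∈ Ω, ‖x - y‖ ≤ s → ‖g x - g y‖ ≤ κ
  pos : 1 ≤ m
  le : ℓ ≤ m * s

variable {Ω : Set E2} {𝒯 : Finset (Finset E2)} {ℓ d δ : ℝ}

lemma Mesh.segment_subset (hM : Mesh Ω 𝒯 ℓ d δ) {v w : E2} (he : IsEdge 𝒯 v w) :
    segment ℝ v w ⊆ Ω := by
  intro x hx
  obtain ⟨hvw, T, hT, hv, hw⟩ := he
  rw [segment_eq_image'] at hx
  obtain ⟨s, hs, rfl⟩ := hx
  obtain ⟨u, hu, hp, -⟩ := exists_wt_segment hv hw hvw hs.1 hs.2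
  exact (hM.cover _).mpr ⟨T, hT, u, hu, hp⟩

variable {g : E2 → ℂ} {R κ ζ s : ℝ} {m : ℕ}

lemma Scales.exists_chains (hS : Scales Ω g ℓ d R κ ζ s m) (hM : Mesh Ω 𝒯 ℓ d δ) :
    ∃ (N : E2 → E2 → ℕ) (X : E2 → E2 → ℕ → E2), ∀ v w, IsEdge 𝒯 v w →
      Chain g R κ v w (N v w) (X v w) ∧ N v w ≤ m + 2 ∧ N w v = N v w ∧
        ∀ i ≤ N v w, X w v i = X v w (N v w - i) := by
  classical
  have h1 : ∀ v w, ∃ (n : ℕ) (x : ℕ → E2), IsEdge 𝒯 v w → n ≤ m + 2 ∧ Chain g R κ v w n x := by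
    intro v w
    by_cases he : IsEdge 𝒯 v w
    · have hsub := hM.segment_subset he
      obtain ⟨hvw, T, hT, hv, hw⟩ := id he
      have hR : 0 < R := hS.nonneg.trans_lt hS.lt
      have hd := hS.apart v (hsub (left_mem_segment _ _ _)) w (hsub (right_mem_segment _ _ _))
        (hM.sep.le_of_vertices hT hT hv hw hvw)
      obtain ⟨n, hn, x, hx⟩ := exists_chain (hS.cont.mono hsub) hR (by linarith) hS.pos
        ((hM.diam T hT v hv w hw).trans hS.le)
        (fun x hx y hy => hS.step x (hsub hx) y (hsub hy))
      exact ⟨n, x, fun _ => ⟨hn, hx⟩⟩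
    · exact ⟨0, fun _ => v, fun h => absurd h he⟩
  choose n x hx using h1
  refine ⟨fun v w => if WellOrderingRel v w then n v w else n w v,
    fun v w i => if WellOrderingRel v w then x v w i else x w v (n w v - i), fun v w he => ?_⟩
  rcases trichotomous_of WellOrderingRel v w with h | h | h
  · have h' : ¬ WellOrderingRel w v := asymm_of _ h
    simp only [if_pos h, if_neg h']
    exact ⟨(hx v w he).2, (hx v w he).1, trivial, fun i _ => trivial⟩
  · exact absurd h he.1
  · have h' : ¬ WellOrderingRel v w := asymm_of _ h
    simp only [if_pos h, if_neg h']
    refine ⟨(hx w v he.symm).2.reverse, (hx w v he.symm).1, trivial, fun i hi => ?_⟩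
    rw [Nat.sub_sub_self hi]

/-- The images of the sides of a fine mesh can be replaced by broken lines which meet only where
the sides do. -/
theorem Scales.exists_graph (hS : Scales Ω g ℓ d R κ ζ s m) (hM : Mesh Ω 𝒯 ℓ d δ) (hd : 0 < d) :
    ∃ (N : E2 → E2 → ℕ) (Ξ : E2 → E2),
      (∀ v w, IsEdge 𝒯 v w → 3 ≤ N v w ∧ N v w ≤ m + 2 ∧ N w v = N v w ∧ Ξ v = v) ∧
      (∀ v w, IsEdge 𝒯 v w → ∀ i ≤ N v w, Ξ (node (N v w) v w i) ∈ segment ℝ v w) ∧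
      InjOn Ξ {p | IsNode 𝒯 N p} ∧
      (∀ e, IsSub 𝒯 N e → ‖g (Ξ e.1) - g (Ξ e.2)‖ ≤ R) ∧
      ∀ e e', IsSub 𝒯 N e → IsSub 𝒯 N e' →
        SegOK (fun p => g (Ξ p)) e.1 e.2 e'.1 e'.2 := by
  classical
  have hR : 0 < R := hS.nonneg.trans_lt hS.lt
  obtain ⟨N, X, hX⟩ := hS.exists_chains hM
  have hN : ∀ v w, IsEdge 𝒯 v w → 0 < N v w ∧ N w v = N v w := fun v w he =>
    ⟨by have := (hX v w he).1.three; omega, (hX v w he).2.2.1⟩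
  have hQ : IsSubdivision 𝒯 N X :=
    ⟨fun v w he => (hX v w he).1.zero, fun v w he => (hX v w he).1.last,
      fun v w he => (hX v w he).1.mem,
      fun v w he i hi j hj => (hX v w he).1.inj hS.nonneg hR he.1 hi hj,
      fun v w he => (hX v w he).2.2.2⟩
  have hP := isSubdivision_node hN
  have hN' := fun v w he => (hN v w he).2
  have hex : ∃ Ξ : E2 → E2, ∀ v w i, IsEdge 𝒯 v w → i ≤ N v w →
      Ξ (node (N v w) v w i) = X v w i := by
    refine ⟨fun p => if h : ∃ t : E2 × E2 × ℕ, IsEdge 𝒯 t.1 t.2.1 ∧ t.2.2 ≤ N t.1 t.2.1 ∧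
      p = node (N t.1 t.2.1) t.1 t.2.1 t.2.2 then X h.choose.1 h.choose.2.1 h.choose.2.2 else p,
      fun v w i he hi => ?_⟩
    have h : ∃ t : E2 × E2 × ℕ, IsEdge 𝒯 t.1 t.2.1 ∧ t.2.2 ≤ N t.1 t.2.1 ∧
      node (N v w) v w i = node (N t.1 t.2.1) t.1 t.2.1 t.2.2 := ⟨(v, w, i), he, hi, rfl⟩
    beta_reduce
    rw [dif_pos h]
    obtain ⟨h1, h2, h3⟩ := h.choose_spec
    exact (hP.congr hQ hM.sep hd hN' he h1 hi h2 h3).symm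
  obtain ⟨Ξ, hΞ⟩ := hex
  have hinj : InjOn Ξ {p | IsNode 𝒯 N p} := by
    rintro p ⟨v, w, i, he, hi, rfl⟩ q ⟨v', w', j, he', hj, rfl⟩ hpq
    rw [hΞ v w i he hi, hΞ v' w' j he' hj] at hpq
    exact hQ.congr hP hM.sep hd hN' he he' hi hj hpq
  refine ⟨N, Ξ, fun v w he => ⟨(hX v w he).1.three, (hX v w he).2.1, (hN v w he).2, ?_⟩,
    fun v w he i hi => by rw [hΞ v w i he hi]; exact hQ.mem v w he i hi, hinj, ?_, ?_⟩
  · have := hΞ v w 0 he (Nat.zero_le _)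
    rwa [node_zero, hQ.zero v w he] at this
  · rintro e ⟨v, w, i, he, hi, rfl⟩
    simp only
    rw [hΞ v w i he hi.le, hΞ v w _ he hi]
    exact (hX v w he).1.step_le hS.lt.le hi
  have hmem : ∀ {v w : E2} {i : ℕ}, IsEdge 𝒯 v w → i ≤ N v w → X v w i ∈ Ω :=
    fun he hi => hM.segment_subset he (hQ.mem _ _ he _ hi)
  have hv0 : ∀ {v w a : E2}, IsEdge 𝒯 v w → (a = v ∨ a = w) → a ∈ Ω ∧ ∃ T ∈ 𝒯, a ∈ T := by
    intro v w a he ha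
    refine ⟨hM.segment_subset he ?_, ?_⟩
    · rcases ha with rfl | rfl
      exacts [left_mem_segment _ _ _, right_mem_segment _ _ _]
    · obtain ⟨-, T, hT, hv, hw⟩ := he
      exact ⟨T, hT, by rcases ha with rfl | rfl <;> assumption⟩
  have hlong : ∀ {v w : E2}, IsEdge 𝒯 v w → 2 * R < ‖g v - g w‖ := by
    intro v w he
    obtain ⟨hvw, T, hT, hv, hw⟩ := id he
    have := hS.apart v (hv0 he (Or.inl rfl)).1 w (hv0 he (Or.inr rfl)).1
      (hM.sep.le_of_vertices hT hT hv hw hvw)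
    linarith
  have hvert : ∀ {v w v' w' : E2}, IsEdge 𝒯 v w → IsEdge 𝒯 v' w' → ∀ a, a = v ∨ a = w →
      a ≠ v' → a ≠ w' → ∀ j ≤ N v' w', R + κ < ‖g a - g (X v' w' j)‖ := by
    intro v w v' w' he he' a ha h1 h2 j hj
    obtain ⟨haΩ, T, hT, haT⟩ := hv0 he ha
    have := hS.apart a haΩ _ (hmem he' hj)
      (hM.sep.le_of_vertex hd.le hT haT he' h1 h2 (hQ.mem v' w' he' j hj))
    linarith [hS.lt]
  rintro e e' ⟨v, w, i, he, hi, rfl⟩ ⟨v', w', j, he', hj, rfl⟩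
  refine SegOK.of_comp (S := {p | IsNode 𝒯 N p}) hinj ⟨v, w, i, he, hi.le, rfl⟩
    ⟨v, w, _, he, hi, rfl⟩ ⟨v', w', j, he', hj.le, rfl⟩ ⟨v', w', _, he', hj, rfl⟩ ?_
  rw [hΞ v w i he hi.le, hΞ v w _ he hi, hΞ v' w' j he' hj.le, hΞ v' w' _ he' hj]
  by_cases k : v = v' ∧ w = w'
  · obtain ⟨rfl, rfl⟩ := k
    exact (hX v w he).1.segOK_self hS.lt (hlong he) hi hj
  by_cases k' : v = w' ∧ w = v'
  · obtain ⟨rfl, rfl⟩ := k'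
    rw [(hN v w he).2] at hj
    rw [hQ.symm _ _ he _ hj.le, hQ.symm _ _ he _ hj]
    have := (hX v w he).1.segOK_self hS.lt (hlong he) hi (show N v w - (j + 1) < _ by omega)
    rw [show N v w - (j + 1) + 1 = N v w - j by omega] at this
    exact this.swap_right
  refine (hX v w he).1.segOK (hX v' w' he').1 hS.nonneg ?_ ?_ (hvert he he') (hvert he' he) hi hj
  · intro i j h1 h2 h1' h2'
    refine hS.far _ (hmem he h2.le) _ (hmem he' h2'.le) ?_
    have hm := hQ.mem v w he i h2.le
    rw [segment_eq_image'] at hm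
    obtain ⟨t, ht, e⟩ := hm
    beta_reduce at e
    have hℓ : ‖w - v‖ ≤ ℓ := by
      obtain ⟨-, T, hT, hv, hw⟩ := he
      exact hM.diam T hT w hw v hv
    have hvw : 0 < ‖w - v‖ := norm_pos_iff.mpr (sub_ne_zero.mpr he.1.symm)
    have hz1 := hS.zeta _ (hmem he h2.le) v (hv0 he (Or.inl rfl)).1 ((hX v w he).1.left i h1 h2)
    have hz2 := hS.zeta _ (hmem he h2.le) w (hv0 he (Or.inr rfl)).1 ((hX v w he).1.right i h1 h2)
    rw [← e, show v + t • (w - v) - v = t • (w - v) by module, norm_smul, Real.norm_eq_abs,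
      abs_of_nonneg ht.1] at hz1
    rw [← e, show v + t • (w - v) - w = (t - 1) • (w - v) by module, norm_smul, Real.norm_eq_abs,
      abs_sub_comm, abs_of_nonneg (by linarith [ht.2])] at hz2
    have := hM.sep.le_of_ne hd.le he he' k k' ht.1 ht.2 (hQ.mem v' w' he' j h2'.le)
    rw [e] at this
    refine le_trans (mul_le_mul_of_nonneg_right (le_min ?_ ?_) hd.le) this
    · rw [div_le_iff₀ (hvw.trans_le hℓ)]
      exact hz1.trans (mul_le_mul_of_nonneg_left hℓ ht.1)
    · rw [div_le_iff₀ (hvw.trans_le hℓ)]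
      exact hz2.trans (mul_le_mul_of_nonneg_left hℓ (by linarith [ht.2]))
  · intro a ha b hb hab
    obtain ⟨haΩ, T, hT, haT⟩ := hv0 he ha
    obtain ⟨hbΩ, T', hT', hbT⟩ := hv0 he' hb
    have := hS.apart a haΩ b hbΩ (hM.sep.le_of_vertices hT hT' haT hbT hab)
    linarith

end Graph

section Loops

lemma pathEdges_map_range (f : ℕ → ι) (n : ℕ) : pathEdges ((List.range n).map f ++ [f n]) =
    (List.range n).map fun i => (f i, f (i + 1)) := by
  induction n with
  | zero => rfl
  | succ n ih =>
    rw [List.range_succ, List.map_append, List.map_append, ← ih, List.append_assoc]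
    exact pathEdges_append _ _ _

variable (N : E2 → E2 → ℕ) (b : E2 → ι)

/-- The labels of the partition points of a side, without the last one. -/
def side (v w : E2) : List ι := (List.range (N v w)).map fun i => b (node (N v w) v w i)

/-- The labels of the partition points of the boundary of a triangle. -/
def loop (A B C : E2) : List ι := side N b A B ++ (side N b B C ++ side N b C A)

/-- The sides of a triangle. -/
def sides (A B C : E2) : List (E2 × E2) := [(A, B), (B, C), (C, A)]

/-- The labels of the partition points of a side, without the ends. -/
def midSide (v w : E2) : List ι :=
  (List.range (N v w - 1)).map fun i => b (node (N v w) v w (i + 1))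

variable {N b}

lemma side_eq_cons {v w : E2} (h : 0 < N v w) : side N b v w = b v :: midSide N b v w := by
  obtain ⟨n, hn⟩ : ∃ n, N v w = n + 1 := ⟨N v w - 1, by omega⟩
  rw [side, midSide, hn, List.range_succ_eq_map, List.map_cons, node_zero, List.map_map]
  rfl

lemma pathEdges_side {v w : E2} (h : 0 < N v w) :
    pathEdges (b v :: midSide N b v w ++ [b w]) = (List.range (N v w)).map fun i =>
      (b (node (N v w) v w i), b (node (N v w) v w (i + 1))) := by
  have := pathEdges_map_range (fun i => b (node (N v w) v w i)) (N v w)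
  simp only [node_self h] at this
  rw [← side_eq_cons h, side, this]

variable {A B C : E2}

lemma polyEdges_loop (h : ∀ f ∈ sides A B C, 0 < N f.1 f.2) : polyEdges (loop N b A B C) =
    pathEdges (b A :: midSide N b A B ++ [b B]) ++ (pathEdges (b B :: midSide N b B C ++ [b C]) ++
      pathEdges (b C :: midSide N b C A ++ [b A])) := by
  have h1 := h (A, B) (by simp [sides])
  have h2 := h (B, C) (by simp [sides])
  have h3 := h (C, A) (by simp [sides])
  rw [loop, side_eq_cons h1, side_eq_cons h2, side_eq_cons h3,
    List.cons_append (as := midSide N b B C), polyEdges_append_cons]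
  congr 1
  rw [← List.cons_append, List.append_assoc]
  exact pathEdges_append _ _ _

lemma mem_polyEdges_loop (h : ∀ f ∈ sides A B C, 0 < N f.1 f.2) {e : ι × ι} :
    e ∈ polyEdges (loop N b A B C) ↔ ∃ f ∈ sides A B C, ∃ i < N f.1 f.2,
      e = (b (node (N f.1 f.2) f.1 f.2 i), b (node (N f.1 f.2) f.1 f.2 (i + 1))) := by
  rw [polyEdges_loop h, pathEdges_side (h (A, B) (by simp [sides])),
    pathEdges_side (h (B, C) (by simp [sides])), pathEdges_side (h (C, A) (by simp [sides]))]
  simp [sides, eq_comm]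

lemma mem_loop {a : ι} : a ∈ loop N b A B C ↔
    ∃ f ∈ sides A B C, ∃ i < N f.1 f.2, a = b (node (N f.1 f.2) f.1 f.2 i) := by
  simp [loop, side, sides, eq_comm]

lemma three_le_length_loop (h : ∀ f ∈ sides A B C, 0 < N f.1 f.2) :
    3 ≤ (loop N b A B C).length := by
  have h1 := h (A, B) (by simp [sides])
  have h2 := h (B, C) (by simp [sides])
  have h3 := h (C, A) (by simp [sides])
  simp only [loop, side, List.length_append, List.length_map, List.length_range]
  simp only at h1 h2 h3
  omega

/-- `A B C` are the vertices of `T`. -/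
structure IsTri (T : Finset E2) (A B C : E2) : Prop where
  ab : A ≠ B
  bc : B ≠ C
  ca : C ≠ A
  mem : ∀ x, x ∈ T ↔ x = A ∨ x = B ∨ x = C

variable {𝒯 : Finset (Finset E2)} {d : ℝ} {T T' : Finset E2} {A' B' C' : E2}

lemma IsTri.isEdge (h : IsTri T A B C) (hT : T ∈ 𝒯) : ∀ f ∈ sides A B C, IsEdge 𝒯 f.1 f.2 := by
  have hm := h.mem
  intro f hf
  simp only [sides, List.mem_cons, List.not_mem_nil, or_false] at hf
  rcases hf with rfl | rfl | rfl
  · exact ⟨h.ab, T, hT, by simp [hm], by simp [hm]⟩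
  · exact ⟨h.bc, T, hT, by simp [hm], by simp [hm]⟩
  · exact ⟨h.ca, T, hT, by simp [hm], by simp [hm]⟩

lemma IsTri.mem_sides (h : IsTri T A B C) {v w : E2} (hv : v ∈ T) (hw : w ∈ T) (hvw : v ≠ w) :
    (v, w) ∈ sides A B C ∨ (w, v) ∈ sides A B C := by
  rw [h.mem] at hv hw
  simp only [sides, List.mem_cons, List.not_mem_nil, or_false, Prod.mk.injEq]
  rcases hv with rfl | rfl | rfl <;> rcases hw with rfl | rfl | rfl <;> simp_all

lemma IsTri.mem_of_sides (h : IsTri T A B C) {f : E2 × E2} (hf : f ∈ sides A B C) :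
    f.1 ∈ T ∧ f.2 ∈ T := by
  have hm := h.mem
  simp only [sides, List.mem_cons, List.not_mem_nil, or_false] at hf
  rcases hf with rfl | rfl | rfl <;> simp [hm]

lemma IsTri.exists_side (h : IsTri T A B C) {v : E2} (hv : v ∈ T) : ∃ w, (v, w) ∈ sides A B C := by
  rw [h.mem] at hv
  rcases hv with rfl | rfl | rfl
  exacts [⟨B, by simp [sides]⟩, ⟨C, by simp [sides]⟩, ⟨A, by simp [sides]⟩]

/-- Partition points of different sides differ. -/
lemma FacesApart.node_ne (h : FacesApart 𝒯 d) (hd : 0 < d) {v w v' w' : E2} (he : IsEdge 𝒯 v w)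
    (he' : IsEdge 𝒯 v' w') (hne : ¬(v = v' ∧ w = w')) (hne' : ¬(v = w' ∧ w = v')) {n n' i j : ℕ}
    (hi0 : 0 < i) (hi : i < n) (hj : j ≤ n') : node n v w i ≠ node n' v' w' j := by
  intro heq
  have hn : (0 : ℝ) < n := by exact_mod_cast (by omega : 0 < n)
  rcases h.edge_cases hd he he' (div_mem_Icc hi.le).1 (div_mem_Icc hi.le).2 (div_mem_Icc hj).1
    (div_mem_Icc hj).2 heq with c | c | ⟨c | c, -⟩
  · exact hne ⟨c.1, c.2.1⟩
  · exact hne' ⟨c.1, c.2.1⟩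
  · rw [div_eq_zero_iff] at c
    rcases c with c | c
    · exact hi0.ne' (by exact_mod_cast c)
    · exact hn.ne' c
  · rw [div_eq_one_iff_eq hn.ne'] at c
    exact hi.ne (by exact_mod_cast c)

lemma node_ne_of_ne (h : FacesApart 𝒯 d) (hd : 0 < d) {v w v' w' : E2} (he : IsEdge 𝒯 v w)
    (he' : IsEdge 𝒯 v' w') (hv : v ≠ v') (hne' : ¬(v = w' ∧ w = v')) {n n' i j : ℕ}
    (hi : i < n) (hj : j < n') : node n v w i ≠ node n' v' w' j := by
  rcases Nat.eq_zero_or_pos i with rfl | hi0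
  · rcases Nat.eq_zero_or_pos j with rfl | hj0
    · rwa [node_zero, node_zero]
    · exact (h.node_ne hd he' he (fun k => hv k.1.symm) (fun k => hne' ⟨k.2.symm, k.1.symm⟩) hj0 hj
        hi.le).symm
  · exact h.node_ne hd he he' (fun k => hv k.1) hne' hi0 hi hj.le

/-- The number of parts of each side is at least two and does not depend on its orientation. -/
def Symm (𝒯 : Finset (Finset E2)) (N : E2 → E2 → ℕ) : Prop :=
  ∀ v w, IsEdge 𝒯 v w → 2 ≤ N v w ∧ N w v = N v w

lemma Symm.pos (hN : Symm 𝒯 N) (hT : T ∈ 𝒯) (hABC : IsTri T A B C) :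
    ∀ f ∈ sides A B C, 0 < N f.1 f.2 :=
  fun f hf => by have := (hN _ _ (hABC.isEdge hT f hf)).1; omega

lemma SegOK.of_map {V : Type*} [AddCommGroup V] [Module ℝ V] {r : ι → V} {p q p' q' : E2}
    (h : SegOK (fun a => r (b a)) p q p' q') : SegOK r (b p) (b q) (b p') (b q') := by
  intro x hx hx'
  rcases h x hx hx' with ⟨h1, h2⟩ | ⟨h1, h2⟩ | ⟨i, hi, hi', rfl⟩
  · exact Or.inl ⟨by rw [h1], by rw [h2]⟩
  · exact Or.inr (Or.inl ⟨by rw [h1], by rw [h2]⟩)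
  · exact Or.inr (Or.inr ⟨b i, hi.imp (congrArg b) (congrArg b), hi'.imp (congrArg b) (congrArg b),
      rfl⟩)

lemma IsTri.isSub (hABC : IsTri T A B C) (hN : Symm 𝒯 N) (hT : T ∈ 𝒯) {e : ι × ι}
    (he : e ∈ polyEdges (loop N b A B C)) :
    ∃ p q, IsSub 𝒯 N (p, q) ∧ e = (b p, b q) := by
  obtain ⟨f, hf, i, hi, rfl⟩ := (mem_polyEdges_loop (hN.pos hT hABC)).mp he
  exact ⟨_, _, ⟨f.1, f.2, i, hABC.isEdge hT f hf, hi, rfl⟩, rfl⟩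

lemma IsTri.isNode (hABC : IsTri T A B C) (hT : T ∈ 𝒯) {a : ι}
    (ha : a ∈ loop N b A B C) : ∃ p, IsNode 𝒯 N p ∧ a = b p := by
  obtain ⟨f, hf, i, hi, rfl⟩ := mem_loop.mp ha
  exact ⟨_, ⟨f.1, f.2, i, hABC.isEdge hT f hf, hi.le, rfl⟩, rfl⟩

lemma loop_nodup (h : FacesApart 𝒯 d) (hd : 0 < d) (hN : Symm 𝒯 N) (hb : Function.Injective b)
    (hT : T ∈ 𝒯) (hABC : IsTri T A B C) : (loop N b A B C).Nodup := by
  have he := hABC.isEdge hT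
  have h1 := he (A, B) (by simp [sides])
  have h2 := he (B, C) (by simp [sides])
  have h3 := he (C, A) (by simp [sides])
  have hs : ∀ v w, IsEdge 𝒯 v w → (side N b v w).Nodup := fun v w he =>
    List.Nodup.map_on (fun i hi j hj hij => (isSubdivision_node fun v w he =>
      ⟨by have := (hN v w he).1; omega, (hN v w he).2⟩).inj v w he i (List.mem_range.mp hi).le j
        (List.mem_range.mp hj).le (hb hij)) List.nodup_range
  have hdj : ∀ {v w v' w'}, IsEdge 𝒯 v w → IsEdge 𝒯 v' w' → v ≠ v' → ¬(v = w' ∧ w = v') →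
      List.Disjoint (side N b v w) (side N b v' w') := by
    intro v w v' w' he he' h1 h2 x hx hx'
    simp only [side, List.mem_map, List.mem_range] at hx hx'
    obtain ⟨i, hi, rfl⟩ := hx
    obtain ⟨j, hj, hij⟩ := hx'
    exact node_ne_of_ne h hd he he' h1 h2 hi hj (hb hij).symm
  refine (hs _ _ h1).append ((hs _ _ h2).append (hs _ _ h3) ?_) ?_
  · exact hdj h2 h3 hABC.bc fun k => hABC.ab k.1.symm
  · exact List.disjoint_append_right.mpr ⟨hdj h1 h2 hABC.ab fun k => hABC.ca k.1.symm,
      hdj h1 h3 hABC.ca.symm fun k => hABC.bc k.2⟩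

lemma loop_simplePoly (h : FacesApart 𝒯 d) (hd : 0 < d) (hN : Symm 𝒯 N) (hb : Function.Injective b)
    {r : ι → ℂ} (hT : T ∈ 𝒯) (hABC : IsTri T A B C)
    (hinj : InjOn (fun p => r (b p)) {p | IsNode 𝒯 N p})
    (hok : ∀ e e', IsSub 𝒯 N e → IsSub 𝒯 N e' →
      SegOK (fun p => r (b p)) e.1 e.2 e'.1 e'.2) : SimplePoly r (loop N b A B C) := by
  refine ⟨loop_nodup h hd hN hb hT hABC, fun a ha a' ha' haa => ?_, fun e he e' he' => ?_⟩
  · obtain ⟨p, hp, rfl⟩ := hABC.isNode hT ha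
    obtain ⟨p', hp', rfl⟩ := hABC.isNode hT ha'
    exact congrArg b (hinj hp hp' haa)
  · obtain ⟨p, q, hs, rfl⟩ := hABC.isSub hN hT he
    obtain ⟨p', q', hs', rfl⟩ := hABC.isSub hN hT he'
    exact (hok _ _ hs hs').of_map

lemma vertex_notMem_loop (h : FacesApart 𝒯 d) (hd : 0 < d) (hb : Function.Injective b)
    (hT : T ∈ 𝒯) (hT' : T' ∈ 𝒯) (hABC : IsTri T A B C) {v : E2} (hv' : v ∈ T')
    (hv : v ∉ T) : b v ∉ loop N b A B C := by
  intro hm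
  obtain ⟨f, hf, i, hi, hbi⟩ := mem_loop.mp hm
  obtain ⟨h1, h2⟩ := hABC.mem_of_sides hf
  have := h.le_of_vertex hd.le hT' hv' (hABC.isEdge hT f hf) (fun k => hv (k ▸ h1))
    (fun k => hv (k ▸ h2)) (node_mem_segment hi.le f.1 f.2)
  rw [← hb hbi, sub_self, norm_zero] at this
  linarith

/-- The polygons of different triangles are outside of each other. -/
lemma outside_loop (h : FacesApart 𝒯 d) (hd : 0 < d) (hN : Symm 𝒯 N) (hb : Function.Injective b)
    {r : ι → ℂ} (hT : T ∈ 𝒯) (hT' : T' ∈ 𝒯) (hABC : IsTri T A B C)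
    (hABC' : IsTri T' A' B' C') (hne : ∃ v ∈ T', v ∉ T)
    (hok : ∀ e e', IsSub 𝒯 N e → IsSub 𝒯 N e' →
      SegOK (fun p => r (b p)) e.1 e.2 e'.1 e'.2)
    (hw : ∀ v ∈ T', v ∉ T → wind r (polyEdges (loop N b A B C)) (r (b v)) = 0) :
    Outside r (loop N b A B C) (loop N b A' B' C') := by
  refine ⟨fun e he e' he' => ?_, fun e he => ?_, ?_⟩
  · obtain ⟨p, q, hs, rfl⟩ := hABC.isSub hN hT he
    obtain ⟨p', q', hs', rfl⟩ := hABC'.isSub hN hT' he'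
    exact (hok _ _ hs hs').of_map
  · obtain ⟨f, hf, i, hi, rfl⟩ := (mem_polyEdges_loop (hN.pos hT' hABC')).mp he
    have hed := hABC'.isEdge hT' f hf
    obtain ⟨hN2, hNs⟩ := hN _ _ hed
    have hf' := hABC'.mem_of_sides hf
    by_cases hc : f.1 ∈ T ∧ f.2 ∈ T
    · rcases hABC.mem_sides hc.1 hc.2 hed.1 with k | k
      · exact Or.inl ((mem_polyEdges_loop (hN.pos hT hABC)).mpr ⟨f, k, i, hi, rfl⟩)
      · refine Or.inr (Or.inl ((mem_polyEdges_loop (hN.pos hT hABC)).mpr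
          ⟨_, k, N f.1 f.2 - (i + 1), by rw [hNs]; omega, ?_⟩))
        simp only [hNs]
        rw [node_symm (by omega) (Nat.sub_le _ _) f.1 f.2,
          node_symm (by omega) (show N f.1 f.2 - (i + 1) + 1 ≤ _ by omega) f.1 f.2,
          show N f.1 f.2 - (N f.1 f.2 - (i + 1)) = i + 1 by omega,
          show N f.1 f.2 - (N f.1 f.2 - (i + 1) + 1) = i by omega]
    · have hv : ∃ v, (v = f.1 ∨ v = f.2) ∧ v ∈ T' ∧ v ∉ T := by
        rw [not_and_or] at hc
        rcases hc with k | k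
        exacts [⟨_, Or.inl rfl, hf'.1, k⟩, ⟨_, Or.inr rfl, hf'.2, k⟩]
      obtain ⟨v, hv, hvT', hvT⟩ := hv
      have hp := pathEdges_side (N := N) (b := b) (v := f.1) (w := f.2) (by omega)
      refine Or.inr (Or.inr ⟨b f.1, midSide N b f.1 f.2, b f.2, ?_, ?_, fun e' he' => ?_,
        fun x hx => ?_, b v, hv.imp (congrArg b) (congrArg b),
        vertex_notMem_loop h hd hb hT hT' hABC hvT' hvT, hw v hvT' hvT⟩)
      · simp only [midSide, ne_eq, List.map_eq_nil_iff, List.range_eq_nil]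
        omega
      · rw [hp]
        exact List.mem_map.mpr ⟨i, List.mem_range.mpr hi, rfl⟩
      · rw [hp] at he'
        obtain ⟨j, hj, rfl⟩ := List.mem_map.mp he'
        exact (mem_polyEdges_loop (hN.pos hT' hABC')).mpr ⟨f, hf, j, List.mem_range.mp hj, rfl⟩
      · obtain ⟨j, hj, rfl⟩ := List.mem_map.mp hx
        rw [List.mem_range] at hj
        intro hm
        obtain ⟨f', hf', k, hk, hbk⟩ := mem_loop.mp hm
        obtain ⟨h1, h2⟩ := hABC.mem_of_sides hf'
        refine h.node_ne hd hed (hABC.isEdge hT f' hf') ?_ ?_ (Nat.succ_pos j) (by omega) hk.le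
          (hb hbk)
        · exact fun k => hc ⟨k.1 ▸ h1, k.2 ▸ h2⟩
        · exact fun k => hc ⟨k.1 ▸ h2, k.2 ▸ h1⟩
  · obtain ⟨v, hv', hv⟩ := hne
    obtain ⟨w, hw'⟩ := hABC'.exists_side hv'
    exact ⟨b v, mem_loop.mpr ⟨(v, w), hw', 0, hN.pos hT' hABC' _ hw', by rw [node_zero]⟩,
      vertex_notMem_loop h hd hb hT hT' hABC hv' hv, hw v hv' hv⟩

end Loops

lemma wind_eq_zero_of_notMem_convex {r : ι → ℂ} {l : List ι} {S : Set ℂ} (hS : Convex ℝ S)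
    (hc : IsClosed S) (hl : ∀ a ∈ l, r a ∈ S) {y : ℂ} (hy : y ∉ S) :
    wind r (polyEdges l) y = 0 := by
  obtain ⟨f, u, hu, hf⟩ := geometric_hahn_banach_point_closed hS hc hy
  refine wind_eq_zero_of_halfPlane (w := f 1 - f Complex.I * Complex.I) fun a ha => ?_
  have h1 : ∀ z : ℂ, (z * (f 1 - f Complex.I * Complex.I)).re = f z := by
    intro z
    conv_rhs => rw [← Complex.re_add_im z, show (z.re : ℂ) + z.im * Complex.I =
      z.re • (1 : ℂ) + z.im • Complex.I by simp, map_add, map_smul, map_smul]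
    simp
  rw [h1, map_sub]
  linarith [hf _ (hl a ha)]

/-- A polygon which can be contracted away from `y` with short edges does not wind about `y`. -/
lemma wind_eq_zero_of_contract {V : Type*} {S : Set V} [NormedAddCommGroup V] [NormedSpace ℝ V]
    (hS : Convex ℝ S) {g : V → ℂ} (hg : ContinuousOn g S) {ξ : ι → V} {l : List ι}
    (hl : ∀ a ∈ l, ξ a ∈ S) {c : V} (hc : c ∈ S) {y : ℂ}
    (h : ∀ e ∈ polyEdges l, ∀ t ∈ Icc (0 : ℝ) 1,
      ‖g (c + t • (ξ e.1 - c)) - g (c + t • (ξ e.2 - c))‖ < ‖g (c + t • (ξ e.1 - c)) - y‖) :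
    wind (fun a => g (ξ a)) (polyEdges l) y = 0 := by
  have hmem : ∀ a ∈ l, ∀ t ∈ Icc (0 : ℝ) 1, c + t • (ξ a - c) ∈ S := fun a ha t ht =>
    hS.add_smul_sub_mem hc (hl a ha) ht
  have hns : ∀ e ∈ polyEdges l, ∀ t ∈ Icc (0 : ℝ) 1,
      y ∉ segment ℝ (g (c + t • (ξ e.1 - c))) (g (c + t • (ξ e.2 - c))) := by
    intro e he t ht hy
    have h1 := h e he t ht
    rw [segment_eq_image'] at hy
    obtain ⟨θ, hθ, rfl⟩ := hy
    beta_reduce at h1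
    rw [sub_add_cancel_left, norm_neg, norm_smul, norm_of_nonneg hθ.1, norm_sub_rev] at h1
    nlinarith [norm_nonneg (g (c + t • (ξ e.2 - c)) - g (c + t • (ξ e.1 - c))), hθ.2]
  have hcont : ContinuousOn (fun t : ℝ => wind (fun a => g (c + t • (ξ a - c))) (polyEdges l) y)
      (Icc 0 1) := by
    have : ∀ E : List (ι × ι), (∀ e ∈ E, e ∈ polyEdges l) → ContinuousOn
        (fun t : ℝ => wind (fun a => g (c + t • (ξ a - c))) E y) (Icc 0 1) := by
      intro E
      induction E with
      | nil => exact fun _ => continuousOn_const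
      | cons e E ih =>
        intro hE
        have he := hE e (by simp)
        have hel := mem_of_mem_polyEdges he
        simp only [wind, edgeSum_cons]
        refine ContinuousOn.add ?_ (ih fun e' he' => hE e' (by simp [he']))
        have hg' : ∀ a ∈ l, ContinuousOn (fun t : ℝ => g (c + t • (ξ a - c))) (Icc 0 1) :=
          fun a ha => hg.comp (by fun_prop) fun t ht => hmem a ha t ht
        refine ContinuousOn.congr (f := fun t : ℝ =>
          ((g (c + t • (ξ e.2 - c)) - y) / (g (c + t • (ξ e.1 - c)) - y)).arg) ?_
          fun t ht => ang_of_notMem (hns e he t ht)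
        intro t ht
        refine (Complex.continuousAt_arg
          (div_sub_mem_slitPlane (hns e he t ht))).comp_continuousWithinAt
          (f := fun t : ℝ => (g (c + t • (ξ e.2 - c)) - y) / (g (c + t • (ξ e.1 - c)) - y)) ?_
        exact ((hg' _ hel.2 t ht).sub continuousWithinAt_const).div
          ((hg' _ hel.1 t ht).sub continuousWithinAt_const)
          (sub_ne_zero_of_notMem_segment (hns e he t ht)).1
    exact this _ fun _ => id
  have hq : ∀ t ∈ Icc (0 : ℝ) 1, ∃ n : ℤ,
      wind (fun a => g (c + t • (ξ a - c))) (polyEdges l) y = n * (2 * π) := by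
    intro t ht
    refine exists_wind_eq fun hy => ?_
    obtain ⟨e, he, hy⟩ := mem_trace.mp hy
    exact hns e he t ht hy
  have h0 : wind (fun a => g (c + (0 : ℝ) • (ξ a - c))) (polyEdges l) y = 0 := by
    unfold wind edgeSum
    refine List.sum_eq_zero fun x hx => ?_
    obtain ⟨e, he, rfl⟩ := List.mem_map.mp hx
    have := ang_of_notMem (hns e he 0 (by simp))
    have h2 := (sub_ne_zero_of_notMem_segment (hns e he 0 (by simp))).1
    simp only [zero_smul, add_zero] at this h2 ⊢
    rw [this, div_self h2, Complex.arg_one]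
  have h1 : wind (fun a => g (c + (1 : ℝ) • (ξ a - c))) (polyEdges l) y =
      wind (fun a => g (ξ a)) (polyEdges l) y := by simp
  rw [← h1, ← h0]
  obtain ⟨_, -, hy⟩ := isPreconnected_Icc.eqOn_const_of_mapsTo
    (T := (AddSubgroup.zmultiples (2 * π) : Set ℝ))
    ⟨inferInstanceAs (DiscreteTopology (AddSubgroup.zmultiples (2 * π)))⟩
    hcont (fun t ht => by
      obtain ⟨n, hn⟩ := hq t ht
      exact AddSubgroup.mem_zmultiples_iff.mpr ⟨n, by simp [hn]⟩) ⟨0, zero_mem _⟩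
  exact (hy (right_mem_Icc.mpr zero_le_one)).trans (hy (left_mem_Icc.mpr zero_le_one)).symm

lemma SegOK.comp_linearMap {V W : Type*} [AddCommGroup V] [Module ℝ V] [AddCommGroup W]
    [Module ℝ W] {r : ι → V} {a b c d : ι} (h : SegOK r a b c d) (L : V →ₗ[ℝ] W)
    (hL : Function.Injective L) : SegOK (fun i => L (r i)) a b c d := by
  intro x hx hx'
  have hs : ∀ p q, segment ℝ (L p) (L q) = L '' segment ℝ p q :=
    fun p q => (image_segment ℝ L.toAffineMap p q).symm
  rw [hs] at hx hx'
  obtain ⟨p, hp, rfl⟩ := hx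
  obtain ⟨q, hq, hpq⟩ := hx'
  rw [hL hpq] at hq
  rcases h p hp hq with k | k | ⟨i, h1, h2, rfl⟩
  exacts [Or.inl k, Or.inr (Or.inl k), Or.inr (Or.inr ⟨i, h1, h2, rfl⟩)]

section Builder

lemma wt_single {s : Finset ι} {i : ι} [DecidableEq ι] (hi : i ∈ s) :
    Wt s (Pi.single i (1 : ℝ)) where
  nonneg j := by by_cases h : j = i <;> simp [h]
  supp j hj := by
    rw [Pi.single_apply, if_neg]
    rintro rfl
    exact hj hi
  sum := by simp [Pi.single_apply, hi]

lemma pt_single {V : Type*} [AddCommGroup V] [Module ℝ V] {s : Finset ι} {i : ι} [DecidableEq ι]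
    (hi : i ∈ s) (r : ι → V) : pt r s (Pi.single i (1 : ℝ)) = r i := by
  simp [pt, Pi.single_apply, hi]

/-- The convex hull of finitely many points is the set of their convex combinations. -/
lemma mem_convexHull_image_iff_wt {V : Type*} [AddCommGroup V] [Module ℝ V] {r : ι → V}
    {s : Finset ι} {x : V} : x ∈ convexHull ℝ (r '' s) ↔ ∃ w, Wt s w ∧ pt r s w = x := by
  classical
  refine ⟨fun hx => ?_, ?_⟩
  · refine convexHull_min (t := {x | ∃ w, Wt s w ∧ pt r s w = x}) ?_ ?_ hx
    · rintro _ ⟨i, hi, rfl⟩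
      exact ⟨_, wt_single hi, pt_single hi r⟩
    · rintro _ ⟨w, hw, rfl⟩ _ ⟨w', hw', rfl⟩ a b ha hb hab
      refine ⟨a • w + b • w', ⟨fun i => ?_, fun i hi => ?_, ?_⟩, ?_⟩
      · exact add_nonneg (mul_nonneg ha (hw.nonneg i)) (mul_nonneg hb (hw'.nonneg i))
      · simp [hw.supp i hi, hw'.supp i hi]
      · simp [Finset.sum_add_distrib, ← Finset.mul_sum, hw.sum, hw'.sum, hab]
      · simp [pt, add_smul, Finset.sum_add_distrib, Finset.smul_sum, mul_smul]
  · rintro ⟨w, hw, rfl⟩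
    exact (convex_convexHull ℝ _).sum_mem (fun i _ => hw.nonneg i) hw.sum
      fun i hi => subset_convexHull ℝ _ (mem_image_of_mem r hi)

lemma map_pt {V W : Type*} [AddCommGroup V] [Module ℝ V] [AddCommGroup W] [Module ℝ W]
    {s : Finset ι} {w : ι → ℝ} (hw : Wt s w) (r : ι → V) (A : V →ᵃ[ℝ] W) :
    A (pt r s w) = pt (A ∘ r) s w := by
  rw [pt, ← s.affineCombination_eq_linear_combination r w hw.sum,
    s.map_affineCombination r w hw.sum, s.affineCombination_eq_linear_combination _ w hw.sum, pt]

/-- Barycentric coordinates agree on the intersections of the members of the family. -/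
def WtUnique {V : Type*} [AddCommGroup V] [Module ℝ V] (𝒮 : Finset (Finset ι)) (r : ι → V) : Prop :=
  ∀ S ∈ 𝒮, ∀ S' ∈ 𝒮, ∀ w w', Wt S w → Wt S' w' → pt r S w = pt r S' w' → w = w'

namespace WtUnique

variable {V : Type*} [AddCommGroup V] [Module ℝ V] {𝒮 : Finset (Finset ι)} {r : ι → V}
  {S S' : Finset ι}

lemma eq (h : WtUnique 𝒮 r) (hS : S ∈ 𝒮) (hS' : S' ∈ 𝒮) {i j : ι} (hi : i ∈ S) (hj : j ∈ S')
    (hij : r i = r j) : i = j := by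
  classical
  have := h S hS S' hS' _ _ (wt_single hi) (wt_single hj) (by rw [pt_single hi, pt_single hj, hij])
  by_contra hne
  have h1 := congrFun this i
  simp [hne] at h1

lemma inter_subset (h : WtUnique 𝒮 r) (hS : S ∈ 𝒮) (hS' : S' ∈ 𝒮) {A B : Set V}
    (hA : A ⊆ r '' S) (hB : B ⊆ r '' S') :
    convexHull ℝ A ∩ convexHull ℝ B ⊆ convexHull ℝ (A ∩ B) := by
  classical
  have hf : ∀ (S : Finset ι) (A : Set V), A ⊆ r '' S → A = r '' (S.filter fun i => r i ∈ A) := by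
    intro S A hA
    ext x
    refine ⟨fun hx => ?_, ?_⟩
    · obtain ⟨i, hi, rfl⟩ := hA hx
      exact ⟨i, by simpa using ⟨hi, hx⟩, rfl⟩
    · rintro ⟨i, hi, rfl⟩
      exact (Finset.mem_filter.mp hi).2
  rintro x ⟨hx, hx'⟩
  rw [hf S A hA] at hx
  rw [hf S' B hB] at hx'
  obtain ⟨w, hw, rfl⟩ := mem_convexHull_image_iff_wt.mp hx
  obtain ⟨w', hw', he⟩ := mem_convexHull_image_iff_wt.mp hx'
  have hs := Finset.filter_subset (fun i => r i ∈ A) S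
  have hs' := Finset.filter_subset (fun i => r i ∈ B) S'
  obtain rfl := h S hS S' hS' w w' (hw.mono hs) (hw'.mono hs')
    (by rw [hw.pt_mono hs, hw'.pt_mono hs', he])
  have h0 : ∀ i ∉ (S.filter fun i => r i ∈ A).filter fun i => r i ∈ B, w i = 0 := by
    intro i hi
    by_contra hne
    have h1 : i ∈ S.filter fun i => r i ∈ A := by_contra fun k => hne (hw.supp i k)
    have h2 : i ∈ S'.filter fun i => r i ∈ B := by_contra fun k => hne (hw'.supp i k)
    exact hi (Finset.mem_filter.mpr ⟨h1, (Finset.mem_filter.mp h2).2⟩)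
  refine convexHull_mono ?_ (mem_convexHull_image_iff_wt.mpr ⟨w, hw.of_zero h0, hw.pt_of_zero h0 r⟩)
  rintro _ ⟨i, hi, rfl⟩
  simp only [Finset.coe_filter, Finset.mem_filter, mem_ofPred_eq] at hi
  exact ⟨hi.1.2, hi.2⟩

lemma affineIndependent (h : WtUnique 𝒮 r) (hS : S ∈ 𝒮) :
    AffineIndependent ℝ fun i : S => r i := by
  by_contra hn
  obtain ⟨I, x, hx⟩ := Convex.radon_partition hn
  have hs : ∀ J : Set S, (fun i : S => r i) '' J ⊆ r '' S := by
    rintro J _ ⟨i, -, rfl⟩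
    exact mem_image_of_mem r i.2
  have := h.inter_subset hS hS (hs _) (hs _) hx
  rw [← image_inter fun i j hij => Subtype.ext (h.eq hS hS i.2 j.2 hij), inter_compl_self,
    image_empty, convexHull_empty] at this
  exact this

end WtUnique

lemma continuousOn_invFunOn {X Y : Type*} [TopologicalSpace X] [Nonempty X] [TopologicalSpace Y]
    [T2Space Y] {f : X → Y} {S : Set X} (hS : IsCompact S) (hf : ContinuousOn f S)
    (hi : InjOn f S) : ContinuousOn (Function.invFunOn f S) (f '' S) := by
  rw [continuousOn_iff_isClosed]
  intro C hC
  refine ⟨f '' (S ∩ C), ((hS.inter_right hC).image_of_continuousOn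
    (hf.mono inter_subset_left)).isClosed, ?_⟩
  ext y
  constructor
  · rintro ⟨h1, x, hx, rfl⟩
    rw [mem_preimage, hi.leftInvOn_invFunOn hx] at h1
    exact ⟨⟨x, ⟨hx, h1⟩, rfl⟩, x, hx, rfl⟩
  · rintro ⟨⟨x, ⟨hx, h1⟩, rfl⟩, h2⟩
    exact ⟨by rwa [mem_preimage, hi.leftInvOn_invFunOn hx], h2⟩

/-- The simplicial complex of all faces of a family of triangles. -/
def WtUnique.complex {𝒮 : Finset (Finset ι)} {r : ι → E2} (h : WtUnique 𝒮 r) :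
    SimplicialComplex ℝ E2 where
  faces := {s | s.Nonempty ∧ ∃ S ∈ 𝒮, (s : Set E2) ⊆ r '' S}
  isRelLowerSet_faces := by
    rintro s ⟨hs, S, hS, hsS⟩
    exact ⟨hs, fun t hts ht => ⟨ht, S, hS, (Finset.coe_subset.mpr hts).trans hsS⟩⟩
  indep := by
    rintro s ⟨-, S, hS, hsS⟩
    refine (h.affineIndependent hS).range.mono fun x hx => ?_
    obtain ⟨i, hi, rfl⟩ := hsS hx
    exact ⟨⟨i, hi⟩, rfl⟩
  inter_subset_convexHull := by
    rintro s t ⟨-, S, hS, hsS⟩ ⟨-, S', hS', hsS'⟩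
    exact h.inter_subset hS hS' hsS hsS'

lemma exists_affineMap {S : Finset ι} (hS : S.card = 3) {r p : ι → E2}
    (hr : AffineIndependent ℝ fun i : S => r i) :
    ∃ A : E2 →ᵃ[ℝ] E2, ∀ i ∈ S, A (r i) = p i := by
  classical
  let b : AffineBasis S ℝ E2 := ⟨fun i => r i, hr,
    hr.affineSpan_eq_top_iff_card_eq_finrank_add_one.mpr (by simp [hS])⟩
  refine ⟨(Fintype.linearCombination ℝ fun j : S => p j).toAffineMap.comp b.coords,
    fun i hi => ?_⟩
  change Fintype.linearCombination ℝ (fun j : S => p j) (b.coords (b ⟨i, hi⟩)) = p i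
  simp [Fintype.linearCombination_apply, b.coord_apply]

/-- A family of triangles given by labels, realized in two ways, yields a triangulation and a
piecewise affine homeomorphism. -/
theorem WtUnique.exists_homeo {𝒮 : Finset (Finset ι)} {r p : ι → E2} {Ω : Set E2}
    (h : WtUnique 𝒮 r) (h' : WtUnique 𝒮 p) (hc : ∀ S ∈ 𝒮, S.card = 3)
    (hΩ : ∀ x, x ∈ Ω ↔ ∃ S ∈ 𝒮, ∃ w, Wt S w ∧ pt r S w = x) :
    ∃ f : E2 → E2, IsTriangulation h.complex Ω ∧ IsHomeoOn f Ω ∧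
      PiecewiseAffineOn f h.complex ∧ ∀ S ∈ 𝒮, ∀ w, Wt S w → f (pt r S w) = pt p S w := by
  classical
  have hf : ∃ f : E2 → E2, ∀ S ∈ 𝒮, ∀ w, Wt S w → f (pt r S w) = pt p S w := by
    refine ⟨fun x => if hx : ∃ S ∈ 𝒮, ∃ w, Wt S w ∧ pt r S w = x then
      pt p hx.choose hx.choose_spec.2.choose else 0, fun S hS w hw => ?_⟩
    have hx : ∃ S' ∈ 𝒮, ∃ w', Wt S' w' ∧ pt r S' w' = pt r S w := ⟨S, hS, w, hw, rfl⟩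
    beta_reduce
    rw [dif_pos hx]
    obtain ⟨h1, h2⟩ := hx.choose_spec.2.choose_spec
    have h3 := h _ hx.choose_spec.1 _ hS _ _ h1 hw h2
    rw [h3] at h1 ⊢
    rw [← h1.pt_mono Finset.subset_union_left p (s' := hx.choose ∪ S),
      ← hw.pt_mono Finset.subset_union_right p (s' := hx.choose ∪ S)]
  obtain ⟨f, hf⟩ := hf
  have haff : ∀ S ∈ 𝒮, ∃ A : E2 →ᵃ[ℝ] E2, ∀ x ∈ convexHull ℝ (r '' S), f x = A x := by
    intro S hS
    obtain ⟨A, hA⟩ := exists_affineMap (hc S hS) (p := p) (h.affineIndependent hS)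
    refine ⟨A, fun x hx => ?_⟩
    obtain ⟨w, hw, rfl⟩ := mem_convexHull_image_iff_wt.mp hx
    rw [hf S hS w hw, map_pt hw]
    exact Finset.sum_congr rfl fun i hi => by rw [← hA i hi, Function.comp_apply]
  have hΩ' : Ω = ⋃ S : 𝒮, convexHull ℝ (r '' (S : Finset ι)) := by
    ext x
    simp only [hΩ, mem_iUnion, mem_convexHull_image_iff_wt, Subtype.exists, exists_prop]
  have hcpt : ∀ S : Finset ι, IsCompact (convexHull ℝ (r '' S)) :=
    fun S => (S.finite_toSet.image r).isCompact_convexHull ℝ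
  have hΩc : IsCompact Ω := by
    rw [hΩ']
    exact isCompact_iUnion fun S => hcpt S
  have hcont : ContinuousOn f Ω := by
    rw [hΩ']
    refine (locallyFinite_of_finite _).continuousOn_iUnion (fun S => (hcpt S).isClosed) fun S => ?_
    obtain ⟨A, hA⟩ := haff S S.2
    exact A.continuous_of_finiteDimensional.continuousOn.congr hA
  have hinj : InjOn f Ω := by
    intro x hx y hy hxy
    obtain ⟨S, hS, w, hw, rfl⟩ := (hΩ x).mp hx
    obtain ⟨S', hS', w', hw', rfl⟩ := (hΩ y).mp hy
    rw [hf S hS w hw, hf S' hS' w' hw'] at hxy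
    obtain rfl := h' S hS S' hS' w w' hw hw' hxy
    rw [← hw.pt_mono Finset.subset_union_left r (s' := S ∪ S'),
      ← hw'.pt_mono Finset.subset_union_right r (s' := S ∪ S')]
  have hcard : ∀ S ∈ 𝒮, (S.image r).card = 3 := fun S hS => by
    rw [Finset.card_image_of_injOn fun i hi j hj hij => h.eq hS hS hi hj hij, hc S hS]
  have hface : ∀ S ∈ 𝒮, S.image r ∈ h.complex.faces := fun S hS =>
    ⟨Finset.card_pos.mp (by rw [hcard S hS]; norm_num), S, hS, (Finset.coe_image).le⟩
  refine ⟨f, ⟨?_, ?_, ?_, ?_⟩, ⟨hcont, hinj, continuousOn_invFunOn hΩc hcont hinj⟩, ?_, hf⟩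
  · refine (𝒮.biUnion fun S => (S.image r).powerset).finite_toSet.subset ?_
    rintro s ⟨-, S, hS, hsS⟩
    rw [Finset.mem_coe, Finset.mem_biUnion]
    exact ⟨S, hS, Finset.mem_powerset.mpr (by exact_mod_cast hsS)⟩
  · rintro s ⟨-, S, hS, hsS⟩
    rw [← hcard S hS]
    exact Finset.card_le_card (by exact_mod_cast hsS)
  · ext x
    rw [SimplicialComplex.mem_space_iff, hΩ', mem_iUnion]
    constructor
    · rintro ⟨s, ⟨-, S, hS, hsS⟩, hx⟩
      exact ⟨⟨S, hS⟩, convexHull_mono hsS hx⟩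
    · rintro ⟨S, hx⟩
      exact ⟨_, hface S S.2, by rwa [Finset.coe_image]⟩
  · rintro s ⟨-, S, hS, hsS⟩
    exact ⟨_, hface S hS, by exact_mod_cast hsS, hcard S hS⟩
  · rintro s ⟨-, S, hS, hsS⟩
    obtain ⟨A, hA⟩ := haff S hS
    exact ⟨A, fun x hx => hA x (convexHull_mono hsS hx)⟩

end Builder

lemma sin_angle_mul (p q u : E2) : Real.sin (∠ p q u) * (‖p - q‖ * ‖q - u‖) =
    |orient (toC p) (toC q) (toC u)| := by
  have h := InnerProductGeometry.sin_angle_mul_norm_mul_norm (p - q) (u - q)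
  rw [EuclideanGeometry.angle, vsub_eq_sub, vsub_eq_sub, norm_sub_rev q u, h,
    ← Real.sqrt_sq_eq_abs, orient_rotate]
  congr 1
  rw [← toC.inner_map_map (p - q) (p - q), ← toC.inner_map_map (u - q) (u - q),
    ← toC.inner_map_map (p - q) (u - q), map_sub, map_sub, orient, cr]
  simp only [Complex.inner]
  simp
  ring

namespace Fat

variable {s δ : ℝ} {ρ : ι → ℂ} {t : ι × ι × ι}

lemma le_norm (h : Fat s δ (ρ t.1) (ρ t.2.1) (ρ t.2.2)) {i j : ι} (hi : i ∈ verts t)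
    (hj : j ∈ verts t) (hij : i ≠ j) : δ ≤ ‖ρ i - ρ j‖ := by
  rw [mem_verts] at hi hj
  have h1 := h.ab
  have h2 := h.bc
  have h3 := h.ca
  have h1' := h1
  have h2' := h2
  have h3' := h3
  rw [norm_sub_rev] at h1' h2' h3'
  rcases hi with rfl | rfl | rfl <;> rcases hj with rfl | rfl | rfl <;>
    first | exact absurd rfl hij | assumption

lemma le_orient (h : Fat s δ (ρ t.1) (ρ t.2.1) (ρ t.2.2)) {i j k : ι} (hi : i ∈ verts t)
    (hj : j ∈ verts t) (hk : k ∈ verts t) (hij : i ≠ j) (hjk : j ≠ k) (hik : i ≠ k) :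
    s * (‖ρ i - ρ j‖ * ‖ρ j - ρ k‖) ≤ |orient (ρ i) (ρ j) (ρ k)| := by
  have key : ∀ a b c : ℂ, Fat s δ a b c → s * (‖a - b‖ * ‖b - c‖) ≤ |orient a b c| ∧
      s * (‖c - b‖ * ‖b - a‖) ≤ |orient c b a| := by
    intro a b c h
    have h1 := h.sb.trans (le_abs_self _)
    refine ⟨h1, ?_⟩
    rw [orient_swap, abs_neg, orient_rotate, norm_sub_rev c, norm_sub_rev b a, mul_comm ‖b - c‖]
    exact h1
  have h1 := key _ _ _ h
  have h2 := key _ _ _ h.rotate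
  have h3 := key _ _ _ h.rotate.rotate
  rw [mem_verts] at hi hj hk
  rcases hi with rfl | rfl | rfl <;> rcases hj with rfl | rfl | rfl <;>
    rcases hk with rfl | rfl | rfl <;>
    first | exact absurd rfl hij | exact absurd rfl hik | exact absurd rfl hjk |
      exact h1.1 | exact h1.2 | exact h2.1 | exact h2.2 | exact h3.1 | exact h3.2

end Fat

section Bounds

variable {𝒮 : Finset (Finset ι)} {r : ι → E2} {s δ ℓ : ℝ}

lemma WtUnique.angleLB (h : WtUnique 𝒮 r) (hf : ∀ S ∈ 𝒮, ∃ t, S = verts t ∧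
    Fat s δ (toC (r t.1)) (toC (r t.2.1)) (toC (r t.2.2))) : AngleLB h.complex s := by
  rintro e ⟨-, S, hS, heS⟩ p hp q hq u hu hpq hqu hpu
  obtain ⟨t, rfl, ht⟩ := hf S hS
  obtain ⟨i, hi, rfl⟩ := heS hp
  obtain ⟨j, hj, rfl⟩ := heS hq
  obtain ⟨k, hk, rfl⟩ := heS hu
  have hij : i ≠ j := fun h => hpq (h ▸ rfl)
  have hjk : j ≠ k := fun h => hqu (h ▸ rfl)
  have hik : i ≠ k := fun h => hpu (h ▸ rfl)
  have h1 := ht.le_orient (ρ := fun i => toC (r i)) hi hj hk hij hjk hik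
  rw [← sin_angle_mul, ← map_sub, ← map_sub, toC.norm_map, toC.norm_map] at h1
  exact le_of_mul_le_mul_right h1
    (mul_pos (norm_sub_pos_iff.mpr hpq) (norm_sub_pos_iff.mpr hqu))

lemma WtUnique.edgeLen_mem (h : WtUnique 𝒮 r) (hf : ∀ S ∈ 𝒮, ∃ t, S = verts t ∧
    Fat s δ (toC (r t.1)) (toC (r t.2.1)) (toC (r t.2.2)))
    (hℓ : ∀ S ∈ 𝒮, ∀ i ∈ S, ∀ j ∈ S, ‖r i - r j‖ ≤ ℓ) {e : Finset E2}
    (he : e ∈ h.complex.faces) (hc : e.card = 2) : δ ≤ edgeLen e ∧ edgeLen e ≤ ℓ := by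
  obtain ⟨-, S, hS, heS⟩ := he
  obtain ⟨a, b, hab, rfl⟩ := Finset.card_eq_two.mp hc
  obtain ⟨i, hi, rfl⟩ := heS (by simp : a ∈ _)
  obtain ⟨j, hj, rfl⟩ := heS (by simp : b ∈ _)
  have h1 : edgeLen {r i, r j} = ‖r i - r j‖ := by
    rw [edgeLen, Finset.coe_pair, Metric.diam_pair, dist_eq_norm]
  rw [h1]
  refine ⟨?_, hℓ S hS i hi j hj⟩
  obtain ⟨t, rfl, ht⟩ := hf S hS
  have h2 := ht.le_norm (ρ := fun i => toC (r i)) hi hj fun h => hab (h ▸ rfl)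
  rwa [← map_sub, toC.norm_map] at h2

end Bounds

section Center

/-- The barycenter of a triangle. -/
def barycenter (T : Finset E2) : E2 := (3 : ℝ)⁻¹ • ∑ x ∈ T, x

variable {T : Finset E2} {A B C : E2} {ℓ δ : ℝ}

lemma IsTri.rotate (h : IsTri T A B C) : IsTri T B C A :=
  ⟨h.bc, h.ca, h.ab, fun x => by rw [h.mem]; tauto⟩

lemma IsTri.center_eq (h : IsTri T A B C) : barycenter T = (3 : ℝ)⁻¹ • (A + B + C) := by
  have hT : T = {A, B, C} := by
    ext x
    simp [h.mem]
  rw [barycenter, hT, Finset.sum_insert (by simp [h.ab, h.ca.symm]), Finset.sum_pair h.bc,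
    add_assoc]

lemma barycenter_mem (hT : T.card = 3) : barycenter T ∈ convexHull ℝ (T : Set E2) := by
  have := (convex_convexHull ℝ (T : Set E2)).sum_mem (t := T) (w := fun _ => (3 : ℝ)⁻¹)
    (z := fun x => x) (fun _ _ => by norm_num) (by simp [hT]) fun x hx => subset_convexHull ℝ _ hx
  rwa [← Finset.smul_sum] at this

lemma norm_sub_le_of_mem_convexHull (hℓ : ∀ a ∈ T, ∀ b ∈ T, ‖a - b‖ ≤ ℓ) {x y : E2}
    (hx : x ∈ convexHull ℝ (T : Set E2)) (hy : y ∈ convexHull ℝ (T : Set E2)) : ‖x - y‖ ≤ ℓ := by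
  obtain ⟨a, ha, b, hb, h⟩ := convexHull_exists_dist_ge2 hx hy
  rw [dist_eq_norm, dist_eq_norm] at h
  exact h.trans (hℓ a ha b hb)

lemma IsTri.orient_center (h : IsTri T A B C) : ∀ f ∈ sides A B C,
    orient (toC (barycenter T)) (toC f.1) (toC f.2) = orient (toC A) (toC B) (toC C) / 3 := by
  have key : ∀ A B C : E2, IsTri T A B C →
      orient (toC (barycenter T)) (toC A) (toC B) = orient (toC A) (toC B) (toC C) / 3 := by
    intro A B C h
    rw [h.center_eq]
    simp [orient, cr]
    ring
  intro f hf
  simp only [sides, List.mem_cons, List.not_mem_nil, or_false] at hf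
  rcases hf with rfl | rfl | rfl
  · exact key _ _ _ h
  · rw [key _ _ _ h.rotate, orient_rotate]
  · rw [key _ _ _ h.rotate.rotate, orient_rotate, orient_rotate]

lemma orient_node {n i : ℕ} (hn : 0 < n) (c v w : E2) :
    orient (toC c) (toC (node n v w i)) (toC (node n v w (i + 1))) =
      orient (toC c) (toC v) (toC w) / n := by
  have : (n : ℝ) ≠ 0 := by exact_mod_cast hn.ne'
  have h : ∀ j : ℕ, toC (node n v w j) = toC v + ((j : ℝ) / n) • (toC w - toC v) := by
    intro j
    simp [node]
  rw [h, h]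
  simp only [orient, cr, Complex.sub_re, Complex.sub_im, Complex.add_re, Complex.add_im,
    Complex.smul_re, Complex.smul_im, smul_eq_mul]
  push_cast
  field_simp
  ring

lemma IsTri.segment_subset (h : IsTri T A B C) {f : E2 × E2} (hf : f ∈ sides A B C) :
    segment ℝ f.1 f.2 ⊆ convexHull ℝ (T : Set E2) := by
  obtain ⟨h1, h2⟩ := h.mem_of_sides hf
  exact segment_subset_convexHull h1 h2

lemma cr_le (u v : ℂ) : cr u v ≤ ‖u‖ * ‖v‖ := by
  refine abs_le_of_sq_le_sq' ?_ (by positivity) |>.2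
  rw [mul_pow, Complex.sq_norm, Complex.sq_norm, Complex.normSq_apply, Complex.normSq_apply, cr]
  nlinarith [sq_nonneg (u.re * v.re + u.im * v.im)]

/-- The distance of the sides from the barycenter. -/
lemma IsTri.le_norm_sub_center (h : IsTri T A B C)
    (hO : δ ≤ orient (toC A) (toC B) (toC C)) (hℓ0 : 0 < ℓ) (hℓ : ∀ a ∈ T, ∀ b ∈ T, ‖a - b‖ ≤ ℓ)
    {f : E2 × E2} (hf : f ∈ sides A B C) {x : E2} (hx : x ∈ segment ℝ f.1 f.2) :
    δ / (3 * ℓ) ≤ ‖x - barycenter T‖ := by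
  have h1 := h.orient_center f hf
  have h2 : orient (toC (barycenter T)) (toC f.1) (toC f.2) =
      cr (toC (x - barycenter T)) (toC (f.2 - f.1)) := by
    rw [segment_eq_image'] at hx
    obtain ⟨θ, -, rfl⟩ := hx
    simp [orient, cr]
    ring
  have h3 := cr_le (toC (x - barycenter T)) (toC (f.2 - f.1))
  rw [toC.norm_map, toC.norm_map] at h3
  obtain ⟨m1, m2⟩ := h.mem_of_sides hf
  have h4 := mul_le_mul_of_nonneg_left (hℓ _ m2 _ m1) (norm_nonneg (x - barycenter T))
  rw [div_le_iff₀ (by positivity)]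
  nlinarith

end Center

/-- The labels of the vertices: points and their copies inside of the triangles. -/
abbrev Label : Type := E2 × Option (Finset E2)

/-- The label of a point. -/
def label (a : E2) : Label := (a, none)

/-- The label of the copy inside of a triangle. -/
def innerLabel (T : Finset E2) (a : Label) : Label := (a.1, some T)

lemma label_injective : Function.Injective label := fun _ _ h => congrArg Prod.fst h

/-- The positions of the vertices, the copies being on circles of radius `ρ`. -/
def position (ρ : ℝ) : Label → E2
  | (a, none) => a
  | (a, some T) => barycenter T + (ρ / ‖a - barycenter T‖) • (a - barycenter T)

section Domain

variable {𝒯 : Finset (Finset E2)} {N : E2 → E2 → ℕ} {d ℓ δ : ℝ} {n : ℕ} {T T' : Finset E2}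
  {A B C A' B' C' : E2}

lemma Symm.segOK (hN : Symm 𝒯 N) (h : FacesApart 𝒯 d) (hd : 0 < d) (ρ : ℝ) (e e' : E2 × E2)
    (he : IsSub 𝒯 N e) (he' : IsSub 𝒯 N e') :
    SegOK (fun p => toC (position ρ (label p))) e.1 e.2 e'.1 e'.2 :=
  (h.segOK_node hd (fun v w hvw => ⟨by have := (hN v w hvw).1; omega, (hN v w hvw).2⟩)
    he he').comp_linearMap (r := id) toC.toLinearEquiv.toLinearMap toC.injective

lemma mem_loop_segment {a : Label} (ha : a ∈ loop N label A B C) :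
    ∃ f ∈ sides A B C, ∃ x ∈ segment ℝ f.1 f.2, a = label x := by
  obtain ⟨f, hf, i, hi, rfl⟩ := mem_loop.mp ha
  exact ⟨f, hf, _, node_mem_segment hi.le f.1 f.2, rfl⟩

lemma domain_tiling (h : FacesApart 𝒯 d) (hd : 0 < d) (hN : Symm 𝒯 N) (hT : T ∈ 𝒯) (hc : T.card = 3)
    (hABC : IsTri T A B C) (hO : δ ≤ orient (toC A) (toC B) (toC C)) (hδ : 0 < δ) (hℓ0 : 0 < ℓ)
    (hℓ : ∀ a ∈ T, ∀ b ∈ T, ‖a - b‖ ≤ ℓ) (hn : ∀ v w, IsEdge 𝒯 v w → N v w ≤ n)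
    {g : Label → ℂ} {ts : List (Label × Label × Label)} {σ : ℝ}
    (F : Filling g (loop N label A B C) ts σ) :
    Tiling (fun a => toC (position (δ / (6 * ℓ)) a)) (loop N label A B C)
        (annulus (innerLabel T) (loop N label A B C) ts) 1 ∧
      ∀ t ∈ annulus (innerLabel T) (loop N label A B C) ts,
        Fat (δ ^ 2 / (144 * n * ℓ ^ 4)) (δ ^ 2 / (72 * n * ℓ ^ 3))
          (toC (position (δ / (6 * ℓ)) t.1)) (toC (position (δ / (6 * ℓ)) t.2.1))
          (toC (position (δ / (6 * ℓ)) t.2.2)) := by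
  have hpos := hN.pos hT hABC
  have hn0 : (0 : ℝ) < n := by
    have h1 := hpos (A, B) (by simp [sides])
    have h2 := hn _ _ (hABC.isEdge hT (A, B) (by simp [sides]))
    exact_mod_cast h1.trans_le h2
  have key := annulus_circle (r := fun a => toC (position (δ / (6 * ℓ)) a)) (n := innerLabel T)
    (c := toC (barycenter T)) (x := δ / (3 * n)) (M := ℓ) (r₀ := δ / (6 * ℓ))
    (loop_simplePoly h hd hN label_injective hT hABC (toC.injective.injOn) (hN.segOK h hd _))
    (three_le_length_loop hpos) F (by positivity) (by positivity) ?_ ?_ ?_ ?_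
  · rwa [show δ / (6 * ℓ) * (δ / (3 * n)) / (8 * ℓ ^ 3) = δ ^ 2 / (144 * n * ℓ ^ 4) by
      field_simp; norm_num, show δ / (6 * ℓ) * (δ / (3 * n)) / (4 * ℓ ^ 2) =
      δ ^ 2 / (72 * n * ℓ ^ 3) by field_simp; norm_num] at key
  · intro e he
    obtain ⟨f, hf, i, hi, rfl⟩ := (mem_polyEdges_loop hpos).mp he
    have h1 := orient_node (i := i) (hpos f hf) (barycenter T) f.1 f.2
    have h2 : (N f.1 f.2 : ℝ) ≤ n := by exact_mod_cast hn _ _ (hABC.isEdge hT f hf)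
    have h3 : (0 : ℝ) < N f.1 f.2 := by exact_mod_cast hpos f hf
    rw [hABC.orient_center f hf] at h1
    change δ / (3 * n) ≤ orient (toC (barycenter T)) (toC (node (N f.1 f.2) f.1 f.2 i))
      (toC (node (N f.1 f.2) f.1 f.2 (i + 1)))
    rw [h1, div_div]
    gcongr
    exact hδ.le.trans hO
  · intro a ha
    obtain ⟨f, hf, x, hx, rfl⟩ := mem_loop_segment ha
    change ‖toC x - toC (barycenter T)‖ ≤ ℓ
    rw [← map_sub, toC.norm_map]
    exact norm_sub_le_of_mem_convexHull hℓ (hABC.segment_subset hf hx) (barycenter_mem hc)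
  · intro a ha
    obtain ⟨f, hf, x, hx, rfl⟩ := mem_loop_segment ha
    change _ ≤ ‖toC x - toC (barycenter T)‖
    rw [← map_sub, toC.norm_map]
    convert hABC.le_norm_sub_center hO hℓ0 hℓ hf hx using 1
    field_simp
    norm_num
  · intro a ha
    obtain ⟨f, hf, x, hx, rfl⟩ := mem_loop_segment ha
    change toC (barycenter T + (_ / ‖x - barycenter T‖) • (x - barycenter T)) =
      toC (barycenter T) + _ * ((toC x - toC (barycenter T)) / ‖toC x - toC (barycenter T)‖)
    rw [map_add, map_smul, map_sub, ← map_sub, toC.norm_map, map_sub]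
    simp only [Complex.real_smul]
    push_cast
    ring

/-- The positions of the vertices of the tiling of a triangle belong to the triangle. -/
lemma position_mem (hc : T.card = 3) (hABC : IsTri T A B C)
    (hO : δ ≤ orient (toC A) (toC B) (toC C)) (hδ : 0 < δ) (hℓ0 : 0 < ℓ)
    (hℓ : ∀ a ∈ T, ∀ b ∈ T, ‖a - b‖ ≤ ℓ) {a : Label} (ha : a ∈ loop N label A B C) :
    position (δ / (6 * ℓ)) a ∈ convexHull ℝ (T : Set E2) ∧
      position (δ / (6 * ℓ)) (innerLabel T a) ∈ convexHull ℝ (T : Set E2) := by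
  obtain ⟨f, hf, x, hx, rfl⟩ := mem_loop_segment ha
  have hm := hABC.segment_subset hf hx
  have h1 := hABC.le_norm_sub_center hO hℓ0 hℓ hf hx
  refine ⟨hm, (convex_convexHull ℝ _).add_smul_sub_mem (barycenter_mem hc) hm
    ⟨by positivity, div_le_one_of_le₀ (le_trans ?_ h1) (norm_nonneg _)⟩⟩
  gcongr
  norm_num

lemma FacesApart.le_norm_sub (h : FacesApart 𝒯 d) (hT : T ∈ 𝒯) (hT' : T' ∈ 𝒯) {x v : E2}
    (hx : x ∈ convexHull ℝ (T : Set E2)) (hv' : v ∈ T') (hv : v ∉ T) : d ≤ ‖x - v‖ := by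
  obtain ⟨w, hw, rfl⟩ := mem_convexHull_iff_wt.mp hx
  have := h T hT T' hT' w _ hw (wt_single hv') fun u => by
    by_cases hu : u = v
    · exact Or.inl (hw.supp u (hu ▸ hv))
    · exact Or.inr (by simp [hu])
  rwa [pt_single hv'] at this

lemma domain_wind (h : FacesApart 𝒯 d) (hd : 0 < d) (ρ : ℝ) (hT : T ∈ 𝒯) (hT' : T' ∈ 𝒯)
    (hABC : IsTri T A B C) {v : E2} (hv' : v ∈ T') (hv : v ∉ T) :
    wind (fun a => toC (position ρ a)) (polyEdges (loop N label A B C))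
      (toC (position ρ (label v))) = 0 := by
  have hS : Convex ℝ (toC '' convexHull ℝ (T : Set E2)) :=
    (convex_convexHull ℝ _).is_linear_image toC.toLinearEquiv.toLinearMap.isLinear
  refine wind_eq_zero_of_notMem_convex hS ?_ (fun a ha => ?_) ?_
  · exact ((T.finite_toSet.isCompact_convexHull ℝ).image toC.continuous).isClosed
  · obtain ⟨f, hf, x, hx, rfl⟩ := mem_loop_segment ha
    exact mem_image_of_mem _ (hABC.segment_subset hf hx)
  · rintro ⟨y, hy, hyv⟩
    obtain rfl : y = v := toC.injective hyv
    have := h.le_norm_sub hT hT' hy hv' hv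
    rw [sub_self, norm_zero] at this
    linarith

end Domain

section Cover

variable {𝒯 : Finset (Finset E2)} {N : E2 → E2 → ℕ} {d ℓ δ : ℝ} {n : ℕ} {T T' : Finset E2}
  {A B C A' B' C' : E2}

lemma Mesh.exists_isTri {Ω : Set E2} (hM : Mesh Ω 𝒯 ℓ d δ) (hT : T ∈ 𝒯) :
    ∃ A B C, IsTri T A B C ∧ δ ≤ orient (toC A) (toC B) (toC C) := by
  obtain ⟨a, b, c, hab, hac, hbc, rfl⟩ := Finset.card_eq_three.mp (hM.card T hT)
  have h := hM.fat _ hT a (by simp) b (by simp) c (by simp) hab hbc hac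
  rcases le_abs.mp h with h | h
  · exact ⟨a, b, c, ⟨hab, hbc, hac.symm, fun x => by simp⟩, h⟩
  · exact ⟨b, a, c, ⟨hab.symm, hac, hbc.symm, fun x => by simp; tauto⟩, by rwa [orient_swap]⟩

lemma exists_mem_segment_node {n : ℕ} (hn : 0 < n) {v w x : E2} (hx : x ∈ segment ℝ v w) :
    ∃ i < n, x ∈ segment ℝ (node n v w i) (node n v w (i + 1)) := by
  have hn' : (0 : ℝ) < n := by exact_mod_cast hn
  rw [segment_eq_image'] at hx
  obtain ⟨θ, hθ, rfl⟩ := hx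
  have key : ∀ i : ℕ, (i : ℝ) ≤ θ * n → θ * n ≤ i + 1 →
      v + θ • (w - v) ∈ segment ℝ (node n v w i) (node n v w (i + 1)) := by
    intro i h1 h2
    rw [segment_eq_image']
    refine ⟨θ * n - i, ⟨by linarith, by linarith⟩, ?_⟩
    simp only [node]
    match_scalars <;> field_simp <;> ring
  have h0 : 0 ≤ θ * n := mul_nonneg hθ.1 hn'.le
  by_cases h : ⌊θ * n⌋₊ < n
  · exact ⟨_, h, key _ (Nat.floor_le h0) (Nat.lt_floor_add_one _).le⟩
  · have h1 : (n : ℝ) ≤ θ * n := (Nat.le_floor_iff h0).mp (not_lt.mp h)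
    have h2 : θ * n ≤ n := by nlinarith [hθ.2]
    refine ⟨n - 1, by omega, key _ ?_ ?_⟩ <;> push_cast [Nat.cast_sub hn] <;> linarith

lemma IsTri.orient_pos_or (hABC : IsTri T A B C) (hO : 0 < orient (toC A) (toC B) (toC C))
    {x : E2} (hx : x ∈ convexHull ℝ (T : Set E2)) :
    ∀ f ∈ sides A B C, 0 < orient (toC x) (toC f.1) (toC f.2) ∨ x ∈ segment ℝ f.1 f.2 := by
  have key : ∀ A B C : E2, IsTri T A B C → 0 < orient (toC A) (toC B) (toC C) →
      0 < orient (toC x) (toC A) (toC B) ∨ x ∈ segment ℝ A B := by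
    intro A B C h hO
    have hT : T = verts (A, B, C) := by
      ext y
      rw [mem_verts, h.mem]
    obtain ⟨w, hw, hwx⟩ := mem_convexHull_iff_wt.mp hx
    have hs := hw.sum
    rw [hT, pt_verts _ ⟨h.ab, h.bc, h.ca⟩] at hwx
    rw [hT, sum_verts ⟨h.ab, h.bc, h.ca⟩] at hs
    simp only [id] at hwx hs
    rcases (hw.nonneg C).eq_or_lt with k | k
    · refine Or.inr ⟨w A, w B, hw.nonneg A, hw.nonneg B, by linarith, ?_⟩
      rw [← hwx, ← k]
      simp
    · left
      have : orient (toC x) (toC A) (toC B) = w C * orient (toC A) (toC B) (toC C) := by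
        have hA : w A = 1 - w B - w C := by linarith
        rw [← hwx, hA]
        simp [orient, cr]
        ring
      rw [this]
      positivity
  intro f hf
  simp only [sides, List.mem_cons, List.not_mem_nil, or_false] at hf
  rcases hf with rfl | rfl | rfl
  · exact key _ _ _ hABC hO
  · exact key _ _ _ hABC.rotate (by rwa [orient_rotate])
  · exact key _ _ _ hABC.rotate.rotate (by rwa [orient_rotate, orient_rotate])

/-- The triangles of the tiling of `T` cover `T`. -/
lemma IsTri.exists_wt (hN : Symm 𝒯 N) (hT : T ∈ 𝒯) (hABC : IsTri T A B C)
    (hO : 0 < orient (toC A) (toC B) (toC C)) {ρ : ℝ} {r : Label → ℂ}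
    (hr : ∀ a, r a = toC (position ρ a)) {ts : List (Label × Label × Label)}
    (hR : Tiling r (loop N label A B C) ts 1) {x : E2} (hx : x ∈ convexHull ℝ (T : Set E2)) :
    ∃ t ∈ ts, ∃ w, Wt (verts t) w ∧ pt (position ρ) (verts t) w = x := by
  have hpos := hN.pos hT hABC
  have hrl : ∀ p, r (label p) = toC p := fun p => hr _
  suffices hs : ∃ t ∈ ts, toC x ∈ closedTri 1 (r t.1) (r t.2.1) (r t.2.2) by
    obtain ⟨t, ht, hy⟩ := hs
    obtain ⟨w, hw, hwx⟩ := exists_wt_of_mem_closedTri (hR.pos t ht) hy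
    refine ⟨t, ht, w, hw, toC.injective ?_⟩
    rw [← hwx, show r = toC ∘ position ρ from funext hr]
    exact map_pt hw (position ρ) toC.toLinearEquiv.toLinearMap.toAffineMap
  have hc := hABC.orient_pos_or hO hx
  by_cases hk : ∃ f ∈ sides A B C, x ∈ segment ℝ f.1 f.2
  · obtain ⟨f, hf, hxf⟩ := hk
    obtain ⟨i, hi, hxi⟩ := exists_mem_segment_node (hpos f hf) hxf
    obtain ⟨t, ht, he⟩ := hR.exists_triEdge ((mem_polyEdges_loop hpos).mpr ⟨f, hf, i, hi, rfl⟩)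
    refine ⟨t, ht, segment_subset_closedTri' (hR.pos t ht) he ?_⟩
    rw [hrl, hrl]
    exact image_segment ℝ toC.toLinearEquiv.toLinearMap.toAffineMap _ _ ▸ mem_image_of_mem _ hxi
  · have hlt : ∀ e ∈ polyEdges (loop N label A B C), 0 < orient (toC x) (r e.1) (r e.2) := by
      intro e he
      obtain ⟨f, hf, i, hi, rfl⟩ := (mem_polyEdges_loop hpos).mp he
      dsimp only
      rw [hrl, hrl, orient_node (hpos f hf)]
      have := (hc f hf).resolve_right fun k => hk ⟨f, hf, k⟩
      have h3 : (0 : ℝ) < N f.1 f.2 := by exact_mod_cast hpos f hf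
      positivity
    have hl := three_le_length_loop (b := label) hpos
    obtain ⟨ts', σ, F⟩ := hR.poly.exists_filling hl
    have hw := (F.wind_of_pos (by rintro k; simp [k] at hl) hlt).2
    refine hR.exists_of_mem_inside ⟨fun hy => ?_, by rw [hw]; positivity⟩
    obtain ⟨e, he, hy⟩ := mem_trace.mp hy
    have := hlt e he
    rw [segment_eq_image'] at hy
    obtain ⟨θ, -, hθ⟩ := hy
    beta_reduce at hθ
    rw [← hθ] at this
    simp only [orient, cr, Complex.sub_re, Complex.sub_im, Complex.add_re, Complex.add_im,
      Complex.smul_re, Complex.smul_im, smul_eq_mul] at this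
    linarith

end Cover

section Assembly

variable {𝒯 : Finset (Finset E2)} {N : E2 → E2 → ℕ} {d ℓ δ : ℝ} {T T' : Finset E2}

lemma wtUnique_of_tilings {L : Finset E2 → List ι} {tl : Finset E2 → List (ι × ι × ι)}
    {σ : Finset E2 → ℝ} {p : ι → E2} {q : ι → ℂ} (hq : ∀ a, toC (p a) = q a)
    (hR : ∀ T ∈ 𝒯, Tiling q (L T) (tl T) (σ T))
    (hO : ∀ T ∈ 𝒯, ∀ T' ∈ 𝒯, T ≠ T' → Outside q (L T) (L T')) {𝒮 : Finset (Finset ι)}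
    (h𝒮 : ∀ S ∈ 𝒮, ∃ T ∈ 𝒯, ∃ t ∈ tl T, verts t = S) : WtUnique 𝒮 p := by
  intro S hS S' hS' w w' hw hw' he
  obtain ⟨T, hT, t, ht, rfl⟩ := h𝒮 S hS
  obtain ⟨T', hT', t', ht', rfl⟩ := h𝒮 S' hS'
  have he' : pt q (verts t) w = pt q (verts t') w' := by
    have h1 := map_pt hw p toC.toLinearEquiv.toLinearMap.toAffineMap
    have h2 := map_pt hw' p toC.toLinearEquiv.toLinearMap.toAffineMap
    rw [← show toC.toLinearEquiv.toLinearMap.toAffineMap ∘ p = q from funext hq, ← h1, ← h2, he]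
  by_cases hTT : T = T'
  · subst hTT
    exact (hR T hT).wt_unique ht ht' hw hw' he'
  · exact (hR T hT).wt_unique_of_outside (hR T' hT') (hO T hT T' hT' hTT)
      (hO T' hT' T hT (Ne.symm hTT)) ht ht' hw hw' he'

lemma Mesh.exists_notMem {Ω : Set E2} (hM : Mesh Ω 𝒯 ℓ d δ) (hT : T ∈ 𝒯) (hT' : T' ∈ 𝒯)
    (hne : T ≠ T') : ∃ v ∈ T', v ∉ T := by
  by_contra! h
  exact hne (Finset.eq_of_subset_of_card_le h (by rw [hM.card T hT, hM.card T' hT'])).symm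

lemma Mesh.convexHull_subset {Ω : Set E2} (hM : Mesh Ω 𝒯 ℓ d δ) (hT : T ∈ 𝒯) :
    convexHull ℝ (T : Set E2) ⊆ Ω := fun _ hx =>
  (hM.cover _).mpr ⟨T, hT, mem_convexHull_iff_wt.mp hx⟩

/-- The polygons bounding the images of two triangles are apart. -/
lemma target_outside {Ω : Set E2} {g : E2 → ℂ} {Ξ : E2 → E2} {R : ℝ} (hM : Mesh Ω 𝒯 ℓ d δ)
    (hd : 0 < d) (hN : Symm 𝒯 N) (hg : ContinuousOn g Ω)
    (hv : ∀ v w, IsEdge 𝒯 v w → Ξ v = v)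
    (hΞ : ∀ v w, IsEdge 𝒯 v w → ∀ i ≤ N v w, Ξ (node (N v w) v w i) ∈ segment ℝ v w)
    (hR : ∀ e, IsSub 𝒯 N e → ‖g (Ξ e.1) - g (Ξ e.2)‖ ≤ R)
    (hcon : ∀ x ∈ Ω, ∀ y ∈ Ω, ‖g x - g y‖ ≤ R → ∀ x' ∈ Ω, ∀ y' ∈ Ω, ‖x' - y'‖ ≤ ‖x - y‖ →
      ∀ v ∈ Ω, d ≤ ‖x' - v‖ → ‖g x' - g y'‖ < ‖g x' - g v‖)
    {q : Label → ℂ} (hq : ∀ x, q (label x) = g (Ξ x))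
    (hok : ∀ e e', IsSub 𝒯 N e → IsSub 𝒯 N e' → SegOK (fun p => g (Ξ p)) e.1 e.2 e'.1 e'.2)
    (hT : T ∈ 𝒯) (hT' : T' ∈ 𝒯) {A B C A' B' C' : E2} (hABC : IsTri T A B C)
    (hABC' : IsTri T' A' B' C') (hne : T ≠ T') :
    Outside q (loop N label A B C) (loop N label A' B' C') := by
  refine outside_loop hM.sep hd hN label_injective hT hT' hABC hABC'
    (hM.exists_notMem hT hT' hne) (by simpa only [hq] using hok) fun v hv' hvT => ?_
  obtain ⟨u, hu⟩ : ∃ u, IsEdge 𝒯 v u := by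
    obtain ⟨u, hu, huv⟩ := Finset.exists_mem_ne (by rw [hM.card T' hT']; norm_num) v
    exact ⟨u, huv.symm, T', hT', hv', hu⟩
  have hS := convex_convexHull ℝ (T : Set E2)
  have hl : ∀ a ∈ loop N label A B C, Ξ a.1 ∈ convexHull ℝ (T : Set E2) := by
    intro a ha
    obtain ⟨f, hf, i, hi, rfl⟩ := mem_loop.mp ha
    exact hABC.segment_subset hf (hΞ _ _ (hABC.isEdge hT f hf) i hi.le)
  have hsub := hM.convexHull_subset hT
  have hcm := barycenter_mem (hM.card T hT)
  have hvΩ := hM.convexHull_subset hT' (subset_convexHull ℝ _ hv')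
  have key := wind_eq_zero_of_contract (g := g) (ξ := fun a : Label => Ξ a.1) (y := g v) hS
    (hg.mono hsub) hl hcm fun e he t ht => by
      have h1 := hl _ (mem_of_mem_polyEdges he).1
      have h2 := hl _ (mem_of_mem_polyEdges he).2
      have m1 := hS.add_smul_sub_mem hcm h1 ht
      have m2 := hS.add_smul_sub_mem hcm h2 ht
      refine hcon _ (hsub h1) _ (hsub h2) ?_ _ (hsub m1) _ (hsub m2) ?_ v hvΩ
        (hM.sep.le_norm_sub hT hT' m1 hv' hvT)
      · obtain ⟨p, p', hs, rfl⟩ := hABC.isSub hN hT he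
        exact hR _ hs
      · rw [add_sub_add_left_eq_sub, ← smul_sub, sub_sub_sub_cancel_right, norm_smul,
          Real.norm_of_nonneg ht.1]
        exact mul_le_of_le_one_left (norm_nonneg _) ht.2
  rw [hq, hv v u hu, ← key]
  refine wind_congr (fun e he => ?_) _
  have h0 : ∀ a ∈ loop N label A B C, q a = g (Ξ a.1) := by
    intro a ha
    obtain ⟨f, hf, i, hi, rfl⟩ := mem_loop.mp ha
    exact hq _
  exact ⟨h0 _ (mem_of_mem_polyEdges he).1, h0 _ (mem_of_mem_polyEdges he).2⟩

/-- The mesh and the images of its sides are refined to two triangulations of the same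
combinatorial type, the first of which covers the polygon and is fat. -/
theorem Scales.exists_realizations {Ω : Set E2} {g : E2 → ℂ} {R κ ζ s η : ℝ} {m : ℕ}
    (hS : Scales Ω g ℓ d R κ ζ s m) (hM : Mesh Ω 𝒯 ℓ d δ) (hd : 0 < d) (hδ : 0 < δ) (hℓ : 0 < ℓ)
    (hη : 0 < η) (hg : InjOn g Ω)
    (hcon : ∀ x ∈ Ω, ∀ y ∈ Ω, ‖g x - g y‖ ≤ R → ∀ x' ∈ Ω, ∀ y' ∈ Ω, ‖x' - y'‖ ≤ ‖x - y‖ →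
      ∀ v ∈ Ω, d ≤ ‖x' - v‖ → ‖g x' - g y'‖ < ‖g x' - g v‖) :
    ∃ (𝒮 : Finset (Finset Label)) (r p : Label → E2), WtUnique 𝒮 r ∧ WtUnique 𝒮 p ∧
      (∀ S ∈ 𝒮, S.card = 3) ∧ (∀ x, x ∈ Ω ↔ ∃ S ∈ 𝒮, ∃ w, Wt S w ∧ pt r S w = x) ∧
      (∀ S ∈ 𝒮, ∃ t, S = verts t ∧
        Fat (δ ^ 2 / (144 * (m + 2 : ℕ) * ℓ ^ 4)) (δ ^ 2 / (72 * (m + 2 : ℕ) * ℓ ^ 3))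
          (toC (r t.1)) (toC (r t.2.1)) (toC (r t.2.2))) ∧
      ∀ S ∈ 𝒮, ∃ T ∈ 𝒯, ∀ i ∈ S, r i ∈ convexHull ℝ (T : Set E2) ∧
        ∃ x ∈ convexHull ℝ (T : Set E2), ‖toC (p i) - g x‖ ≤ η := by
  classical
  obtain ⟨N, Ξ, hNΞ, hΞ, hinj, hR, hok⟩ := hS.exists_graph hM hd
  have hN : Symm 𝒯 N := fun v w h => ⟨by have := (hNΞ v w h).1; omega, (hNΞ v w h).2.2.1⟩
  choose! A B C hABC hO using fun T (hT : T ∈ 𝒯) => hM.exists_isTri hT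
  have hpos := fun T (hT : T ∈ 𝒯) => hN.pos hT (hABC T hT)
  set L : Finset E2 → List Label := fun T => loop N label (A T) (B T) (C T) with hL
  have hlen : ∀ T ∈ 𝒯, 3 ≤ (L T).length := fun T hT => three_le_length_loop (hpos T hT)
  have hnode : ∀ p, IsNode 𝒯 N p → Ξ p ∈ Ω := by
    rintro p ⟨v, w, i, he, hi, rfl⟩
    exact hM.segment_subset he (hΞ v w he i hi)
  have hloop : ∀ T ∈ 𝒯, ∀ a ∈ L T, a = label a.1 ∧ Ξ a.1 ∈ convexHull ℝ (T : Set E2) := by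
    intro T hT a ha
    obtain ⟨f, hf, i, hi, rfl⟩ := mem_loop.mp ha
    exact ⟨rfl, (hABC T hT).segment_subset hf (hΞ _ _ ((hABC T hT).isEdge hT f hf) i hi.le)⟩
  have hpoly : ∀ T ∈ 𝒯, SimplePoly (fun a : Label => g (Ξ a.1)) (L T) := fun T hT =>
    loop_simplePoly hM.sep hd hN label_injective hT (hABC T hT)
      (fun p hp p' hp' he => hinj hp hp' (hg (hnode p hp) (hnode p' hp') he)) hok
  choose! ts σ F using fun T hT => (hpoly T hT).exists_filling (hlen T hT)
  choose! o ho ho' using fun T hT =>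
    (F T hT).exists_offset (hpoly T hT) (hlen T hT) (innerLabel T) hη
  set q : Label → ℂ := fun a => a.2.elim (g (Ξ a.1)) fun T => g (Ξ a.1) + o T (label a.1) with hq
  set tl : Finset E2 → List (Label × Label × Label) := fun T =>
    annulus (innerLabel T) (L T) (ts T) with htl
  have hD := fun T (hT : T ∈ 𝒯) => domain_tiling hM.sep hd hN hT (hM.card T hT) (hABC T hT)
    (hO T hT) hδ hℓ (hM.diam T hT) (fun v w he => (hNΞ v w he).2.1) (F T hT)
  have hP : ∀ T ∈ 𝒯, Tiling q (L T) (tl T) (σ T) := by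
    intro T hT
    refine ho' T hT q (fun a ha => ?_) fun a ha => ?_
    · rw [(hloop T hT a ha).1]
      rfl
    · rw [(hloop T hT a ha).1]
      rfl
  set 𝒮 : Finset (Finset Label) := 𝒯.biUnion fun T => ((tl T).map verts).toFinset with h𝒮
  have mem𝒮 : ∀ S, S ∈ 𝒮 ↔ ∃ T ∈ 𝒯, ∃ t ∈ tl T, verts t = S := fun S => by
    simp only [h𝒮, Finset.mem_biUnion, List.mem_toFinset, List.mem_map]
  have hmem : ∀ T ∈ 𝒯, ∀ t ∈ tl T, ∀ i ∈ verts t,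
      position (δ / (6 * ℓ)) i ∈ convexHull ℝ (T : Set E2) ∧
      ∃ x ∈ convexHull ℝ (T : Set E2), ‖q i - g x‖ ≤ η := by
    intro T hT t ht i hi
    obtain ⟨a, ha, h⟩ := verts_annulus (F T hT).cyc ht hi
    have h1 := position_mem (hM.card T hT) (hABC T hT) (hO T hT) hδ hℓ (hM.diam T hT) ha
    have h2 := hloop T hT a ha
    rcases h with rfl | rfl
    · refine ⟨h1.1, _, h2.2, ?_⟩
      rw [h2.1]
      simpa [hq, label] using hη.le
    · refine ⟨h1.2, _, h2.2, ?_⟩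
      have := ho T hT a ha
      rw [h2.1] at this
      simpa [hq, innerLabel] using this
  refine ⟨𝒮, position (δ / (6 * ℓ)), fun a => toC.symm (q a), ?_, ?_, ?_, ?_, ?_, ?_⟩
  · refine wtUnique_of_tilings (fun _ => rfl) (fun T hT => (hD T hT).1)
      (fun T hT T' hT' hne => ?_) fun S hS => (mem𝒮 S).mp hS
    exact outside_loop hM.sep hd hN label_injective hT hT' (hABC T hT) (hABC T' hT')
      (hM.exists_notMem hT hT' hne) (hN.segOK hM.sep hd _) fun v hv' hv =>
        domain_wind hM.sep hd _ hT hT' (hABC T hT) hv' hv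
  · exact wtUnique_of_tilings (fun _ => toC.apply_symm_apply _) hP
      (fun T hT T' hT' hne => target_outside hM hd hN hS.cont (fun v w he => (hNΞ v w he).2.2.2) hΞ
        hR hcon (fun _ => rfl) hok hT hT' (hABC T hT) (hABC T' hT') hne)
      fun S hS => (mem𝒮 S).mp hS
  · intro S hS
    obtain ⟨T, hT, t, ht, rfl⟩ := (mem𝒮 S).mp hS
    have := ne_of_pos ((hP T hT).pos t ht)
    rw [Finset.card_eq_three]
    exact ⟨_, _, _, this.1, this.2.2.symm, this.2.1, by ext i; simp [mem_verts]⟩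
  · intro x
    constructor
    · intro hx
      obtain ⟨T, hT, hxT⟩ := (hM.cover x).mp hx
      obtain ⟨t, ht, w, hw, hwx⟩ := (hABC T hT).exists_wt hN hT (hδ.trans_le (hO T hT))
        (fun _ => rfl) (hD T hT).1 (mem_convexHull_iff_wt.mpr hxT)
      exact ⟨_, (mem𝒮 _).mpr ⟨T, hT, t, ht, rfl⟩, w, hw, hwx⟩
    · rintro ⟨S, hS, w, hw, rfl⟩
      obtain ⟨T, hT, t, ht, rfl⟩ := (mem𝒮 S).mp hS
      refine hM.convexHull_subset hT (convexHull_min ?_ (convex_convexHull ℝ _)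
        (mem_convexHull_image_iff_wt.mpr ⟨w, hw, rfl⟩))
      rintro _ ⟨i, hi, rfl⟩
      exact (hmem T hT t ht i hi).1
  · intro S hS
    obtain ⟨T, hT, t, ht, rfl⟩ := (mem𝒮 S).mp hS
    exact ⟨t, rfl, (hD T hT).2 t ht⟩
  · intro S hS
    obtain ⟨T, hT, t, ht, rfl⟩ := (mem𝒮 S).mp hS
    refine ⟨T, hT, fun i hi => ?_⟩
    rw [toC.apply_symm_apply]
    exact hmem T hT t ht i hi

end Assembly

section Numbers

lemma rpow_inv_le_of_le {a H X Y : ℝ} (ha : 0 < a) (hH : 0 < H) (hX : 0 ≤ X) (hY : 0 ≤ Y)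
    (h : X ≤ H * Y ^ a) : (X / H) ^ a⁻¹ ≤ Y := by
  rw [Real.rpow_inv_le_iff_of_pos (by positivity) hY ha, div_le_iff₀' hH]
  exact h

lemma mul_rpow_rpow {u τ : ℝ} (hu : 0 ≤ u) (hτ : 0 < τ) (e b : ℝ) :
    (u * τ ^ e) ^ b = u ^ b * τ ^ (e * b) := by
  rw [Real.mul_rpow hu (by positivity), Real.rpow_mul hτ.le]

lemma exists_pos_mul_rpow_lt {K X e : ℝ} (hK : 0 < K) (hX : 0 < X) (he : 0 < e) :
    ∃ ρ > 0, K * ρ ^ e < X ∧ 4 * ρ < X := by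
  refine ⟨min ((X / (2 * K)) ^ e⁻¹) (X / 8), by positivity, ?_, ?_⟩
  · have h : min ((X / (2 * K)) ^ e⁻¹) (X / 8) ^ e ≤ X / (2 * K) := by
      refine (Real.rpow_le_rpow (by positivity) (min_le_left _ _) he.le).trans ?_
      rw [Real.rpow_inv_rpow (by positivity) he.ne']
    have := mul_le_mul_of_nonneg_left h hK.le
    have h2 : K * (X / (2 * K)) = X / 2 := by field_simp
    linarith
  · linarith [min_le_right ((X / (2 * K)) ^ e⁻¹) (X / 8)]

/-- Scales for bi-Hölder homeomorphisms. -/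
lemma exists_scales {a b c C H H' : ℝ} (ha : 0 < a) (ha1 : a ≤ 1) (hb : 0 < b) (hb1 : b ≤ 1)
    (hc : 0 < c) (hC : 0 < C) (hH : 0 < H) (hH' : 0 < H') :
    ∃ M > 0, ∀ τ, 0 < τ → τ ≤ 1 → ∀ (Ω : Set E2) (g : E2 → ℂ), ContinuousOn g Ω →
      (∀ x ∈ Ω, ∀ y ∈ Ω, ‖g x - g y‖ ≤ H * ‖x - y‖ ^ a) →
      (∀ x ∈ Ω, ∀ y ∈ Ω, ‖x - y‖ ≤ H' * ‖g x - g y‖ ^ b) →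
      ∃ R κ ζ s m, Scales Ω g (C * τ) (c * τ) R κ ζ s m ∧
        (∀ x ∈ Ω, ∀ y ∈ Ω, ‖g x - g y‖ ≤ R → ∀ x' ∈ Ω, ∀ y' ∈ Ω, ‖x' - y'‖ ≤ ‖x - y‖ →
          ∀ v ∈ Ω, c * τ ≤ ‖x' - v‖ → ‖g x' - g y'‖ < ‖g x' - g v‖) ∧
        ((m + 2 : ℕ) : ℝ) ≤ M * τ ^ (1 - (a⁻¹ * b⁻¹) ^ 3) := by
  have ha' := one_le_inv₀ ha |>.mpr ha1
  have hb' := one_le_inv₀ hb |>.mpr hb1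
  obtain ⟨ρ, hρ, hρ1, hρ2⟩ := exists_pos_mul_rpow_lt (K := H * H' ^ a)
    (X := (c / H') ^ b⁻¹) (e := b * a) (by positivity) (by positivity) (by positivity)
  set K := (ρ / H) ^ a⁻¹ * (c / C) / H' with hK
  have hK0 : 0 < K := by positivity
  obtain ⟨κ₀, hκ, hκ1⟩ := exists_between (show 0 < min (K ^ b⁻¹) ρ by positivity)
  obtain ⟨hκ1, hκ2⟩ := lt_min_iff.mp hκ1
  refine ⟨C / (κ₀ / H) ^ a⁻¹ + 3, by positivity, fun τ hτ hτ1 Ω g hg hi lo => ?_⟩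
  have hmono : ∀ {e e' : ℝ}, e ≤ e' → τ ^ e' ≤ τ ^ e := fun h =>
    Real.rpow_le_rpow_of_exponent_ge hτ hτ1 h
  have hτp : ∀ e : ℝ, 0 < τ ^ e := fun e => Real.rpow_pos_of_pos hτ e
  have hlow : ∀ x ∈ Ω, ∀ y ∈ Ω, c * τ ≤ ‖x - y‖ → (c / H') ^ b⁻¹ * τ ^ b⁻¹ ≤ ‖g x - g y‖ := by
    intro x hx y hy h
    have := rpow_inv_le_of_le hb hH' (by positivity) (norm_nonneg _) (h.trans (lo x hx y hy))
    rwa [mul_div_right_comm, Real.mul_rpow (by positivity) hτ.le] at this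
  set R := ρ * τ ^ (a⁻¹ * b⁻¹ * b⁻¹) with hR
  set κ := κ₀ * τ ^ (a⁻¹ * b⁻¹ * b⁻¹ * a⁻¹ * b⁻¹) with hκdef
  set s := (κ / H) ^ a⁻¹ with hs
  have hs0 : 0 < s := by positivity
  have hsτ : s = (κ₀ / H) ^ a⁻¹ * τ ^ ((a⁻¹ * b⁻¹) ^ 3) := by
    rw [hs, hκdef, mul_div_right_comm, mul_rpow_rpow (by positivity) hτ]
    ring_nf
  have hab : 1 ≤ a⁻¹ * b⁻¹ := one_le_mul_of_one_le_of_one_le ha' hb'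
  refine ⟨R, κ, (R / H) ^ a⁻¹, s, ⌈C * τ / s⌉₊, ⟨hg, by positivity, ?_, ?_, ?_, ?_, ?_, ?_, ?_⟩,
    ?_, ?_⟩
  · refine mul_lt_mul hκ2 (hmono ?_) (hτp _) hρ.le
    rw [mul_assoc _ a⁻¹ b⁻¹]
    exact le_mul_of_one_le_right (by positivity) hab
  · intro x hx y hy h
    refine lt_of_lt_of_le ?_ (hlow x hx y hy h)
    rw [hR, ← mul_assoc]
    exact mul_lt_mul hρ2 (hmono (le_mul_of_one_le_left (by positivity) hab)) (hτp _)
      (by positivity)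
  · intro x hx y hy h
    exact rpow_inv_le_of_le ha hH (by positivity) (norm_nonneg _) (h.trans (hi x hx y hy))
  · intro x hx y hy h
    refine lt_of_lt_of_le ?_
      (rpow_inv_le_of_le hb hH' (by positivity) (norm_nonneg _) (h.trans (lo x hx y hy)))
    have : (R / H) ^ a⁻¹ / (C * τ) * (c * τ) / H' = K * τ ^ (a⁻¹ * b⁻¹ * b⁻¹ * a⁻¹) := by
      rw [hR, mul_div_right_comm ρ, mul_rpow_rpow (by positivity) hτ, hK]
      field_simp
    rw [this, mul_rpow_rpow hK0.le hτ]
    exact mul_lt_mul_of_pos_right hκ1 (hτp _)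
  · intro x hx y hy h
    refine (hi x hx y hy).trans ?_
    have := Real.rpow_le_rpow (norm_nonneg _) h ha.le
    rw [hs, Real.rpow_inv_rpow (by positivity) ha.ne', le_div_iff₀' hH] at this
    exact this
  · exact Nat.one_le_iff_ne_zero.mpr (Nat.ceil_pos.mpr (by positivity)).ne'
  · rw [← div_le_iff₀ hs0]
    exact Nat.le_ceil _
  · intro x hx y hy h x' hx' y' hy' h' v hv hd
    refine lt_of_le_of_lt (hi x' hx' y' hy') (lt_of_lt_of_le ?_ (hlow x' hx' v hv hd))
    have h1 : ‖x' - y'‖ ≤ H' * R ^ b := h'.trans ((lo x hx y hy).trans (by gcongr))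
    calc H * ‖x' - y'‖ ^ a ≤ H * (H' * R ^ b) ^ a := by gcongr
      _ = H * H' ^ a * ρ ^ (b * a) * τ ^ b⁻¹ := by
        rw [hR, mul_rpow_rpow hρ.le hτ, ← mul_assoc, mul_rpow_rpow (by positivity) hτ,
          Real.mul_rpow hH'.le (by positivity), Real.rpow_mul hρ.le]
        rw [show a⁻¹ * b⁻¹ * b⁻¹ * b * a = b⁻¹ by field_simp]
        ring
      _ < _ := mul_lt_mul_of_pos_right hρ1 (hτp _)
  · push_cast
    have h1 := (Nat.ceil_lt_add_one (show 0 ≤ C * τ / s by positivity)).le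
    have h2 : C * τ / s = C / (κ₀ / H) ^ a⁻¹ * τ ^ (1 - (a⁻¹ * b⁻¹) ^ 3) := by
      rw [hsτ, Real.rpow_sub hτ, Real.rpow_one]
      field_simp
    have h3 : 1 ≤ τ ^ (1 - (a⁻¹ * b⁻¹) ^ 3) := by
      have := hmono (sub_nonpos.mpr (one_le_pow₀ hab (n := 3)))
      rwa [Real.rpow_zero] at this
    rw [h2] at h1 ⊢
    nlinarith

end Numbers

section Main

variable {𝒯 : Finset (Finset E2)} {d ℓ δ : ℝ}

/-- The approximation with a given mesh and given scales. -/
lemma Scales.exists_approx {Ω : Set E2} {h : E2 → E2} {R κ ζ s η ε : ℝ} {m : ℕ}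
    (hS : Scales Ω (fun x => toC (h x)) ℓ d R κ ζ s m) (hM : Mesh Ω 𝒯 ℓ d δ) (hd : 0 < d)
    (hδ : 0 < δ) (hℓ : 0 < ℓ) (hη : 0 < η) (hh : InjOn h Ω)
    (hcon : ∀ x ∈ Ω, ∀ y ∈ Ω, ‖toC (h x) - toC (h y)‖ ≤ R → ∀ x' ∈ Ω, ∀ y' ∈ Ω,
      ‖x' - y'‖ ≤ ‖x - y‖ → ∀ v ∈ Ω, d ≤ ‖x' - v‖ →
      ‖toC (h x') - toC (h y')‖ < ‖toC (h x') - toC (h v)‖)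
    (hosc : ∀ x ∈ Ω, ∀ y ∈ Ω, ‖x - y‖ ≤ ℓ → ‖h x - h y‖ + η ≤ ε) :
    ∃ (K : SimplicialComplex ℝ E2) (f : E2 → E2),
      IsTriangulation K Ω ∧ IsHomeoOn f Ω ∧ PiecewiseAffineOn f K ∧
      (∀ x ∈ Ω, ‖f x - h x‖ ≤ ε) ∧ AngleLB K (δ ^ 2 / (144 * (m + 2 : ℕ) * ℓ ^ 4)) ∧
      ∀ e ∈ K.faces, e.card = 2 →
        δ ^ 2 / (72 * (m + 2 : ℕ) * ℓ ^ 3) ≤ edgeLen e ∧ edgeLen e ≤ ℓ := by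
  obtain ⟨𝒮, r, p, hr, hp, hc, hΩ, hf, hT⟩ :=
    hS.exists_realizations hM hd hδ hℓ hη (toC.injective.comp_injOn hh) hcon
  obtain ⟨f, h1, h2, h3, h4⟩ := hr.exists_homeo hp hc hΩ
  refine ⟨hr.complex, f, h1, h2, h3, fun x hx => ?_, hr.angleLB hf, fun e he hec =>
    hr.edgeLen_mem hf (fun S hS i hi j hj => ?_) he hec⟩
  · obtain ⟨S, hS, w, hw, rfl⟩ := (hΩ x).mp hx
    obtain ⟨T, hT𝒯, hTi⟩ := hT S hS
    have hrx : pt r S w ∈ convexHull ℝ (T : Set E2) := by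
      refine convexHull_min ?_ (convex_convexHull ℝ _)
        (mem_convexHull_image_iff_wt.mpr ⟨w, hw, rfl⟩)
      rintro _ ⟨i, hi, rfl⟩
      exact (hTi i hi).1
    rw [h4 S hS w hw, ← dist_eq_norm]
    refine mem_closedBall.mp (convexHull_min ?_ (convex_closedBall (h (pt r S w)) ε)
      (mem_convexHull_image_iff_wt.mpr ⟨w, hw, rfl⟩))
    rintro _ ⟨i, hi, rfl⟩
    obtain ⟨y, hy, hyi⟩ := (hTi i hi).2
    have k := hosc y (hM.convexHull_subset hT𝒯 hy) _ hx
      (norm_sub_le_of_mem_convexHull (hM.diam T hT𝒯) hy hrx)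
    rw [← map_sub, toC.norm_map] at hyi
    rw [mem_closedBall, dist_eq_norm]
    linarith [norm_sub_le_norm_sub_add_norm_sub (p i) (h y) (h (pt r S w))]
  · obtain ⟨T, hT𝒯, hTi⟩ := hT S hS
    exact norm_sub_le_of_mem_convexHull (hM.diam T hT𝒯) (hTi i hi).1 (hTi j hj).1

end Main

end Preparation

/-- construction of the approximating piecewise affine homeomorphism
in the supremum norm, with explicit bounds on the triangulation. -/
theorem statement13 (Ω : Set E2) (hΩ : IsClosedPolygon Ω)
    (α α' : ℝ) (hα0 : 0 < α) (hα1 : α ≤ 1) (hα'0 : 0 < α') (hα'1 : α' ≤ 1)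
    (H H' : ℝ) (hH : 0 < H) (hH' : 0 < H')
    (b₁ a₀ a₁ a₂ : ℝ)
    (hb₁ : b₁ = -2 / α + 2 / (α ^ 2 * α') + 1 / (α ^ 3 * α' ^ 2))
    (ha₀ : a₀ = 2 * b₁ / (α * α') - 2 / α)
    (ha₁ : a₁ = b₁ / (α * α'))
    (ha₂ : a₂ = 1 / α) :
    ∃ ε₀ > (0 : ℝ), ∃ A₀ > (0 : ℝ), ∃ A₁ > (0 : ℝ), ∃ A₂ > (0 : ℝ),
      ∀ ε : ℝ, 0 < ε → ε ≤ ε₀ →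
      ∀ h : E2 → E2, IsHomeoOn h Ω →
        (∀ x ∈ Ω, ∀ y ∈ Ω, ‖h x - h y‖ ≤ H * ‖x - y‖ ^ α) →
        (∀ x ∈ h '' Ω, ∀ y ∈ h '' Ω,
          ‖Function.invFunOn h Ω x - Function.invFunOn h Ω y‖ ≤ H' * ‖x - y‖ ^ α') →
        ∃ (K : SimplicialComplex ℝ E2) (f : E2 → E2),
          IsTriangulation K Ω ∧ IsHomeoOn f Ω ∧ PiecewiseAffineOn f K ∧
          (∀ x ∈ Ω, ‖f x - h x‖ ≤ ε) ∧
          AngleLB K (A₀ * ε ^ a₀) ∧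
          (∀ e ∈ K.faces, e.card = 2 →
            A₁ * ε ^ a₁ ≤ edgeLen e ∧ edgeLen e ≤ A₂ * ε ^ a₂) := by
  obtain ⟨c, hc, C, hC, hmesh⟩ := hΩ.exists_mesh
  obtain ⟨M, hM, hscale⟩ := exists_scales hα0 hα1 hα'0 hα'1 hc hC hH hH'
  set k := α⁻¹ * α'⁻¹ with hk
  have hk1 : 1 ≤ k := one_le_mul_of_one_le_of_one_le ((one_le_inv₀ hα0).mpr hα1)
    ((one_le_inv₀ hα'0).mpr hα'1)
  have hb : b₁ = α⁻¹ * (k ^ 2 + 2 * k - 2) := by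
    rw [hb₁, hk]
    field_simp
    ring
  have hdiv : ∀ x : ℝ, x / (α * α') = x * k := fun x => by rw [hk, div_eq_mul_inv, mul_inv]
  rw [hdiv, hb] at ha₀ ha₁
  rw [div_eq_mul_inv] at ha₀
  have e₀ : α⁻¹ * (k ^ 3 - 1) ≤ a₀ := by
    have : 0 ≤ α⁻¹ * (k ^ 3 + 4 * k ^ 2 - 4 * k - 1) :=
      mul_nonneg (by positivity)
        (by nlinarith [mul_nonneg (sub_nonneg.mpr hk1) (sub_nonneg.mpr hk1)])
    linarith
  have e₁ : α⁻¹ * k ^ 3 ≤ a₁ := by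
    have : 0 ≤ α⁻¹ * (2 * k ^ 2 - 2 * k) := mul_nonneg (by positivity) (by nlinarith)
    linarith
  obtain ⟨c₁, hc₁, hc₁', hc₁''⟩ := exists_pos_mul_rpow_lt (K := H * C ^ α)
    (X := 1 / 2) (e := α) (by positivity) (by positivity) hα0
  refine ⟨1, one_pos, c ^ 2 / (144 * M * C ^ 4) * c₁ ^ (k ^ 3 - 1), by positivity,
    c ^ 2 / (72 * M * C ^ 3) * c₁ ^ k ^ 3, by positivity, C * c₁, by positivity,
    fun ε hε hε1 h hh hi lo => ?_⟩
  set τ := c₁ * ε ^ α⁻¹ with hτdef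
  have hτ : 0 < τ := by positivity
  have hτ1 : τ ≤ 1 := by
    have := Real.rpow_le_one hε.le hε1 (inv_pos.mpr hα0).le
    nlinarith
  have hτe : ∀ e e', α⁻¹ * e ≤ e' → c₁ ^ e * ε ^ e' ≤ τ ^ e := fun e e' he => by
    rw [hτdef, mul_rpow_rpow hc₁.le hε]
    exact mul_le_mul_of_nonneg_left (Real.rpow_le_rpow_of_exponent_ge hε hε1 he) (by positivity)
  obtain ⟨𝒯, hmesh⟩ := hmesh τ hτ hτ1
  have hlo : ∀ x ∈ Ω, ∀ y ∈ Ω, ‖x - y‖ ≤ H' * ‖h x - h y‖ ^ α' := by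
    intro x hx y hy
    have := lo _ (mem_image_of_mem h hx) _ (mem_image_of_mem h hy)
    rwa [hh.2.1.leftInvOn_invFunOn hx, hh.2.1.leftInvOn_invFunOn hy] at this
  have hn : ∀ x y, ‖toC (h x) - toC (h y)‖ = ‖h x - h y‖ := fun x y => by
    rw [← map_sub, toC.norm_map]
  obtain ⟨R, κ, ζ, s, m, hS, hcon, hm⟩ := hscale τ hτ hτ1 Ω (fun x => toC (h x))
    (toC.continuous.comp_continuousOn hh.1) (by simpa only [hn] using hi)
    (by simpa only [hn] using hlo)
  obtain ⟨K, f, h1, h2, h3, h4, h5, h6⟩ := hS.exists_approx (η := ε / 2) (ε := ε) hmesh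
    (by positivity) (by positivity) (by positivity) (by positivity) hh.2.1 hcon
    fun x hx y hy hxy => by
      have : H * (C * τ) ^ α ≤ ε / 2 := by
        rw [Real.mul_rpow hC.le hτ.le, hτdef, Real.mul_rpow hc₁.le (by positivity),
          Real.rpow_inv_rpow hε.le hα0.ne']
        nlinarith
      have h' : H * ‖x - y‖ ^ α ≤ H * (C * τ) ^ α := by gcongr
      linarith [hi x hx y hy]
  refine ⟨K, f, h1, h2, h3, h4, fun t ht p hp q hq r hr hpq hqr hpr =>
    le_trans ?_ (h5 t ht p hp q hq r hr hpq hqr hpr), fun e he hec =>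
    ⟨le_trans ?_ (h6 e he hec).1, (h6 e he hec).2.trans ?_⟩⟩
  · calc _ = c ^ 2 / (144 * M * C ^ 4) * (c₁ ^ (k ^ 3 - 1) * ε ^ a₀) := by ring
      _ ≤ c ^ 2 / (144 * M * C ^ 4) * τ ^ (k ^ 3 - 1) := by
        gcongr
        exact hτe _ _ e₀
      _ = (c * τ ^ 2) ^ 2 / (144 * (M * τ ^ (1 - k ^ 3)) * (C * τ) ^ 4) := by
        rw [show k ^ 3 - 1 = -(1 - k ^ 3) by ring, Real.rpow_neg hτ.le]
        field_simp
      _ ≤ _ := by gcongr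
  · calc _ = c ^ 2 / (72 * M * C ^ 3) * (c₁ ^ k ^ 3 * ε ^ a₁) := by ring
      _ ≤ c ^ 2 / (72 * M * C ^ 3) * τ ^ k ^ 3 := by
        gcongr
        exact hτe _ _ e₁
      _ = (c * τ ^ 2) ^ 2 / (72 * (M * τ ^ (1 - k ^ 3)) * (C * τ) ^ 3) := by
        rw [Real.rpow_sub hτ, Real.rpow_one]
        field_simp
      _ ≤ _ := by gcongr
  · rw [hτdef, ha₂, one_div, mul_assoc]

end
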